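/- Let α, ε, Δ > 0. Almost surely, the binomial random graph G(n, (1+ε)log n / n) contains a copy of every tree T ∈ T(n,Δ) which has at least αn/log⁹n vertex-disjoint bare paths of length ⌈log⁹ n⌉. -/

import Mathlib

/- Probability that the binomial random graph `G(n,p)` satisfies the property `P`. -/
open Classical in
noncomputable def probOf (n : ℕ) (p : ℝ) (P : SimpleGraph (Fin n) → Prop) : ℝ :=
  ∑ G : SimpleGraph (Fin n),
    if P G then p ^ G.edgeSet.ncard * (1 - p) ^ (n.choose 2 - G.edgeSet.ncard) else 0

/-- `G` contains a copy of `T` (an injective graph homomorphism from `T` to `G`). -/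
def ContainsCopy {V W : Type*} (T : SimpleGraph V) (G : SimpleGraph W) : Prop :=
  ∃ f : T →g G, Function.Injective f

/-- A bare path in `T`: a path all of whose interior vertices have degree 2 in `T`. -/
def IsBarePath {V : Type*} (T : SimpleGraph V) {u v : V} (w : T.Walk u v) : Prop :=
  w.IsPath ∧ ∀ x ∈ w.support, x ≠ u → x ≠ v → (T.neighborSet x).ncard = 2

/-- `T` has `m` pairwise vertex-disjoint bare paths of length `k`. -/
def HasDisjBarePaths {V : Type*} (T : SimpleGraph V) (k m : ℕ) : Prop :=
  ∃ (u v : Fin m → V) (w : ∀ i, T.Walk (u i) (v i)),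
    (∀ i, IsBarePath T (w i) ∧ (w i).length = k) ∧
    ∀ i j, i ≠ j → (w i).support.Disjoint (w j).support

set_option linter.unusedSectionVars false

namespace SpanningTree

open Finset Function

section FriedmanPippenger

variable {L R : Type*} [DecidableEq L] [DecidableEq R]

/-- Every set of at most `2 * m` left elements has enough neighbours outside `X` for its
capacities. -/
def Good (N : L → Finset R) (m : ℕ) (X : Finset R) (c : L → ℕ) : Prop :=
  ∀ U : Finset L, U.card ≤ 2 * m → ∑ u ∈ U, c u ≤ (U.biUnion N \ X).card

lemma Good.mono {N : L → Finset R} {m : ℕ} {X X' : Finset R} {c c' : L → ℕ}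
    (h : Good N m X c) (hX : X' ⊆ X) (hc : ∀ u, c' u ≤ c u) : Good N m X' c' := fun U hU =>
  (sum_le_sum fun u _ => hc u).trans <| (h U hU).trans <|
    card_le_card (sdiff_subset_sdiff le_rfl hX)

lemma card_biUnion_sdiff_submodular (N : L → Finset R) (X : Finset R) (U V : Finset L) :
    ((U ∪ V).biUnion N \ X).card + ((U ∩ V).biUnion N \ X).card ≤
      (U.biUnion N \ X).card + (V.biUnion N \ X).card := by
  have h1 : (U ∪ V).biUnion N \ X = (U.biUnion N \ X) ∪ (V.biUnion N \ X) := by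
    rw [union_biUnion, union_sdiff_distrib]
  have h2 : (U ∩ V).biUnion N \ X ⊆ (U.biUnion N \ X) ∩ (V.biUnion N \ X) := by
    intro x
    simp only [mem_sdiff, mem_biUnion, mem_inter]
    grind
  rw [h1, ← card_union_add_card_inter (U.biUnion N \ X)]
  exact Nat.add_le_add_left (card_le_card h2) _

lemma Good.tight_union {N : L → Finset R} {m : ℕ} {X : Finset R} {c : L → ℕ}
    (h : Good N m X c)
    (hbig : ∀ U : Finset L, m ≤ U.card → U.card ≤ 2 * m →
      ∑ u ∈ U, c u < (U.biUnion N \ X).card)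
    {U V : Finset L} (hU : U.card < m) (hV : V.card < m)
    (hUt : (U.biUnion N \ X).card ≤ ∑ u ∈ U, c u)
    (hVt : (V.biUnion N \ X).card ≤ ∑ u ∈ V, c u) :
    (U ∪ V).card < m ∧ ((U ∪ V).biUnion N \ X).card ≤ ∑ u ∈ U ∪ V, c u := by
  have h1 := card_biUnion_sdiff_submodular N X U V
  have h2 := sum_union_inter (s₁ := U) (s₂ := V) (f := c)
  have hc : (U ∪ V).card ≤ 2 * m := (card_union_le _ _).trans (by omega)
  have h3 := h (U ∩ V) ((card_le_card inter_subset_left).trans (by omega))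
  have h4 : ((U ∪ V).biUnion N \ X).card ≤ ∑ u ∈ U ∪ V, c u := by omega
  refine ⟨?_, h4⟩
  by_contra hlt
  have := hbig (U ∪ V) (by omega) hc
  omega

lemma Good.extend {N : L → Finset R} {m : ℕ} {X : Finset R} {c : L → ℕ}
    (h : Good N m X c) (hm : 1 ≤ m)
    (hbig : ∀ U : Finset L, m ≤ U.card → U.card ≤ 2 * m →
      ∑ u ∈ U, c u < (U.biUnion N \ X).card)
    (s : L) (hs : 1 ≤ c s) :
    ∃ x ∈ N s, x ∉ X ∧ Good N m (insert x X) (update c s (c s - 1)) := by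
  by_contra hcon
  push Not at hcon
  have key : ∀ x ∈ N s \ X, ∃ U : Finset L, U.card < m ∧ s ∉ U ∧ x ∈ U.biUnion N ∧
      (U.biUnion N \ X).card ≤ ∑ u ∈ U, c u := by
    intro x hx
    rw [mem_sdiff] at hx
    have h1 := hcon x hx.1 hx.2
    unfold Good at h1
    push Not at h1
    obtain ⟨U, hU, hlt⟩ := h1
    have h2 := h U hU
    have hsU : s ∉ U := by
      intro hsU
      rw [sum_update_of_mem hsU, ] at hlt
      have h3 := add_sum_erase U c hsU
      rw [erase_eq] at h3
      have h4 : (U.biUnion N \ X).card ≤ (U.biUnion N \ insert x X).card + 1 := by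
        rw [sdiff_insert]
        have := pred_card_le_card_erase (s := U.biUnion N \ X) (a := x)
        omega
      omega
    rw [sum_update_of_notMem hsU] at hlt
    have hxU : x ∈ U.biUnion N := by
      by_contra hxU
      rw [sdiff_insert, erase_eq_of_notMem (by simp [hxU])] at hlt
      omega
    have hxU' : x ∈ U.biUnion N \ X := by simp [hxU, hx.2]
    have h5 : (U.biUnion N \ X).card ≤ ∑ u ∈ U, c u := by
      rw [sdiff_insert, card_erase_of_mem hxU'] at hlt
      omega
    refine ⟨U, ?_, hsU, hxU, h5⟩
    by_contra hm'
    have := hbig U (by omega) hU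
    omega
  choose! F hF using key
  have hun : ∀ T : Finset R, T ⊆ N s \ X → (T.biUnion F).card < m ∧
      ((T.biUnion F).biUnion N \ X).card ≤ ∑ u ∈ T.biUnion F, c u := by
    intro T
    induction T using Finset.induction_on with
    | empty => intro _; simp; omega
    | insert a T _ ih =>
      intro hT
      have ha := hF a (hT (mem_insert_self _ _))
      have ih' := ih (fun x hx => hT (mem_insert_of_mem hx))
      rw [biUnion_insert]
      exact h.tight_union hbig ha.1 ih'.1 ha.2.2.2 ih'.2
  obtain ⟨h1, h2⟩ := hun _ le_rfl
  set U := (N s \ X).biUnion F with hUdef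
  have hsU : s ∉ U := by
    rw [hUdef, mem_biUnion]
    rintro ⟨x, hx, hxs⟩
    exact (hF x hx).2.1 hxs
  have h3 := h (insert s U) ((card_insert_le _ _).trans (by omega))
  rw [sum_insert hsU] at h3
  have h4 : (insert s U).biUnion N \ X ⊆ U.biUnion N \ X := by
    intro x hx
    rw [mem_sdiff, biUnion_insert, mem_union] at hx
    rw [mem_sdiff]
    refine ⟨?_, hx.2⟩
    rcases hx.1 with hx1 | hx1
    · have hx' : x ∈ N s \ X := mem_sdiff.2 ⟨hx1, hx.2⟩
      obtain ⟨u, hu, hxu⟩ := mem_biUnion.1 (hF x hx').2.2.1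
      exact mem_biUnion.2 ⟨u, mem_biUnion.2 ⟨x, hx', hu⟩, hxu⟩
    · exact hx1
  have h5 := card_le_card h4
  omega

lemma Good.restore {N : L → Finset R} {m : ℕ} {X : Finset R} {c : L → ℕ} {x : R} {p : L}
    (h : Good N m (insert x X) c) (hx : x ∉ X) (hp : x ∈ N p) :
    Good N m X (fun u => c u + if u = p then 1 else 0) := by
  intro U hU
  have h1 := h U hU
  rw [sum_add_distrib, sum_ite_eq']
  split_ifs with hpU
  · have hxU : x ∈ U.biUnion N \ X := by simp [hx]; exact ⟨p, hpU, hp⟩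
    rw [sdiff_insert, card_erase_of_mem hxU] at h1
    have : 0 < (U.biUnion N \ X).card := card_pos.2 ⟨x, hxU⟩
    omega
  · exact h1.trans (card_le_card (sdiff_subset_sdiff le_rfl (subset_insert _ _)))

/-- Number of edges of `T` at the left vertex `u`. -/
def cnt (T : Finset (L × R)) (u : L) : ℕ := (T.filter (fun e => e.1 = u)).card

lemma cnt_union {T T' : Finset (L × R)} (h : Disjoint T T') (u : L) :
    cnt (T ∪ T') u = cnt T u + cnt T' u := by
  unfold cnt
  rw [filter_union, card_union_of_disjoint]
  exact disjoint_filter_filter h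

lemma cnt_ne_zero {T : Finset (L × R)} {u : L} (h : cnt T u ≠ 0) : ∃ e ∈ T, e.1 = u := by
  unfold cnt at h
  obtain ⟨e, he⟩ := card_ne_zero.1 h
  exact ⟨e, (mem_filter.1 he).1, (mem_filter.1 he).2⟩

lemma Good.prune {N : L → Finset R} {m : ℕ} {X : Finset R} {c : L → ℕ} (T : Finset (L × R))
    (h : Good N m (X ∪ T.image Prod.snd) c) (hd : Disjoint X (T.image Prod.snd))
    (hN : ∀ e ∈ T, e.2 ∈ N e.1) (hinj : Set.InjOn Prod.snd (T : Set (L × R))) :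
    Good N m X (fun u => c u + cnt T u) := by
  induction T using Finset.induction_on generalizing c with
  | empty => simpa [cnt] using h
  | insert e T he ih =>
    have hx : e.2 ∉ X ∪ T.image Prod.snd := by
      rw [mem_union]
      rintro (h1 | h1)
      · exact disjoint_left.1 hd h1 (mem_image_of_mem _ (mem_insert_self _ _))
      · obtain ⟨e', he', hee⟩ := mem_image.1 h1
        have := hinj (by simp [he']) (by simp) hee
        exact he (this ▸ he')
    have h1 : Good N m (insert e.2 (X ∪ T.image Prod.snd)) c := by
      rwa [image_insert, union_insert] at h
    have h2 := ih (h1.restore hx (hN e (mem_insert_self _ _)))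
      (hd.mono_right (image_subset_image (subset_insert _ _)))
      (fun e' he' => hN e' (mem_insert_of_mem he'))
      (hinj.mono (by simp))
    refine h2.mono le_rfl fun u => ?_
    unfold cnt
    rw [filter_insert]
    by_cases hu : e.1 = u
    · rw [if_pos hu, if_pos hu.symm, card_insert_of_notMem (by simp [he])]
      omega
    · rw [if_neg hu, if_neg (Ne.symm hu)]
      omega

/-- No unused edge leads to `s`. -/
def Rooted (N : L → Finset R) (f : L → R → L) (X : Finset R) (s : L) : Prop :=
  ∀ s' x', x' ∈ N s' → x' ∉ X → f s' x' ≠ s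

lemma Rooted.mono {N : L → Finset R} {f : L → R → L} {X X' : Finset R} {s : L}
    (h : Rooted N f X s) (hX : X ⊆ X') : Rooted N f X' s :=
  fun s' x' h1 h2 => h s' x' h1 (fun h3 => h2 (hX h3))

/-- A partially built structure: `X` is the set of used right vertices, `c` the capacities. -/
structure St (N : L → Finset R) (f : L → R → L) (m d : ℕ) (X : Finset R) (c : L → ℕ) : Prop where
  good : Good N m X c
  le : ∀ u, c u ≤ d
  fresh : ∀ s x, x ∈ N s → x ∉ X → d ≤ c (f s x)

/-- The state `(X ∪ T, c')` arises from `(X, c)` by adding the edges in `T`. -/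
structure Grown (N : L → Finset R) (f : L → R → L) (m d : ℕ) (X : Finset R) (c : L → ℕ)
    (T : Finset (L × R)) (c' : L → ℕ) : Prop where
  st : St N f m d (X ∪ T.image Prod.snd) c'
  disj : Disjoint X (T.image Prod.snd)
  nbr : ∀ e ∈ T, e.2 ∈ N e.1
  inj : Set.InjOn Prod.snd (T : Set (L × R))
  cap : ∀ u, c' u + cnt T u = c u
  rooted : ∀ e ∈ T, Rooted N f (X ∪ T.image Prod.snd) e.1

/-- A walk of edges from `s` to `a`. -/
def EP (f : L → R → L) : L → List (L × R) → L → Prop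
  | s, [], a => s = a
  | s, e :: es, a => e.1 = s ∧ EP f (f s e.2) es a

lemma EP.append {f : L → R → L} {s a b : L} {es es' : List (L × R)} (h : EP f s es a)
    (h' : EP f a es' b) : EP f s (es ++ es') b := by
  induction es generalizing s with
  | nil => cases h; exact h'
  | cons e es ih => exact ⟨h.1, ih h.2⟩

variable {N : L → Finset R} {f : L → R → L} {m d B : ℕ}

lemma Grown.refl {X : Finset R} {c : L → ℕ} (h : St N f m d X c) : Grown N f m d X c ∅ c where
  st := by simpa using h
  disj := by simp
  nbr := by simp
  inj := by simp
  cap := by simp [cnt]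
  rooted := by simp

lemma Grown.disjoint_edges {X X' : Finset R} {T T' : Finset (L × R)}
    (h : T.image Prod.snd ⊆ X) (h' : Disjoint X (T'.image Prod.snd)) (_ : X' = X) :
    Disjoint T T' := by
  rw [disjoint_left]
  intro e he he'
  exact disjoint_left.1 h' (h (mem_image_of_mem _ he)) (mem_image_of_mem _ he')

lemma Grown.trans {X : Finset R} {c c' c'' : L → ℕ} {T T' : Finset (L × R)}
    (h : Grown N f m d X c T c') (h' : Grown N f m d (X ∪ T.image Prod.snd) c' T' c'') :
    Grown N f m d X c (T ∪ T') c'' := by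
  have hdis : Disjoint T T' :=
    Grown.disjoint_edges (X := X ∪ T.image Prod.snd) subset_union_right h'.disj rfl
  have himg : X ∪ (T ∪ T').image Prod.snd = X ∪ T.image Prod.snd ∪ T'.image Prod.snd := by
    rw [image_union, union_assoc]
  refine ⟨?_, ?_, ?_, ?_, ?_, ?_⟩
  · rw [himg]; exact h'.st
  · rw [image_union, disjoint_union_right]
    exact ⟨h.disj, h'.disj.mono_left subset_union_left⟩
  · intro e he
    rcases mem_union.1 he with he | he
    exacts [h.nbr e he, h'.nbr e he]
  · rw [coe_union, Set.injOn_union (by exact_mod_cast hdis)]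
    refine ⟨h.inj, h'.inj, fun a ha b hb hab => ?_⟩
    exact disjoint_left.1 h'.disj
      (mem_union_right _ (mem_image_of_mem _ ha))
      (hab ▸ mem_image_of_mem _ hb)
  · intro u
    rw [cnt_union hdis]
    have := h.cap u
    have := h'.cap u
    omega
  · intro e he
    rw [himg]
    rcases mem_union.1 he with he | he
    exacts [(h.rooted e he).mono subset_union_left, h'.rooted e he]

lemma Grown.prune {X : Finset R} {c c' : L → ℕ} {T T' : Finset (L × R)}
    (hX : St N f m d X c)
    (h : Grown N f m d X c T c') (hT : T' ⊆ T)
    (hr : ∀ e ∈ T', Rooted N f (X ∪ T'.image Prod.snd) e.1) :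
    Grown N f m d X c T' (fun u => c u - cnt T' u) := by
  have hdis : Disjoint T' (T \ T') := disjoint_sdiff
  have hu : T' ∪ (T \ T') = T := union_sdiff_of_subset hT
  have hcap : ∀ u, c u - cnt T' u = c' u + cnt (T \ T') u := by
    intro u
    have h1 := cnt_union hdis u
    rw [hu] at h1
    have := h.cap u
    omega
  refine ⟨⟨?_, ?_, ?_⟩, ?_, ?_, ?_, ?_, hr⟩
  · have h1 : Good N m (X ∪ T'.image Prod.snd) (fun u => c' u + cnt (T \ T') u) := by
      apply Good.prune
      · rw [union_assoc, ← image_union, hu]; exact h.st.good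
      · rw [disjoint_union_left]
        refine ⟨h.disj.mono_right (image_subset_image sdiff_subset), ?_⟩
        rw [disjoint_left]
        intro x hx hx'
        obtain ⟨e, he, rfl⟩ := mem_image.1 hx
        obtain ⟨e', he', hee⟩ := mem_image.1 hx'
        have h3 := h.inj (sdiff_subset he') (hT he) hee
        subst h3
        exact (mem_sdiff.1 he').2 he
      · exact fun e he => h.nbr e (sdiff_subset he)
      · exact h.inj.mono (by exact_mod_cast sdiff_subset)
    exact h1.mono le_rfl fun u => (hcap u).le
  · exact fun u => (Nat.sub_le _ _).trans (hX.le u)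
  · intro s x hx hxX
    have h0 : cnt T' (f s x) = 0 := by
      by_contra hne
      obtain ⟨e, he, hee⟩ := cnt_ne_zero hne
      exact hr e he s x hx hxX hee.symm
    have := hX.fresh s x hx (fun hh => hxX (mem_union_left _ hh))
    simp only [h0]; omega
  · exact h.disj.mono_right (image_subset_image hT)
  · exact fun e he => h.nbr e (hT he)
  · exact h.inj.mono (by exact_mod_cast hT)
  · intro u
    have h1 := cnt_union hdis u
    rw [hu] at h1
    have := h.cap u
    omega

/-- Sets of between `m` and `2 * m` members of `L` have many out-edges, and an out-edge is
determined by its end. -/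
structure Spreading (N : L → Finset R) (f : L → R → L) (m d B : ℕ) : Prop where
  one_le : 1 ≤ m
  big : ∀ U : Finset L, m ≤ U.card → U.card ≤ 2 * m → 2 * m * d + B < (U.biUnion N).card
  inj : ∀ s s' x x', x ∈ N s → x' ∈ N s' → f s x = f s' x' → x = x'

lemma St.step {X : Finset R} {c : L → ℕ} (h : St N f m d X c) (hN : Spreading N f m d B)
    (hB : X.card ≤ B) {s : L} (hs : Rooted N f X s) (hc : 1 ≤ c s) :
    ∃ x ∈ N s, x ∉ X ∧ Grown N f m d X c {(s, x)} (update c s (c s - 1)) ∧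
      Rooted N f (insert x X) (f s x) := by
  obtain ⟨x, hx, hxX, hg⟩ := h.good.extend hN.one_le (fun U h1 h2 => by
    have h3 := hN.big U h1 h2
    have h4 : ∑ u ∈ U, c u ≤ 2 * m * d := (sum_le_card_nsmul U c d fun u _ => h.le u).trans
      (by rw [smul_eq_mul]; exact Nat.mul_le_mul_right _ h2)
    have h5 := le_card_sdiff X (U.biUnion N)
    omega) s hc
  have hroot : ∀ s', Rooted N f X s' → Rooted N f (insert x X) s' :=
    fun s' hs' => hs'.mono (subset_insert _ _)
  refine ⟨x, hx, hxX, ⟨⟨?_, ?_, ?_⟩, ?_, ?_, ?_, ?_, ?_⟩, ?_⟩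
  · simpa [union_comm X] using hg
  · intro u
    rw [update_apply]
    split_ifs with hu
    · exact (Nat.sub_le _ _).trans (h.le s)
    · exact h.le u
  · intro s' x' hx' hxX'
    have hx'X : x' ∉ X := fun hh => hxX' (mem_union_left _ hh)
    rw [update_of_ne (hs s' x' hx' hx'X)]
    exact h.fresh s' x' hx' hx'X
  · simpa using hxX
  · simpa using hx
  · simp
  · intro u
    by_cases hu : u = s
    · subst hu
      simp [cnt, filter_singleton]; omega
    · simp [cnt, filter_singleton, hu, Ne.symm hu]
  · intro e he
    rw [mem_singleton] at he
    subst he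
    exact hs.mono subset_union_left
  · intro s' x' hx' hxX' heq
    have := hN.inj _ _ _ _ hx' hx heq
    exact hxX' (by simp [this])

lemma EP.fst_mem {s a : L} {es : List (L × R)} (h : EP f s es a) :
    ∀ e ∈ es, e.1 = s ∨ ∃ e' ∈ es, e.1 = f e'.1 e'.2 := by
  induction es generalizing s with
  | nil => simp
  | cons e es ih =>
    intro e' he'
    obtain ⟨rfl, h2⟩ := h
    rcases List.mem_cons.1 he' with rfl | he'
    · exact Or.inl rfl
    · rcases ih h2 e' he' with h3 | ⟨e'', h3, h4⟩
      · exact Or.inr ⟨e, by simp, h3⟩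
      · exact Or.inr ⟨e'', by simp [h3], h4⟩

lemma Grown.rooted_out (hN : Spreading N f m d B)
    {X : Finset R} {c c' : L → ℕ} {T : Finset (L × R)}
    (h : Grown N f m d X c T c') {e : L × R} (he : e ∈ T) :
    Rooted N f (X ∪ T.image Prod.snd) (f e.1 e.2) := by
  intro s' x' hx' hX' heq
  have := hN.inj _ _ _ _ hx' (h.nbr e he) heq
  exact hX' (mem_union_right _ (this ▸ mem_image_of_mem _ he))

/-- Extend by a walk of `e` new edges from `s`. -/
lemma St.walk (hN : Spreading N f m d B) (hd : 1 ≤ d)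
    (k : ℕ) : ∀ {X : Finset R} {c : L → ℕ} (_ : St N f m d X c) {s : L} (_ : Rooted N f X s)
      (_ : 1 ≤ c s) (_ : X.card + k ≤ B + 1),
      ∃ (T : Finset (L × R)) (c' : L → ℕ) (es : List (L × R)) (a : L),
        Grown N f m d X c T c' ∧ T = es.toFinset ∧ EP f s es a ∧ es.length = k ∧
        (es.map Prod.snd).Nodup ∧ Rooted N f (X ∪ T.image Prod.snd) a ∧
        (k ≠ 0 → d ≤ c' a ∧ ¬ Rooted N f X a) := by
  induction k with
  | zero =>
    intro X c h s hs _ _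
    exact ⟨∅, c, [], s, Grown.refl h, by simp, rfl, rfl, by simp, by simpa using hs, by simp⟩
  | succ k ih =>
    intro X c h s hs hc hB
    obtain ⟨x, hx, hxX, hg, hr⟩ := h.step hN (by omega) hs hc
    have hX : X ∪ ({(s, x)} : Finset (L × R)).image Prod.snd = insert x X := by
      simp [union_comm X]
    have hne : f s x ≠ s := hs s x hx hxX
    have hcx : d ≤ update c s (c s - 1) (f s x) := by
      rw [update_of_ne hne]; exact h.fresh s x hx hxX
    obtain ⟨T, c', es, a, h1, h2, h3, h4, h5, h6, h7⟩ := ih hg.st (s := f s x)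
      (by rwa [hX]) (by omega) (by rw [hX, card_insert_of_notMem hxX]; omega)
    have hx_es : ∀ e ∈ es, e.2 ≠ x := by
      intro e he hex
      have hx1 : x ∈ T.image Prod.snd := mem_image.2 ⟨e, by rw [h2]; simpa using he, hex⟩
      refine disjoint_left.1 h1.disj ?_ hx1
      rw [hX]; simp
    refine ⟨_, c', (s, x) :: es, a, hg.trans h1, ?_, ⟨rfl, h3⟩, by simp [h4], ?_, ?_, ?_⟩
    · rw [h2, List.toFinset_cons, insert_eq]
    · rw [List.map_cons, List.nodup_cons]
      refine ⟨?_, h5⟩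
      rw [List.mem_map]
      rintro ⟨e, he, hex⟩
      exact hx_es e he hex
    · rw [image_union, ← union_assoc]; exact h6
    · intro _
      by_cases hk : k = 0
      · subst hk
        rw [List.length_eq_zero_iff] at h4
        subst h4
        cases h3
        refine ⟨?_, fun hh => hh s x hx hxX rfl⟩
        have h8 := h1.cap (f s x)
        rw [h2] at h8
        simp only [cnt, List.toFinset_nil, filter_empty, card_empty] at h8
        omega
      · exact ⟨(h7 hk).1, fun hh => (h7 hk).2 (hh.mono (by rw [hX]; exact subset_insert _ _))⟩

/-- Grow a binary tree of depth `h` from `s`. -/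
lemma St.grow (hN : Spreading N f m d B) (hd : 2 ≤ d)
    (h : ℕ) : ∀ {X : Finset R} {c : L → ℕ} (_ : St N f m d X c) {s : L} (_ : Rooted N f X s)
      (_ : 2 ≤ c s) (_ : X.card + 2 ^ (h + 1) ≤ B + 2),
      ∃ (T : Finset (L × R)) (c' : L → ℕ) (A : Finset L),
        Grown N f m d X c T c' ∧ T.card + 2 ≤ 2 ^ (h + 1) ∧ A.card = 2 ^ h ∧
        (∀ u, ¬ Rooted N f (X ∪ T.image Prod.snd) u → cnt T u = 0) ∧
        (∀ u, Rooted N f X u → u ≠ s → cnt T u = 0) ∧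
        ∀ a ∈ A, (h ≠ 0 → ∃ e ∈ T, a = f e.1 e.2) ∧ (h = 0 → a = s) ∧
          ∃ es : List (L × R), EP f s es a ∧ es.length = h ∧ (∀ e ∈ es, e ∈ T) ∧
          (es.map Prod.snd).Nodup := by
  induction h with
  | zero =>
    intro X c h s hs _ _
    refine ⟨∅, c, {s}, Grown.refl h, by simp, by simp, by simp [cnt], by simp [cnt], ?_⟩
    intro a ha
    rw [mem_singleton] at ha
    subst ha
    exact ⟨by simp, by simp, [], rfl, rfl, by simp, by simp⟩
  | succ h ih =>
    intro X c hst s hs hc hB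
    have hpow : 2 ^ (h + 1 + 1) = 2 * 2 ^ (h + 1) := by ring
    have hpow1 : 2 ^ (h + 1) = 2 * 2 ^ h := by ring
    have hpos : 1 ≤ 2 ^ h := Nat.one_le_two_pow
    -- one child with its subtree
    have child : ∀ {X' : Finset R} {c₀ : L → ℕ} (_ : St N f m d X' c₀) (_ : Rooted N f X' s)
      (_ : 1 ≤ c₀ s) (_ : X'.card + 2 ^ (h + 1) ≤ B + 1),
      ∃ (T : Finset (L × R)) (c' : L → ℕ) (A : Finset L),
        Grown N f m d X' c₀ T c' ∧ T.card + 1 ≤ 2 ^ (h + 1) ∧ A.card = 2 ^ h ∧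
        (∀ u, ¬ Rooted N f (X' ∪ T.image Prod.snd) u → cnt T u = 0) ∧
        (∀ u, Rooted N f X' u → u ≠ s → cnt T u = 0) ∧ cnt T s = 1 ∧
        ∀ a ∈ A, (∃ e ∈ T, a = f e.1 e.2) ∧
          ∃ es : List (L × R), EP f s es a ∧ es.length = h + 1 ∧ (∀ e ∈ es, e ∈ T) ∧
          (es.map Prod.snd).Nodup := by
      intro X' c₀ hst hs hc hB
      obtain ⟨x, hx, hxX, hg, hr⟩ := hst.step hN (by omega) hs hc
      have hX : X' ∪ ({(s, x)} : Finset (L × R)).image Prod.snd = insert x X' := by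
        simp [union_comm X']
      have hne : f s x ≠ s := hs s x hx hxX
      obtain ⟨T, c', A, h1, h2, h3, h4, h5, h6⟩ := ih hg.st (s := f s x) (by rwa [hX])
        (by rw [update_of_ne hne]; exact hd.trans (hst.fresh s x hx hxX))
        (by rw [hX, card_insert_of_notMem hxX]; omega)
      have hg2 := hg.trans h1
      have hdis : Disjoint {(s, x)} T :=
        Grown.disjoint_edges (X := X' ∪ ({(s, x)} : Finset (L × R)).image Prod.snd)
          subset_union_right h1.disj rfl
      have hcnt : ∀ u, cnt ({(s, x)} : Finset (L × R)) u = if s = u then 1 else 0 := by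
        intro u
        unfold cnt
        rw [filter_singleton]
        split_ifs <;> simp
      refine ⟨_, c', A, hg2, ?_, h3, ?_, ?_, ?_, ?_⟩
      · have := card_union_le {(s, x)} T
        rw [card_singleton] at this
        omega
      · intro u hu
        by_contra hne
        obtain ⟨e, he, rfl⟩ := cnt_ne_zero hne
        exact hu (hg2.rooted e he)
      · intro u hu hus
        rw [cnt_union hdis, hcnt, if_neg (Ne.symm hus), zero_add]
        exact h5 u (hu.mono subset_union_left) (fun hh => hu s x hx hxX hh.symm)
      · rw [cnt_union hdis, hcnt, if_pos rfl, h5 s (hs.mono subset_union_left) hne.symm]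
      · intro a ha
        obtain ⟨h7, h7', es, h8, h9, h10, h11⟩ := h6 a ha
        refine ⟨?_, (s, x) :: es, ⟨rfl, h8⟩, by simp [h9], ?_, ?_⟩
        · by_cases hh : h = 0
          · exact ⟨(s, x), by simp, h7' hh⟩
          · obtain ⟨e, he, hea⟩ := h7 hh
            exact ⟨e, mem_union_right _ he, hea⟩
        · intro e he
          rcases List.mem_cons.1 he with rfl | he
          · simp
          · exact mem_union_right _ (h10 e he)
        · rw [List.map_cons, List.nodup_cons]
          refine ⟨?_, h11⟩
          rw [List.mem_map]
          rintro ⟨e, he, hex⟩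
          have hx1 : x ∈ T.image Prod.snd := mem_image.2 ⟨e, h10 e he, hex⟩
          refine disjoint_left.1 h1.disj ?_ hx1
          rw [hX]; simp
    obtain ⟨T₁, c₁, A₁, g1, g2, g3, g4, g5, g6, g7⟩ := child hst hs (by omega) (by omega)
    have hc1 := g1.cap s
    have hcardX : (X ∪ T₁.image Prod.snd).card ≤ X.card + T₁.card :=
      (card_union_le _ _).trans (Nat.add_le_add_left card_image_le _)
    obtain ⟨T₂, c₂, A₂, k1, k2, k3, k4, k5, k6, k7⟩ := child g1.st
      (hs.mono subset_union_left) (by omega) (by omega)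
    have hg := g1.trans k1
    refine ⟨T₁ ∪ T₂, c₂, A₁ ∪ A₂, hg, ?_, ?_, ?_, ?_, ?_⟩
    · have := card_union_le T₁ T₂
      omega
    · rw [card_union_of_disjoint, g3, k3]
      · ring
      · rw [disjoint_left]
        intro a ha ha'
        obtain ⟨e, he, hea⟩ := (g7 a ha).1
        obtain ⟨e', he', hea'⟩ := (k7 a ha').1
        have := hN.inj _ _ _ _ (g1.nbr e he) (k1.nbr e' he') (hea.symm.trans hea')
        exact disjoint_left.1 k1.disj
          (mem_union_right _ (mem_image_of_mem _ he))
          (this ▸ mem_image_of_mem _ he')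
    · intro u hu
      by_contra hne
      obtain ⟨e, he, rfl⟩ := cnt_ne_zero hne
      exact hu (hg.rooted e he)
    · intro u hu hus
      rw [cnt_union, g5 u hu hus, k5 u (hu.mono subset_union_left) hus]
      exact Grown.disjoint_edges (X := X ∪ T₁.image Prod.snd) subset_union_right k1.disj rfl
    · intro a ha
      refine ⟨fun _ => ?_, by simp, ?_⟩
      · rcases mem_union.1 ha with ha | ha
        · obtain ⟨e, he, hh⟩ := (g7 a ha).1
          exact ⟨e, mem_union_left _ he, hh⟩
        · obtain ⟨e, he, hh⟩ := (k7 a ha).1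
          exact ⟨e, mem_union_right _ he, hh⟩
      · rcases mem_union.1 ha with ha | ha
        · obtain ⟨es, i1, i2, i3, i4⟩ := (g7 a ha).2
          exact ⟨es, i1, i2, fun e he => mem_union_left _ (i3 e he), i4⟩
        · obtain ⟨es, i1, i2, i3, i4⟩ := (k7 a ha).2
          exact ⟨es, i1, i2, fun e he => mem_union_right _ (i3 e he), i4⟩

lemma EP.fst_nodup (hN : Spreading N f m d B)
    {s a : L} {es : List (L × R)} (h : EP f s es a) (hes : ∀ e ∈ es, e.2 ∈ N e.1)
    (hnd : (es.map Prod.snd).Nodup) (hs : ∀ e ∈ es, f e.1 e.2 ≠ s) :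
    (es.map Prod.fst).Nodup := by
  induction es generalizing s with
  | nil => simp
  | cons e es ih =>
    obtain ⟨rfl, h2⟩ := h
    rw [List.map_cons, List.nodup_cons] at hnd ⊢
    refine ⟨?_, ih h2 (fun e' he' => hes e' (by simp [he'])) hnd.2 fun e' he' heq => ?_⟩
    · rw [List.mem_map]
      rintro ⟨e', he', hee⟩
      rcases h2.fst_mem e' he' with h3 | ⟨e'', h3, h4⟩
      · exact hs e (by simp) (h3.symm.trans hee)
      · exact hs e'' (by simp [h3]) (h4.symm.trans hee)
    · have := hN.inj _ _ _ _ (hes e' (by simp [he'])) (hes e (by simp)) heq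
      exact hnd.1 (List.mem_map.2 ⟨e', he', this⟩)

/-- Connect `s` and `t` through the relation `J`. -/
lemma St.connect (hN : Spreading N f m d B) (hd : 2 ≤ d)
    {h : ℕ} (hmh : m ≤ 2 ^ h) (J : L → L → Prop)
    (k : ℕ) (hk : 1 ≤ k) {X : Finset R} {c : L → ℕ} (hst : St N f m d X c)
    {s t : L} (hs : Rooted N f X s) (ht : Rooted N f X t) (hne : s ≠ t)
    (hcs : 1 ≤ c s) (hct : 1 ≤ c t) (hB : X.card + k + 4 * 2 ^ h ≤ B)
    (hJ : ∀ A A' : Finset L, m ≤ A.card → m ≤ A'.card → Disjoint A A' →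
      (∀ a ∈ A ∪ A', ¬ Rooted N f X a) → ∃ a ∈ A, ∃ a' ∈ A', J a a') :
    ∃ (es es' : List (L × R)) (a a' : L) (c' : L → ℕ),
      Grown N f m d X c (es.toFinset ∪ es'.toFinset) c' ∧
      EP f s es a ∧ EP f t es' a' ∧ J a a' ∧ es.length = k + h ∧ es'.length = h + 1 ∧
      ((es ++ es').map Prod.snd).Nodup ∧
      (∀ u, c u ≤ c' u + 1) ∧ (∀ u, Rooted N f X u → u ≠ s → u ≠ t → c' u = c u) := by
  have hpos : 1 ≤ 2 ^ h := Nat.one_le_two_pow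
  obtain ⟨T₁, c₁, p₁, s', a1, a2, a3, a4, a5, a6, a7⟩ :=
    hst.walk hN (by omega) k hs hcs (by omega)
  have ha7 := a7 (by omega)
  have hT₁ : T₁.card ≤ k := by rw [a2, ← a4]; exact List.toFinset_card_le _
  have hX₁ : (X ∪ T₁.image Prod.snd).card ≤ X.card + T₁.card :=
    (card_union_le _ _).trans (Nat.add_le_add_left card_image_le _)
  have hroot1 : ∀ e ∈ T₁, Rooted N f X e.1 → e.1 = s := by
    intro e he hr
    rw [a2, List.mem_toFinset] at he
    rcases a3.fst_mem e he with h1 | ⟨e', h1, h2⟩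
    · exact h1
    · have h3 : e' ∈ T₁ := by rw [a2]; simpa using h1
      exact (hr e'.1 e'.2 (a1.nbr e' h3) (fun hh => disjoint_left.1 a1.disj hh
        (mem_image_of_mem _ h3)) h2.symm).elim
  have hct1 : 1 ≤ c₁ t := by
    have h1 := a1.cap t
    have h2 : cnt T₁ t = 0 := by
      by_contra hn
      obtain ⟨e, he, hee⟩ := cnt_ne_zero hn
      exact hne (hee ▸ (hroot1 e he (hee ▸ ht)).symm)
    omega
  obtain ⟨T₂, c₂, p₂, t', b1, b2, b3, b4, b5, b6, b7⟩ :=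
    a1.st.walk hN (by omega) 1 (ht.mono subset_union_left) hct1 (by omega)
  have hb7 := b7 (by omega)
  have hT₂ : T₂.card ≤ 1 := by rw [b2, ← b4]; exact List.toFinset_card_le _
  have hst' : s' ≠ t' := fun hh => hb7.2 (hh ▸ a6)
  have hs't : s' ≠ t := fun hh => ha7.2 (hh ▸ ht)
  have hX₂ : (X ∪ T₁.image Prod.snd ∪ T₂.image Prod.snd).card ≤ X.card + T₁.card + T₂.card :=
    (card_union_le _ _).trans (Nat.add_le_add hX₁ card_image_le)
  have hp₂ : ∀ e ∈ T₂, e.1 = t := by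
    intro e he
    rw [b2, List.mem_toFinset] at he
    obtain ⟨e', rfl⟩ := List.length_eq_one_iff.1 b4
    rw [List.mem_singleton] at he
    subst he
    exact b3.1
  have hcs2 : 2 ≤ c₂ s' := by
    have h1 := b1.cap s'
    have h2 : cnt T₂ s' = 0 := by
      by_contra hn
      obtain ⟨e, he, hee⟩ := cnt_ne_zero hn
      exact hs't (hee ▸ hp₂ e he)
    omega
  have hr' : Rooted N f (X ∪ T₁.image Prod.snd ∪ T₂.image Prod.snd) s' :=
    a6.mono subset_union_left
  obtain ⟨T₃, c₃, A, g1, g2, g3, g4, g5, g6⟩ := b1.st.grow hN hd h hr' hcs2 (by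
    rw [pow_succ]; omega)
  rw [pow_succ] at g2
  have hX₃ : (X ∪ T₁.image Prod.snd ∪ T₂.image Prod.snd ∪ T₃.image Prod.snd).card ≤
      X.card + T₁.card + T₂.card + T₃.card :=
    (card_union_le _ _).trans (Nat.add_le_add hX₂ card_image_le)
  have hct3 : 2 ≤ c₃ t' := by
    have h1 := g1.cap t'
    have h2 := g5 t' b6 hst'.symm
    omega
  obtain ⟨T₄, c₄, A', k1, k2, k3, k4, k5, k6⟩ := g1.st.grow hN hd h
    (b6.mono subset_union_left) hct3 (by rw [pow_succ]; omega)
  have htot := ((a1.trans (T' := T₂) b1).trans (T' := T₃) (by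
    rw [image_union, ← union_assoc]; exact g1)).trans (T' := T₄) (c'' := c₄) (by
    rw [image_union, ← union_assoc, image_union, ← union_assoc]
    exact k1)
  -- freshness of the ends
  have hAroot : ∀ a ∈ A, ¬ Rooted N f X a ∧ Rooted N f
      (X ∪ T₁.image Prod.snd ∪ T₂.image Prod.snd ∪ T₃.image Prod.snd) a := by
    intro a ha
    by_cases hh : h = 0
    · rw [(g6 a ha).2.1 hh]
      exact ⟨ha7.2, hr'.mono subset_union_left⟩
    · obtain ⟨e, he, rfl⟩ := (g6 a ha).1 hh
      refine ⟨fun hr => hr e.1 e.2 (g1.nbr e he) (fun hX => ?_) rfl, g1.rooted_out hN he⟩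
      exact disjoint_left.1 g1.disj (mem_union_left _ (mem_union_left _ hX))
        (mem_image_of_mem _ he)
  have hA'root : ∀ a ∈ A', ¬ Rooted N f X a ∧ a ∉ A := by
    intro a ha
    by_cases hh : h = 0
    · have h0 := (k6 a ha).2.1 hh
      rw [h0]
      refine ⟨fun hr => hb7.2 (hr.mono subset_union_left), fun hA => ?_⟩
      exact hst' ((g6 _ hA).2.1 hh).symm
    · obtain ⟨e, he, rfl⟩ := (k6 a ha).1 hh
      have hnX : e.2 ∉ X ∪ T₁.image Prod.snd ∪ T₂.image Prod.snd ∪ T₃.image Prod.snd :=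
        fun hX => disjoint_left.1 k1.disj hX (mem_image_of_mem _ he)
      refine ⟨fun hr => hr e.1 e.2 (k1.nbr e he) (fun hX => hnX ?_) rfl, fun hA => ?_⟩
      · exact mem_union_left _ (mem_union_left _ (mem_union_left _ hX))
      · exact (hAroot _ hA).2 e.1 e.2 (k1.nbr e he) hnX rfl
  obtain ⟨a, haA, a', haA', hJaa⟩ := hJ A A' (by omega) (by omega)
    (disjoint_right.2 fun a ha => (hA'root a ha).2) (by
      intro a ha
      rcases mem_union.1 ha with ha | ha
      exacts [(hAroot a ha).1, (hA'root a ha).1])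
  obtain ⟨q₁, i1, i2, i3, i4⟩ := (g6 a haA).2.2
  obtain ⟨q₂, j1, j2, j3, j4⟩ := (k6 a' haA').2.2
  have e1 : EP f s (p₁ ++ q₁) a := a3.append i1
  have e2 : EP f t (p₂ ++ q₂) a' := b3.append j1
  have hmem1 : ∀ e ∈ p₁ ++ q₁, e ∈ T₁ ∪ T₃ := by
    intro e he
    rcases List.mem_append.1 he with he | he
    · exact mem_union_left _ (by rw [a2]; simpa using he)
    · exact mem_union_right _ (i3 e he)
  have hmem2 : ∀ e ∈ p₂ ++ q₂, e ∈ T₂ ∪ T₄ := by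
    intro e he
    rcases List.mem_append.1 he with he | he
    · exact mem_union_left _ (by rw [b2]; simpa using he)
    · exact mem_union_right _ (j3 e he)
  have hsub : (p₁ ++ q₁).toFinset ∪ (p₂ ++ q₂).toFinset ⊆ T₁ ∪ T₂ ∪ T₃ ∪ T₄ := by
    intro e he
    rw [mem_union, List.mem_toFinset, List.mem_toFinset] at he
    have := hmem1 e
    have := hmem2 e
    grind
  have d12 : Disjoint (T₁.image Prod.snd) (T₂.image Prod.snd) :=
    b1.disj.mono_left subset_union_right
  have d13 : Disjoint (T₁.image Prod.snd) (T₃.image Prod.snd) :=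
    g1.disj.mono_left (subset_union_right.trans subset_union_left)
  have d23 : Disjoint (T₂.image Prod.snd) (T₃.image Prod.snd) :=
    g1.disj.mono_left subset_union_right
  have d4 : ∀ x ∈ T₄.image Prod.snd, x ∉ X ∪ T₁.image Prod.snd ∪ T₂.image Prod.snd ∪
    T₃.image Prod.snd := fun x hx hx' => disjoint_left.1 k1.disj hx' hx
  have hnd : ((p₁ ++ q₁ ++ (p₂ ++ q₂)).map Prod.snd).Nodup := by
    simp only [List.map_append]
    refine List.Nodup.append (List.Nodup.append a5 i4 ?_) (List.Nodup.append b5 j4 ?_) ?_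
    · intro x hx hx'
      obtain ⟨e, he, rfl⟩ := List.mem_map.1 hx
      obtain ⟨e', he', hee⟩ := List.mem_map.1 hx'
      exact disjoint_left.1 d13 (mem_image_of_mem _ (by rw [a2]; simpa using he))
        (mem_image.2 ⟨e', i3 e' he', hee⟩)
    · intro x hx hx'
      obtain ⟨e, he, rfl⟩ := List.mem_map.1 hx
      obtain ⟨e', he', hee⟩ := List.mem_map.1 hx'
      refine d4 e.2 (mem_image.2 ⟨e', j3 e' he', hee⟩) ?_
      exact mem_union_left _ (mem_union_right _
        (mem_image_of_mem _ (by rw [b2]; simpa using he)))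
    · intro x hx hx'
      rw [← List.map_append] at hx hx'
      obtain ⟨e, he, rfl⟩ := List.mem_map.1 hx
      obtain ⟨e', he', hee⟩ := List.mem_map.1 hx'
      have h1 := hmem1 e he
      have h2 := hmem2 e' he'
      rcases mem_union.1 h2 with h2 | h2
      · have h2' : e.2 ∈ T₂.image Prod.snd := mem_image.2 ⟨e', h2, hee⟩
        rcases mem_union.1 h1 with h1 | h1
        · exact disjoint_left.1 d12 (mem_image_of_mem _ h1) h2'
        · exact disjoint_left.1 d23 h2' (mem_image_of_mem _ h1)
      · refine d4 e.2 (mem_image.2 ⟨e', h2, hee⟩) ?_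
        rcases mem_union.1 h1 with h1 | h1
        · exact mem_union_left _ (mem_union_left _ (mem_union_right _
            (mem_image_of_mem _ h1)))
        · exact mem_union_right _ (mem_image_of_mem _ h1)
  set T' := (p₁ ++ q₁).toFinset ∪ (p₂ ++ q₂).toFinset with hT'
  have hT'mem : ∀ e, e ∈ T' ↔ e ∈ (p₁ ++ q₁) ∨ e ∈ (p₂ ++ q₂) := by
    intro e; rw [hT', mem_union, List.mem_toFinset, List.mem_toFinset]
  have hnotX : ∀ e ∈ T', e.2 ∉ X := fun e he hX =>
    disjoint_left.1 htot.disj hX (mem_image_of_mem _ (hsub he))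
  have hfst : ∀ e ∈ T', e.1 = s ∨ e.1 = t ∨ ∃ e' ∈ T', e.1 = f e'.1 e'.2 := by
    intro e he
    rcases (hT'mem e).1 he with he | he
    · rcases e1.fst_mem e he with h1 | ⟨e', h1, h2⟩
      · exact Or.inl h1
      · exact Or.inr (Or.inr ⟨e', (hT'mem _).2 (Or.inl h1), h2⟩)
    · rcases e2.fst_mem e he with h1 | ⟨e', h1, h2⟩
      · exact Or.inr (Or.inl h1)
      · exact Or.inr (Or.inr ⟨e', (hT'mem _).2 (Or.inr h1), h2⟩)
  have hN' : ∀ e ∈ T', e.2 ∈ N e.1 := fun e he => htot.nbr e (hsub he)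
  have hrooted : ∀ u, Rooted N f X u → ∀ e ∈ T', f e.1 e.2 ≠ u := fun u hu e he =>
    hu e.1 e.2 (hN' e he) (hnotX e he)
  have hfin := Grown.prune hst htot hsub (by
    intro e he
    rcases hfst e he with h1 | h1 | ⟨e', h1, h2⟩
    · rw [h1]; exact hs.mono subset_union_left
    · rw [h1]; exact ht.mono subset_union_left
    · rw [h2]
      intro x y hy hyX heq
      exact hyX (mem_union_right _ (mem_image.2 ⟨e', h1,
        hN.inj _ _ _ _ (hN' e' h1) hy heq.symm⟩)))
  have hlist : T' = (p₁ ++ q₁ ++ (p₂ ++ q₂)).toFinset := by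
    rw [List.toFinset_append (l := p₁ ++ q₁)]
  have hfnd : ((p₁ ++ q₁ ++ (p₂ ++ q₂)).map Prod.fst).Nodup := by
    have hnd' := hnd
    rw [List.map_append, List.nodup_append] at hnd'
    rw [List.map_append]
    refine List.Nodup.append
      (e1.fst_nodup hN (fun e he => hN' e ((hT'mem e).2 (Or.inl he))) hnd'.1
        (fun e he => hrooted s hs e ((hT'mem e).2 (Or.inl he))))
      (e2.fst_nodup hN (fun e he => hN' e ((hT'mem e).2 (Or.inr he))) hnd'.2.1
        (fun e he => hrooted t ht e ((hT'mem e).2 (Or.inr he)))) ?_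
    intro u hu hu'
    obtain ⟨e, he, rfl⟩ := List.mem_map.1 hu
    obtain ⟨e', he', hee⟩ := List.mem_map.1 hu'
    rcases e1.fst_mem e he with h1 | ⟨w, h1, h2⟩
    · rcases e2.fst_mem e' he' with h3 | ⟨w', h3, h4⟩
      · exact hne (by rw [← h1, ← h3, hee])
      · exact hrooted s hs w' ((hT'mem w').2 (Or.inr h3)) (by rw [← h4, hee, h1])
    · rcases e2.fst_mem e' he' with h3 | ⟨w', h3, h4⟩
      · exact hrooted t ht w ((hT'mem w).2 (Or.inl h1)) (by rw [← h2, ← hee, h3])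
      · have h5 := hN.inj _ _ _ _ (hN' w ((hT'mem w).2 (Or.inl h1)))
          (hN' w' ((hT'mem w').2 (Or.inr h3))) (by rw [← h2, ← h4, hee])
        exact hnd'.2.2 w.2 (List.mem_map_of_mem h1) w'.2 (List.mem_map_of_mem h3) h5
  have hcnt1 : ∀ u, cnt T' u ≤ 1 := by
    intro u
    rw [cnt, card_le_one]
    intro e he e' he'
    rw [mem_filter, hlist, List.mem_toFinset] at he he'
    exact List.inj_on_of_nodup_map hfnd he.1 he'.1 (he.2.trans he'.2.symm)
  refine ⟨p₁ ++ q₁, p₂ ++ q₂, a, a', _, hfin, e1, e2, hJaa, by simp [a4, i2],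
    by simp [b4, j2, add_comm],
    hnd, fun u => ?_, fun u hu hus hut => ?_⟩
  · have := hcnt1 u
    omega
  · have h0 : cnt T' u = 0 := by
      by_contra hn
      obtain ⟨e, he, hee⟩ := cnt_ne_zero hn
      rcases hfst e he with h1 | h1 | ⟨e', h1, h2⟩
      · exact hus (hee ▸ h1)
      · exact hut (hee ▸ h1)
      · exact hrooted u hu e' h1 (by rw [← h2, hee])
    omega

end FriedmanPippenger

section GraphState

open Classical in
/-- The neighbourhood of `v` as a finset. -/
noncomputable def nb {V : Type*} [Fintype V] (H : SimpleGraph V) (v : V) : Finset V :=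
  univ.filter (H.Adj v)

variable {V : Type*} [Fintype V] [DecidableEq V]

lemma mem_nb {H : SimpleGraph V} {v w : V} : w ∈ nb H v ↔ H.Adj v w := by simp [nb]

/-- `Seg H u l v`: the list `u :: l` is a walk in `H` ending in `v`. -/
def Seg (H : SimpleGraph V) : V → List V → V → Prop
  | u, [], v => u = v
  | u, x :: l, v => H.Adj u x ∧ Seg H x l v

lemma Seg.append {H : SimpleGraph V} {u v w : V} {l l' : List V} (h : Seg H u l v)
    (h' : Seg H v l' w) : Seg H u (l ++ l') w := by
  induction l generalizing u with
  | nil => cases h; exact h'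
  | cons x l ih => exact ⟨h.1, ih h.2⟩

lemma Seg.split {H : SimpleGraph V} {u w : V} {l l' : List V} (h : Seg H u (l ++ l') w) :
    ∃ v, Seg H u l v ∧ Seg H v l' w := by
  induction l generalizing u with
  | nil => exact ⟨u, rfl, h⟩
  | cons x l ih =>
    obtain ⟨v, h1, h2⟩ := ih h.2
    exact ⟨v, ⟨h.1, h1⟩, h2⟩

lemma Seg.eq_of_concat {H : SimpleGraph V} {u v w : V} {l : List V} (h : Seg H u (l ++ [v]) w) :
    v = w := by
  obtain ⟨x, _, h2⟩ := h.split
  exact h2.2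

lemma Seg.reverse {H : SimpleGraph V} {u v : V} {l : List V} (h : Seg H u (l ++ [v]) v) :
    Seg H v (l.reverse ++ [u]) u := by
  induction l generalizing u with
  | nil => exact ⟨h.1.symm, rfl⟩
  | cons x l ih =>
    have h1 := ih h.2
    rw [List.reverse_cons]
    exact h1.append ⟨h.1.symm, rfl⟩

lemma Seg.mono {H H' : SimpleGraph V} (hH : H ≤ H') {u v : V} {l : List V} (h : Seg H u l v) :
    Seg H' u l v := by
  induction l generalizing u with
  | nil => exact h
  | cons x l ih => exact ⟨hH h.1, ih h.2⟩

/-- State of an embedding into `H`. -/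
abbrev GSt (H : SimpleGraph V) (m d : ℕ) (X : Finset V) (c : V → ℕ) : Prop :=
  St (nb H) (fun _ x => x) m d X c

/-- Parameters and properties of the graph in which structures are built. -/
structure Expander (H : SimpleGraph V) (m d B h : ℕ) : Prop where
  one_le : 1 ≤ m
  d_ge : 6 ≤ d
  le_pow : m ≤ 2 ^ h
  big : ∀ U : Finset V, m ≤ U.card → U.card ≤ 2 * m →
    2 * m * d + (B + 4 * 2 ^ h) < (U.biUnion (nb H)).card
  joined : ∀ A A' : Finset V, m ≤ A.card → m ≤ A'.card → Disjoint A A' →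
    ∃ a ∈ A, ∃ a' ∈ A', H.Adj a a'

/-- The state `(X ∪ Z, c')` is obtained from `(X, c)` changing capacities in `X` only on `I`. -/
structure Built (H : SimpleGraph V) (m d : ℕ) (X : Finset V) (c : V → ℕ) (I Z : Finset V)
    (c' : V → ℕ) : Prop where
  disj : Disjoint X Z
  st : GSt H m d (X ∪ Z) c'
  keep : ∀ u ∈ X, u ∉ I → c' u = c u

variable {H : SimpleGraph V} {m d B h : ℕ}

lemma Built.refl {X : Finset V} {c : V → ℕ} (h : GSt H m d X c) (I : Finset V) :
    Built H m d X c I ∅ c :=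
  ⟨by simp, by simpa using h, fun _ _ _ => rfl⟩

lemma Built.trans {X I Z I' Z' J : Finset V} {c c' c'' : V → ℕ} (h : Built H m d X c I Z c')
    (h' : Built H m d (X ∪ Z) c' I' Z' c'') (hI : I ⊆ J) (hI' : I' ⊆ J ∪ Z) :
    Built H m d X c J (Z ∪ Z') c'' where
  disj := disjoint_union_right.2 ⟨h.disj, h'.disj.mono_left subset_union_left⟩
  st := by rw [← union_assoc]; exact h'.st
  keep u hu huJ := by
    rw [h'.keep u (mem_union_left _ hu), h.keep u hu (fun hh => huJ (hI hh))]
    intro hh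
    rcases mem_union.1 (hI' hh) with h1 | h1
    exacts [huJ h1, disjoint_left.1 h.disj hu h1]

lemma Built.weaken {X I Z J : Finset V} {c c' : V → ℕ} (h : Built H m d X c I Z c')
    (hI : I ⊆ J) : Built H m d X c J Z c' :=
  ⟨h.disj, h.st, fun u hu hn => h.keep u hu (fun hh => hn (hI hh))⟩

lemma rooted_of_mem {X : Finset V} {s : V} (hs : s ∈ X) :
    Rooted (nb H) (fun _ x => x) X s := by
  intro s' x' _ hx hxs
  have hxs' : x' = s := hxs
  exact hx (hxs' ▸ hs)

/-- Attach a new leaf to `s`. -/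
lemma GSt.leaf (hE : Expander H m d B h) {X : Finset V} {c : V → ℕ} (hst : GSt H m d X c)
    (hB : X.card ≤ B) {s : V} (hs : s ∈ X) (hc : 1 ≤ c s) :
    ∃ (x : V) (c' : V → ℕ), H.Adj s x ∧ Built H m d X c {s} {x} c' ∧ c s = c' s + 1 ∧
      d ≤ c' x := by
  obtain ⟨x, hx, hxX, hg, -⟩ := St.step (B := B + 4 * 2 ^ h) hst
    ⟨hE.one_le, hE.big, fun _ _ _ _ _ _ h => h⟩ (by omega) (rooted_of_mem hs) hc
  have hxs : x ≠ s := fun hh => hxX (hh ▸ hs)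
  refine ⟨x, update c s (c s - 1), mem_nb.1 hx, ⟨by simpa using hxX, ?_, ?_⟩,
    by rw [update_self]; omega, ?_⟩
  · simpa using hg.st
  · intro u hu hus
    rw [update_of_ne (by simpa using hus)]
  · rw [update_of_ne hxs]
    exact hst.fresh s x hx hxX

lemma EP.toSeg {s a : V} {es : List (V × V)} (h : EP (fun _ x => x) s es a)
    (hN : ∀ e ∈ es, e.2 ∈ nb H e.1) : Seg H s (es.map Prod.snd) a := by
  induction es generalizing s with
  | nil => exact h
  | cons e es ih =>
    obtain ⟨rfl, h2⟩ := h
    exact ⟨mem_nb.1 (hN e (by simp)), ih h2 fun e' he' => hN e' (by simp [he'])⟩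

/-- Connect `s` to `t` by a path with exactly `k + 2 * h + 1` new interior vertices. -/
lemma GSt.connect (hE : Expander H m d B h) {X : Finset V} {c : V → ℕ} (hst : GSt H m d X c)
    {k : ℕ} (hk : 1 ≤ k) (hB : X.card + (k + 2 * h + 1) ≤ B) {s t : V} (hs : s ∈ X) (ht : t ∈ X)
    (hne : s ≠ t) (hcs : 1 ≤ c s) (hct : 1 ≤ c t) :
    ∃ (l : List V) (c' : V → ℕ), Seg H s (l ++ [t]) t ∧ l.length = k + 2 * h + 1 ∧ l.Nodup ∧
      Built H m d X c {s, t} l.toFinset c' ∧ (∀ u, c u ≤ c' u + 1) ∧ (∀ u ∈ l, d ≤ c' u + 1) := by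
  have hd := hE.d_ge
  obtain ⟨es, es', a, a', c', h1, h2, h3, h4, h5, h6, h7, h8, h9⟩ :=
    St.connect (B := B + 4 * 2 ^ h) ⟨hE.one_le, hE.big, fun _ _ _ _ _ _ h => h⟩ (by omega)
      hE.le_pow (fun a a' => H.Adj a a') k hk hst
      (rooted_of_mem hs) (rooted_of_mem ht) hne hcs hct (by omega)
      (fun A A' hA hA' hd _ => hE.joined A A' hA hA' hd)
  have hN : ∀ e ∈ es ++ es', e.2 ∈ nb H e.1 := fun e he => h1.nbr e (by simpa using he)
  have s1 := h2.toSeg (H := H) (fun e he => hN e (by simp [he]))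
  have s2 := h3.toSeg (H := H) (fun e he => hN e (by simp [he]))
  obtain ⟨p, hp⟩ : ∃ p, es'.map Prod.snd = p ++ [a'] := by
    rcases List.eq_nil_or_concat (es'.map Prod.snd) with h0 | ⟨p, y, hp⟩
    · rw [List.map_eq_nil_iff] at h0
      rw [h0] at h6; simp at h6
    · rw [hp, List.concat_eq_append] at s2
      exact ⟨p, by rw [hp, List.concat_eq_append, s2.eq_of_concat]⟩
  have hset : (es.map Prod.snd ++ (es'.map Prod.snd).reverse).toFinset =
      (es.toFinset ∪ es'.toFinset).image Prod.snd := by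
    ext x
    simp only [List.mem_toFinset, List.mem_append, List.mem_reverse, List.mem_map,
      mem_image, mem_union]
    grind
  refine ⟨es.map Prod.snd ++ (es'.map Prod.snd).reverse, c', ?_, by simp [h5, h6]; omega, ?_,
    ⟨?_, ?_, ?_⟩, h8, ?_⟩
  · rw [List.append_assoc]
    refine s1.append ?_
    rw [hp] at s2 ⊢
    rw [List.reverse_append, List.reverse_singleton]
    exact ⟨h4, s2.reverse⟩
  · rw [List.map_append, List.nodup_append] at h7
    refine List.Nodup.append h7.1 (List.nodup_reverse.2 h7.2.1) ?_
    intro x hx hx'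
    exact h7.2.2 x hx x (List.mem_reverse.1 hx') rfl
  · rw [hset]; exact h1.disj
  · rw [hset]; exact h1.st
  · intro u hu hun
    simp only [mem_insert, mem_singleton, not_or] at hun
    exact h9 u (rooted_of_mem hu) hun.1 hun.2
  · intro u hu
    refine le_trans ?_ (h8 u)
    have hu' : u ∈ (es.toFinset ∪ es'.toFinset).image Prod.snd := by
      rw [← hset]; simpa using hu
    obtain ⟨e, he, rfl⟩ := mem_image.1 hu'
    exact hst.fresh e.1 e.2 (h1.nbr e he) (fun hX => disjoint_left.1 h1.disj hX hu')

/-- Build a family of structures one after another. -/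
lemma GSt.family {κ W : Type*} [Nonempty W] (s : Finset κ) (I : κ → Finset V)
    (cost : ℕ) (P : κ → Finset V → W → Prop) (O : κ → W → Finset V) (e : ℕ)
    (need : κ → (V → ℕ) → Prop)
    (hneed : ∀ k ∈ s, ∀ c c' : V → ℕ, (∀ u ∈ I k, c' u = c u) → need k c → need k c')
    (hstep : ∀ k ∈ s, ∀ X c, GSt H m d X c → I k ⊆ X → need k c → X.card + cost ≤ B →
      ∃ Z c' w, Built H m d X c (I k) Z c' ∧ P k Z w ∧ Z.card ≤ cost ∧ O k w ⊆ Z ∧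
        ∀ v ∈ O k w, e ≤ c' v)
    {X : Finset V} {c : V → ℕ} (hst : GSt H m d X c) (hI : ∀ k ∈ s, I k ⊆ X)
    (hdisj : ∀ k ∈ s, ∀ k' ∈ s, k ≠ k' → Disjoint (I k) (I k'))
    (hc : ∀ k ∈ s, need k c) (hB : X.card + s.card * cost ≤ B) :
    ∃ (Z : κ → Finset V) (c' : V → ℕ) (w : κ → W),
      Built H m d X c (s.biUnion I) (s.biUnion Z) c' ∧
      (∀ k ∈ s, P k (Z k) (w k) ∧ (Z k).card ≤ cost ∧ O k (w k) ⊆ Z k ∧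
        ∀ v ∈ O k (w k), e ≤ c' v) ∧
      (∀ k ∈ s, ∀ k' ∈ s, k ≠ k' → Disjoint (Z k) (Z k')) := by
  classical
  induction s using Finset.induction_on with
  | empty =>
    exact ⟨fun _ => ∅, c, fun _ => Classical.arbitrary W, by simpa using Built.refl hst _,
      by simp, by simp⟩
  | insert k s hk ih =>
    rw [card_insert_of_notMem hk, Nat.add_mul, one_mul] at hB
    obtain ⟨Z, c₁, w, h1, h2, h3⟩ := ih
      (fun k hk => hneed k (mem_insert_of_mem hk))
      (fun k hk => hstep k (mem_insert_of_mem hk))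
      (fun k hk => hI k (mem_insert_of_mem hk))
      (fun k hk k' hk' => hdisj k (mem_insert_of_mem hk) k' (mem_insert_of_mem hk'))
      (fun k hk => hc k (mem_insert_of_mem hk)) (by omega)
    have hcard : (s.biUnion Z).card ≤ s.card * cost :=
      card_biUnion_le_card_mul _ _ _ fun k hk => (h2 k hk).2.1
    have hkI : ∀ u ∈ I k, c₁ u = c u := by
      intro u hu
      refine h1.keep u (hI k (mem_insert_self _ _) hu) fun hu' => ?_
      obtain ⟨k', hk', hu''⟩ := mem_biUnion.1 hu'
      exact disjoint_left.1 (hdisj k (mem_insert_self _ _) k'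
        (mem_insert_of_mem hk') (fun hh => hk (hh ▸ hk'))) hu hu''
    obtain ⟨Z', c', w', g1, g2, g3, g4, g5⟩ := hstep k (mem_insert_self _ _)
      (X ∪ s.biUnion Z) c₁ h1.st
      ((hI k (mem_insert_self _ _)).trans subset_union_left)
      (hneed k (mem_insert_self _ _) _ _ hkI (hc k (mem_insert_self _ _)))
      (by have := card_union_le X (s.biUnion Z); omega)
    have hZ : ∀ k' ∈ s, update Z k Z' k' = Z k' := fun k' hk' =>
      update_of_ne (ne_of_mem_of_not_mem hk' hk) _ _
    have hw : ∀ k' ∈ s, update w k w' k' = w k' := fun k' hk' =>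
      update_of_ne (ne_of_mem_of_not_mem hk' hk) _ _
    have hdZ : ∀ k' ∈ s, Disjoint Z' (Z k') := fun k' hk' =>
      (g1.disj.mono_left ((subset_biUnion_of_mem Z hk').trans
        subset_union_right)).symm
    refine ⟨update Z k Z', c', update w k w', ?_, ?_, ?_⟩
    · have h4 := h1.trans g1 (J := (insert k s).biUnion I)
        (biUnion_subset_biUnion_of_subset_left _ (subset_insert _ _))
        ((subset_biUnion_of_mem I (mem_insert_self k s)).trans
          subset_union_left)
      rw [biUnion_insert (t := update Z k Z'), update_self,
        biUnion_congr rfl hZ, union_comm Z']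
      exact h4
    · intro k' hk'
      rcases mem_insert.1 hk' with rfl | hk'
      · simp only [update_self]
        exact ⟨g2, g3, g4, g5⟩
      · rw [hZ k' hk', hw k' hk']
        obtain ⟨i1, i2, i3, i4⟩ := h2 k' hk'
        refine ⟨i1, i2, i3, fun v hv => ?_⟩
        have hvZ : v ∈ s.biUnion Z := mem_biUnion.2 ⟨k', hk', i3 hv⟩
        rw [g1.keep v (mem_union_right _ hvZ)]
        · exact i4 v hv
        · intro hvI
          exact disjoint_left.1 h1.disj (hI k (mem_insert_self _ _) hvI) hvZ
    · intro k₁ hk₁ k₂ hk₂ hne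
      rcases mem_insert.1 hk₁ with e₁ | m₁ <;> rcases mem_insert.1 hk₂ with e₂ | m₂
      · exact absurd (e₁.trans e₂.symm) hne
      · rw [e₁, update_self, hZ k₂ m₂]; exact hdZ k₂ m₂
      · rw [e₂, update_self, hZ k₁ m₁]; exact (hdZ k₁ m₁).symm
      · rw [hZ k₁ m₁, hZ k₂ m₂]; exact h3 k₁ m₁ k₂ m₂ hne

/-- A ladder between two walks from `x` to `p` and from `x'` to `p'`, with rungs joining
corresponding vertices. -/
def Ladder (H : SimpleGraph V) : V → V → List (V × V × List V) → V → V → Prop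
  | x, x', [], p, p' => H.Adj x p ∧ H.Adj x' p'
  | x, x', t :: T, p, p' => H.Adj x t.1 ∧ H.Adj x' t.2.1 ∧ Seg H t.1 (t.2.2 ++ [t.2.1]) t.2.1 ∧
      Ladder H t.1 t.2.1 T p p'

/-- All vertices of a ladder. -/
def ladderVerts (T : List (V × V × List V)) : Multiset V :=
  (T.map fun t => ({t.1, t.2.1} : Multiset V) + (t.2.2 : Multiset V)).sum

lemma ladderVerts_card {T : List (V × V × List V)} {k : ℕ} (hT : ∀ t ∈ T, t.2.2.length = k) :
    (ladderVerts T).card = T.length * (k + 2) := by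
  induction T with
  | nil => simp [ladderVerts]
  | cons t T ih =>
    have h1 := ih fun t' ht' => hT t' (by simp [ht'])
    have h2 := hT t (by simp)
    unfold ladderVerts at h1 ⊢
    rw [List.map_cons, List.sum_cons, Multiset.card_add, h1, Multiset.card_add,
      Multiset.coe_card, h2, List.length_cons]
    simp only [Multiset.insert_eq_cons, Multiset.card_cons, Multiset.card_singleton]
    ring

lemma Ladder.route {x x' p p' : V} {T : List (V × V × List V)} (hT : Ladder H x x' T p p')
    {k : ℕ} (hk : ∀ t ∈ T, t.2.2.length = k) (b : Bool) :
    ∃ (b' : Bool) (l : List V), Seg H (bif b' then x' else x) l (bif b then p' else p) ∧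
      (l : Multiset V) = ladderVerts T + {bif b then p' else p} ∧
      l.length = T.length * (k + 2) + 1 := by
  induction T generalizing x x' with
  | nil =>
    refine ⟨b, [bif b then p' else p], ?_, by simp [ladderVerts], by simp⟩
    cases b
    exacts [⟨hT.1, rfl⟩, ⟨hT.2, rfl⟩]
  | cons t T ih =>
    obtain ⟨u, v, w⟩ := t
    obtain ⟨h1, h2, h3, h4⟩ := hT
    obtain ⟨b', l, g1, g2, g3⟩ := ih h4 fun t ht => hk t (by simp [ht])
    have hw : w.length = k := hk (u, v, w) (by simp)
    have hv : ladderVerts ((u, v, w) :: T) = ({u, v} : Multiset V) + w + ladderVerts T := by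
      simp [ladderVerts]
    have huv : ({u, v} : Multiset V) = {u} + {v} := rfl
    cases b'
    · refine ⟨true, v :: w.reverse ++ u :: l, ?_, ?_, ?_⟩
      · refine ⟨h2, ?_⟩
        have := h3.reverse.append g1
        simpa using this
      · have e1 : ((v :: w.reverse ++ u :: l : List V) : Multiset V) =
            {v} + w + {u} + l := by
          rw [← Multiset.coe_add, ← Multiset.cons_coe, ← Multiset.cons_coe,
            ← Multiset.singleton_add, ← Multiset.singleton_add, Multiset.coe_reverse, add_assoc,
            add_assoc]
          simp only [add_assoc]
        rw [e1, g2, hv, huv]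
        abel
      · simp [g3, hw]; ring
    · refine ⟨false, u :: w ++ v :: l, ?_, ?_, ?_⟩
      · refine ⟨h1, ?_⟩
        have := h3.append g1
        simpa using this
      · have e1 : ((u :: w ++ v :: l : List V) : Multiset V) = {u} + w + {v} + l := by
          rw [← Multiset.coe_add, ← Multiset.cons_coe, ← Multiset.cons_coe,
            ← Multiset.singleton_add, ← Multiset.singleton_add]
          simp only [add_assoc]
        rw [e1, g2, hv, huv]
        abel
      · simp [g3, hw]; ring

/-- Add the rungs between two given walks. -/
lemma GSt.ladder (hE : Expander H m d B h) {p p' : V} (l l' : List V) :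
    ∀ {x x' : V} {X : Finset V} {c : V → ℕ} (_ : GSt H m d X c) (_ : l.length = l'.length)
      (_ : Seg H x (l ++ [p]) p) (_ : Seg H x' (l' ++ [p']) p') (_ : (l ++ l').Nodup)
      (_ : ∀ u ∈ l ++ l', u ∈ X ∧ 1 ≤ c u) (_ : X.card + l.length * (2 * h + 2) ≤ B),
      ∃ (T : List (V × V × List V)) (Z : Finset V) (c' : V → ℕ),
        Ladder H x x' T p p' ∧ (∀ t ∈ T, t.2.2.length = 2 * h + 2) ∧ T.length = l.length ∧
        ladderVerts T = l + l' + Z.val ∧ Built H m d X c (l ++ l').toFinset Z c' := by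
  induction l generalizing l' with
  | nil =>
    intro x x' X c hst hl hs hs' _ _ _
    have : l' = [] := List.length_eq_zero_iff.1 hl.symm
    subst this
    exact ⟨[], ∅, c, ⟨hs.1, hs'.1⟩, by simp, rfl, by simp [ladderVerts], Built.refl hst _⟩
  | cons u l ih =>
    intro x x' X c hst hl hs hs' hnd hX hB
    obtain _ | ⟨v, l'⟩ := l'
    · simp at hl
    have huv : u ≠ v := by
      rintro rfl
      simp at hnd
    simp only [List.length_cons, Nat.add_mul, one_mul] at hB hl
    obtain ⟨w, c₁, g1, g2, g3, g4, -, -⟩ := hst.connect hE (k := 1) le_rfl (by omega)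
      (hX u (by simp)).1 (hX v (by simp)).1 huv (hX u (by simp)).2 (hX v (by simp)).2
    have hsub : ∀ a ∈ l ++ l', a ∈ u :: l ++ v :: l' := by
      intro a ha; simp only [List.mem_append, List.mem_cons] at ha ⊢; tauto
    have hnin : ∀ a ∈ l ++ l', a ∉ ({u, v} : Finset V) := by
      intro a ha hh
      simp only [mem_insert, mem_singleton] at hh
      rcases hh with rfl | rfl
      · rw [List.cons_append, List.nodup_cons] at hnd
        exact hnd.1 (by simp only [List.mem_append, List.mem_cons] at ha ⊢; tauto)
      · have := (List.perm_middle (l₁ := u :: l) (l₂ := l') (a := a)).nodup_iff.1 hnd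
        rw [List.nodup_cons] at this
        exact this.1 (by
          simp only [List.mem_append, List.cons_append, List.mem_cons] at ha ⊢; tauto)
    have hnd' : (l ++ l').Nodup := by
      refine hnd.sublist ?_
      exact (List.sublist_cons_self _ _).append (List.sublist_cons_self _ _)
    have hwc : w.toFinset.card = 2 * h + 2 := by
      rw [List.toFinset_card_of_nodup g3, g2]; ring
    obtain ⟨T, Z, c', k1, k2, k3, k4, k5⟩ :=
      ih l' (x := u) (x' := v) g4.st (by omega) hs.2 hs'.2 hnd'
      (by
        intro a ha
        refine ⟨mem_union_left _ (hX a (hsub a ha)).1, ?_⟩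
        rw [g4.keep a (hX a (hsub a ha)).1 (hnin a ha)]
        exact (hX a (hsub a ha)).2)
      (by have := card_union_le X w.toFinset; omega)
    refine ⟨(u, v, w) :: T, w.toFinset ∪ Z, c', ⟨hs.1, hs'.1, g1, k1⟩, ?_, by simp [k3], ?_,
      g4.trans k5 ?_ ?_⟩
    · intro t ht
      rcases List.mem_cons.1 ht with rfl | ht
      · rw [g2]; ring
      · exact k2 t ht
    · have hdis : Disjoint w.toFinset Z := k5.disj.mono_left subset_union_right
      have hv : ladderVerts ((u, v, w) :: T) = ({u, v} : Multiset V) + w + ladderVerts T := by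
        simp [ladderVerts]
      have huv : ({u, v} : Multiset V) = {u} + {v} := rfl
      rw [hv, huv, k4, ← disjUnion_eq_union _ _ hdis, disjUnion_val,
        List.toFinset_val, g3.dedup, ← Multiset.cons_coe, ← Multiset.cons_coe,
        ← Multiset.singleton_add, ← Multiset.singleton_add]
      abel
    · intro a ha
      simp only [mem_insert, mem_singleton] at ha
      rcases ha with rfl | rfl <;> simp
    · intro a ha
      exact mem_union_left _ (List.mem_toFinset.2 (hsub a (List.mem_toFinset.1 ha)))

/-- Length of a route through a swap gadget. -/
def gadgetLen (h : ℕ) : ℕ := (h + 1) * (2 * h + 4) + 1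

/-- `o true, o false` are outputs of a gadget with inputs `a true, a false`. -/
def IsSwap (H : SimpleGraph V) (ℓ : ℕ) (a : Bool → V) (Z : Finset V) (o : Bool → V) : Prop :=
  Injective o ∧ (∀ i, o i ∈ Z) ∧
  ∀ s : Bool, ∃ l : Bool → List V, (∀ i, Seg H (a i) (l i) (o (xor i s)) ∧ (l i).length = ℓ) ∧
    ∑ i, (l i : Multiset V) = Z.val

lemma GSt.swap (hE : Expander H m d B h) {X : Finset V} {c : V → ℕ} (hst : GSt H m d X c)
    {a : Bool → V} (ha : Injective a) (haX : ∀ i, a i ∈ X) (hac : ∀ i, 2 ≤ c (a i))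
    (hB : X.card + 2 * gadgetLen h ≤ B) :
    ∃ (Z : Finset V) (c' : V → ℕ) (o : Bool → V),
      Built H m d X c (univ.image a) Z c' ∧ IsSwap H (gadgetLen h) a Z o ∧
      Z.card = 2 * gadgetLen h ∧ ∀ i, d ≤ c' (o i) + 1 := by
  have hd := hE.d_ge
  have hne : a false ≠ a true := fun hh => by simpa using ha hh
  have hgl : 2 * gadgetLen h = 4 * h * h + 12 * h + 10 := by unfold gadgetLen; ring
  have hhh : 0 ≤ h * h := Nat.zero_le _
  have hmul : 4 * h * h = 4 * (h * h) := by ring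
  obtain ⟨P, c₁, p1, p2, p3, p4, p5, p6⟩ := hst.connect hE (k := 2) (by omega)
    (by omega) (haX false) (haX true) hne (by have := hac false; omega)
    (by have := hac true; omega)
  have hPc : P.toFinset.card = 2 * h + 3 := by
    rw [List.toFinset_card_of_nodup p3, p2]; ring
  obtain ⟨P', c₂, q1, q2, q3, q4, q5, q6⟩ := p4.st.connect hE (k := 2) (by omega)
    (by have := card_union_le X P.toFinset; omega)
    (mem_union_left _ (haX false)) (mem_union_left _ (haX true)) hne
    (by have := hac false; have := p5 (a false); omega)
    (by have := hac true; have := p5 (a true); omega)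
  have hPc' : P'.toFinset.card = 2 * h + 3 := by
    rw [List.toFinset_card_of_nodup q3, q2]; ring
  have b2 := p4.trans q4 (J := univ.image a) (by
    intro u hu
    simp only [mem_insert, mem_singleton] at hu
    rcases hu with rfl | rfl <;> simp) (by
    intro u hu
    simp only [mem_insert, mem_singleton] at hu
    rcases hu with rfl | rfl <;> simp)
  -- split both arms in the middle
  obtain ⟨A, p, A', rfl, hA, hA'⟩ : ∃ A p A', P = A ++ p :: A' ∧ A.length = h + 1 ∧
      A'.length = h + 1 := by
    refine ⟨P.take (h + 1), P[h + 1], P.drop (h + 2), ?_, ?_, ?_⟩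
    · rw [← List.drop_eq_getElem_cons, List.take_append_drop]
    · rw [List.length_take]; omega
    · rw [List.length_drop]; omega
  obtain ⟨D, q, D', rfl, hD, hD'⟩ : ∃ A p A', P' = A ++ p :: A' ∧ A.length = h + 1 ∧
      A'.length = h + 1 := by
    refine ⟨P'.take (h + 1), P'[h + 1], P'.drop (h + 2), ?_, ?_, ?_⟩
    · rw [← List.drop_eq_getElem_cons, List.take_append_drop]
    · rw [List.length_take]; omega
    · rw [List.length_drop]; omega
  have armsplit : ∀ {A A' : List V} {p : V}, Seg H (a false) (A ++ p :: A' ++ [a true]) (a true) →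
      Seg H (a false) (A ++ [p]) p ∧ Seg H (a true) (A'.reverse ++ [p]) p := by
    intro A A' p hs
    have hs' : Seg H (a false) ((A ++ [p]) ++ (A' ++ [a true])) (a true) := by simpa using hs
    obtain ⟨y, hy1, hy2⟩ := hs'.split
    have := hy1.eq_of_concat
    subst this
    exact ⟨hy1, hy2.reverse⟩
  obtain ⟨sA, sA'⟩ := armsplit p1
  obtain ⟨sD, sD'⟩ := armsplit q1
  have hPP : Disjoint (A ++ p :: A').toFinset (D ++ q :: D').toFinset :=
    q4.disj.mono_left subset_union_right
  have hnd : ((A ++ p :: A') ++ (D ++ q :: D')).Nodup := by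
    refine p3.append q3 fun x hx hx' => ?_
    exact disjoint_left.1 hPP (List.mem_toFinset.2 hx) (List.mem_toFinset.2 hx')
  have hcap : ∀ u ∈ (A ++ p :: A') ++ (D ++ q :: D'), u ∈ X ∪ ((A ++ p :: A').toFinset ∪
      (D ++ q :: D').toFinset) ∧ d ≤ c₂ u + 1 := by
    intro u hu
    rcases List.mem_append.1 hu with hu | hu
    · have huP := List.mem_toFinset.2 hu
      refine ⟨mem_union_right _ (mem_union_left _ huP), ?_⟩
      rw [q4.keep u (mem_union_right _ huP)]
      · exact p6 u hu
      · intro hh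
        have huX : u ∈ X := by
          simp only [mem_insert, mem_singleton] at hh
          rcases hh with rfl | rfl
          exacts [haX _, haX _]
        exact disjoint_left.1 p4.disj huX huP
    · exact ⟨mem_union_right _ (mem_union_right _ (List.mem_toFinset.2 hu)), q6 u hu⟩
  have hcard2 : (X ∪ ((A ++ p :: A').toFinset ∪ (D ++ q :: D').toFinset)).card ≤
      X.card + (4 * h + 6) := by
    have := card_union_le X ((A ++ p :: A').toFinset ∪ (D ++ q :: D').toFinset)
    have := card_union_le (A ++ p :: A').toFinset (D ++ q :: D').toFinset
    omega
  have hmul2 : (h + 1) * (2 * h + 2) = 2 * (h * h) + 4 * h + 2 := by ring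
  obtain ⟨T, Z₁, c₃, t1, t2, t3, t4, t5⟩ := GSt.ladder hE (p := p) (p' := q) A D
    (x := a false) (x' := a false) b2.st (by omega) sA sD
    (hnd.sublist ((List.sublist_append_left _ _).append (List.sublist_append_left _ _)))
    (fun u hu => by
      have := hcap u (by simp only [List.mem_append, List.mem_cons] at hu ⊢; tauto)
      exact ⟨this.1, by omega⟩)
    (by rw [hA]; omega)
  have hndR : (A'.reverse ++ D'.reverse).Nodup := by
    have h1 : (A' ++ D').Nodup := hnd.sublist
      (((List.sublist_cons_self _ _).trans (List.sublist_append_right _ _)).append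
        ((List.sublist_cons_self _ _).trans (List.sublist_append_right _ _)))
    rw [List.nodup_append] at h1 ⊢
    refine ⟨List.nodup_reverse.2 h1.1, List.nodup_reverse.2 h1.2.1, fun x hx y hy => ?_⟩
    exact h1.2.2 x (List.mem_reverse.1 hx) y (List.mem_reverse.1 hy)
  have hkeep3 : ∀ u ∈ (A ++ p :: A') ++ (D ++ q :: D'), u ∉ A ++ D → c₃ u = c₂ u := fun u hu hn =>
    t5.keep u (hcap u hu).1 (fun hh => hn (List.mem_toFinset.1 hh))
  have hsep : ∀ u, u ∈ p :: A' ∨ u ∈ q :: D' → u ∉ A ++ D := by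
    intro u hu hu'
    have n1 := List.nodup_append.1 hnd
    have n2 := List.nodup_append.1 n1.1
    have n3 := List.nodup_append.1 n1.2.1
    rcases hu with hu | hu <;> rcases List.mem_append.1 hu' with hu' | hu'
    · exact n2.2.2 u hu' u hu rfl
    · exact n1.2.2 u (List.mem_append_right _ hu) u (List.mem_append_left _ hu') rfl
    · exact n1.2.2 u (List.mem_append_left _ hu') u (List.mem_append_right _ hu) rfl
    · exact n3.2.2 u hu' u hu rfl
  have hZ₁ : Z₁.card = (h + 1) * (2 * h + 2) := by
    have e1 := congrArg Multiset.card t4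
    rw [ladderVerts_card t2, t3, hA] at e1
    simp only [Multiset.card_add, Multiset.coe_card, hA, hD, card_val] at e1
    have : (h + 1) * (2 * h + 2 + 2) = (h + 1) * (2 * h + 2) + 2 * (h + 1) := by ring
    omega
  obtain ⟨T', Z₂, c₄, s1, s2, s3, s4, s5⟩ := GSt.ladder hE (p := p) (p' := q) A'.reverse D'.reverse
    (x := a true) (x' := a true) t5.st (by simp; omega) sA' sD' hndR
    (fun u hu => by
      have hu' : u ∈ p :: A' ∨ u ∈ q :: D' := by
        simp only [List.mem_append, List.mem_reverse, List.mem_cons] at hu ⊢; tauto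
      have hu'' : u ∈ (A ++ p :: A') ++ (D ++ q :: D') := by
        simp only [List.mem_append] at hu' ⊢; tauto
      have := hcap u hu''
      refine ⟨mem_union_left _ this.1, ?_⟩
      rw [hkeep3 u hu'' (hsep u hu')]
      omega)
    (by
      have := card_union_le (X ∪ ((A ++ p :: A').toFinset ∪ (D ++ q :: D').toFinset)) Z₁
      rw [List.length_reverse, hA']; omega)
  have b3 := b2.trans t5 (J := univ.image a) le_rfl (by
    intro u hu
    refine mem_union_right _ ?_
    rw [List.mem_toFinset, List.mem_append] at hu
    simp only [mem_union, List.mem_toFinset, List.mem_append]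
    tauto)
  have b4 := b3.trans (c' := c₃) (I' := (A'.reverse ++ D'.reverse).toFinset) (Z' := Z₂) (c'' := c₄)
    (J := univ.image a) (by rw [← union_assoc]; exact s5) le_rfl (by
    intro u hu
    refine mem_union_right _ (mem_union_left _ ?_)
    simp only [mem_union, List.mem_toFinset, List.mem_append, List.mem_reverse,
      List.mem_cons] at hu ⊢
    tauto)
  have hval : ((A ++ p :: A').toFinset ∪ (D ++ q :: D').toFinset ∪ Z₁ ∪ Z₂).val =
      (ladderVerts T + {p}) + (ladderVerts T' + {q}) := by
    have d1 : Disjoint ((A ++ p :: A').toFinset ∪ (D ++ q :: D').toFinset) Z₁ :=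
      t5.disj.mono_left subset_union_right
    have d2 : Disjoint ((A ++ p :: A').toFinset ∪ (D ++ q :: D').toFinset ∪ Z₁) Z₂ := by
      refine s5.disj.mono_left ?_
      rw [union_assoc X]
      exact subset_union_right
    rw [← disjUnion_eq_union _ _ d2, disjUnion_val,
      ← disjUnion_eq_union _ _ d1, disjUnion_val,
      ← disjUnion_eq_union _ _ hPP, disjUnion_val, t4, s4,
      List.toFinset_val, List.toFinset_val, p3.dedup, q3.dedup, Multiset.coe_reverse,
      Multiset.coe_reverse, ← Multiset.coe_add, ← Multiset.coe_add, ← Multiset.cons_coe,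
      ← Multiset.cons_coe, ← Multiset.singleton_add, ← Multiset.singleton_add]
    abel
  have hpq : p ≠ q := by
    rintro rfl
    refine (List.nodup_append.1 hnd).2.2 p ?_ p ?_ rfl <;> simp
  refine ⟨_, c₄, fun i => bif i then q else p, b4, ⟨?_, ?_, ?_⟩, ?_, ?_⟩
  · intro i j hij
    cases i <;> cases j <;> simp_all [Ne.symm hpq]
  · intro i
    cases i <;> simp
  · intro s
    have hT2 : ∀ {T : List (V × V × List V)}, T.length = h + 1 →
        T.length * (2 * h + 2 + 2) + 1 = gadgetLen h := by
      intro T hT; rw [hT]; rfl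
    have fork : ∀ {x : V} {T : List (V × V × List V)}, Ladder H x x T p q →
        (∀ t ∈ T, t.2.2.length = 2 * h + 2) → T.length = h + 1 → ∀ b : Bool,
        ∃ l : List V, Seg H x l (bif b then q else p) ∧
          (l : Multiset V) = ladderVerts T + {bif b then q else p} ∧ l.length = gadgetLen h := by
      intro x T hT hk hl b
      obtain ⟨b', l, k1, k2, k3⟩ := hT.route hk b
      refine ⟨l, ?_, k2, k3.trans (hT2 hl)⟩
      cases b' <;> exact k1
    obtain ⟨l₀, k1, k2, k3⟩ := fork t1 t2 (t3.trans hA) s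
    obtain ⟨l₁, j1, j2, j3⟩ := fork s1 s2 (s3.trans (by simpa using hA')) (!s)
    refine ⟨fun i => bif i then l₁ else l₀, ?_, ?_⟩
    · intro i
      cases i
      · exact ⟨by simpa using k1, k3⟩
      · exact ⟨by simpa using j1, j3⟩
    · rw [hval, Fintype.sum_bool]
      simp only [cond_true, cond_false, k2, j2]
      cases s
      · simp only [Bool.not_false, cond_true, cond_false]; abel
      · simp only [Bool.not_true, cond_true, cond_false]; abel
  · rw [← card_val, hval]
    simp only [Multiset.card_add, Multiset.card_singleton, t4, s4, Multiset.coe_card,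
      card_val, hZ₁, hA, hD, List.length_reverse, hA', hD']
    have hZ₂ : Z₂.card = (h + 1) * (2 * h + 2) := by
      have e1 := congrArg Multiset.card s4
      rw [ladderVerts_card s2, s3, List.length_reverse, hA'] at e1
      simp only [Multiset.card_add, Multiset.coe_card, List.length_reverse, hA', hD',
        card_val] at e1
      have : (h + 1) * (2 * h + 2 + 2) = (h + 1) * (2 * h + 2) + 2 * (h + 1) := by ring
      omega
    rw [hZ₂, hgl]; ring
  · intro i
    have hio : ∀ u, u = p ∨ u = q → d ≤ c₄ u + 1 := by
      intro u hu
      have hu' : u ∈ (A ++ p :: A') ++ (D ++ q :: D') := by rcases hu with rfl | rfl <;> simp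
      have hn1 : u ∉ A ++ D := hsep u (by rcases hu with rfl | rfl <;> simp)
      rw [s5.keep u (mem_union_left _ (hcap u hu').1), hkeep3 u hu' hn1]
      · exact (hcap u hu').2
      · intro hh
        have n1 := List.nodup_append.1 hnd
        have n2 := List.nodup_cons.1 (List.nodup_append.1 n1.1).2.1
        have n3 := List.nodup_cons.1 (List.nodup_append.1 n1.2.1).2.1
        simp only [List.mem_toFinset, List.mem_append, List.mem_reverse] at hh
        rcases hu with rfl | rfl <;> rcases hh with hh | hh
        · exact n2.1 hh
        · exact n1.2.2 u (by simp) u (by simp [hh]) rfl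
        · exact n1.2.2 u (by simp [hh]) u (by simp) rfl
        · exact n3.1 hh
    exact hio _ (by cases i <;> simp)

end GraphState

section Decomposition

variable {ι : Type*} [Fintype ι] [DecidableEq ι]

/-- Three distinct elements of a fibre of the first projection of `ι × Bool` do not exist. -/
lemma eq_of_fst_eq {p q r : ι × Bool} (h₁ : p.1 = q.1) (h₂ : q.1 = r.1) (hpr : p ≠ r)
    (hqr : q ≠ r) : p = q := by
  obtain ⟨x, i⟩ := p
  obtain ⟨y, j⟩ := q
  obtain ⟨z, k⟩ := r
  simp only at h₁ h₂
  subst h₁ h₂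
  cases i <;> cases j <;> cases k <;> simp_all

/-- A permutation of `ι × Bool` factors through two permutations of `ι` and switches. -/
lemma exists_switches (σ : Equiv.Perm (ι × Bool)) :
    ∃ (s s' : ι → Bool) (τ : Bool → Equiv.Perm ι), ∀ x i,
      σ (x, i) = (τ (xor i (s x)) x, xor (xor i (s x)) (s' (τ (xor i (s x)) x))) := by
  obtain ⟨f, hf, hft⟩ := (all_card_le_biUnion_card_iff_exists_injective
    (fun x => univ.image fun i => (σ (x, i)).1)).1 (by
      intro S
      have h1 : ((S ×ˢ (univ : Finset Bool)).map σ.toEmbedding) ⊆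
          (S.biUnion fun x => univ.image fun i => (σ (x, i)).1) ×ˢ univ := by
        intro p hp
        obtain ⟨⟨x, i⟩, hq, rfl⟩ := mem_map.1 hp
        simp only [mem_product, mem_univ, and_true, mem_biUnion,
          mem_image, true_and] at hq ⊢
        exact ⟨x, hq, i, rfl⟩
      have h2 := card_le_card h1
      rw [card_map, card_product, card_product, card_univ,
        Fintype.card_bool] at h2
      omega)
  have hs : ∀ x, ∃ i, (σ (x, i)).1 = f x := fun x => by
    obtain ⟨i, -, hi⟩ := mem_image.1 (hft x)
    exact ⟨i, hi⟩
  choose s hs using hs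
  have hfs : Surjective f := Finite.surjective_of_injective hf
  have hg : Injective fun x => (σ (x, !s x)).1 := by
    intro x y hxy
    obtain ⟨w, hw⟩ := hfs (σ (y, !s y)).1
    have hne : ∀ u, σ (u, !s u) ≠ σ (w, s w) := by
      intro u hu
      have h := σ.injective hu
      rw [Prod.mk.injEq] at h
      obtain ⟨rfl, h⟩ := h
      simp at h
    have := σ.injective (eq_of_fst_eq hxy (((hs w).trans hw).symm) (hne x) (hne y))
    exact (Prod.mk.inj this).1
  let τ : Bool → Equiv.Perm ι := fun b => bif b
    then Equiv.ofBijective _ (Finite.injective_iff_bijective.1 hg)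
    else Equiv.ofBijective f (Finite.injective_iff_bijective.1 hf)
  have ht : ∀ x, τ true x = (σ (x, !s x)).1 := fun x => rfl
  have hf' : ∀ x, τ false x = (σ (x, s x)).1 := fun x => (hs x).symm
  refine ⟨s, fun z => (σ ((τ false).symm z, s ((τ false).symm z))).2, τ, fun x i => ?_⟩
  by_cases hi : i = s x
  · subst hi
    simp only [Bool.xor_self, Equiv.symm_apply_apply, Bool.false_xor]
    exact Prod.ext (hf' x).symm rfl
  · have hi' : i = !s x := by cases i <;> cases h : s x <;> simp_all
    subst hi'
    have hx : (xor (!s x) (s x)) = true := by cases s x <;> rfl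
    rw [hx]
    refine Prod.ext (ht x).symm ?_
    obtain ⟨y, hy⟩ := (τ false).surjective (τ true x)
    simp only [← hy, Equiv.symm_apply_apply]
    have hne : σ (x, !s x) ≠ σ (y, s y) := by
      intro hu
      have h := σ.injective hu
      rw [Prod.mk.injEq] at h
      obtain ⟨rfl, h⟩ := h
      simp at h
    have h1 : (σ (x, !s x)).1 = (σ (y, s y)).1 := by rw [← hf', hy, ht]
    have h2 : (σ (x, !s x)).2 ≠ (σ (y, s y)).2 := fun h => hne (Prod.ext h1 h)
    simp only [Bool.true_xor]
    cases h3 : (σ (x, !s x)).2 <;> cases h4 : (σ (y, s y)).2 <;> simp_all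

end Decomposition

section Network

variable {V : Type*} [Fintype V] [DecidableEq V] {H : SimpleGraph V} {m d B h : ℕ}

/-- Disjoint paths with vertex set `Z` (starting points excluded) from `a i` to `b (σ i)`. -/
def RouteFor (H : SimpleGraph V) {ι κ : Type*} [Fintype ι] (σ : ι → κ) (a : ι → V) (b : κ → V)
    (Z : Finset V) (len : ι → ℕ) : Prop :=
  ∃ l : ι → List V, (∀ i, Seg H (a i) (l i) (b (σ i)) ∧ (l i).length = len i) ∧
    ∑ i, (l i : Multiset V) = Z.val

lemma union_val_of_disjoint {Z Z' : Finset V} (hd : Disjoint Z Z') :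
    (Z ∪ Z').val = Z.val + Z'.val := by
  rw [← disjUnion_eq_union _ _ hd, disjUnion_val]

lemma biUnion_val_of_disjoint {κ : Type*} [DecidableEq κ] (s : Finset κ) (Z : κ → Finset V)
    (hd : ∀ k ∈ s, ∀ k' ∈ s, k ≠ k' → Disjoint (Z k) (Z k')) :
    (s.biUnion Z).val = ∑ k ∈ s, (Z k).val := by
  induction s using Finset.induction_on with
  | empty => simp
  | insert k s hk ih =>
    rw [biUnion_insert, union_val_of_disjoint, sum_insert hk, ih]
    · exact fun a ha b hb =>
        hd a (mem_insert_of_mem ha) b (mem_insert_of_mem hb)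
    · rw [disjoint_biUnion_right]
      exact fun k' hk' => hd k (mem_insert_self _ _) k' (mem_insert_of_mem hk')
        (fun hh => hk (hh ▸ hk'))

lemma RouteFor.card {ι κ : Type*} [Fintype ι] {σ : ι → κ} {a : ι → V} {b : κ → V}
    {Z : Finset V} {len : ι → ℕ} (hr : RouteFor H σ a b Z len) : Z.card = ∑ i, len i := by
  obtain ⟨l, h1, h2⟩ := hr
  rw [← card_val, ← h2, Multiset.card_sum]
  exact sum_congr rfl fun i _ => by rw [Multiset.coe_card]; exact (h1 i).2

lemma RouteFor.comp {ι κ μ : Type*} [Fintype ι] [Fintype κ] {σ : ι → κ} {τ : κ → μ} {a : ι → V}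
    {b : κ → V} {e : μ → V} {Z Z' : Finset V} {len : ι → ℕ} {len' : κ → ℕ}
    (hr : RouteFor H σ a b Z len) (hr' : RouteFor H τ b e Z' len') (hσ : Bijective σ)
    (hd : Disjoint Z Z') :
    RouteFor H (fun i => τ (σ i)) a e (Z ∪ Z') (fun i => len i + len' (σ i)) := by
  obtain ⟨l, h1, h2⟩ := hr
  obtain ⟨l', h1', h2'⟩ := hr'
  refine ⟨fun i => l i ++ l' (σ i), fun i => ⟨(h1 i).1.append (h1' _).1, ?_⟩, ?_⟩
  · rw [List.length_append, (h1 i).2, (h1' _).2]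
  · rw [union_val_of_disjoint hd, ← h2, ← h2', ← Bijective.sum_comp hσ,
      ← sum_add_distrib]
    simp only [Multiset.coe_add]

lemma RouteFor.equiv {ι ι' : Type*} [Fintype ι] [Fintype ι'] (e : ι ≃ ι') {σ : ι' → ι'}
    {a : ι → V} {b : ι' → V} {Z : Finset V} {len : ι' → ℕ}
    (hr : RouteFor H σ (fun i => a (e.symm i)) b Z len) :
    RouteFor H (fun i => e.symm (σ (e i))) a (fun i => b (e i)) Z (fun i => len (e i)) := by
  obtain ⟨l, h1, h2⟩ := hr
  refine ⟨fun i => l (e i), fun i => ⟨?_, (h1 _).2⟩, ?_⟩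
  · simpa using (h1 (e i)).1
  · rw [← h2]; exact Equiv.sum_comp e (fun i => (l i : Multiset V))

lemma RouteFor.prodBool {ι : Type*} [Fintype ι] {τ : Bool → ι → ι} {a b : ι × Bool → V}
    {Z : Bool → Finset V} {len : ℕ}
    (hr : ∀ i, RouteFor H (τ i) (fun x => a (x, i)) (fun x => b (x, i)) (Z i) (fun _ => len))
    (hd : Disjoint (Z false) (Z true)) :
    RouteFor H (fun p : ι × Bool => (τ p.2 p.1, p.2)) a b (Z false ∪ Z true) (fun _ => len) := by
  choose l h1 h2 using hr
  refine ⟨fun p => l p.2 p.1, fun p => h1 p.2 p.1, ?_⟩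
  rw [union_val_of_disjoint hd, ← h2, ← h2, Fintype.sum_prod_type_right, Fintype.sum_bool, add_comm]

/-- A layer of swapping gadgets. -/
lemma GSt.layer (hE : Expander H m d B h) {ι : Type*} [Fintype ι] [DecidableEq ι]
    {X : Finset V} {c : V → ℕ}
    (hst : GSt H m d X c) {a : ι × Bool → V} (ha : Injective a) (haX : ∀ p, a p ∈ X)
    (hac : ∀ p, 2 ≤ c (a p)) (hB : X.card + Fintype.card ι * (2 * gadgetLen h) ≤ B) :
    ∃ (Z : Finset V) (c' : V → ℕ) (o : ι × Bool → V),
      Built H m d X c (univ.image a) Z c' ∧ Injective o ∧ (∀ p, o p ∈ Z) ∧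
      (∀ p, d ≤ c' (o p) + 1) ∧ ∀ s : ι → Bool,
        RouteFor H (fun p => (p.1, xor p.2 (s p.1))) a o Z (fun _ => gadgetLen h) := by
  rcases isEmpty_or_nonempty ι with hι | ⟨⟨x₀⟩⟩
  · refine ⟨∅, c, isEmptyElim, Built.refl hst _, fun p => isEmptyElim p, fun p => isEmptyElim p,
      fun p => isEmptyElim p, fun s => ⟨isEmptyElim, fun p => isEmptyElim p, by simp⟩⟩
  have : Nonempty (Bool → V) := ⟨fun _ => a (x₀, false)⟩
  obtain ⟨Z, c', o, h1, h2, h3⟩ := GSt.family (H := H) (m := m) (d := d) (B := B)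
    (univ : Finset ι) (fun x => univ.image fun i => a (x, i)) (2 * gadgetLen h)
    (fun x Z o => IsSwap H (gadgetLen h) (fun i => a (x, i)) Z o)
    (fun _ o => univ.image o) (d - 1) (fun x c => ∀ i, 2 ≤ c (a (x, i)))
    (by
      intro x _ c c' hcc hx i
      rw [hcc _ (mem_image_of_mem _ (mem_univ i))]; exact hx i)
    (by
      intro x _ X c hst hI hx hB
      obtain ⟨Z, c', o, g1, g2, g3, g4⟩ := hst.swap hE (a := fun i => a (x, i))
        (fun i j hij => (Prod.mk.inj (ha hij)).2)
        (fun i => hI (mem_image_of_mem _ (mem_univ i))) hx hB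
      refine ⟨Z, c', o, g1, g2, g3.le, ?_, ?_⟩
      · intro v hv
        obtain ⟨i, -, rfl⟩ := mem_image.1 hv
        exact g2.2.1 i
      · intro v hv
        obtain ⟨i, -, rfl⟩ := mem_image.1 hv
        have := g4 i
        omega)
    hst (fun x _ v hv => by
      obtain ⟨i, -, rfl⟩ := mem_image.1 hv
      exact haX _)
    (fun x _ y _ hxy => by
      rw [disjoint_left]
      intro v hv hv'
      obtain ⟨i, -, rfl⟩ := mem_image.1 hv
      obtain ⟨j, -, hj⟩ := mem_image.1 hv'
      exact hxy (Prod.mk.inj (ha hj)).1.symm)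
    (fun x _ i => hac _) (by simpa using hB)
  have hoZ : ∀ x i, o x i ∈ Z x := fun x i => (h2 x (mem_univ x)).1.2.1 i
  refine ⟨univ.biUnion Z, c', fun p => o p.1 p.2, h1.weaken ?_, ?_, ?_, ?_, ?_⟩
  · intro v hv
    simp only [mem_biUnion, mem_image, mem_univ, true_and] at hv ⊢
    obtain ⟨x, i, rfl⟩ := hv
    exact ⟨_, rfl⟩
  · rintro ⟨x, i⟩ ⟨y, j⟩ hxy
    simp only at hxy
    by_cases hne : x = y
    · subst hne
      rw [(h2 x (mem_univ x)).1.1 hxy]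
    · exact absurd hxy (disjoint_left.1
        (h3 x (mem_univ _) y (mem_univ _) hne) (hoZ x i) <| · ▸ hoZ y j)
  · exact fun p => mem_biUnion.2 ⟨p.1, mem_univ _, hoZ _ _⟩
  · intro p
    have := (h2 p.1 (mem_univ _)).2.2.2 (o p.1 p.2)
      (mem_image_of_mem _ (mem_univ _))
    exact Nat.sub_le_iff_le_add.1 this
  · intro s
    have hl := fun x => (h2 x (mem_univ x)).1.2.2 (s x)
    choose l g1 g2 using hl
    refine ⟨fun p => l p.1 p.2, fun p => g1 p.1 p.2, ?_⟩
    rw [biUnion_val_of_disjoint _ _ h3, Fintype.sum_prod_type]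
    exact sum_congr rfl fun x _ => g2 x

/-- Length of the paths in a permutation network with `2 ^ k` inputs. -/
def benesLen (h : ℕ) : ℕ → ℕ
  | 0 => 1
  | k + 1 => gadgetLen h + benesLen h k + gadgetLen h

/-- Any vertices can be attached to the inputs of a permutation network. -/
def HasNetwork (H : SimpleGraph V) (m d B : ℕ) (ι : Type) [Fintype ι] (len : ℕ) : Prop :=
  ∀ (X : Finset V) (c : V → ℕ), GSt H m d X c → ∀ a : ι → V, Injective a →
    (∀ i, a i ∈ X) → (∀ i, 2 ≤ c (a i)) → X.card + Fintype.card ι * len ≤ B →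
    ∃ (Z : Finset V) (c' : V → ℕ) (o : ι → V), Built H m d X c (univ.image a) Z c' ∧
      Injective o ∧ (∀ i, o i ∈ Z) ∧ (∀ i, d ≤ c' (o i) + 1) ∧
      ∀ σ : Equiv.Perm ι, RouteFor H σ a o Z (fun _ => len)

lemma HasNetwork.equiv {ι ι' : Type} [Fintype ι] [Fintype ι'] (e : ι ≃ ι') {len : ℕ}
    (hn : HasNetwork H m d B ι' len) : HasNetwork H m d B ι len := by
  intro X c hst a ha haX hac hB
  obtain ⟨Z, c', o, h1, h2, h3, h4, h5⟩ := hn X c hst (fun i => a (e.symm i))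
    (ha.comp e.symm.injective) (fun _ => haX _) (fun _ => hac _) (by rwa [← Fintype.card_congr e])
  refine ⟨Z, c', fun i => o (e i), ?_, h2.comp e.injective, fun _ => h3 _, fun _ => h4 _, ?_⟩
  · refine h1.weaken ?_
    intro v hv
    simp only [mem_image, mem_univ, true_and] at hv ⊢
    obtain ⟨i, rfl⟩ := hv
    exact ⟨_, rfl⟩
  · intro σ
    have := (h5 (e.symm.trans (σ.trans e))).equiv e
    simpa using this

lemma HasNetwork.prodBool (hE : Expander H m d B h) {ι : Type} [Fintype ι] [DecidableEq ι]
    {len : ℕ} (hn : HasNetwork H m d B ι len) :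
    HasNetwork H m d B (ι × Bool) (gadgetLen h + len + gadgetLen h) := by
  intro X c hst a ha haX hac hB
  have hd := hE.d_ge
  rw [Fintype.card_prod, Fintype.card_bool] at hB
  have hB' : Fintype.card ι * 2 * (gadgetLen h + len + gadgetLen h) =
      Fintype.card ι * (2 * gadgetLen h) + 2 * (Fintype.card ι * len) +
        Fintype.card ι * (2 * gadgetLen h) := by ring
  have hcb : Fintype.card (ι × Bool) * gadgetLen h = Fintype.card ι * (2 * gadgetLen h) := by
    rw [Fintype.card_prod, Fintype.card_bool]; ring
  obtain ⟨Z₁, c₁, o₁, a1, a2, a3, a4, a5⟩ := hst.layer hE ha haX hac (by omega)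
  have z1 : Z₁.card = Fintype.card ι * (2 * gadgetLen h) := by
    rw [(a5 fun _ => false).card, sum_const, card_univ, smul_eq_mul, hcb]
  have i1 : ∀ b, Injective fun x => o₁ (x, b) := fun b x y hxy => (Prod.mk.inj (a2 hxy)).1
  have u1 := card_union_le X Z₁
  obtain ⟨Z₂, c₂, o₂, b1, b2, b3, b4, b5⟩ := hn _ _ a1.st (fun x => o₁ (x, false)) (i1 _)
    (fun x => mem_union_right _ (a3 _)) (fun x => by have := a4 (x, false); omega) (by omega)
  have z2 : Z₂.card = Fintype.card ι * len := by
    rw [(b5 1).card, sum_const, card_univ, smul_eq_mul]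
  have u2 := card_union_le (X ∪ Z₁) Z₂
  have ht : ∀ x, c₂ (o₁ (x, true)) = c₁ (o₁ (x, true)) := by
    intro x
    refine b1.keep _ (mem_union_right _ (a3 _)) ?_
    intro hh
    obtain ⟨y, -, hy⟩ := mem_image.1 hh
    have := (Prod.mk.inj (a2 hy)).2
    simp at this
  obtain ⟨Z₃, c₃, o₃, d1, d2, d3, d4, d5⟩ := hn _ _ b1.st (fun x => o₁ (x, true)) (i1 _)
    (fun x => mem_union_left _ (mem_union_right _ (a3 _)))
    (fun x => by have := a4 (x, true); rw [ht]; omega) (by omega)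
  have z3 : Z₃.card = Fintype.card ι * len := by
    rw [(d5 1).card, sum_const, card_univ, smul_eq_mul]
  have u3 := card_union_le (X ∪ Z₁ ∪ Z₂) Z₃
  have d23 : Disjoint Z₂ Z₃ := d1.disj.mono_left subset_union_right
  let o : ι × Bool → V := fun p => bif p.2 then o₃ p.1 else o₂ p.1
  have ho : Injective o := by
    rintro ⟨x, i⟩ ⟨y, j⟩ hxy
    cases i <;> cases j <;> simp only [o, cond_true, cond_false] at hxy
    · rw [b2 hxy]
    · exact absurd hxy fun hh => disjoint_left.1 d23 (b3 x) (hh ▸ d3 y)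
    · exact absurd hxy fun hh => disjoint_left.1 d23 (b3 y) (hh ▸ d3 x)
    · rw [d2 hxy]
  have hoc : ∀ p, d ≤ c₃ (o p) + 1 := by
    rintro ⟨x, i⟩
    cases i <;> simp only [o, cond_true, cond_false]
    · rw [d1.keep _ (mem_union_right _ (b3 x))]
      · exact b4 x
      · intro hh
        obtain ⟨y, -, hy⟩ := mem_image.1 hh
        exact disjoint_left.1 b1.disj (mem_union_right _ (a3 (y, true)))
          (hy ▸ b3 x)
    · exact d4 x
  have hoX : ∀ p, o p ∈ Z₂ ∪ Z₃ := by
    rintro ⟨x, i⟩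
    cases i <;> simp only [o, cond_true, cond_false]
    exacts [mem_union_left _ (b3 x), mem_union_right _ (d3 x)]
  obtain ⟨Z₄, c₄, o₄, e1, e2, e3, e4, e5⟩ := d1.st.layer hE ho
    (fun p => by
      rw [union_assoc]; exact mem_union_right _ (hoX p))
    (fun p => by have := hoc p; omega) (by omega)
  have t1 := a1.trans b1 (J := univ.image a) le_rfl (by
    intro v hv
    obtain ⟨x, -, rfl⟩ := mem_image.1 hv
    exact mem_union_right _ (a3 _))
  have t2 := t1.trans (c' := c₂) (I' := univ.image fun x => o₁ (x, true)) (Z' := Z₃)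
    (c'' := c₃) (J := univ.image a) (by rw [← union_assoc]; exact d1) le_rfl (by
    intro v hv
    obtain ⟨x, -, rfl⟩ := mem_image.1 hv
    exact mem_union_right _ (mem_union_left _ (a3 _)))
  have t3 := t2.trans (c' := c₃) (I' := univ.image o) (Z' := Z₄)
    (c'' := c₄) (J := univ.image a)
    (by rw [← union_assoc, ← union_assoc]; exact e1) le_rfl (by
    intro v hv
    obtain ⟨p, -, rfl⟩ := mem_image.1 hv
    rw [union_assoc Z₁]
    exact mem_union_right _ (mem_union_right _ (hoX p)))
  refine ⟨_, c₄, o₄, t3, e2, fun p => mem_union_right _ (e3 p), e4, fun σ => ?_⟩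
  obtain ⟨s, s', τ, hσ⟩ := exists_switches σ
  have hmid : RouteFor H (fun p : ι × Bool => (τ p.2 p.1, p.2)) o₁ o (Z₂ ∪ Z₃) (fun _ => len) := by
    have := RouteFor.prodBool (H := H) (τ := fun i => τ i) (a := o₁) (b := o)
      (Z := fun i => bif i then Z₃ else Z₂) (len := len) (by
        intro i
        cases i
        · exact b5 (τ false)
        · exact d5 (τ true)) d23
    exact this
  have hb1 : Bijective fun p : ι × Bool => (p.1, xor p.2 (s p.1)) := by
    refine Finite.injective_iff_bijective.1 ?_
    rintro ⟨x, i⟩ ⟨y, j⟩ hxy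
    obtain ⟨rfl, h2⟩ := Prod.mk.inj hxy
    simpa using h2
  have hb2 : Bijective fun p : ι × Bool => (τ p.2 p.1, p.2) := by
    refine Finite.injective_iff_bijective.1 ?_
    rintro ⟨x, i⟩ ⟨y, j⟩ hxy
    obtain ⟨h1, h2⟩ := Prod.mk.inj hxy
    simp only at h1 h2
    subst h2
    rw [(τ i).injective h1]
  have c1 := (a5 s).comp hmid hb1 (by
    rw [disjoint_union_right]
    exact ⟨b1.disj.mono_left subset_union_right,
      d1.disj.mono_left (subset_union_right.trans subset_union_left)⟩)
  have c2 := c1.comp (e5 s') (hb2.comp hb1) (by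
    refine e1.disj.mono_left ?_
    intro v hv
    simp only [mem_union] at hv ⊢
    tauto)
  have hfun : (fun p : ι × Bool => ((τ (xor p.2 (s p.1)) p.1,
      xor (xor p.2 (s p.1)) (s' (τ (xor p.2 (s p.1)) p.1))) : ι × Bool)) = ⇑σ :=
    funext fun p => (hσ p.1 p.2).symm
  rw [← hfun, union_assoc Z₁]
  exact c2

/-- Permutation networks with `2 ^ k` inputs. -/
theorem hasNetwork (hE : Expander H m d B h) (k : ℕ) {ι : Type} [Fintype ι]
    (hι : Fintype.card ι = 2 ^ k) : HasNetwork H m d B ι (benesLen h k) := by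
  induction k generalizing ι with
  | zero =>
    rw [pow_zero, Fintype.card_eq_one_iff_nonempty_unique] at hι
    obtain ⟨hu⟩ := hι
    intro X c hst a ha haX hac hB
    rw [Fintype.card_unique] at hB
    obtain ⟨x, c', h1, h2, h3, h4⟩ := hst.leaf hE (by omega) (haX default)
      (by have := hac default; omega)
    refine ⟨{x}, c', fun _ => x, ?_, fun _ _ _ => Subsingleton.elim _ _, by simp,
      fun _ => h4.trans (Nat.le_succ _), fun σ => ⟨fun _ => [x], fun i => ?_, ?_⟩⟩
    · simpa using h2
    · rw [Subsingleton.elim i default]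
      exact ⟨⟨h1, rfl⟩, rfl⟩
    · simp
  | succ k ih =>
    have e : ι ≃ Fin (2 ^ k) × Bool := Fintype.equivOfCardEq (by simp [hι, pow_succ])
    exact (HasNetwork.prodBool hE (ih (by simp))).equiv e

/-- Attach a leaf to each of the vertices `a i`, `i ∈ S`. -/
lemma GSt.leaves (hE : Expander H m d B h) {ι : Type*} [Fintype ι] [DecidableEq ι]
    {X : Finset V} {c : V → ℕ} (hst : GSt H m d X c) {a : ι → V} (ha : Injective a)
    (haX : ∀ i, a i ∈ X) (S : Finset ι) (hac : ∀ i ∈ S, 1 ≤ c (a i)) (hB : X.card + S.card ≤ B) :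
    ∃ (Z : Finset V) (c' : V → ℕ) (x : ι → V), Built H m d X c (S.image a) Z c' ∧
      (∀ i ∈ S, H.Adj (a i) (x i) ∧ d ≤ c' (x i)) ∧ Set.InjOn x S ∧ Z = S.image x := by
  rcases isEmpty_or_nonempty ι with hι | ⟨⟨i₀⟩⟩
  · refine ⟨∅, c, isEmptyElim, Built.refl hst _, fun i => isEmptyElim i, fun i => isEmptyElim i,
      by ext; simp⟩
  have : Nonempty V := ⟨a i₀⟩
  obtain ⟨Z, c', x, h1, h2, h3⟩ := GSt.family (H := H) (m := m) (d := d) (B := B)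
    S (fun i => {a i}) 1 (fun i Z x => H.Adj (a i) x ∧ Z = {x}) (fun _ x => {x}) d
    (fun i c => 1 ≤ c (a i))
    (fun i _ c c' hcc hi => by rw [hcc _ (mem_singleton_self _)]; exact hi)
    (fun i _ X c hst hI hi hB => by
      obtain ⟨x, c', g1, g2, g3, g4⟩ := hst.leaf hE (by omega)
        (hI (mem_singleton_self _)) hi
      exact ⟨{x}, c', x, g2, ⟨g1, rfl⟩, by simp, le_rfl, by simpa using g4⟩)
    hst (fun i _ => by simpa using haX i)
    (fun i _ j _ hij => by simpa using fun hh => hij (ha hh.symm).symm)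
    hac (by simpa using hB)
  have hZ : S.biUnion Z = S.image x := by
    ext v
    simp only [mem_biUnion, mem_image]
    constructor
    · rintro ⟨i, hi, hv⟩
      rw [(h2 i hi).1.2, mem_singleton] at hv
      exact ⟨i, hi, hv.symm⟩
    · rintro ⟨i, hi, rfl⟩
      exact ⟨i, hi, by rw [(h2 i hi).1.2]; simp⟩
  refine ⟨S.biUnion Z, c', x, h1.weaken ?_, fun i hi => ⟨(h2 i hi).1.1, ?_⟩, ?_, hZ⟩
  · intro v hv
    simpa [eq_comm] using hv
  · exact (h2 i hi).2.2.2 _ (mem_singleton_self _)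
  · intro i hi j hj hij
    by_contra hne
    have := h3 i hi j hj hne
    rw [(h2 i hi).1.2, (h2 j hj).1.2, hij] at this
    simp at this

lemma exists_perm_of_card_eq {ι : Type*} [Fintype ι] [DecidableEq ι] {S T : Finset ι}
    (hST : S.card = T.card) : ∃ σ : Equiv.Perm ι, ∀ i, σ i ∈ T ↔ i ∈ S := by
  let e : {i // i ∈ S} ≃ {i // i ∈ T} := Fintype.equivOfCardEq (by simpa using hST)
  refine ⟨e.extendSubtype, fun i => ⟨fun hi => ?_, fun hi => ?_⟩⟩
  · by_contra hn
    exact e.extendSubtype_not_mem i hn hi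
  · exact e.extendSubtype_mem i hi

/-- Permutation networks whose path lengths can be chosen, for a prescribed total length. -/
theorem GSt.stages (hE : Expander H m d B h) {ι : Type} [Fintype ι] [DecidableEq ι] {len : ℕ}
    (hn : HasNetwork H m d B ι len) (T : Finset ι) (E : ℕ) {X : Finset V} {c : V → ℕ}
    (hst : GSt H m d X c) {a : ι → V} (ha : Injective a) (haX : ∀ i, a i ∈ X)
    (hac : ∀ i, 2 ≤ c (a i))
    (hB : X.card + ((E + 1) * (Fintype.card ι * len) + E * T.card) ≤ B) :
    ∃ (Z : Finset V) (c' : V → ℕ) (o : ι → V), Built H m d X c (univ.image a) Z c' ∧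
      Injective o ∧ (∀ i, o i ∈ Z) ∧ (∀ i, d ≤ c' (o i) + 1) ∧
      ∀ (σ : Equiv.Perm ι) (e : ι → ℕ), (∀ i, e i ≤ E) → ∑ i, e i = E * T.card →
        RouteFor H σ a o Z (fun i => (E + 1) * len + e i) := by
  have hd := hE.d_ge
  induction E generalizing X c a with
  | zero =>
    obtain ⟨Z, c', o, h1, h2, h3, h4, h5⟩ := hn X c hst a ha haX hac (by omega)
    refine ⟨Z, c', o, h1, h2, h3, h4, fun σ e he _ => ?_⟩
    have : (fun i => (0 + 1) * len + e i) = fun _ => len := by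
      funext i
      have := he i
      simp only [Nat.le_zero] at this
      rw [this]; ring
    rw [this]
    exact h5 σ
  | succ E ih =>
    have hB' : (E + 1 + 1) * (Fintype.card ι * len) + (E + 1) * T.card =
      Fintype.card ι * len + T.card + ((E + 1) * (Fintype.card ι * len) + E * T.card) := by ring
    obtain ⟨Z₁, c₁, o₁, a1, a2, a3, a4, a5⟩ := hn X c hst a ha haX hac (by omega)
    have z1 : Z₁.card = Fintype.card ι * len := by
      rw [(a5 1).card, sum_const, card_univ, smul_eq_mul]
    have u1 := card_union_le X Z₁
    obtain ⟨Z₂, c₂, x, b1, b2, b3, b4⟩ := a1.st.leaves hE a2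
      (fun i => mem_union_right _ (a3 i)) T (fun i _ => by have := a4 i; omega) (by omega)
    have z2 : Z₂.card = T.card := by rw [b4, card_image_of_injOn b3]
    have u2 := card_union_le (X ∪ Z₁) Z₂
    have hxZ : ∀ i ∈ T, x i ∈ Z₂ := fun i hi => by rw [b4]; exact mem_image_of_mem _ hi
    have d12 : Disjoint Z₁ Z₂ := b1.disj.mono_left subset_union_right
    let o₂ : ι → V := fun i => if i ∈ T then x i else o₁ i
    have ho₂ : Injective o₂ := by
      intro i j hij
      by_cases hi : i ∈ T <;> by_cases hj : j ∈ T <;>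
        simp only [o₂, hi, hj, if_true, if_false] at hij
      · exact b3 hi hj hij
      · exact absurd (a3 j) (disjoint_right.1 d12 (hij ▸ hxZ i hi))
      · exact absurd (a3 i) (disjoint_right.1 d12 (hij ▸ hxZ j hj))
      · exact a2 hij
    have hoZ : ∀ i, o₂ i ∈ Z₁ ∪ Z₂ := by
      intro i
      by_cases hi : i ∈ T <;> simp only [o₂, hi, if_true, if_false]
      exacts [mem_union_right _ (hxZ i hi), mem_union_left _ (a3 i)]
    have hoc : ∀ i, 2 ≤ c₂ (o₂ i) := by
      intro i
      by_cases hi : i ∈ T <;> simp only [o₂, hi, if_true, if_false]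
      · have := (b2 i hi).2; omega
      · rw [b1.keep _ (mem_union_right _ (a3 i))]
        · have := a4 i; omega
        · intro hh
          obtain ⟨j, hj, hji⟩ := mem_image.1 hh
          exact hi (a2 hji ▸ hj)
    obtain ⟨Z₃, c₃, o, e1, e2, e3, e4, e5⟩ := ih b1.st ho₂
      (fun i => by rw [union_assoc]; exact mem_union_right _ (hoZ i)) hoc (by omega)
    have t1 := a1.trans b1 (J := univ.image a) le_rfl (by
      intro v hv
      obtain ⟨x, -, rfl⟩ := mem_image.1 hv
      exact mem_union_right _ (a3 _))
    have t2 := t1.trans (c' := c₂) (I' := univ.image o₂) (Z' := Z₃)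
      (c'' := c₃) (J := univ.image a) (by rw [← union_assoc]; exact e1) le_rfl (by
      intro v hv
      obtain ⟨x, -, rfl⟩ := mem_image.1 hv
      exact mem_union_right _ (hoZ _))
    refine ⟨_, c₃, o, t2, e2, fun i => mem_union_right _ (e3 i), e4, ?_⟩
    intro σ e he hsum
    obtain ⟨S, hS1, hS2, hS3⟩ := exists_subsuperset_card_eq
      (s := univ.filter fun i => e i = E + 1) (t := univ.filter fun i => 1 ≤ e i)
      (n := T.card) (by intro i; simp; omega)
      (by
        have : (univ.filter fun i => e i = E + 1).card * (E + 1) ≤ (E + 1) * T.card := by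
          rw [← hsum, ← sum_filter_add_sum_filter_not _ (fun i => e i = E + 1)]
          refine le_trans ?_ (Nat.le_add_right _ _)
          rw [← smul_eq_mul, ← sum_const]
          exact sum_le_sum fun i hi => (mem_filter.1 hi).2.ge
        rw [mul_comm (E + 1)] at this
        exact Nat.le_of_mul_le_mul_right this (Nat.succ_pos E))
      (by
        have : (E + 1) * T.card ≤ (univ.filter fun i => 1 ≤ e i).card * (E + 1) := by
          rw [← hsum, ← sum_filter_add_sum_filter_not _ (fun i => 1 ≤ e i)]
          rw [sum_eq_zero (s := univ.filter fun i => ¬ 1 ≤ e i)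
            (fun i hi => by have := (mem_filter.1 hi).2; omega), add_zero]
          rw [← smul_eq_mul, ← sum_const]
          exact sum_le_sum fun i _ => he i
        rw [mul_comm (E + 1)] at this
        exact Nat.le_of_mul_le_mul_right this (Nat.succ_pos E))
    obtain ⟨ρ, hρ⟩ := exists_perm_of_card_eq hS3
    have hS : ∀ i, i ∈ S → 1 ≤ e i := fun i hi => (mem_filter.1 (hS2 hi)).2
    have hS' : ∀ i, i ∉ S → e i ≤ E := fun i hi => by
      by_contra hcon
      exact hi (hS1 (mem_filter.2 ⟨mem_univ _, by have := he i; omega⟩))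
    have hone : ∑ i, (if i ∈ S then 1 else 0) = T.card := by
      rw [← hS3]; simp
    have hsplit : ∀ i, e i = (if i ∈ S then 1 else 0) + (e i - if i ∈ S then 1 else 0) := by
      intro i
      by_cases hi : i ∈ S <;> simp only [hi, if_true, if_false]
      · have := hS i hi; omega
      · omega
    have hlast := e5 (ρ.symm.trans σ) (fun i => e (ρ.symm i) - if ρ.symm i ∈ S then 1 else 0)
      (by
        intro i
        by_cases hi : ρ.symm i ∈ S <;> simp only [hi, if_true, if_false]
        · have := he (ρ.symm i); omega
        · have := hS' _ hi; omega)
      (by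
        rw [Equiv.sum_comp ρ.symm (fun i => e i - if i ∈ S then 1 else 0)]
        have h1 : ∑ i, e i = ∑ i, (if i ∈ S then 1 else 0) +
            ∑ i, (e i - if i ∈ S then 1 else 0) := by
          rw [← sum_add_distrib]
          exact sum_congr rfl fun i _ => hsplit i
        rw [hsum, hone, Nat.add_mul, one_mul] at h1
        omega)
    have hmid : RouteFor H (id : ι → ι) o₁ o₂ Z₂ (fun i => if i ∈ T then 1 else 0) := by
      refine ⟨fun i => if i ∈ T then [x i] else [], fun i => ?_, ?_⟩
      · by_cases hi : i ∈ T
        · simp only [hi, if_true, o₂, id]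
          exact ⟨⟨(b2 i hi).1, rfl⟩, rfl⟩
        · simp only [hi, if_false, o₂, id]
          exact ⟨rfl, rfl⟩
      · rw [b4, image_val_of_injOn b3, ← sum_filter_add_sum_filter_not _ (· ∈ T)]
        rw [sum_eq_zero (s := univ.filter fun i => ¬ i ∈ T)
            (fun i hi => by simp [(mem_filter.1 hi).2]), add_zero, filter_mem_eq_inter,
            univ_inter]
        rw [sum_congr rfl (g := fun i => ({x i} : Multiset V))
          (fun i hi => by simp [hi])]
        rw [sum_eq_multiset_sum, ← Multiset.sum_map_singleton (T.val.map x),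
          Multiset.map_map]
        rfl
    have r1 := (a5 ρ).comp hmid ρ.bijective d12
    have r2 := r1.comp hlast ρ.bijective (by
      refine e1.disj.mono_left ?_
      intro v hv
      simp only [mem_union] at hv ⊢
      tauto)
    have f1 : (fun i => (ρ.symm.trans σ) (id (ρ i))) = ⇑σ := by funext i; simp
    rw [f1] at r2
    have f2 : (fun i => (E + 1 + 1) * len + e i) = fun i => len + (if ρ i ∈ T then 1 else 0) +
        ((E + 1) * len + (e (ρ.symm (id (ρ i))) - if ρ.symm (id (ρ i)) ∈ S then 1 else 0)) := by
      funext i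
      have h1 : (if ρ i ∈ T then 1 else 0) = if i ∈ S then 1 else 0 := by simp only [hρ]
      rw [h1, id, Equiv.symm_apply_apply]
      have := hsplit i
      have h2 : (E + 1 + 1) * len = len + (E + 1) * len := by ring
      omega
    rw [f2]
    exact r2

end Network

section TreeEmbed

open Classical in
/-- Every nonempty set of vertices of a tree has a vertex with at most one neighbour in it. -/
lemma exists_card_filter_adj_le_one {A : Type*} {T : SimpleGraph A} (hT : T.IsTree) {S : Finset A}
    (hS : S.Nonempty) : ∃ v ∈ S, (S.filter (T.Adj v)).card ≤ 1 := by
  obtain ⟨r, hr⟩ := hS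
  obtain ⟨v, hv, hmax⟩ := S.exists_max_image (T.dist r) ⟨r, hr⟩
  refine ⟨v, hv, card_le_one.2 fun x hx y hy => ?_⟩
  have key : ∀ x ∈ S.filter (T.Adj v), ∃ p : T.Walk r v, p.IsPath ∧ p.penultimate = x := by
    intro x hx
    obtain ⟨hxS, hxv⟩ := mem_filter.1 hx
    obtain ⟨p, hp⟩ := hT.1.exists_walk_length_eq_dist r x
    have h1 := hmax x hxS
    have h2 := hT.dist_ne_of_adj r hxv
    have h3 := T.dist_le (p.concat hxv.symm)
    rw [SimpleGraph.Walk.length_concat, hp] at h3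
    refine ⟨p.concat hxv.symm, SimpleGraph.Walk.isPath_of_length_eq_dist _ ?_, by simp⟩
    rw [SimpleGraph.Walk.length_concat, hp]
    omega
  obtain ⟨p, hp, rfl⟩ := key x hx
  obtain ⟨q, hq, rfl⟩ := key y hy
  have := (hT.2.subsingleton_path r v).elim ⟨p, hp⟩ ⟨q, hq⟩
  rw [Subtype.mk.injEq] at this
  rw [this]

variable {V : Type*} [Fintype V] [DecidableEq V] {H : SimpleGraph V} {m d B h : ℕ}

open Classical in
/-- Embed the subgraph of a tree induced by `S`. -/
theorem GSt.embed (hE : Expander H m d B h) {A : Type*} {T : SimpleGraph A} (hT : T.IsTree)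
    {Δ : ℕ} (hΔ : Δ + 2 ≤ d) {X : Finset V} {c : V → ℕ} (hst : GSt H m d X c) {w : V}
    (hw : w ∈ X) (hcw : 1 ≤ c w) (S : Finset A) (hdeg : ∀ v ∈ S, (S.filter (T.Adj v)).card ≤ Δ)
    (hB : X.card + S.card ≤ B) :
    ∃ (Z : Finset V) (c' : V → ℕ) (φ : A → V), Built H m d X c {w} Z c' ∧
      Set.InjOn φ S ∧ S.image φ = Z ∧ (∀ u ∈ S, ∀ v ∈ S, T.Adj u v → H.Adj (φ u) (φ v)) ∧
      ∀ u ∈ S, d ≤ c' (φ u) + Δ + 1 := by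
  suffices ∃ (Z : Finset V) (c' : V → ℕ) (φ : A → V) (w' : V), Built H m d X c {w} Z c' ∧
      Set.InjOn φ S ∧ S.image φ = Z ∧ (∀ u ∈ S, ∀ v ∈ S, T.Adj u v → H.Adj (φ u) (φ v)) ∧
      w' ∈ insert w Z ∧ (w' = w → 1 ≤ c' w) ∧
      ∀ u ∈ S, d ≤ c' (φ u) + (S.filter (T.Adj u)).card + if φ u = w' then 0 else 1 by
    obtain ⟨Z, c', φ, w', h1, h2, h3, h4, -, -, h5⟩ := this
    refine ⟨Z, c', φ, h1, h2, h3, h4, fun u hu => ?_⟩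
    have := h5 u hu
    have := hdeg u hu
    split_ifs at * <;> omega
  induction hs : S.card generalizing S with
  | zero =>
    rw [card_eq_zero] at hs
    subst hs
    exact ⟨∅, c, fun _ => w, w, Built.refl hst _, by simp, by simp, by simp, by simp,
      fun _ => hcw, by simp⟩
  | succ k ih =>
    obtain ⟨v, hv, hv1⟩ := exists_card_filter_adj_le_one hT (S := S)
      (card_pos.1 (by omega))
    have hsub : ∀ u, (S.erase v).filter (T.Adj u) ⊆ S.filter (T.Adj u) := fun u =>
      filter_subset_filter _ (erase_subset _ _)
    have hck : (S.erase v).card = k := by rw [card_erase_of_mem hv]; omega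
    obtain ⟨Z, c', φ, w', h1, h2, h3, h4, h5, h6, h7⟩ := ih (S.erase v)
      (fun u hu => (card_le_card (hsub u)).trans (hdeg u (mem_of_mem_erase hu)))
      (by omega) hck
    have hZc : Z.card ≤ k := by rw [← h3, ← hck]; exact card_image_le
    have hXZ := card_union_le X Z
    have hφ : ∀ u ∈ S.erase v, φ u ∈ Z := fun u hu => h3 ▸ mem_image_of_mem _ hu
    -- extension of the embedding by a leaf `x` attached at `s`
    have main : ∀ (s x : V) (c'' : V → ℕ) (w'' : V), H.Adj s x →
        Built H m d (X ∪ Z) c' {s} {x} c'' → c' s = c'' s + 1 → d ≤ c'' x → s ∈ insert w Z →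
        (∀ u ∈ S.erase v, T.Adj u v → φ u = s) →
        ((w'' = w' ∧ ∃ u ∈ S.erase v, T.Adj u v) ∨ (w'' = x ∧ s = w')) →
        ((w'' = w → 1 ≤ c'' w)) →
        ∃ (Z : Finset V) (c' : V → ℕ) (φ : A → V) (w' : V), Built H m d X c {w} Z c' ∧
          Set.InjOn φ S ∧ S.image φ = Z ∧ (∀ u ∈ S, ∀ v ∈ S, T.Adj u v → H.Adj (φ u) (φ v)) ∧
          w' ∈ insert w Z ∧ (w' = w → 1 ≤ c' w) ∧
          ∀ u ∈ S, d ≤ c' (φ u) + (S.filter (T.Adj u)).card + if φ u = w' then 0 else 1 := by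
      intro s x c'' w'' g1 g2 g3 g4 g5 g6 g7 g8
      have hxn : x ∉ X ∪ Z := by simpa using disjoint_right.1 g2.disj
      have hxZ : x ∉ Z := fun hh => hxn (mem_union_right _ hh)
      have hupd : ∀ u ∈ S.erase v, update φ v x u = φ u := fun u hu =>
        update_of_ne (ne_of_mem_erase hu) _ _
      have hxs : s ∈ X ∪ Z := by
        rcases mem_insert.1 g5 with rfl | g5
        exacts [mem_union_left _ hw, mem_union_right _ g5]
      refine ⟨Z ∪ {x}, c'', update φ v x, w'', h1.trans g2 le_rfl ?_, ?_, ?_, ?_, ?_, g8, ?_⟩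
      · simpa using g5
      · intro a ha b hb hab
        by_cases hav : a = v <;> by_cases hbv : b = v
        · rw [hav, hbv]
        · have hb' : b ∈ S.erase v := mem_erase.2 ⟨hbv, hb⟩
          rw [hav, update_self, hupd b hb'] at hab
          exact absurd (hab ▸ hφ b hb') hxZ
        · have ha' : a ∈ S.erase v := mem_erase.2 ⟨hav, ha⟩
          rw [hbv, update_self, hupd a ha'] at hab
          exact absurd (hab ▸ hφ a ha') hxZ
        · have ha' : a ∈ S.erase v := mem_erase.2 ⟨hav, ha⟩
          have hb' : b ∈ S.erase v := mem_erase.2 ⟨hbv, hb⟩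
          rw [hupd a ha', hupd b hb'] at hab
          exact h2 ha' hb' hab
      · conv_lhs => rw [← insert_erase hv]
        rw [image_insert, update_self, image_congr (g := φ)
          (fun u hu => hupd u hu), h3, union_comm, singleton_union]
      · intro a ha b hb hab
        by_cases hav : a = v <;> by_cases hbv : b = v
        · rw [hav, hbv] at hab; exact absurd hab (T.irrefl)
        · have hb' : b ∈ S.erase v := mem_erase.2 ⟨hbv, hb⟩
          rw [hav] at hab
          rw [hav, update_self, hupd b hb', g6 b hb' hab.symm]
          exact g1.symm
        · have ha' : a ∈ S.erase v := mem_erase.2 ⟨hav, ha⟩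
          rw [hbv] at hab
          rw [hbv, update_self, hupd a ha', g6 a ha' hab]
          exact g1
        · have ha' : a ∈ S.erase v := mem_erase.2 ⟨hav, ha⟩
          have hb' : b ∈ S.erase v := mem_erase.2 ⟨hbv, hb⟩
          rw [hupd a ha', hupd b hb']
          exact h4 a ha' b hb' hab
      · rcases g7 with ⟨rfl, -⟩ | ⟨rfl, -⟩
        · simp only [mem_insert, mem_union, mem_singleton] at h5 ⊢
          tauto
        · simp
      · intro a ha
        by_cases hav : a = v
        · rw [hav, update_self]; omega
        · have ha' : a ∈ S.erase v := mem_erase.2 ⟨hav, ha⟩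
          rw [hupd a ha']
          have h7a := h7 a ha'
          have hle := card_le_card (hsub a)
          have haXZ : φ a ∈ X ∪ Z := mem_union_right _ (hφ a ha')
          have hx' : φ a ≠ x := fun hh => hxZ (hh ▸ hφ a ha')
          by_cases has : φ a = s
          · rw [has] at h7a ⊢
            rcases g7 with ⟨rfl, u, hu, huv⟩ | ⟨rfl, rfl⟩
            · have : u = a := h2 hu ha' ((g6 u hu huv).trans has.symm)
              subst this
              have hlt : ((S.erase v).filter (T.Adj u)).card < (S.filter (T.Adj u)).card := by
                refine card_lt_card ⟨hsub u, fun hh => ?_⟩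
                have := hh (mem_filter.2 ⟨hv, huv⟩)
                simp at this
              split_ifs at h7a ⊢ <;> omega
            · rw [if_pos rfl] at h7a
              rw [if_neg fun hh => hx' (has.trans hh)]
              omega
          · rw [g2.keep _ haXZ (by simpa using has)]
            rcases g7 with ⟨rfl, -⟩ | ⟨rfl, rfl⟩
            · split_ifs at h7a ⊢ <;> omega
            · rw [if_neg has] at h7a
              rw [if_neg hx']
              omega
    by_cases hex : ∃ u ∈ S.erase v, T.Adj u v
    · obtain ⟨u, hu, huv⟩ := hex
      have hcu : 1 ≤ c' (φ u) := by
        have := h7 u hu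
        have := (card_le_card (hsub u)).trans (hdeg u (mem_of_mem_erase hu))
        split_ifs at * <;> omega
      have huXZ : φ u ∈ X ∪ Z := mem_union_right _ (hφ u hu)
      obtain ⟨x, c'', g1, g2, g3, g4⟩ := h1.st.leaf hE (by omega) huXZ hcu
      have hwφ : w ≠ φ u := fun hh => disjoint_left.1 h1.disj (hh ▸ hw) (hφ u hu)
      refine main (φ u) x c'' w' g1 g2 g3 g4 (mem_insert_of_mem (hφ u hu)) ?_
        (Or.inl ⟨rfl, u, hu, huv⟩) ?_
      · intro u' hu' huv'
        have := card_le_one.1 hv1 u (mem_filter.2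
          ⟨mem_of_mem_erase hu, huv.symm⟩) u' (mem_filter.2
          ⟨mem_of_mem_erase hu', huv'.symm⟩)
        rw [this]
      · intro hh
        rw [g2.keep w (mem_union_left _ hw) (by simpa using hwφ)]
        exact h6 hh
    · have hno : ∀ u ∈ S.erase v, ¬ T.Adj u v := fun u hu huv => hex ⟨u, hu, huv⟩
      have hwX : w' ∈ X ∪ Z := by
        rcases mem_insert.1 h5 with rfl | g5
        exacts [mem_union_left _ hw, mem_union_right _ g5]
      have hcw' : 1 ≤ c' w' := by
        rcases mem_insert.1 h5 with rfl | g5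
        · exact h6 rfl
        · rw [← h3] at g5
          obtain ⟨u, hu, rfl⟩ := mem_image.1 g5
          have := h7 u hu
          have := (card_le_card (hsub u)).trans (hdeg u (mem_of_mem_erase hu))
          rw [if_pos rfl] at *
          omega
      obtain ⟨x, c'', g1, g2, g3, g4⟩ := h1.st.leaf hE (by omega) hwX hcw'
      refine main w' x c'' x g1 g2 g3 g4 h5 (fun u hu huv => absurd huv (hno u hu))
        (Or.inr ⟨rfl, rfl⟩) ?_
      rintro rfl
      exact absurd (mem_union_left _ hw)
        (by simpa using disjoint_right.1 g2.disj)

end TreeEmbed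

section Posa

open Classical in
/-- The number of consecutive pairs in a list that are edges of `G`. -/
noncomputable def score {V : Type*} (G : SimpleGraph V) : List V → ℕ
  | [] => 0
  | [_] => 0
  | a :: b :: l => (if G.Adj a b then 1 else 0) + score G (b :: l)

variable {V : Type*} {G G' : SimpleGraph V}

open Classical in
lemma score_append {A B : List V} {a b : V} (hA : A.getLast? = some a) (hB : B.head? = some b) :
    score G (A ++ B) = score G A + (if G.Adj a b then 1 else 0) + score G B := by
  induction A with
  | nil => simp at hA
  | cons x A ih =>
    cases A with
    | nil =>
      cases B with
      | nil => simp at hB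
      | cons y B =>
        simp only [List.getLast?_singleton, Option.some.injEq, List.head?_cons] at hA hB
        subst hA hB
        simp [score]
    | cons y A =>
      rw [List.getLast?_cons_cons] at hA
      have := ih hA
      simp only [List.cons_append] at this ⊢
      simp only [score]
      rw [this]; ring

lemma score_reverse (l : List V) : score G l.reverse = score G l := by
  classical
  induction l with
  | nil => rfl
  | cons a l ih =>
    cases l with
    | nil => rfl
    | cons b l =>
      rw [List.reverse_cons, score_append (a := b) (b := a) (by simp) (by simp), ih]
      simp only [score, G.adj_comm a b]; ring

lemma score_mono (h : G ≤ G') (l : List V) : score G l ≤ score G' l := by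
  classical
  induction l with
  | nil => exact le_rfl
  | cons a l ih =>
    cases l with
    | nil => exact le_rfl
    | cons b l =>
      simp only [score]
      have : (if G.Adj a b then 1 else 0) ≤ if G'.Adj a b then 1 else 0 := by
        by_cases hab : G.Adj a b
        · simp [hab, h hab]
        · simp [hab]
      omega

lemma score_le_of_adj {l : List V} (h : ∀ a b, [a, b] <:+: l → G'.Adj a b → G.Adj a b) :
    score G' l ≤ score G l := by
  classical
  induction l with
  | nil => exact le_rfl
  | cons a l ih =>
    cases l with
    | nil => exact le_rfl
    | cons b l =>
      simp only [score]
      have h1 := ih fun x y hxy => h x y (hxy.trans (List.suffix_cons _ _).isInfix)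
      have : (if G'.Adj a b then 1 else 0) ≤ if G.Adj a b then 1 else 0 := by
        by_cases hab : G'.Adj a b
        · simp [hab, h a b ⟨[], l, rfl⟩ hab]
        · simp [hab]
      omega

lemma isChain_or_exists_not_adj (l : List V) :
    l.IsChain G.Adj ∨ ∃ A a b B, l = A ++ a :: b :: B ∧ ¬ G.Adj a b := by
  induction l with
  | nil => exact Or.inl .nil
  | cons a l ih =>
    cases l with
    | nil => exact Or.inl (.singleton a)
    | cons b l =>
      by_cases hab : G.Adj a b
      · rcases ih with ih | ⟨A, x, y, B, h1, h2⟩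
        · exact Or.inl (List.isChain_cons_cons.2 ⟨hab, ih⟩)
        · exact Or.inr ⟨a :: A, x, y, B, by rw [h1]; rfl, h2⟩
      · exact Or.inr ⟨[], a, b, l, rfl, hab⟩

/-- A rotation of a list along an edge at its last element. -/
inductive Rot (G : SimpleGraph V) : List V → List V → Prop
  | mk (A : List V) (x : V) (C : List V) (z : V) (hz : C.getLast? = some z) (hxz : G.Adj x z) :
      Rot G (A ++ x :: C) (A ++ x :: C.reverse)

lemma Rot.perm {l l' : List V} (h : Rot G l l') : l'.Perm l := by
  obtain ⟨A, x, C, z, hz, hxz⟩ := h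
  exact List.Perm.append_left _ ((List.reverse_perm C).cons x)

lemma Rot.head? {l l' : List V} (h : Rot G l l') : l'.head? = l.head? := by
  obtain ⟨A, x, C, z, hz, hxz⟩ := h
  cases A <;> rfl

lemma Rot.score_le {l l' : List V} (h : Rot G l l') : score G l ≤ score G l' := by
  classical
  obtain ⟨A, x, C, z, hz, hxz⟩ := h
  obtain ⟨y, hy⟩ : ∃ y, C.head? = some y := by
    cases C with
    | nil => simp at hz
    | cons y C => exact ⟨y, rfl⟩
  have e : ∀ C, A ++ x :: C = (A ++ [x]) ++ C := by simp
  rw [e C, e C.reverse, score_append (A := A ++ [x]) (B := C) (a := x) (b := y) (by simp) hy,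
    score_append (A := A ++ [x]) (B := C.reverse) (a := x) (b := z) (by simp)
      (by rw [List.head?_reverse]; exact hz), score_reverse, if_pos hxz]
  split_ifs <;> omega

/-- Consecutive elements of a list, in either order. -/
def Consec (l : List V) (u v : V) : Prop := [u, v] <:+: l ∨ [v, u] <:+: l

lemma Consec.symm {l : List V} {u v : V} (h : Consec l u v) : Consec l v u := Or.symm h

lemma Consec.reverse {l : List V} {u v : V} (h : Consec l.reverse u v) : Consec l u v := by
  rcases h with h | h
  · exact Or.inr (by simpa using h.reverse)
  · exact Or.inl (by simpa using h.reverse)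

lemma infix_pair_append {A B : List V} {u v : V} (h : [u, v] <:+: A ++ B) :
    [u, v] <:+: A ∨ [u, v] <:+: B ∨ (A.getLast? = some u ∧ B.head? = some v) := by
  obtain ⟨s, t, h⟩ := h
  induction A generalizing s with
  | nil => exact Or.inr (Or.inl ⟨s, t, by simpa using h⟩)
  | cons a A ih =>
    cases s with
    | nil =>
      simp only [List.nil_append, List.cons_append, List.cons.injEq] at h
      obtain ⟨rfl, h⟩ := h
      cases A with
      | nil => exact Or.inr (Or.inr ⟨rfl, by rw [← List.nil_append B, ← h]; rfl⟩)
      | cons b A =>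
        simp only [List.cons_append, List.cons.injEq] at h
        obtain ⟨rfl, h⟩ := h
        exact Or.inl ⟨[], A, rfl⟩
    | cons b s =>
      simp only [List.cons_append, List.cons.injEq] at h
      rcases ih s (by simpa using h.2) with h1 | h1 | ⟨h1, h2⟩
      · exact Or.inl (h1.trans (List.suffix_cons _ _).isInfix)
      · exact Or.inr (Or.inl h1)
      · refine Or.inr (Or.inr ⟨?_, h2⟩)
        cases A with
        | nil => simp at h1
        | cons c A => rwa [List.getLast?_cons_cons]

lemma getLast?_append_cons_reverse (A : List V) (x y : V) (C : List V) :
    (A ++ x :: (y :: C).reverse).getLast? = some y := by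
  have : A ++ x :: (y :: C).reverse = (A ++ x :: C.reverse) ++ [y] := by simp
  rw [this, List.getLast?_append]
  rfl

/-- New consecutive pairs created by a rotation. -/
lemma Rot.consec {l l' : List V} (h : Rot G l l') : ∃ x y z, Consec l x y ∧
    l'.getLast? = some y ∧ l.getLast? = some z ∧ ∀ u v, Consec l' u v →
      Consec l u v ∨ (u = x ∧ v = z) ∨ (u = z ∧ v = x) := by
  obtain ⟨A, x, C, z, hz, hxz⟩ := h
  obtain ⟨y, C', rfl⟩ : ∃ y C', C = y :: C' := by
    cases C with
    | nil => simp at hz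
    | cons y C => exact ⟨y, C, rfl⟩
  have e : ∀ C, A ++ x :: C = (A ++ [x]) ++ C := by simp
  have main : ∀ u v, [u, v] <:+: A ++ x :: (y :: C').reverse →
      Consec (A ++ x :: y :: C') u v ∨ (u = x ∧ v = z) := by
    intro u v h
    rw [e] at h
    rcases infix_pair_append h with h | h | ⟨h1, h2⟩
    · exact Or.inl (Or.inl (by rw [e]; exact h.trans (List.prefix_append _ _).isInfix))
    · refine Or.inl ?_
      have h1 : Consec (y :: C') u v := Consec.reverse (Or.inl h)
      rw [e]
      exact h1.imp (fun h => h.trans (List.suffix_append _ _).isInfix)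
        (fun h => h.trans (List.suffix_append _ _).isInfix)
    · refine Or.inr ⟨?_, ?_⟩
      · simpa using h1.symm
      · rw [List.head?_reverse, hz] at h2
        simpa using h2.symm
  refine ⟨x, y, z, Or.inl ⟨A, C', by simp⟩, getLast?_append_cons_reverse _ _ _ _, ?_, ?_⟩
  · rw [e, List.getLast?_append, hz]; rfl
  · rintro u v (h | h)
    · rcases main u v h with h | h
      exacts [Or.inl h, Or.inr (Or.inl h)]
    · rcases main v u h with h | h
      exacts [Or.inl h.symm, Or.inr (Or.inr ⟨h.2, h.1⟩)]

/-- Last elements of lists obtained from `l` by rotations. -/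
def IsEnd (G : SimpleGraph V) (l : List V) (z : V) : Prop :=
  ∃ l', Relation.ReflTransGen (Rot G) l l' ∧ l'.getLast? = some z

lemma consec_of_rot {l l' : List V} (h : Relation.ReflTransGen (Rot G) l l') {u : V}
    (hu : ¬ IsEnd G l u) (hn : ∀ y, Consec l u y → ¬ IsEnd G l y) {y : V} (hy : Consec l' u y) :
    Consec l u y := by
  induction h generalizing y with
  | refl => exact hy
  | @tail l' l'' h1 h2 ih =>
    obtain ⟨a, b, z, c1, c2, c3, c4⟩ := h2.consec
    rcases c4 u y hy with h | ⟨rfl, -⟩ | ⟨rfl, -⟩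
    · exact ih h
    · exact absurd ⟨l'', h1.tail h2, c2⟩ (hn b (ih c1))
    · exact absurd ⟨l', h1, c3⟩ hu

/-- Neighbours of end points are end points or consecutive to end points. -/
lemma exists_consec_isEnd {l : List V} {u z : V} (hul : u ∈ l) (hz : IsEnd G l z)
    (huz : G.Adj u z) (hu : ¬ IsEnd G l u) : ∃ y, Consec l u y ∧ IsEnd G l y := by
  obtain ⟨l', h1, h2⟩ := hz
  have hp : l'.Perm l := by
    clear h2
    induction h1 with
    | refl => exact List.Perm.refl _
    | tail _ h ih => exact h.perm.trans ih
  by_contra hcon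
  have hcon' : ∀ y, Consec l u y → ¬ IsEnd G l y := fun y h1 h2 => hcon ⟨y, h1, h2⟩
  obtain ⟨A, C, rfl⟩ := List.append_of_mem (hp.mem_iff.2 hul)
  cases C with
  | nil =>
    refine hu ⟨_, h1, by simp⟩
  | cons y C =>
    have hzC : (y :: C).getLast? = some z := by
      rw [List.getLast?_append] at h2
      simpa using h2
    have hc : Consec (A ++ u :: y :: C) u y := Or.inl ⟨A, C, by simp⟩
    have hr : Rot G (A ++ u :: y :: C) (A ++ u :: (y :: C).reverse) := .mk A u _ z hzC huz
    exact hcon' y (consec_of_rot h1 hu hcon' hc)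
      ⟨_, h1.tail hr, getLast?_append_cons_reverse _ _ _ _⟩

lemma infix_pair_left_unique {l : List V} (hl : l.Nodup) {u u' v : V} (h : [u, v] <:+: l)
    (h' : [u', v] <:+: l) : u = u' := by
  induction l with
  | nil => simp at h
  | cons a l ih =>
    have hn := List.nodup_cons.1 hl
    rw [List.infix_cons_iff] at h h'
    rcases h with h | h <;> rcases h' with h' | h'
    · rw [List.cons_prefix_cons] at h h'
      rw [h.1, h'.1]
    · rw [List.cons_prefix_cons] at h
      cases l with
      | nil => simp at h'
      | cons b l =>
        rw [List.cons_prefix_cons] at h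
        have h2 := List.nodup_cons.1 hn.2
        rw [← h.2.1, List.infix_cons_iff, List.cons_prefix_cons] at h'
        rw [← h.2.1] at h2
        rcases h' with h' | h'
        · exact absurd (h'.2.subset (by simp)) h2.1
        · exact absurd (h'.subset (by simp)) h2.1
    · rw [List.cons_prefix_cons] at h'
      cases l with
      | nil => simp at h
      | cons b l =>
        rw [List.cons_prefix_cons] at h'
        have h2 := List.nodup_cons.1 hn.2
        rw [← h'.2.1, List.infix_cons_iff, List.cons_prefix_cons] at h
        rw [← h'.2.1] at h2
        rcases h with h | h
        · exact absurd (h.2.subset (by simp)) h2.1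
        · exact absurd (h.subset (by simp)) h2.1
    · exact ih hn.2 h h'

lemma card_filter_exists_le {V : Type*} [Fintype V] [DecidableEq V] (S : Finset V)
    (R : V → V → Prop) (hR : ∀ u u' v, R u v → R u' v → u = u')
    [DecidablePred fun u => ∃ v ∈ S, R u v] :
    (univ.filter fun u => ∃ v ∈ S, R u v).card ≤ S.card := by
  classical
  refine (card_le_card (t := S.image fun v =>
    if h : ∃ u, R u v then h.choose else v) ?_).trans card_image_le
  intro u hu
  obtain ⟨v, hv, huv⟩ := (mem_filter.1 hu).2
  refine mem_image.2 ⟨v, hv, ?_⟩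
  have h : ∃ u, R u v := ⟨u, huv⟩
  rw [dif_pos h]
  exact hR _ _ _ h.choose_spec huv

variable [Fintype V] [DecidableEq V]

/-- Every nonempty subset of `W` of size at most `m` has more than three times as many neighbours
in `W`. -/
def Expands (G : SimpleGraph V) (W : Finset V) (m : ℕ) : Prop :=
  ∀ U ⊆ W, U.Nonempty → U.card ≤ m → 3 * U.card < (U.biUnion (nb G) ∩ W).card

lemma Expands.mono {W : Finset V} {m : ℕ} (h : G ≤ G') (hE : Expands G W m) : Expands G' W m := by
  intro U hU h1 h2
  refine (hE U hU h1 h2).trans_le (card_le_card (inter_subset_inter_right ?_))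
  exact biUnion_mono fun u _ v hv => mem_nb.2 (h (mem_nb.1 hv))

/-- `l` is an ordering of `W`. -/
def IsOrd (W : Finset V) (l : List V) : Prop := l.Nodup ∧ l.toFinset = W

lemma IsOrd.perm {W : Finset V} {l l' : List V} (h : IsOrd W l) (hp : l'.Perm l) : IsOrd W l' :=
  ⟨hp.nodup_iff.2 h.1, by rw [← h.2]; exact List.toFinset_eq_of_perm _ _ hp⟩

open Classical in
lemma card_isEnd {W : Finset V} {m : ℕ} (hE : Expands G W m) {l : List V} (hl : IsOrd W l)
    (hne : W.Nonempty) : m < (univ.filter (IsEnd G l)).card := by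
  by_contra hcon
  set S := univ.filter (IsEnd G l) with hS
  have hmem : ∀ z, z ∈ S ↔ IsEnd G l z := by simp [hS]
  have hSW : S ⊆ W := by
    intro z hz
    obtain ⟨l', h1, h2⟩ := (hmem z).1 hz
    have hp : l'.Perm l := by
      clear h2
      induction h1 with
      | refl => exact List.Perm.refl _
      | tail _ h ih => exact h.perm.trans ih
    rw [← hl.2, List.mem_toFinset, ← hp.mem_iff]
    exact List.mem_of_getLast? h2
  have hSne : S.Nonempty := by
    cases hlast : l.getLast? with
    | none =>
      rw [List.getLast?_eq_none_iff] at hlast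
      rw [← hl.2, hlast] at hne
      simp at hne
    | some z => exact ⟨z, (hmem z).2 ⟨l, .refl, hlast⟩⟩
  have h1 := hE S hSW hSne (not_lt.1 hcon)
  have h2 : S.biUnion (nb G) ∩ W ⊆ S ∪ ((univ.filter fun u => ∃ v ∈ S, [u, v] <:+: l) ∪
      (univ.filter fun u => ∃ v ∈ S, [v, u] <:+: l)) := by
    intro u hu
    obtain ⟨hu1, hu2⟩ := mem_inter.1 hu
    obtain ⟨z, hz, hzu⟩ := mem_biUnion.1 hu1
    by_cases huS : u ∈ S
    · exact mem_union_left _ huS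
    · obtain ⟨y, hy1, hy2⟩ := exists_consec_isEnd (u := u) (z := z)
        (by rw [← List.mem_toFinset, hl.2]; exact hu2) ((hmem z).1 hz) (mem_nb.1 hzu).symm
        (fun h => huS ((hmem u).2 h))
      rw [← hmem] at hy2
      refine mem_union_right _ (mem_union.2 ?_)
      rcases hy1 with hy1 | hy1
      · exact Or.inl (by simpa using ⟨y, hy2, hy1⟩)
      · exact Or.inr (by simpa using ⟨y, hy2, hy1⟩)
  have h3 := card_filter_exists_le S (fun u v => [u, v] <:+: l)
    (fun u u' v h h' => infix_pair_left_unique hl.1 h h')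
  have h4 := card_filter_exists_le S (fun u v => [v, u] <:+: l)
    (fun u u' v h h' => by
      refine infix_pair_left_unique (l := l.reverse) (v := v) (List.nodup_reverse.2 hl.1) ?_ ?_
      · simpa using h.reverse
      · simpa using h'.reverse)
  have h5 := card_le_card h2
  have h6 := card_union_le S ((univ.filter fun u => ∃ v ∈ S, [u, v] <:+: l) ∪
      (univ.filter fun u => ∃ v ∈ S, [v, u] <:+: l))
  have h7 := card_union_le (univ.filter fun u => ∃ v ∈ S, [u, v] <:+: l)
      (univ.filter fun u => ∃ v ∈ S, [v, u] <:+: l)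
  omega

lemma exists_max_score (G : SimpleGraph V) (W : Finset V) :
    ∃ l, IsOrd W l ∧ ∀ l', IsOrd W l' → score G l' ≤ score G l := by
  classical
  have hfin : {l : List V | IsOrd W l}.Finite := by
    refine (List.finite_length_eq V W.card).subset ?_
    rintro l ⟨h1, h2⟩
    change l.length = W.card
    rw [← List.toFinset_card_of_nodup h1, h2]
  obtain ⟨l, h1, h2⟩ := hfin.toFinset.exists_max_image (score G)
    ⟨W.toList, by simp [IsOrd, nodup_toList]⟩
  exact ⟨l, by simpa using h1, fun l' hl' => h2 l' (by simpa using hl')⟩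

lemma IsOrd.reach {W : Finset V} {l l' : List V} (hl : IsOrd W l)
    (h : Relation.ReflTransGen (Rot G) l l') :
    IsOrd W l' ∧ l'.head? = l.head? ∧ score G l ≤ score G l' := by
  induction h with
  | refl => exact ⟨hl, rfl, le_rfl⟩
  | tail _ h ih => exact ⟨ih.1.perm h.perm, h.head?.trans ih.2.1, ih.2.2.trans h.score_le⟩

open Classical in
/-- Either `G` has a Hamiltonian path on `W`, or there are many pairs whose addition
to `G` increases the maximal score. -/
theorem exists_boosters {W : Finset V} {m : ℕ} (hE : Expands G W m) (hne : W.Nonempty) :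
    (∃ l, IsOrd W l ∧ l.IsChain G.Adj) ∨ ∃ P : Finset (Sym2 V), m * m ≤ 2 * P.card ∧
      (∀ e ∈ P, ¬ e.IsDiag) ∧ ∀ G', G ≤ G' → ∀ l', IsOrd W l' →
        (∀ l, IsOrd W l → score G' l ≤ score G l') → ∀ e ∈ P, e ∉ G'.edgeSet := by
  obtain ⟨l, hl, hmax⟩ := exists_max_score G W
  by_cases hham : ∃ l, IsOrd W l ∧ l.IsChain G.Adj
  · exact Or.inl hham
  refine Or.inr ?_
  have hz : ∀ z ∈ univ.filter (IsEnd G l), ∃ l', IsOrd W l' ∧ l'.head? = some z ∧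
      score G l ≤ score G l' := by
    intro z hz
    obtain ⟨l', h1, h2⟩ := (mem_filter.1 hz).2
    obtain ⟨h3, -, h4⟩ := hl.reach h1
    exact ⟨l'.reverse, h3.perm (List.reverse_perm _), by simpa using h2, by rwa [score_reverse]⟩
  choose! f hf1 hf2 hf3 using hz
  set S := univ.filter (IsEnd G l) with hS
  let T : V → Finset V := fun z => (univ.filter (IsEnd G (f z))).erase z
  have hT : ∀ z ∈ S, m ≤ (T z).card := by
    intro z hz
    have h1 := card_isEnd hE (hf1 z hz) hne
    have h2 := pred_card_le_card_erase (s := univ.filter (IsEnd G (f z))) (a := z)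
    simp only [T]
    omega
  have hScard : m < S.card := card_isEnd hE hl hne
  let Q : Finset (V × V) := S.biUnion fun z =>
    (T z).map ⟨fun w => (z, w), fun a b h => by simpa using h⟩
  have hQ : m * m ≤ Q.card := by
    rw [card_biUnion]
    · calc m * m ≤ S.card * m := Nat.mul_le_mul_right _ hScard.le
        _ = ∑ z ∈ S, m := by rw [sum_const, smul_eq_mul]
        _ ≤ _ := sum_le_sum fun z hz => by rw [card_map]; exact hT z hz
    · intro z _ z' _ hzz
      rw [onFun, disjoint_left]
      intro p hp hp'
      simp only [mem_map] at hp hp'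
      obtain ⟨w, -, rfl⟩ := hp
      obtain ⟨w', -, h⟩ := hp'
      exact hzz (Prod.mk.inj h).1.symm
  refine ⟨Q.image fun p : V × V => (s(p.1, p.2) : Sym2 V), ?_, ?_, ?_⟩
  · have : Q.card ≤ 2 * (Q.image fun p : V × V => (s(p.1, p.2) : Sym2 V)).card := by
      refine card_le_mul_card_image (f := fun p : V × V => (s(p.1, p.2) : Sym2 V)) Q 2 fun e _ => ?_
      induction e using Sym2.ind with
      | _ x y =>
        refine (card_le_card (t := {(x, y), (y, x)}) ?_).trans card_le_two
        intro p hp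
        have := (mem_filter.1 hp).2
        rw [Sym2.eq_iff] at this
        simp only [mem_insert, mem_singleton, Prod.ext_iff]
        exact this
    omega
  · intro e he
    obtain ⟨p, hp, rfl⟩ := mem_image.1 he
    obtain ⟨z, hz, hpz⟩ := mem_biUnion.1 hp
    obtain ⟨w, hw, rfl⟩ := mem_map.1 hpz
    change ¬ s(z, w).IsDiag
    rw [Sym2.mk_isDiag_iff]
    exact (ne_of_mem_erase hw).symm
  · intro G' hGG' l' hl' hmax' e he hadj
    obtain ⟨p, hp, rfl⟩ := mem_image.1 he
    obtain ⟨z, hz, hpz⟩ := mem_biUnion.1 hp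
    obtain ⟨w, hw, rfl⟩ := mem_map.1 hpz
    change G'.Adj z w at hadj
    obtain ⟨k, k1, k2⟩ := (mem_filter.1 (mem_of_mem_erase hw)).2
    obtain ⟨k3, k4, k5⟩ := (hf1 z hz).reach k1
    rw [hf2 z hz] at k4
    rcases isChain_or_exists_not_adj (G := G) k with hk | ⟨A, a, b, B, rfl, hab⟩
    · exact hham ⟨k, k3, hk⟩
    have e1 : A ++ a :: b :: B = (A ++ [a]) ++ (b :: B) := by simp
    rw [e1] at k2 k3 k4 k5
    have hB : (b :: B).getLast? = some w := by
      rw [List.getLast?_append, List.getLast?_cons] at k2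
      rw [List.getLast?_cons]
      exact k2
    have hA : (A ++ [a]).head? = some z := by
      cases A <;> simpa using k4
    have s1 := score_append (G := G) (A := A ++ [a]) (B := b :: B) (a := a) (b := b) (by simp) rfl
    have s2 := score_append (G := G') hB hA
    rw [if_neg hab] at s1
    rw [if_pos hadj.symm] at s2
    have h1 := hmax' _ (k3.perm (List.perm_append_comm (l₁ := b :: B) (l₂ := A ++ [a])))
    have h2 := hmax l' hl'
    have h3 := hf3 z hz
    have h4 := score_mono hGG' (A ++ [a])
    have h5 := score_mono hGG' (b :: B)
    omega

/-- If `G ⊔ G'` has no Hamiltonian path on `W`, then `G'` has a subgraph with few edges such that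
none of its boosters is an edge of `G'`. -/
theorem exists_isChain_or_edges {W : Finset V}
    (P : Finset (Sym2 V) → Finset (Sym2 V))
    (hP : ∀ E : Finset (Sym2 V), (∃ l, IsOrd W l ∧ l.IsChain (G ⊔ .fromEdgeSet E).Adj) ∨
      ∀ G₁, G ⊔ .fromEdgeSet E ≤ G₁ → ∀ l', IsOrd W l' → (∀ l, IsOrd W l → score G₁ l ≤
        score (G ⊔ .fromEdgeSet E) l') → ∀ e ∈ P E, e ∉ G₁.edgeSet) (G' : SimpleGraph V) :
    (∃ l, IsOrd W l ∧ l.IsChain (G ⊔ G').Adj) ∨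
      ∃ E : Finset (Sym2 V), (E : Set (Sym2 V)) ⊆ G'.edgeSet ∧ E.card ≤ W.card ∧
        ∀ e ∈ P E, e ∉ G'.edgeSet := by
  classical
  obtain ⟨l, hl, hmax⟩ := exists_max_score (G ⊔ G') W
  let E : Finset (Sym2 V) := ((l.zip l.tail).map fun p => s(p.1, p.2)).toFinset.filter
    (· ∈ G'.edgeSet)
  have hEG : (E : Set (Sym2 V)) ⊆ G'.edgeSet := fun e he => (mem_filter.1 he).2
  have hle : G ⊔ .fromEdgeSet E ≤ G ⊔ G' := by
    refine sup_le_sup_left ?_ G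
    intro u v huv
    exact hEG ((SimpleGraph.fromEdgeSet_adj _).1 huv).1
  have hEc : E.card ≤ W.card := by
    refine (card_filter_le _ _).trans ((List.toFinset_card_le _).trans ?_)
    rw [List.length_map, List.length_zip, ← hl.2, List.toFinset_card_of_nodup hl.1]
    exact min_le_left _ _
  have hpair : ∀ (l : List V) a b, [a, b] <:+: l →
      s(a, b) ∈ (l.zip l.tail).map fun p => s(p.1, p.2) := by
    intro l a b h
    induction l with
    | nil => simp at h
    | cons x l ih =>
      rw [List.infix_cons_iff] at h
      rcases h with h | h
      · cases l with
        | nil => simp at h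
        | cons y l =>
          rw [List.cons_prefix_cons, List.cons_prefix_cons] at h
          simp [h.1, h.2.1]
      · cases l with
        | nil => simp at h
        | cons y l =>
          have := ih h
          simp only [List.tail_cons, List.zip_cons_cons, List.map_cons, List.mem_cons] at this ⊢
          exact Or.inr this
  have hscore : score (G ⊔ G') l ≤ score (G ⊔ .fromEdgeSet E) l := by
    refine score_le_of_adj fun a b hab h => ?_
    rcases h with h | h
    · exact Or.inl h
    · refine Or.inr ((SimpleGraph.fromEdgeSet_adj _).2 ⟨?_, h.ne⟩)
      exact mem_coe.2 (mem_filter.2 ⟨List.mem_toFinset.2 (hpair l a b hab), h⟩)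
  rcases hP E with ⟨k, hk, hc⟩ | h
  · exact Or.inl ⟨k, hk, hc.imp fun a b h => hle h⟩
  · refine Or.inr ⟨E, hEG, hEc, fun e he h' => ?_⟩
    refine h (G ⊔ G') hle l hl (fun k hk => (hmax k hk).trans hscore) e he ?_
    rw [SimpleGraph.edgeSet_sup]
    exact Or.inr h'

end Posa

section Prob

variable {α : Type*} [Fintype α] [DecidableEq α]

/-- The weight of an outcome of independent coin flips with bias `p`. -/
def wt (p : ℝ) (ω : α → Bool) : ℝ := ∏ a, if ω a then p else 1 - p

/-- The expectation with respect to independent coin flips with bias `p`. -/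
def ex (p : ℝ) (f : (α → Bool) → ℝ) : ℝ := ∑ ω, wt p ω * f ω

open Classical in
/-- The indicator of a proposition. -/
noncomputable def ind (P : Prop) : ℝ := if P then 1 else 0

lemma ind_nonneg (P : Prop) : 0 ≤ ind P := by unfold ind; split_ifs <;> norm_num

lemma ind_le_one (P : Prop) : ind P ≤ 1 := by unfold ind; split_ifs <;> norm_num

lemma ind_mono {P Q : Prop} (h : P → Q) : ind P ≤ ind Q := by
  unfold ind
  split_ifs with h1 h2
  · exact le_rfl
  · exact absurd (h h1) h2
  · norm_num
  · exact le_rfl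

lemma ind_or_le (P Q : Prop) : ind (P ∨ Q) ≤ ind P + ind Q := by
  unfold ind
  by_cases hP : P <;> by_cases hQ : Q <;> simp [hP, hQ]

lemma ind_exists_le {κ : Type*} (C : Finset κ) (P : κ → Prop) :
    ind (∃ c ∈ C, P c) ≤ ∑ c ∈ C, ind (P c) := by
  by_cases h : ∃ c ∈ C, P c
  · obtain ⟨c, hc, hP⟩ := h
    exact (ind_le_one _).trans ((by simp [ind, hP] : (1 : ℝ) ≤ ind (P c)).trans
      (single_le_sum (f := fun c => ind (P c)) (fun c _ => ind_nonneg _) hc))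
  · have : ind (∃ c ∈ C, P c) = 0 := by simp only [ind, h, if_false]
    rw [this]
    exact sum_nonneg fun c _ => ind_nonneg _

lemma wt_nonneg {p : ℝ} (h0 : 0 ≤ p) (h1 : p ≤ 1) (ω : α → Bool) : 0 ≤ wt p ω := by
  refine prod_nonneg fun a _ => ?_
  split_ifs <;> linarith

lemma ex_mono {p : ℝ} (h0 : 0 ≤ p) (h1 : p ≤ 1) {f g : (α → Bool) → ℝ} (h : ∀ ω, f ω ≤ g ω) :
    ex p f ≤ ex p g :=
  sum_le_sum fun ω _ => mul_le_mul_of_nonneg_left (h ω) (wt_nonneg h0 h1 ω)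

lemma ex_add (p : ℝ) (f g : (α → Bool) → ℝ) : ex p (fun ω => f ω + g ω) = ex p f + ex p g := by
  simp only [ex, mul_add, sum_add_distrib]

lemma ex_sum {κ : Type*} (p : ℝ) (C : Finset κ) (f : κ → (α → Bool) → ℝ) :
    ex p (fun ω => ∑ c ∈ C, f c ω) = ∑ c ∈ C, ex p (f c) := by
  simp only [ex, mul_sum]
  exact sum_comm

lemma ex_comm (p q : ℝ) (f : (α → Bool) → (α → Bool) → ℝ) :
    ex p (fun ω => ex q fun η => f ω η) = ex q (fun η => ex p fun ω => f ω η) := by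
  simp only [ex, mul_sum]
  rw [sum_comm]
  refine sum_congr rfl fun _ _ => sum_congr rfl fun _ _ => by ring

/-- The probability that a set of coins shows heads and another one tails. -/
lemma ex_forall (p : ℝ) (A B : Finset α) (hAB : Disjoint A B) :
    ex p (fun ω => ind ((∀ a ∈ A, ω a = true) ∧ ∀ a ∈ B, ω a = false)) =
      p ^ A.card * (1 - p) ^ B.card := by
  classical
  let g : α → Bool → ℝ := fun a b =>
    if b then (if a ∈ B then 0 else p) else (if a ∈ A then 0 else 1 - p)
  have h1 : ∀ ω : α → Bool, wt p ω *
      ind ((∀ a ∈ A, ω a = true) ∧ ∀ a ∈ B, ω a = false) = ∏ a, g a (ω a) := by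
    intro ω
    by_cases h : (∀ a ∈ A, ω a = true) ∧ ∀ a ∈ B, ω a = false
    · rw [ind, if_pos h, mul_one]
      refine prod_congr rfl fun a _ => ?_
      by_cases hω : ω a
      · have : a ∉ B := fun hb => by simp [h.2 a hb] at hω
        simp [g, hω, this]
      · have : a ∉ A := fun ha => hω (h.1 a ha)
        simp [g, hω, this]
    · rw [ind, if_neg h, mul_zero]
      symm
      rw [prod_eq_zero_iff]
      by_contra hcon
      refine h ⟨fun a ha => ?_, fun a ha => ?_⟩
      · by_contra hω
        exact hcon ⟨a, mem_univ _, by simp [g, hω, ha]⟩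
      · by_contra hω
        exact hcon ⟨a, mem_univ _, by simp [g, hω, ha]⟩
  have h2 := (prod_univ_sum (fun _ : α => (univ : Finset Bool)) g).symm
  rw [Fintype.piFinset_univ] at h2
  rw [ex, sum_congr rfl fun ω _ => h1 ω, h2]
  have h3 : ∀ a, ∑ b, g a b = (if a ∈ A then p else 1) * (if a ∈ B then 1 - p else 1) := by
    intro a
    by_cases ha : a ∈ A
    · have : a ∉ B := disjoint_left.1 hAB ha
      simp [g, ha, this]
    · by_cases hb : a ∈ B <;> simp [g, ha, hb]
  rw [prod_congr rfl fun a _ => h3 a, prod_mul_distrib]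
  simp

lemma ex_one (p : ℝ) : ex (α := α) p (fun _ => 1) = 1 := by
  have := ex_forall (α := α) p ∅ ∅ (by simp)
  simpa [ind] using this

lemma ex_const (p c : ℝ) : ex (α := α) p (fun _ => c) = c := by
  have : ex (α := α) p (fun _ => c) = c * ex (α := α) p (fun _ => 1) := by
    simp only [ex, mul_sum]
    exact sum_congr rfl fun _ _ => by ring
  rw [this, ex_one, mul_one]

/-- The union of two random sets is a random set. -/
lemma ex_or (p q : ℝ) (f : (α → Bool) → ℝ) :
    ex p (fun ω => ex q fun η => f fun a => ω a || η a) = ex (1 - (1 - p) * (1 - q)) f := by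
  classical
  let g : α → Bool × Bool → ℝ := fun _ b =>
    (if b.1 then p else 1 - p) * (if b.2 then q else 1 - q)
  have h1 : ex p (fun ω => ex q fun η => f fun a => ω a || η a) =
      ∑ ξ : α → Bool × Bool, (∏ a, g a (ξ a)) * f fun a => (ξ a).1 || (ξ a).2 := by
    rw [← (Equiv.arrowProdEquivProdArrow α (fun _ => Bool) (fun _ => Bool)).symm.sum_comp,
      Fintype.sum_prod_type]
    refine sum_congr rfl fun ω _ => ?_
    simp only [ex, mul_sum]
    refine sum_congr rfl fun η _ => ?_
    simp only [g, wt, prod_mul_distrib]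
    rw [mul_assoc]
    rfl
  rw [h1, ← sum_fiberwise_of_maps_to (s := univ) (t := univ)
    (g := fun ξ : α → Bool × Bool => fun a => (ξ a).1 || (ξ a).2) (fun _ _ => mem_univ _)]
  refine sum_congr rfl fun ω _ => ?_
  have h2 : univ.filter (fun ξ : α → Bool × Bool => (fun a => (ξ a).1 || (ξ a).2) = ω) =
      Fintype.piFinset fun a => univ.filter fun b : Bool × Bool => (b.1 || b.2) = ω a := by
    ext ξ
    simp [Fintype.mem_piFinset, funext_iff]
  have h3 : ∀ ξ ∈ univ.filter (fun ξ : α → Bool × Bool =>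
      (fun a => (ξ a).1 || (ξ a).2) = ω), ((∏ a, g a (ξ a)) * f fun a => (ξ a).1 || (ξ a).2) =
      (∏ a, g a (ξ a)) * f ω := by
    intro ξ hξ
    rw [(mem_filter.1 hξ).2]
  rw [sum_congr rfl h3, ← sum_mul, h2, ← prod_univ_sum]
  congr 1
  refine prod_congr rfl fun a _ => ?_
  rw [sum_filter, Fintype.sum_prod_type]
  cases ω a
  · simp [g]
  · simp [g]; ring

/-- The union bound for the presence and absence of prescribed coins. -/
lemma ex_exists_le {κ : Type*} {p : ℝ} (h0 : 0 ≤ p) (h1 : p ≤ 1) (C : Finset κ)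
    (A B : κ → Finset α) (hAB : ∀ c ∈ C, Disjoint (A c) (B c)) :
    ex p (fun ω => ind (∃ c ∈ C, (∀ a ∈ A c, ω a = true) ∧ ∀ a ∈ B c, ω a = false)) ≤
      ∑ c ∈ C, p ^ (A c).card * (1 - p) ^ (B c).card := by
  refine (ex_mono h0 h1 fun ω => ind_exists_le C _).trans ?_
  rw [ex_sum]
  exact sum_le_sum fun c hc => (ex_forall p _ _ (hAB c hc)).le

/-- Exposing three independent random sets one after the other. -/
lemma one_sub_le_ex {p q r : ℝ} (hp0 : 0 ≤ p) (hp1 : p ≤ 1) (hq0 : 0 ≤ q) (hq1 : q ≤ 1)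
    (hr0 : 0 ≤ r) (hr1 : r ≤ 1) {Q : (α → Bool) → Prop} {e₁ e₂ e₃ e₄ : ℝ}
    (A₁ : (α → Bool) → Prop) (A₂ A₄ : (α → Bool) → (α → Bool) → Prop)
    (A₃ : (α → Bool) → (α → Bool) → (α → Bool) → Prop)
    (h₁ : ex p (fun ω => ind (¬ A₁ ω)) ≤ e₁)
    (h₂ : ∀ ω, A₁ ω → ex q (fun η => ind (¬ A₂ ω η)) ≤ e₂)
    (h₃ : ∀ ω η, A₁ ω → A₂ ω η → ex r (fun ξ => ind (¬ A₃ ω η ξ)) ≤ e₃)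
    (h₄ : ∀ ξ, ex p (fun ω => ind (¬ A₄ ξ ω)) ≤ e₄) (he₂ : 0 ≤ e₂) (he₃ : 0 ≤ e₃)
    (hQ : ∀ ω η ξ, A₁ ω → A₂ ω η → A₃ ω η ξ → A₄ ξ ω → Q fun a => (ω a || η a) || ξ a) :
    1 - (e₁ + e₂ + e₃ + e₄) ≤
      ex (1 - (1 - (1 - (1 - p) * (1 - q))) * (1 - r)) (fun ω => ind (Q ω)) := by
  rw [← ex_or, ← ex_or]
  have key : ∀ ω η ξ, (1 : ℝ) ≤ ind (Q fun a => (ω a || η a) || ξ a) + (ind (¬ A₁ ω) +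
      ind (A₁ ω ∧ ¬ A₂ ω η) + ind (A₁ ω ∧ A₂ ω η ∧ ¬ A₃ ω η ξ) + ind (¬ A₄ ξ ω)) := by
    intro ω η ξ
    have n0 := ind_nonneg (Q fun a => (ω a || η a) || ξ a)
    have n1 := ind_nonneg (¬ A₁ ω)
    have n2 := ind_nonneg (A₁ ω ∧ ¬ A₂ ω η)
    have n3 := ind_nonneg (A₁ ω ∧ A₂ ω η ∧ ¬ A₃ ω η ξ)
    have n4 := ind_nonneg (¬ A₄ ξ ω)
    by_cases a1 : A₁ ω
    · by_cases a2 : A₂ ω η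
      · by_cases a3 : A₃ ω η ξ
        · by_cases a4 : A₄ ξ ω
          · have : ind (Q fun a => (ω a || η a) || ξ a) = 1 := if_pos (hQ ω η ξ a1 a2 a3 a4)
            linarith
          · have : ind (¬ A₄ ξ ω) = 1 := if_pos a4
            linarith
        · have : ind (A₁ ω ∧ A₂ ω η ∧ ¬ A₃ ω η ξ) = 1 := if_pos ⟨a1, a2, a3⟩
          linarith
      · have : ind (A₁ ω ∧ ¬ A₂ ω η) = 1 := if_pos ⟨a1, a2⟩
        linarith
    · have : ind (¬ A₁ ω) = 1 := if_pos a1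
      linarith
  have zero : ∀ (s : ℝ) (P : Prop) (R : (α → Bool) → Prop), ¬ P →
      ex s (fun ω => ind (P ∧ R ω)) = 0 := by
    intro s P R h
    rw [← ex_const (α := α) s 0]
    congr 1; ext ω
    exact if_neg fun h' => h h'.1
  have b2 : ex p (fun ω => ex q fun η => ex (α := α) r fun _ => ind (A₁ ω ∧ ¬ A₂ ω η)) ≤ e₂ := by
    simp only [ex_const]
    rw [← ex_const (α := α) p e₂]
    refine ex_mono hp0 hp1 fun ω => ?_
    by_cases h : A₁ ω
    · simpa [h] using h₂ ω h
    · rw [zero q _ _ h]; exact he₂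
  have b3 : ex p (fun ω => ex q fun η => ex r fun ξ => ind (A₁ ω ∧ A₂ ω η ∧ ¬ A₃ ω η ξ)) ≤ e₃ := by
    rw [← ex_const (α := α) p e₃]
    refine ex_mono hp0 hp1 fun ω => ?_
    rw [← ex_const (α := α) q e₃]
    refine ex_mono hq0 hq1 fun η => ?_
    by_cases h : A₁ ω ∧ A₂ ω η
    · simpa [h.1, h.2] using h₃ ω η h.1 h.2
    · simp only [← and_assoc]
      rw [zero r _ _ h]; exact he₃
  have b4 : ex p (fun ω => ex (α := α) q fun _ => ex r fun ξ => ind (¬ A₄ ξ ω)) ≤ e₄ := by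
    simp only [ex_const]
    rw [ex_comm, ← ex_const (α := α) r e₄]
    exact ex_mono hr0 hr1 h₄
  have b1 : ex p (fun ω => ex (α := α) q fun _ => ex (α := α) r fun _ => ind (¬ A₁ ω)) ≤ e₁ := by
    simpa only [ex_const] using h₁
  have total := ex_mono (α := α) hp0 hp1 fun ω => ex_mono (α := α) hq0 hq1 fun η =>
    ex_mono hr0 hr1 (key ω η)
  simp only [ex_const, ex_add] at total b1 b2 b3 b4 ⊢
  linarith

end Prob

section RandomGraph

variable {V : Type*} [Fintype V] [DecidableEq V]

/-- The graph given by a family of coin flips indexed by the pairs of distinct vertices. -/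
def graphOf (ω : {e : Sym2 V // ¬ e.IsDiag} → Bool) : SimpleGraph V where
  Adj u v := ∃ h : ¬ s(u, v).IsDiag, ω ⟨s(u, v), h⟩ = true
  symm := ⟨fun u v ⟨h, h'⟩ => by
    have e : s(v, u) = s(u, v) := Sym2.eq_swap
    refine ⟨e ▸ h, ?_⟩
    simpa only [e] using h'⟩
  loopless := ⟨fun u ⟨h, _⟩ => h rfl⟩

lemma mem_edgeSet_graphOf {ω : {e : Sym2 V // ¬ e.IsDiag} → Bool} {e : Sym2 V} :
    e ∈ (graphOf ω).edgeSet ↔ ∃ h : ¬ e.IsDiag, ω ⟨e, h⟩ = true := by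
  induction e using Sym2.ind with
  | _ u v => rfl

lemma graphOf_or (ω η : {e : Sym2 V // ¬ e.IsDiag} → Bool) :
    graphOf (fun a => ω a || η a) = graphOf ω ⊔ graphOf η := by
  ext u v
  simp only [graphOf, SimpleGraph.sup_adj, Bool.or_eq_true]
  constructor
  · rintro ⟨h, h' | h'⟩
    exacts [Or.inl ⟨h, h'⟩, Or.inr ⟨h, h'⟩]
  · rintro (⟨h, h'⟩ | ⟨h, h'⟩)
    exacts [⟨h, Or.inl h'⟩, ⟨h, Or.inr h'⟩]

/-- The nondiagonal pairs in a finite set of pairs. -/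
def offDiagPairs (P : Finset (Sym2 V)) : Finset {e : Sym2 V // ¬ e.IsDiag} :=
  P.subtype fun e => ¬ e.IsDiag

lemma card_offDiagPairs {P : Finset (Sym2 V)} (h : ∀ e ∈ P, ¬ e.IsDiag) :
    (offDiagPairs P).card = P.card := by
  rw [offDiagPairs, card_subtype, filter_true_of_mem h]

/-- The pairs between two sets of vertices. -/
def between (A B : Finset V) : Finset (Sym2 V) := (A ×ˢ B).image fun p => s(p.1, p.2)

lemma card_between {A B : Finset V} (h : Disjoint A B) : (between A B).card = A.card * B.card := by
  rw [between, card_image_of_injOn, card_product]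
  rintro ⟨a, b⟩ h1 ⟨a', b'⟩ h2 h3
  simp only [coe_product, Set.mem_prod, mem_coe] at h1 h2
  rcases Sym2.eq_iff.1 h3 with ⟨h4, h5⟩ | ⟨h4, h5⟩
  · exact Prod.ext h4 h5
  · have h4' : a = b' := h4
    exact absurd (h4' ▸ h2.2) (disjoint_left.1 h h1.1)

lemma not_isDiag_of_mem_between {A B : Finset V} (h : Disjoint A B) {e : Sym2 V}
    (he : e ∈ between A B) : ¬ e.IsDiag := by
  obtain ⟨⟨a, b⟩, hp, rfl⟩ := mem_image.1 he
  rw [mem_product] at hp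
  rw [Sym2.mk_isDiag_iff]
  intro hab
  exact disjoint_left.1 h hp.1 (hab ▸ hp.2)

/-- The union bound for the presence and absence of prescribed edges. -/
lemma ex_exists_edges_le {κ : Type*} {p : ℝ} (h0 : 0 ≤ p) (h1 : p ≤ 1) (C : Finset κ)
    (A B : κ → Finset (Sym2 V)) (hAB : ∀ c ∈ C, Disjoint (A c) (B c))
    (hA : ∀ c ∈ C, ∀ e ∈ A c, ¬ e.IsDiag) (hB : ∀ c ∈ C, ∀ e ∈ B c, ¬ e.IsDiag) :
    ex p (fun ω => ind (∃ c ∈ C, (∀ e ∈ A c, e ∈ (graphOf ω).edgeSet) ∧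
      ∀ e ∈ B c, e ∉ (graphOf ω).edgeSet)) ≤
      ∑ c ∈ C, p ^ (A c).card * (1 - p) ^ (B c).card := by
  refine (ex_mono h0 h1 fun ω => ind_mono ?_).trans ((ex_exists_le h0 h1 C
    (fun c => offDiagPairs (A c)) (fun c => offDiagPairs (B c)) ?_).trans ?_)
  · rintro ⟨c, hc, hA', hB'⟩
    refine ⟨c, hc, fun a ha => ?_, fun a ha => ?_⟩
    · obtain ⟨_, h⟩ := mem_edgeSet_graphOf.1 (hA' a.1 (mem_subtype.1 ha))
      exact h
    · have := hB' a.1 (mem_subtype.1 ha)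
      rw [mem_edgeSet_graphOf] at this
      by_contra h
      exact this ⟨a.2, by simpa using h⟩
  · intro c hc
    rw [disjoint_left]
    intro a ha hb
    exact disjoint_left.1 (hAB c hc) (mem_subtype.1 ha) (mem_subtype.1 hb)
  · refine sum_le_sum fun c hc => ?_
    rw [card_offDiagPairs (hA c hc), card_offDiagPairs (hB c hc)]

/-- The union bound for pairs of sets without edges between them. -/
lemma ex_exists_no_edges_le {κ : Type*} {p : ℝ} (h0 : 0 ≤ p) (h1 : p ≤ 1) (C : Finset κ)
    (A B : κ → Finset V) (k : ℕ) (hk : ∀ c ∈ C, k ≤ (A c).card * (B c \ A c).card) :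
    ex p (fun ω => ind (∃ c ∈ C, ∀ a ∈ A c, ∀ b ∈ B c, ¬ (graphOf ω).Adj a b)) ≤
      C.card * Real.exp (-p * k) := by
  refine (ex_mono h0 h1 fun ω => ind_mono ?_).trans ((ex_exists_edges_le h0 h1 C
    (fun _ => ∅) (fun c => between (A c) (B c \ A c)) (by simp) (by simp) ?_).trans ?_)
  · rintro ⟨c, hc, h⟩
    refine ⟨c, hc, by simp, fun e he => ?_⟩
    obtain ⟨⟨a, b⟩, hp, rfl⟩ := mem_image.1 he
    rw [mem_product, mem_sdiff] at hp
    exact h a hp.1 b hp.2.1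
  · exact fun c _ e he => not_isDiag_of_mem_between disjoint_sdiff he
  · rw [← nsmul_eq_mul]
    refine sum_le_card_nsmul _ _ _ fun c hc => ?_
    rw [card_empty, pow_zero, one_mul, card_between disjoint_sdiff]
    refine (pow_le_pow_of_le_one (by linarith) (by linarith) (hk c hc)).trans ?_
    have : 1 - p ≤ Real.exp (-p) := by linarith [Real.add_one_le_exp (-p)]
    refine (pow_le_pow_left₀ (by linarith) this k).trans (le_of_eq ?_)
    rw [← Real.exp_nat_mul]; ring_nf

end RandomGraph

section DepthFirst

variable {V : Type*} [Fintype V] [DecidableEq V] {H : SimpleGraph V}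

/-- The state of a depth first search after `t` steps: the finished vertices `D` and the current
path `l`. -/
lemma exists_dfs_state (t : ℕ) (ht : t ≤ Fintype.card V) : ∃ (D : Finset V) (l : List V),
    l.Nodup ∧ l.IsChain H.Adj ∧ (∀ x ∈ l, x ∉ D) ∧ 2 * D.card + l.length = t ∧
    ∀ a ∈ D, ∀ b, b ∉ D → b ∉ l → ¬ H.Adj a b := by
  induction t with
  | zero => exact ⟨∅, [], by simp⟩
  | succ t ih =>
    obtain ⟨D, l, h1, h2, h3, h4, h5⟩ := ih (by omega)
    by_cases hex : ∃ u, u ∉ D ∧ u ∉ l ∧ ∀ x ∈ l.head?, H.Adj u x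
    · obtain ⟨u, hu1, hu2, hu3⟩ := hex
      refine ⟨D, u :: l, List.nodup_cons.2 ⟨hu2, h1⟩, List.isChain_cons.2 ⟨hu3, h2⟩, ?_, ?_, ?_⟩
      · intro x hx
        rcases List.mem_cons.1 hx with rfl | hx
        exacts [hu1, h3 x hx]
      · simp only [List.length_cons]; omega
      · intro a ha b hb hbl
        exact h5 a ha b hb fun h => hbl (List.mem_cons_of_mem _ h)
    · cases l with
      | nil =>
        exfalso
        have : D.card < Fintype.card V := by simp only [List.length_nil] at h4; omega
        obtain ⟨u, hu⟩ : ∃ u, u ∉ D := by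
          by_contra hcon
          push Not at hcon
          rw [(eq_univ_iff_forall).2 hcon, card_univ] at this
          exact lt_irrefl _ this
        exact hex ⟨u, hu, by simp, by simp⟩
      | cons x l =>
        have hn := List.nodup_cons.1 h1
        have hxD : x ∉ D := h3 x (by simp)
        refine ⟨insert x D, l, hn.2, h2.of_cons, ?_, ?_, ?_⟩
        · intro y hy
          rw [mem_insert, not_or]
          refine ⟨fun h => hn.1 (h ▸ hy), h3 y (List.mem_cons_of_mem _ hy)⟩
        · rw [card_insert_of_notMem hxD]
          simp only [List.length_cons] at h4
          omega
        · intro a ha b hb hbl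
          rw [mem_insert, not_or] at hb
          have hbx : b ∉ x :: l := by
            rw [List.mem_cons, not_or]; exact ⟨hb.1, hbl⟩
          rcases mem_insert.1 ha with rfl | ha
          · intro hab
            exact hex ⟨b, hb.2, hbx, by simpa using hab.symm⟩
          · exact h5 a ha b hb.2 hbx

/-- A graph in which any two disjoint large sets are joined by an edge has a long path. -/
theorem exists_long_path {k : ℕ}
    (hk : ∀ A B : Finset V, k ≤ A.card → k ≤ B.card → Disjoint A B → ∃ a ∈ A, ∃ b ∈ B, H.Adj a b) :
    ∃ l : List V, l.Nodup ∧ l.IsChain H.Adj ∧ Fintype.card V < l.length + 2 * k := by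
  obtain ⟨D, l, h1, h2, h3, h4, h5⟩ := exists_dfs_state (H := H) (Fintype.card V) le_rfl
  refine ⟨l, h1, h2, ?_⟩
  by_contra hcon
  have hdisj : Disjoint D l.toFinset := by
    rw [disjoint_left]
    intro x hx hxl
    exact h3 x (List.mem_toFinset.1 hxl) hx
  have hU : (univ \ (D ∪ l.toFinset)).card = D.card := by
    rw [card_sdiff_of_subset (subset_univ _), card_union_of_disjoint hdisj,
      List.toFinset_card_of_nodup h1, card_univ]
    omega
  obtain ⟨a, ha, b, hb, hab⟩ := hk D (univ \ (D ∪ l.toFinset)) (by omega) (by omega)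
    (by
      rw [disjoint_left]
      intro x hx hx'
      exact (mem_sdiff.1 hx').2 (mem_union_left _ hx))
  rw [mem_sdiff, mem_union, not_or, List.mem_toFinset] at hb
  exact h5 a ha b hb.2.1 hb.2.2 hab

/-- `Y` is a family of disjoint paths with `ℓ` vertices each. -/
structure Wires {ι : Type*} (H : SimpleGraph V) (Y : ι → ℕ → V) (ℓ : ℕ) : Prop where
  inj : ∀ S i S' i', i < ℓ → i' < ℓ → Y S i = Y S' i' → S = S' ∧ i = i'
  adj : ∀ S i, i + 1 < ℓ → H.Adj (Y S i) (Y S (i + 1))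

theorem exists_wires {k : ℕ} (ι : Type*) [Fintype ι] (ℓ : ℕ)
    (hk : ∀ A B : Finset V, k ≤ A.card → k ≤ B.card → Disjoint A B → ∃ a ∈ A, ∃ b ∈ B, H.Adj a b)
    (hle : Fintype.card ι * ℓ + 2 * k ≤ Fintype.card V) : ∃ Y : ι → ℕ → V, Wires H Y ℓ := by
  obtain ⟨l, h1, h2, h3⟩ := exists_long_path hk
  have hlen : Fintype.card ι * ℓ < l.length := by omega
  let e := Fintype.equivFin ι
  have hidx : ∀ S i, i < ℓ → (e S : ℕ) * ℓ + i < l.length := by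
    intro S i hi
    have : ((e S : ℕ) + 1) * ℓ ≤ Fintype.card ι * ℓ := Nat.mul_le_mul_right _ (e S).2
    rw [add_mul, one_mul] at this
    omega
  have hpos : 0 < l.length := by omega
  refine ⟨fun S i => if h : (e S : ℕ) * ℓ + i < l.length then l[(e S : ℕ) * ℓ + i] else l[0],
    ?_, ?_⟩
  · intro S i S' i' hi hi' h
    rw [dif_pos (hidx S i hi), dif_pos (hidx S' i' hi')] at h
    have h' := (List.Nodup.getElem_inj_iff h1).1 h
    have e1 : (e S : ℕ) = e S' := by
      have a1 : ((e S : ℕ) * ℓ + i) / ℓ = e S := by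
        rw [mul_comm, Nat.mul_add_div (by omega), Nat.div_eq_of_lt hi, add_zero]
      have a2 : ((e S' : ℕ) * ℓ + i') / ℓ = e S' := by
        rw [mul_comm, Nat.mul_add_div (by omega), Nat.div_eq_of_lt hi', add_zero]
      rw [← a1, ← a2, h']
    refine ⟨e.injective (Fin.ext e1), ?_⟩
    rw [e1] at h'
    omega
  · intro S i hi
    rw [dif_pos (hidx S i (by omega)), dif_pos (hidx S (i + 1) hi)]
    exact List.isChain_iff_getElem.1 h2 _ _

end DepthFirst

section Hops

variable {V ι : Type*} {H : SimpleGraph V} {Y : ι → ℕ → V} {ℓ : ℕ}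

/-- The vertex where a wire is entered when it is cut before position `i`; `b` is the direction. -/
def enter (Y : ι → ℕ → V) (b : Bool) (S : ι) (i : ℕ) : V := if b then Y S i else Y S (i - 1)

/-- The vertex where a wire is left when it is cut before position `i`; `b` is the direction. -/
def exit (Y : ι → ℕ → V) (b : Bool) (S : ι) (i : ℕ) : V := if b then Y S (i - 1) else Y S i

/-- A sequence of jumps via cut wires from the first vertex to the last one. -/
def Hops (H : SimpleGraph V) (Y : ι → ℕ → V) (ℓ : ℕ) (b : Bool) : V → List (ι × ℕ) → V → Prop
  | z, [], z' => z = z'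
  | z, e :: hs, z' => 1 ≤ e.2 ∧ e.2 < ℓ ∧ H.Adj z (enter Y b e.1 e.2) ∧
      Hops H Y ℓ b (exit Y b e.1 e.2) hs z'

/-- A sequence of forward jumps followed by an edge. -/
def Link (H : SimpleGraph V) (Y : ι → ℕ → V) (ℓ : ℕ) : V → List (ι × ℕ) → V → Prop
  | z, [], z' => H.Adj z z'
  | z, e :: hs, z' => 1 ≤ e.2 ∧ e.2 < ℓ ∧ H.Adj z (Y e.1 e.2) ∧ Link H Y ℓ (Y e.1 (e.2 - 1)) hs z'

lemma Hops.append {b : Bool} {z x z' : V} {hs hs' : List (ι × ℕ)} (h : Hops H Y ℓ b z hs x)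
    (h' : Hops H Y ℓ b x hs' z') : Hops H Y ℓ b z (hs ++ hs') z' := by
  induction hs generalizing z with
  | nil => cases h; exact h'
  | cons e hs ih => exact ⟨h.1, h.2.1, h.2.2.1, ih h.2.2.2⟩

lemma Link.concat {z z' : V} {hs : List (ι × ℕ)} {S : ι} {i : ℕ} (h : Link H Y ℓ z hs (Y S i))
    (h1 : 1 ≤ i) (h2 : i < ℓ) (h3 : H.Adj (Y S (i - 1)) z') : Link H Y ℓ z (hs ++ [(S, i)]) z' := by
  induction hs generalizing z with
  | nil => exact ⟨h1, h2, h, h3⟩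
  | cons e hs ih => exact ⟨h.1, h.2.1, h.2.2.1, ih h.2.2.2⟩

lemma Hops.link {z x z' : V} {hs hs' : List (ι × ℕ)} (h : Hops H Y ℓ true z hs x)
    (h' : Link H Y ℓ x hs' z') : Link H Y ℓ z (hs ++ hs') z' := by
  induction hs generalizing z with
  | nil => cases h; exact h'
  | cons e hs ih => exact ⟨h.1, h.2.1, by simpa [enter] using h.2.2.1, ih h.2.2.2⟩

lemma Link.hops {z x z' : V} {hs hs' : List (ι × ℕ)} (h : Link H Y ℓ z hs x)
    (h' : Hops H Y ℓ false z' hs' x) : Link H Y ℓ z (hs ++ hs'.reverse) z' := by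
  induction hs' generalizing z' with
  | nil => cases h'; simpa using h
  | cons e hs' ih =>
    have h1 := ih h'.2.2.2
    rw [List.reverse_cons, ← List.append_assoc]
    exact Link.concat (by simpa [exit] using h1) h'.1 h'.2.1
      (by simpa [enter] using h'.2.2.1.symm)

/-- Joining forward and backward jumps by an edge. -/
lemma Hops.join {z x x' z' : V} {hs hs' : List (ι × ℕ)} (h : Hops H Y ℓ true z hs x)
    (hx : H.Adj x x') (h' : Hops H Y ℓ false z' hs' x') :
    Link H Y ℓ z (hs ++ hs'.reverse) z' :=
  Link.hops (by simpa using h.link (hs' := []) hx) h'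

end Hops

section Linked

variable {V ι : Type*} [Fintype V] [DecidableEq V] [Fintype ι] [DecidableEq ι]

/-- Position `i` of wire `S` can be entered from `u` and the exit avoids `D`. -/
def Enters (H : SimpleGraph V) (Y : ι → ℕ → V) (ℓ : ℕ) (D : Finset V) (b : Bool) (u : V) (S : ι)
    (i : ℕ) : Prop :=
  1 ≤ i ∧ i < ℓ ∧ H.Adj u (enter Y b S i) ∧ exit Y b S i ∉ D

open Classical in
/-- The wires of level zero that can be entered from a vertex in a given direction. -/
noncomputable def wireNb (H : SimpleGraph V) (Y : ι → ℕ → V) (ℓ : ℕ) (gp : ι → Bool × ℕ)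
    (D : Finset V) (u : V × Bool) : Finset ι :=
  univ.filter fun S => gp S = (u.2, 0) ∧ ∃ i, Enters H Y ℓ D u.2 u.1 S i

open Classical in
/-- The place that is reached from `u` via the wire `S`. -/
noncomputable def wireExit (H : SimpleGraph V) (Y : ι → ℕ → V) (ℓ : ℕ) (D : Finset V)
    (u : V × Bool) (S : ι) : V × Bool :=
  (if h : ∃ i, Enters H Y ℓ D u.2 u.1 S i then exit Y u.2 S h.choose else u.1, u.2)

open Classical in
/-- The exits of the wires of level `j` outside `D` that can be entered from `A`. -/
noncomputable def exits (H : SimpleGraph V) (Y : ι → ℕ → V) (ℓ : ℕ) (gp : ι → Bool × ℕ) (b : Bool)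
    (j : ℕ) (A : Finset V) (D : Finset ι) : Finset V :=
  univ.filter fun x => ∃ a ∈ A, ∃ S ∉ D, gp S = (b, j) ∧ ∃ i, Enters H Y ℓ ∅ b a S i ∧
    x = exit Y b S i

lemma mem_wireNb {H : SimpleGraph V} {Y : ι → ℕ → V} {ℓ : ℕ} {gp : ι → Bool × ℕ} {D : Finset V}
    {u : V × Bool} {S : ι} : S ∈ wireNb H Y ℓ gp D u ↔
      gp S = (u.2, 0) ∧ ∃ i, Enters H Y ℓ D u.2 u.1 S i := by
  simp [wireNb]

lemma mem_exits {H : SimpleGraph V} {Y : ι → ℕ → V} {ℓ : ℕ} {gp : ι → Bool × ℕ} {b : Bool}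
    {j : ℕ} {A : Finset V} {D : Finset ι} {x : V} : x ∈ exits H Y ℓ gp b j A D ↔
      ∃ a ∈ A, ∃ S ∉ D, gp S = (b, j) ∧ ∃ i, Enters H Y ℓ ∅ b a S i ∧ x = exit Y b S i := by
  simp only [exits, mem_filter, mem_univ, true_and]

/-- Conditions under which many pairs of vertices can be linked by disjoint sets of wires. -/
structure Linkable (H : SimpleGraph V) (Y : ι → ℕ → V) (ℓ : ℕ) (gp : ι → Bool × ℕ)
    (Bad : Finset V) (m B h K u : ℕ) (a : ℕ → ℕ) : Prop where
  one_le : 1 ≤ m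
  le_pow : m ≤ 2 ^ h
  good : ∀ U : Finset (V × Bool), U.card ≤ 2 * m →
    ∑ x ∈ U, (if x.1 ∈ Bad then 0 else 3) ≤ (U.biUnion (wireNb H Y ℓ gp Bad)).card
  big : ∀ U : Finset (V × Bool), m ≤ U.card → U.card ≤ 2 * m →
    2 * m * 3 + B < (U.biUnion (wireNb H Y ℓ gp Bad)).card
  le_start : a 0 ≤ m
  level : ∀ b j, j < K → ∀ (A : Finset V) (D : Finset ι), a j ≤ A.card → D.card ≤ u →
    a (j + 1) ≤ (exits H Y ℓ gp b (j + 1) A D).card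
  joined : ∀ A A' : Finset V, a K ≤ A.card → a K ≤ A'.card → Disjoint A A' →
    ∃ x ∈ A, ∃ x' ∈ A', H.Adj x x'

variable {H Hb : SimpleGraph V} {Y : ι → ℕ → V} {ℓ : ℕ} {gp : ι → Bool × ℕ} {Bad : Finset V}
  {m B h K u : ℕ} {a : ℕ → ℕ}

lemma Wires.exit_inj (hY : Wires Hb Y ℓ) {b b' : Bool} {S S' : ι} {i i' : ℕ} (hi : i < ℓ)
    (hi' : i' < ℓ) (hb : b = b') (he : exit Y b S i = exit Y b' S' i') : S = S' := by
  subst hb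
  cases b
  · exact (hY.inj S i S' i' hi hi' (by simpa [exit] using he)).1
  · exact (hY.inj S (i - 1) S' (i' - 1) (by omega) (by omega) (by simpa [exit] using he)).1

lemma Linkable.exists_hops (hL : Linkable H Y ℓ gp Bad m B h K u a) (b : Bool) (A : Finset V)
    (D : Finset ι) (hA : m ≤ A.card) (hD : D.card ≤ u) (j : ℕ) (hj : j ≤ K) :
    ∃ A' : Finset V, a j ≤ A'.card ∧ ∀ x ∈ A', ∃ z ∈ A, ∃ hs, Hops H Y ℓ b z hs x ∧
      hs.length = j ∧ (hs.map Prod.fst).Nodup ∧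
      (∀ e ∈ hs, e.1 ∉ D ∧ ∃ i, 1 ≤ i ∧ i ≤ j ∧ gp e.1 = (b, i)) ∧
      (1 ≤ j → ∃ S i, gp S = (b, j) ∧ i < ℓ ∧ x = exit Y b S i) := by
  induction j with
  | zero => exact ⟨A, hL.le_start.trans hA, fun x hx => ⟨x, hx, [], rfl, by simp⟩⟩
  | succ j ih =>
    obtain ⟨A', h1, h2⟩ := ih (by omega)
    refine ⟨exits H Y ℓ gp b (j + 1) A' D, hL.level b j (by omega) A' D h1 hD, fun x hx => ?_⟩
    obtain ⟨y, hy, S, hS, hgp, i, hi, rfl⟩ := mem_exits.1 hx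
    obtain ⟨z, hz, hs, b1, b2, b3, b4, -⟩ := h2 y hy
    refine ⟨z, hz, hs ++ [(S, i)], b1.append ⟨hi.1, hi.2.1, hi.2.2.1, rfl⟩, by simp [b2], ?_, ?_,
      fun _ => ⟨S, i, hgp, hi.2.1, rfl⟩⟩
    · rw [List.map_append, List.nodup_append]
      refine ⟨b3, by simp, ?_⟩
      rintro S' hS' S'' hS'' rfl
      simp only [List.map_cons, List.map_nil, List.mem_singleton] at hS''
      obtain ⟨e, he, rfl⟩ := List.mem_map.1 hS'
      obtain ⟨_, i', -, hi', hg⟩ := b4 e he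
      rw [hS'', hgp, Prod.mk.injEq] at hg
      omega
    · intro e he
      rcases List.mem_append.1 he with he | he
      · obtain ⟨c1, i', c2, c3, c4⟩ := b4 e he
        exact ⟨c1, i', c2, by omega, c4⟩
      · rw [List.mem_singleton] at he
        subst he
        exact ⟨hS, j + 1, by omega, le_rfl, hgp⟩

/-- The vertices `z` and `z'` can be linked via `2 * K` wires of positive level avoiding `D`. -/
def HighLink (H : SimpleGraph V) (Y : ι → ℕ → V) (ℓ : ℕ) (gp : ι → Bool × ℕ) (K : ℕ)
    (D : Finset ι) (z z' : V) : Prop :=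
  ∃ hs, Link H Y ℓ z hs z' ∧ hs.length = 2 * K ∧ (hs.map Prod.fst).Nodup ∧
    ∀ e ∈ hs, e.1 ∉ D ∧ 1 ≤ (gp e.1).2

lemma Linkable.exists_highLink (hL : Linkable H Y ℓ gp Bad m B h K u a) (hY : Wires Hb Y ℓ)
    (hK : 1 ≤ K) {A A' : Finset V} (hA : m ≤ A.card) (hA' : m ≤ A'.card) {D : Finset ι}
    (hD : D.card ≤ u) : ∃ z ∈ A, ∃ z' ∈ A', HighLink H Y ℓ gp K D z z' := by
  obtain ⟨A₁, a1, a2⟩ := hL.exists_hops true A D hA hD K le_rfl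
  obtain ⟨A₂, b1, b2⟩ := hL.exists_hops false A' D hA' hD K le_rfl
  have hdisj : Disjoint A₁ A₂ := by
    rw [disjoint_left]
    intro x hx hx'
    obtain ⟨_, _, _, -, -, -, -, h1⟩ := a2 x hx
    obtain ⟨_, _, _, -, -, -, -, h2⟩ := b2 x hx'
    obtain ⟨S, i, hg, hi, e⟩ := h1 hK
    obtain ⟨S', i', hg', hi', e'⟩ := h2 hK
    rw [e] at e'
    simp only [exit, if_true, Bool.false_eq_true, if_false] at e'
    rw [(hY.inj _ _ _ _ (by omega) hi' e').1, hg'] at hg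
    simp at hg
  obtain ⟨x, hx, x', hx', hadj⟩ := hL.joined A₁ A₂ a1 b1 hdisj
  obtain ⟨z, hz, hs, c1, c2, c3, c4, -⟩ := a2 x hx
  obtain ⟨z', hz', hs', d1, d2, d3, d4, -⟩ := b2 x' hx'
  refine ⟨z, hz, z', hz', hs ++ hs'.reverse, c1.join hadj d1, ?_, ?_, ?_⟩
  · rw [List.length_append, List.length_reverse, c2, d2]; ring
  · rw [List.map_append, List.map_reverse, List.nodup_append, List.nodup_reverse]
    refine ⟨c3, d3, ?_⟩
    rintro S hS S' hS' rfl
    rw [List.mem_reverse] at hS'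
    obtain ⟨e, he, rfl⟩ := List.mem_map.1 hS
    obtain ⟨e', he', hee⟩ := List.mem_map.1 hS'
    obtain ⟨_, i, -, -, hg⟩ := c4 e he
    obtain ⟨_, i', -, -, hg'⟩ := d4 e' he'
    rw [hee, hg] at hg'
    simp at hg'
  · intro e he
    rcases List.mem_append.1 he with he | he
    · obtain ⟨f1, i, f2, -, f3⟩ := c4 e he
      exact ⟨f1, by rw [f3]; exact f2⟩
    · obtain ⟨f1, i, f2, -, f3⟩ := d4 e (List.mem_reverse.1 he)
      exact ⟨f1, by rw [f3]; exact f2⟩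

lemma EP.hops {s t : V × Bool} {es : List ((V × Bool) × ι)}
    (he : EP (wireExit H Y ℓ Bad) s es t) (hn : ∀ e ∈ es, e.2 ∈ wireNb H Y ℓ gp Bad e.1) :
    t.2 = s.2 ∧ ∃ hs, Hops H Y ℓ s.2 s.1 hs t.1 ∧ hs.map Prod.fst = es.map Prod.snd := by
  induction es generalizing s with
  | nil => cases he; exact ⟨rfl, [], rfl, rfl⟩
  | cons e es ih =>
    obtain ⟨h1, h2⟩ := ih he.2 fun e' he' => hn e' (List.mem_cons_of_mem _ he')
    obtain ⟨hs, h3, h4⟩ := h2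
    have h5 := (mem_wireNb.1 (hn e (by simp))).2
    rw [he.1] at h5
    refine ⟨h1, (e.2, h5.choose) :: hs, ⟨h5.choose_spec.1, h5.choose_spec.2.1,
      h5.choose_spec.2.2.1, ?_⟩, by simp [h4]⟩
    simpa only [wireExit, dif_pos h5] using h3

/-- Every pair in a family of pairs can be linked, with disjoint sets of wires. -/
theorem Linkable.exists_links (hL : Linkable H Y ℓ gp Bad m B h K u a) (hY : Wires Hb Y ℓ)
    (hK : 1 ≤ K) {κ : Type*} [DecidableEq κ] (C : Finset κ) (z z' : κ → V)
    (hz : ∀ k ∈ C, z k ∉ Bad ∧ ∀ S i, i < ℓ → Y S i ≠ z k)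
    (hz' : ∀ k ∈ C, z' k ∉ Bad ∧ ∀ S i, i < ℓ → Y S i ≠ z' k)
    (hzi : Set.InjOn z C) (hzi' : Set.InjOn z' C)
    (hB : C.card * (2 * h + 2) + 1 + 4 * 2 ^ h ≤ B) (hu : C.card * (2 * K) ≤ u) :
    ∃ hs : κ → List (ι × ℕ), (∀ k ∈ C, Link H Y ℓ (z k) (hs k) (z' k) ∧ hs k ≠ [] ∧
      ((hs k).map Prod.fst).Nodup) ∧
      ∀ k ∈ C, ∀ k' ∈ C, k ≠ k' → ((hs k).map Prod.fst).Disjoint ((hs k').map Prod.fst) := by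
  classical
  have hrt : ∀ X (v : V) b, (∀ S i, i < ℓ → Y S i ≠ v) →
      Rooted (wireNb H Y ℓ gp Bad) (wireExit H Y ℓ Bad) X (v, b) := by
    intro X v b hv s S hS _ he
    have h5 := (mem_wireNb.1 hS).2
    rw [wireExit, dif_pos h5, Prod.mk.injEq] at he
    have h6 := h5.choose_spec
    cases hb : s.2
    · refine hv S h5.choose h6.2.1 ?_
      rw [← he.1]; simp only [exit, hb, Bool.false_eq_true, if_false]
    · refine hv S (h5.choose - 1) (by have := h6.2.1; omega) ?_
      rw [← he.1]; simp only [exit, hb, if_true]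
  have hinj : ∀ s s' S S', S ∈ wireNb H Y ℓ gp Bad s → S' ∈ wireNb H Y ℓ gp Bad s' →
      wireExit H Y ℓ Bad s S = wireExit H Y ℓ Bad s' S' → S = S' := by
    intro s s' S S' hS hS' he
    have h5 := (mem_wireNb.1 hS).2
    have h5' := (mem_wireNb.1 hS').2
    rw [wireExit, wireExit, dif_pos h5, dif_pos h5', Prod.mk.injEq] at he
    exact hY.exit_inj h5.choose_spec.2.1 h5'.choose_spec.2.1 he.2 he.1
  let c₀ : V × Bool → ℕ := fun x => if x.1 ∈ Bad then 0 else 3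
  have hst₀ : St (wireNb H Y ℓ gp Bad) (wireExit H Y ℓ Bad) m 3 ∅ c₀ := by
    refine ⟨fun U hU => by simpa using hL.good U hU, fun x => ?_, fun s S hS _ => ?_⟩
    · simp only [c₀]; split_ifs <;> omega
    · have h5 := (mem_wireNb.1 hS).2
      simp only [c₀, wireExit, dif_pos h5, if_neg h5.choose_spec.2.2.2, le_refl]
  suffices hmain : ∀ C' ⊆ C, ∃ (hs : κ → List (ι × ℕ)) (X D : Finset ι) (c : V × Bool → ℕ),
      St (wireNb H Y ℓ gp Bad) (wireExit H Y ℓ Bad) m 3 X c ∧ X.card ≤ C'.card * (2 * h + 2) ∧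
      D.card ≤ C'.card * (2 * K) ∧ (∀ S ∈ X, (gp S).2 = 0) ∧ (∀ S ∈ D, 1 ≤ (gp S).2) ∧
      (∀ k ∈ C, k ∉ C' → c (z k, true) = 3 ∧ c (z' k, false) = 3) ∧
      (∀ k ∈ C', Link H Y ℓ (z k) (hs k) (z' k) ∧ hs k ≠ [] ∧ ((hs k).map Prod.fst).Nodup ∧
        ∀ S ∈ (hs k).map Prod.fst, S ∈ X ∪ D) ∧
      ∀ k ∈ C', ∀ k' ∈ C', k ≠ k' → ((hs k).map Prod.fst).Disjoint ((hs k').map Prod.fst) by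
    obtain ⟨hs, X, D, c, -, -, -, -, -, -, h1, h2⟩ := hmain C subset_rfl
    exact ⟨hs, fun k hk => ⟨(h1 k hk).1, (h1 k hk).2.1, (h1 k hk).2.2.1⟩, h2⟩
  intro C' hC'
  induction C' using Finset.induction_on with
  | empty =>
    refine ⟨fun _ => [], ∅, ∅, c₀, hst₀, by simp, by simp, by simp, by simp, fun k hk _ => ?_,
      by simp, by simp⟩
    simp only [c₀, if_neg (hz k hk).1, if_neg (hz' k hk).1, and_self]
  | insert k C' hk ih =>
    obtain ⟨hs, X, D, c, a1, a2, a3, a4, a5, a6, a7, a8⟩ :=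
      ih ((subset_insert _ _).trans hC')
    have hkC : k ∈ C := hC' (mem_insert_self _ _)
    have hcard : C'.card + 1 ≤ C.card := by
      rw [← card_insert_of_notMem hk]; exact card_le_card hC'
    have hmulX : C'.card * (2 * h + 2) ≤ C.card * (2 * h + 2) :=
      Nat.mul_le_mul_right _ (by omega)
    have hmulD : C'.card * (2 * K) ≤ C.card * (2 * K) := Nat.mul_le_mul_right _ (by omega)
    obtain ⟨es, es', t, t', c', b1, b2, b3, b4, b5, b6, b7, b8, b9⟩ :=
      a1.connect ⟨hL.one_le, hL.big, hinj⟩ (by norm_num) hL.le_pow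
      (fun x x' => x.2 = true → x'.2 = false → HighLink H Y ℓ gp K D x.1 x'.1) 1 le_rfl
      (hrt X (z k) true (hz k hkC).2) (hrt X (z' k) false (hz' k hkC).2) (by simp)
      (by rw [(a6 k hkC hk).1]; norm_num) (by rw [(a6 k hkC hk).2]; norm_num)
      (show X.card + 1 + 4 * 2 ^ h ≤ B by omega) (by
        intro A A' hA hA' _ _
        have hfst : ∀ (b : Bool) (A : Finset (V × Bool)), (∀ x ∈ A, x.2 = b) →
            (A.image Prod.fst).card = A.card := fun b A hb =>
          card_image_of_injOn fun x hx y hy hxy => Prod.ext hxy ((hb x hx).trans (hb y hy).symm)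
        have hne : ∀ A : Finset (V × Bool), m ≤ A.card → A.Nonempty := fun A hA =>
          card_pos.1 (by have := hL.one_le; omega)
        by_cases h1 : ∃ x ∈ A, x.2 = false
        · obtain ⟨x, hx, hx2⟩ := h1
          obtain ⟨x', hx'⟩ := hne A' hA'
          exact ⟨x, hx, x', hx', fun h => by simp [hx2] at h⟩
        by_cases h2 : ∃ x' ∈ A', x'.2 = true
        · obtain ⟨x', hx', hx2⟩ := h2
          obtain ⟨x, hx⟩ := hne A hA
          exact ⟨x, hx, x', hx', fun _ h => by simp [hx2] at h⟩
        have h1' : ∀ x ∈ A, x.2 = true := fun x hx => by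
          by_contra h; exact h1 ⟨x, hx, by simpa using h⟩
        have h2' : ∀ x ∈ A', x.2 = false := fun x hx => by
          by_contra h; exact h2 ⟨x, hx, by simpa using h⟩
        obtain ⟨v, hv, v', hv', hl⟩ := hL.exists_highLink hY hK (A := A.image Prod.fst)
          (A' := A'.image Prod.fst) (by rw [hfst true A h1']; exact hA)
          (by rw [hfst false A' h2']; exact hA') (D := D) (by omega)
        obtain ⟨x, hx, rfl⟩ := mem_image.1 hv
        obtain ⟨x', hx', rfl⟩ := mem_image.1 hv'
        exact ⟨x, hx, x', hx', fun _ _ => hl⟩)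
    obtain ⟨e1, hf, e2, e3⟩ := b2.hops (gp := gp) fun e he => b1.nbr e (by simp [he])
    obtain ⟨e1', hf', e2', e3'⟩ := b3.hops (gp := gp) fun e he => b1.nbr e (by simp [he])
    obtain ⟨hm, f1, f2, f3, f4⟩ := b4 e1 e1'
    set T := es.toFinset ∪ es'.toFinset with hT
    have hTmem : ∀ S, S ∈ T.image Prod.snd ↔ S ∈ (es ++ es').map Prod.snd := by
      intro S
      simp only [hT, mem_image, mem_union, List.mem_toFinset, List.mem_map,
        List.mem_append]
    have hTlev : ∀ S ∈ T.image Prod.snd, (gp S).2 = 0 := by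
      intro S hS
      obtain ⟨e, he, rfl⟩ := mem_image.1 hS
      rw [(mem_wireNb.1 (b1.nbr e he)).1]
    have hfst : (hf ++ hm ++ hf'.reverse).map Prod.fst =
        es.map Prod.snd ++ hm.map Prod.fst ++ (es'.map Prod.snd).reverse := by
      rw [List.map_append, List.map_append, List.map_reverse, e3, e3']
    have hnew : ∀ S ∈ (hf ++ hm ++ hf'.reverse).map Prod.fst,
        S ∈ T.image Prod.snd ∨ S ∈ (hm.map Prod.fst).toFinset := by
      intro S hS
      rw [hfst, List.mem_append, List.mem_append, List.mem_reverse] at hS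
      rw [hTmem, List.map_append, List.mem_append, List.mem_toFinset]
      tauto
    have hnewX : ∀ S ∈ (hf ++ hm ++ hf'.reverse).map Prod.fst, S ∉ X ∪ D := by
      intro S hS hSX
      rcases hnew S hS with h | h
      · rcases mem_union.1 hSX with h' | h'
        · exact disjoint_left.1 b1.disj h' h
        · have := a5 S h'
          rw [hTlev S h] at this; omega
      · obtain ⟨e, he, rfl⟩ := List.mem_map.1 (List.mem_toFinset.1 h)
        rcases mem_union.1 hSX with h' | h'
        · have := (f4 e he).2
          rw [a4 _ h'] at this; omega
        · exact (f4 e he).1 h'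
    refine ⟨update hs k (hf ++ hm ++ hf'.reverse), X ∪ T.image Prod.snd,
      D ∪ (hm.map Prod.fst).toFinset, c', b1.st, ?_, ?_, ?_, ?_, ?_, ?_, ?_⟩
    · have h1 := card_union_le X (T.image Prod.snd)
      have h2 : (T.image Prod.snd).card ≤ T.card := card_image_le
      have h3 := card_union_le es.toFinset es'.toFinset
      have h4 := List.toFinset_card_le es
      have h5 := List.toFinset_card_le es'
      rw [card_insert_of_notMem hk, add_mul, one_mul]
      rw [← hT] at h3
      omega
    · have h1 := card_union_le D (hm.map Prod.fst).toFinset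
      have h2 := List.toFinset_card_le (hm.map Prod.fst)
      rw [List.length_map] at h2
      rw [card_insert_of_notMem hk, add_mul, one_mul]
      omega
    · intro S hS
      rcases mem_union.1 hS with h | h
      exacts [a4 S h, hTlev S h]
    · intro S hS
      rcases mem_union.1 hS with h | h
      · exact a5 S h
      · obtain ⟨e, he, rfl⟩ := List.mem_map.1 (List.mem_toFinset.1 h)
        exact (f4 e he).2
    · intro k' hk' hk'C
      rw [mem_insert, not_or] at hk'C
      obtain ⟨g1, g2⟩ := a6 k' hk' hk'C.2
      rw [b9 _ (hrt X (z k') true (hz k' hk').2) (by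
        intro h; exact hk'C.1 (hzi hk' hkC (Prod.mk.inj h).1)) (by simp),
        b9 _ (hrt X (z' k') false (hz' k' hk').2) (by simp) (by
        intro h; exact hk'C.1 (hzi' hk' hkC (Prod.mk.inj h).1))]
      exact ⟨g1, g2⟩
    · intro k' hk'
      rcases mem_insert.1 hk' with rfl | hk'
      · rw [update_self]
        refine ⟨?_, ?_, ?_, ?_⟩
        · have := (e2.link f1).hops e2'
          exact this
        · intro h
          have : hf.map Prod.fst = [] := by
            rw [List.append_eq_nil_iff, List.append_eq_nil_iff] at h
            rw [h.1.1]; rfl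
          rw [e3, List.map_eq_nil_iff] at this
          rw [this] at b5
          simp at b5
          omega
        · rw [hfst]
          have hmdis : ∀ S ∈ hm.map Prod.fst, S ∉ (es ++ es').map Prod.snd := by
            intro S hS hS'
            obtain ⟨e, he, rfl⟩ := List.mem_map.1 hS
            have := (f4 e he).2
            rw [hTlev _ ((hTmem _).2 hS')] at this
            omega
          rw [List.map_append, List.nodup_append] at b7
          obtain ⟨n1, n2, n3⟩ := b7
          rw [List.nodup_append, List.nodup_append, List.nodup_reverse]
          refine ⟨⟨n1, f3, ?_⟩, n2, ?_⟩
          · rintro S hS S' hS' rfl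
            exact hmdis S hS' (by rw [List.map_append]; exact List.mem_append_left _ hS)
          · rintro S hS S' hS' rfl
            rw [List.mem_reverse] at hS'
            rcases List.mem_append.1 hS with hS | hS
            · exact n3 S hS S hS' rfl
            · exact hmdis S hS (by rw [List.map_append]; exact List.mem_append_right _ hS')
        · intro S hS
          rcases hnew S hS with h | h
          · exact mem_union_left _ (mem_union_right _ h)
          · exact mem_union_right _ (mem_union_right _ h)
      · have hne : k' ≠ k := fun h => hk (h ▸ hk')
        rw [update_of_ne hne]
        obtain ⟨g1, g2, g3, g4⟩ := a7 k' hk'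
        refine ⟨g1, g2, g3, fun S hS => ?_⟩
        rcases mem_union.1 (g4 S hS) with h | h
        · exact mem_union_left _ (mem_union_left _ h)
        · exact mem_union_right _ (mem_union_left _ h)
    · have hold : ∀ k' ∈ C', ((hs k').map Prod.fst).Disjoint
          ((hf ++ hm ++ hf'.reverse).map Prod.fst) := fun k' hk' S hS hS' =>
        hnewX S hS' ((a7 k' hk').2.2.2 S hS)
      intro k₁ hk₁ k₂ hk₂ hne
      rcases mem_insert.1 hk₁ with rfl | h1 <;> rcases mem_insert.1 hk₂ with rfl | h2
      · exact absurd rfl hne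
      · rw [update_self, update_of_ne hne.symm]
        exact (hold k₂ h2).symm
      · rw [update_self, update_of_ne hne]
        exact hold k₁ h1
      · rw [update_of_ne (fun h => hk (by rw [← h]; exact h1)),
          update_of_ne (fun h => hk (by rw [← h]; exact h2))]
        exact a8 k₁ h1 k₂ h2 hne

end Linked

section Insert

variable {V ι : Type*} [Fintype V] [DecidableEq V] {H : SimpleGraph V} {Y : ι → ℕ → V} {ℓ : ℕ}

/-- The `n` vertices of wire `S` from position `i` on. -/
def wirePart (Y : ι → ℕ → V) (S : ι) (i n : ℕ) : List V := (List.range' i n).map (Y S)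

lemma Wires.seg (hY : Wires H Y ℓ) (S : ι) {i n : ℕ} (hin : i + n < ℓ) :
    Seg H (Y S i) (wirePart Y S (i + 1) n) (Y S (i + n)) := by
  induction n generalizing i with
  | zero => rfl
  | succ n ih =>
    have h := ih (i := i + 1) (by omega)
    rw [show i + 1 + n = i + (n + 1) by ring] at h
    exact ⟨hY.adj S i (by omega), h⟩

/-- A wire without its first vertex. -/
def wireTail (Y : ι → ℕ → V) (ℓ : ℕ) (S : ι) : List V := wirePart Y S 1 (ℓ - 1)

lemma wireTail_eq {S : ι} {i : ℕ} (h1 : 1 ≤ i) (h2 : i < ℓ) :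
    wireTail Y ℓ S = wirePart Y S 1 (i - 1) ++ Y S i :: wirePart Y S (i + 1) (ℓ - 1 - i) := by
  have h : ℓ - 1 = (i - 1) + (ℓ - i) := by omega
  rw [wireTail, h, wirePart, ← List.range'_append_1, List.map_append,
    show 1 + (i - 1) = i by omega, show ℓ - i = (ℓ - 1 - i) + 1 by omega, List.range'_succ]
  rw [show i - 1 + (ℓ - 1 - i + 1) - i = ℓ - 1 - i by omega]
  rfl

lemma Wires.seg_tail (hY : Wires H Y ℓ) (hℓ : 1 ≤ ℓ) (S : ι) :
    Seg H (Y S 0) (wireTail Y ℓ S) (Y S (ℓ - 1)) := by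
  have h := hY.seg S (i := 0) (n := ℓ - 1) (by omega)
  simpa [wireTail] using h

lemma length_wirePart (S : ι) (i n : ℕ) : (wirePart Y S i n).length = n := by simp [wirePart]

lemma sum_map_update [DecidableEq ι] {L : List ι} {S : ι} (hS : S ∉ L) {β γ : Type*}
    [AddCommMonoid γ] (f : ι → β) (y : β) (g : β → γ) :
    (L.map fun T => g (update f S y T)).sum = (L.map fun T => g (f T)).sum :=
  congrArg _ (List.map_congr_left fun T hT => by rw [update_of_ne (by rintro rfl; exact hS hT)])

/-- Cutting the wires of a link open and continuing with a given segment. -/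
lemma Link.reroute [DecidableEq ι] (hY : Wires H Y ℓ) {z z' b : V} {hs : List (ι × ℕ)}
    {Q : List V} {M : ℕ} (hl : Link H Y ℓ z hs z') (hn : (hs.map Prod.fst).Nodup)
    (hQ : Seg H z' Q b) (hM : Q.length + 1 ≤ M) (hℓM : ℓ ≤ M) :
    ∃ (l₀ : List V) (e₀ : V) (l : ι → List V) (e : ι → V), Seg H z l₀ e₀ ∧ l₀.length ≤ M ∧
      (∀ S ∈ hs.map Prod.fst, Seg H (Y S 0) (l S) (e S) ∧ (l S).length ≤ ℓ + M) ∧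
      (l₀ : Multiset V) + ((hs.map Prod.fst).map fun S => (l S : Multiset V)).sum =
        ((z' :: Q : List V) : Multiset V) +
          ((hs.map Prod.fst).map fun S => (wireTail Y ℓ S : Multiset V)).sum ∧
      ({e₀} : Multiset V) + ((hs.map Prod.fst).map fun S => ({e S} : Multiset V)).sum =
        {b} + ((hs.map Prod.fst).map fun S => ({Y S (ℓ - 1)} : Multiset V)).sum := by
  induction hs generalizing z with
  | nil => exact ⟨z' :: Q, b, fun _ => [], fun _ => b, ⟨hl, hQ⟩, by simpa using hM, by simp⟩
  | cons x hs ih =>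
    obtain ⟨S, i⟩ := x
    obtain ⟨h1, h2, h3, h4⟩ := hl
    simp only [List.map_cons, List.nodup_cons] at hn h1 h2 h3 h4 ⊢
    obtain ⟨l₀, e₀, l, e, a1, a2, a3, a4, a5⟩ := ih h4 hn.2
    have hpre := hY.seg S (i := 0) (n := i - 1) (by omega)
    have hsuf := hY.seg S (i := i) (n := ℓ - 1 - i) (by omega)
    rw [show i + (ℓ - 1 - i) = ℓ - 1 by omega] at hsuf
    rw [zero_add, zero_add] at hpre
    refine ⟨Y S i :: wirePart Y S (i + 1) (ℓ - 1 - i), Y S (ℓ - 1),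
      update l S (wirePart Y S 1 (i - 1) ++ l₀), update e S e₀,
      ⟨h3, hsuf⟩, ?_, ?_, ?_, ?_⟩
    · rw [List.length_cons, length_wirePart]; omega
    · intro T hT'
      rcases List.mem_cons.1 hT' with rfl | hT
      · rw [update_self, update_self, List.length_append, length_wirePart]
        exact ⟨hpre.append a1, by omega⟩
      · rw [update_of_ne (by rintro rfl; exact hn.1 hT),
          update_of_ne (by rintro rfl; exact hn.1 hT)]
        exact a3 T hT
    · rw [List.sum_cons, List.sum_cons, sum_map_update hn.1 l _ (fun L => (L : Multiset V)),
        update_self, wireTail_eq h1 h2, ← Multiset.coe_add, ← Multiset.coe_add]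
      have hadd : ∀ p q r s t u : Multiset V, r + s = t + u →
          q + (p + r + s) = t + (p + q + u) := by
        intro p q r s t u h
        rw [add_assoc p, h]
        abel
      exact hadd _ _ _ _ _ _ a4
    · rw [List.sum_cons, List.sum_cons, sum_map_update hn.1 e _ (fun v => ({v} : Multiset V)),
        update_self, a5]
      abel

/-- A piece is inserted into the wires of a link between its ends. -/
lemma Link.insert [DecidableEq ι] (hY : Wires H Y ℓ) {z z' : V} {hs : List (ι × ℕ)}
    {P : List V} {Λ : ℕ} (hl : Link H Y ℓ z hs z') (hn : (hs.map Prod.fst).Nodup) (hne : hs ≠ [])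
    (hP : Seg H z' P z) (hΛ : P.length + 1 ≤ Λ) :
    ∃ (l : ι → List V) (e : ι → V),
      (∀ S ∈ (hs.map Prod.fst).toFinset, Seg H (Y S 0) (l S) (e S) ∧
        (l S).length ≤ Λ + 2 * ℓ) ∧
      ∑ S ∈ (hs.map Prod.fst).toFinset, (l S : Multiset V) = ((z' :: P : List V) : Multiset V) +
          ∑ S ∈ (hs.map Prod.fst).toFinset, (wireTail Y ℓ S : Multiset V) ∧
      ∑ S ∈ (hs.map Prod.fst).toFinset, ({e S} : Multiset V) =
        ∑ S ∈ (hs.map Prod.fst).toFinset, ({Y S (ℓ - 1)} : Multiset V) := by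
  match hs, hne with
  | (S, i) :: hs, _ =>
    obtain ⟨h1, h2, h3, h4⟩ := hl
    simp only at h1 h2 h3 h4
    have hn' := hn
    simp only [List.map_cons, List.nodup_cons] at hn
    have hpre := hY.seg S (i := 0) (n := i - 1) (by omega)
    have hsuf := hY.seg S (i := i) (n := ℓ - 1 - i) (by omega)
    rw [show i + (ℓ - 1 - i) = ℓ - 1 by omega] at hsuf
    rw [zero_add, zero_add] at hpre
    obtain ⟨l₀, e₀, l, e, a1, a2, a3, a4, a5⟩ := h4.reroute hY hn.2
      (hP.append (show Seg H z (Y S i :: wirePart Y S (i + 1) (ℓ - 1 - i)) _ from ⟨h3, hsuf⟩))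
      (M := Λ + ℓ) (by rw [List.length_append, List.length_cons, length_wirePart]; omega) (by omega)
    refine ⟨update l S (wirePart Y S 1 (i - 1) ++ l₀), update e S e₀, ?_, ?_, ?_⟩
    · intro T hT'
      rw [List.mem_toFinset, List.map_cons] at hT'
      rcases List.mem_cons.1 hT' with rfl | hT
      · rw [update_self, update_self, List.length_append, length_wirePart]
        exact ⟨hpre.append a1, by omega⟩
      · rw [update_of_ne (by rintro rfl; exact hn.1 hT),
          update_of_ne (by rintro rfl; exact hn.1 hT)]
        exact ⟨(a3 T hT).1, (a3 T hT).2.trans (by omega)⟩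
    · rw [List.sum_toFinset _ hn', List.sum_toFinset _ hn']
      simp only [List.map_cons, List.sum_cons]
      rw [sum_map_update hn.1 l _ (fun L => (L : Multiset V)),
        update_self, wireTail_eq h1 h2, ← Multiset.coe_add, ← Multiset.coe_add, add_assoc, a4,
        ← List.cons_append, ← Multiset.coe_add]
      abel
    · rw [List.sum_toFinset _ hn', List.sum_toFinset _ hn']
      simp only [List.map_cons, List.sum_cons]
      rw [sum_map_update hn.1 e _ (fun v => ({v} : Multiset V)), update_self, a5]

/-- Pieces that are linked by disjoint sets of wires can be inserted at the same time. -/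
theorem exists_reroute [Fintype ι] [DecidableEq ι] (hY : Wires H Y ℓ) (hℓ : 1 ≤ ℓ) {κ : Type*}
    [DecidableEq κ] (C : Finset κ) (z z' : κ → V) (P : κ → List V) (hs : κ → List (ι × ℕ)) {Λ : ℕ}
    (hP : ∀ k ∈ C, Seg H (z' k) (P k) (z k) ∧ (P k).length + 1 ≤ Λ)
    (hl : ∀ k ∈ C, Link H Y ℓ (z k) (hs k) (z' k) ∧ hs k ≠ [] ∧ ((hs k).map Prod.fst).Nodup)
    (hd : ∀ k ∈ C, ∀ k' ∈ C, k ≠ k' →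
      ((hs k).map Prod.fst).Disjoint ((hs k').map Prod.fst)) :
    ∃ (π : Equiv.Perm ι) (l : ι → List V),
      (∀ S, Seg H (Y S 0) (l S) (Y (π S) (ℓ - 1)) ∧ (l S).length ≤ Λ + 2 * ℓ) ∧
      ∑ S, (l S : Multiset V) = ∑ k ∈ C, ((z' k :: P k : List V) : Multiset V) +
        ∑ S, (wireTail Y ℓ S : Multiset V) := by
  suffices hmain : ∀ C' ⊆ C, ∃ (l : ι → List V) (e : ι → V),
      (∀ S, Seg H (Y S 0) (l S) (e S) ∧ (l S).length ≤ Λ + 2 * ℓ) ∧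
      (∀ S, (∀ k ∈ C', S ∉ (hs k).map Prod.fst) → l S = wireTail Y ℓ S ∧ e S = Y S (ℓ - 1)) ∧
      ∑ S, (l S : Multiset V) = ∑ k ∈ C', ((z' k :: P k : List V) : Multiset V) +
        ∑ S, (wireTail Y ℓ S : Multiset V) ∧
      ∑ S, ({e S} : Multiset V) = ∑ S, ({Y S (ℓ - 1)} : Multiset V) by
    obtain ⟨l, e, h1, -, h2, h3⟩ := hmain C subset_rfl
    have hsing : ∀ f : ι → V, ∑ S, ({f S} : Multiset V) = univ.val.map f := fun f => by
      rw [← Multiset.sum_map_singleton (univ.val.map f), Multiset.map_map]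
      rfl
    rw [hsing, hsing] at h3
    have hqi : Injective fun S => Y S (ℓ - 1) := fun S S' h =>
      (hY.inj S _ S' _ (by omega) (by omega) h).1
    have hmem : ∀ S, ∃ S', Y S' (ℓ - 1) = e S := by
      intro S
      have : e S ∈ Multiset.map (fun S => Y S (ℓ - 1)) univ.val := by
        rw [← h3]; exact Multiset.mem_map_of_mem _ (mem_univ_val S)
      obtain ⟨S', -, h⟩ := Multiset.mem_map.1 this
      exact ⟨S', h⟩
    choose π hπ using hmem
    have hnd : (Multiset.map e univ.val).Nodup := by
      rw [h3]; exact Multiset.Nodup.map hqi univ.nodup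
    have hei : Injective e := fun S S' h =>
      Multiset.inj_on_of_nodup_map hnd S (mem_univ_val S) S' (mem_univ_val S') h
    have hπi : Injective π := fun S S' h => hei (by rw [← hπ, ← hπ, h])
    refine ⟨Equiv.ofBijective π ((Fintype.bijective_iff_injective_and_card π).2 ⟨hπi, rfl⟩), l,
      fun S => ?_, h2⟩
    rw [Equiv.ofBijective_apply, hπ]
    exact h1 S
  intro C' hC'
  induction C' using Finset.induction_on with
  | empty =>
    refine ⟨fun S => wireTail Y ℓ S, fun S => Y S (ℓ - 1), fun S => ⟨hY.seg_tail hℓ S, ?_⟩, by simp,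
      by simp, rfl⟩
    simp only [wireTail, length_wirePart]; omega
  | insert k C' hk ih =>
    obtain ⟨l, e, h1, h2, h3, h4⟩ := ih ((subset_insert _ _).trans hC')
    have hkC : k ∈ C := hC' (mem_insert_self _ _)
    obtain ⟨l', e', a1, a2, a3⟩ := (hl k hkC).1.insert hY (hl k hkC).2.2 (hl k hkC).2.1
      (hP k hkC).1 (hP k hkC).2
    set U := ((hs k).map Prod.fst).toFinset with hU
    have hUold : ∀ S ∈ U, l S = wireTail Y ℓ S ∧ e S = Y S (ℓ - 1) := by
      intro S hS
      refine h2 S fun k' hk' h => ?_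
      exact hd k hkC k' (hC' (mem_insert_of_mem hk')) (by rintro rfl; exact hk hk')
        (List.mem_toFinset.1 hS) h
    have hsum : ∀ {γ : Type _} [AddCommMonoid γ] (f g : ι → γ),
        ∑ S, (if S ∈ U then f S else g S) = ∑ S ∈ U, f S + ∑ S ∈ Uᶜ, g S := by
      intro γ _ f g
      rw [← sum_add_sum_compl U]
      congr 1
      · exact sum_congr rfl fun S hS => if_pos hS
      · exact sum_congr rfl fun S hS => if_neg (mem_compl.1 hS)
    refine ⟨fun S => if S ∈ U then l' S else l S, fun S => if S ∈ U then e' S else e S,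
      fun S => ?_, fun S hS => ?_, ?_, ?_⟩
    · dsimp only
      split_ifs with hS
      exacts [a1 S hS, h1 S]
    · have : S ∉ U := by
        rw [hU, List.mem_toFinset]; exact hS k (mem_insert_self _ _)
      simp only [if_neg this]
      exact h2 S fun k' hk' => hS k' (mem_insert_of_mem hk')
    · simp only [apply_ite (fun L : List V => (L : Multiset V))]
      rw [hsum, a2, sum_insert hk, add_assoc, add_assoc, ← h3,
        ← sum_add_sum_compl U fun S => (l S : Multiset V)]
      congr 2
      exact sum_congr rfl fun S hS => by rw [(hUold S hS).1]
    · simp only [apply_ite (fun v : V => ({v} : Multiset V))]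
      rw [hsum, a3, ← h4, ← sum_add_sum_compl U fun S => ({e S} : Multiset V)]
      congr 1
      exact sum_congr rfl fun S hS => by rw [(hUold S hS).2]

end Insert

section Absorb

variable {V ι : Type*} [Fintype V] [DecidableEq V] [Fintype ι] [DecidableEq ι]
variable {H Ha Hb Hc G : SimpleGraph V} {Y : ι → ℕ → V} {ℓ : ℕ}

lemma GSt.cherries {m d B h : ℕ} (hE : Expander H m d B h) {X : Finset V} {c : V → ℕ}
    (hst : GSt H m d X c) (S : Finset V) (hSX : S ⊆ X) (hSc : ∀ v ∈ S, 2 ≤ c v)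
    (hB : X.card + S.card * 2 ≤ B) :
    ∃ (Z : V → Finset V) (c' : V → ℕ) (w : V → V × V), Built H m d X c S (S.biUnion Z) c' ∧
      (∀ v ∈ S, H.Adj v (w v).1 ∧ H.Adj v (w v).2 ∧ (w v).1 ≠ (w v).2 ∧
        Z v = {(w v).1, (w v).2}) ∧
      ∀ v ∈ S, ∀ v' ∈ S, v ≠ v' → Disjoint (Z v) (Z v') := by
  rcases S.eq_empty_or_nonempty with rfl | ⟨v₀, -⟩
  · exact ⟨fun _ => ∅, c, fun v => (v, v), by simpa using Built.refl hst _, by simp, by simp⟩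
  have : Nonempty (V × V) := ⟨(v₀, v₀)⟩
  obtain ⟨Z, c', w, h1, h2, h3⟩ := GSt.family (H := H) (m := m) (d := d) (B := B)
    S (fun v => {v}) 2
    (fun v Z (w : V × V) => H.Adj v w.1 ∧ H.Adj v w.2 ∧ w.1 ≠ w.2 ∧ Z = {w.1, w.2})
    (fun _ _ => ∅) 0 (fun v c => 2 ≤ c v)
    (fun i _ c c' hcc hi => by rw [hcc _ (mem_singleton_self _)]; exact hi)
    (fun v _ X c hst hI hi hB => by
      have hvX := hI (mem_singleton_self v)
      obtain ⟨x, c₁, g1, g2, g3, g4⟩ := hst.leaf hE (by omega) hvX (by omega)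
      obtain ⟨y, c₂, g1', g2', g3', g4'⟩ := GSt.leaf hE g2.st (by
        have := card_union_le X {x}
        simp only [card_singleton] at this
        omega) (mem_union_left _ hvX) (by omega)
      have hxy : x ≠ y := fun h => disjoint_left.1 g2'.disj
        (mem_union_right X (mem_singleton_self x)) (by simp [h])
      refine ⟨{x} ∪ {y}, c₂, (x, y), g2.trans g2' subset_rfl subset_union_left,
        ⟨g1, g1', hxy, rfl⟩, ?_, by simp, by simp⟩
      exact (card_union_le _ _).trans (by simp))
    hst (fun v hv => by simpa using hSX hv) (fun v _ v' _ hvv => by simpa using hvv) hSc hB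
  refine ⟨Z, c', w, ?_, fun v hv => (h2 v hv).1, h3⟩
  rwa [biUnion_singleton_eq_self] at h1

lemma exists_chunks {R : V → V → Prop} {k : ℕ} (hk : 1 ≤ k) (Q : List V) (hQ : Q.IsChain R) :
    ∃ Ps : List (List V), Ps.flatten = Q ∧ Ps.length ≤ Q.length / k + 1 ∧
      ∀ P ∈ Ps, P ≠ [] ∧ P.IsChain R ∧ P.length ≤ k := by
  induction hn : Q.length using Nat.strong_induction_on generalizing Q with
  | _ n ih =>
    subst hn
    by_cases h0 : Q = []
    · exact ⟨[], by simp [h0], by simp, by simp⟩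
    by_cases hle : Q.length ≤ k
    · exact ⟨[Q], by simp, by simp, by simpa using ⟨h0, hQ, hle⟩⟩
    rw [not_le] at hle
    obtain ⟨Ps, h1, h2, h3⟩ := ih (Q.drop k).length (by rw [List.length_drop]; omega) (Q.drop k)
      (hQ.suffix (List.drop_suffix _ _)) rfl
    refine ⟨Q.take k :: Ps, by simp [h1], ?_, ?_⟩
    · have hlen : (Q.drop k).length = Q.length - k := List.length_drop
      rw [List.length_cons]
      have : (Q.length - k) / k + 1 = Q.length / k := by
        rw [← Nat.add_div_right _ (by omega), Nat.sub_add_cancel hle.le]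
      rw [hlen] at h2
      omega
    · intro P hP
      rcases List.mem_cons.1 hP with rfl | hP
      · refine ⟨?_, hQ.take _, by simp⟩
        rw [Ne, List.take_eq_nil_iff]
        exact fun h => h.elim (fun h => by omega) h0
      · exact h3 P hP

lemma seg_of_isChain {v : V} {l : List V} (h : (v :: l).IsChain G.Adj) :
    Seg G v l ((v :: l).getLast (by simp)) := by
  induction l generalizing v with
  | nil => rfl
  | cons x l ih =>
    rw [List.isChain_cons_cons] at h
    refine ⟨h.1, ?_⟩
    rw [List.getLast_cons (by simp)]
    exact ih h.2

lemma Link.mono {H G : SimpleGraph V} (hle : H ≤ G) {z z' : V} {hs : List (ι × ℕ)}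
    (h : Link H Y ℓ z hs z') : Link G Y ℓ z hs z' := by
  induction hs generalizing z with
  | nil => exact hle h
  | cons e hs ih => exact ⟨h.1, h.2.1, hle h.2.2.1, ih h.2.2.2⟩

lemma Wires.mono {H G : SimpleGraph V} (hle : H ≤ G) (h : Wires H Y ℓ) : Wires G Y ℓ :=
  ⟨h.inj, fun S i hi => hle (h.adj S i hi)⟩

/-- The vertices on the wires. -/
def wireSet (Y : ι → ℕ → V) (ℓ : ℕ) : Finset V :=
  univ.biUnion fun S => (range ℓ).image (Y S)

lemma mem_wireSet {v : V} : v ∈ wireSet Y ℓ ↔ ∃ S i, i < ℓ ∧ Y S i = v := by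
  simp [wireSet]

/-- Disjoint short paths can be inserted into the wires. -/
lemma Linkable.reroute {gp : ι → Bool × ℕ} {Bad : Finset V} {m B h K u : ℕ} {a : ℕ → ℕ}
    (hL : Linkable Hc Y ℓ gp Bad m B h K u a) (hY : Wires Hb Y ℓ) (hb : Hb ≤ G) (hc : Hc ≤ G)
    (hℓ : 1 ≤ ℓ) (hK : 1 ≤ K) (Ps : List (List V)) (hnd : Ps.flatten.Nodup) {k : ℕ}
    (hPs : ∀ P ∈ Ps, ∃ hne : P ≠ [], P.IsChain G.Adj ∧ P.length ≤ k ∧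
      (P.head hne ∉ Bad ∧ P.head hne ∉ wireSet Y ℓ) ∧
      (P.getLast hne ∉ Bad ∧ P.getLast hne ∉ wireSet Y ℓ))
    (hB : Ps.length * (2 * h + 2) + 1 + 4 * 2 ^ h ≤ B) (hu : Ps.length * (2 * K) ≤ u) :
    ∃ (π : Equiv.Perm ι) (l : ι → List V),
      (∀ S, Seg G (Y S 0) (l S) (Y (π S) (ℓ - 1)) ∧ (l S).length ≤ k + 2 * ℓ) ∧
      ∑ S, (l S : Multiset V) = (Ps.flatten : Multiset V) +
        ∑ S, (wireTail Y ℓ S : Multiset V) := by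
  have hex : ∀ i : Fin Ps.length, ∃ (v : V) (P : List V), Ps.get i = v :: P := by
    intro i
    obtain ⟨hne, -⟩ := hPs _ (List.get_mem Ps i)
    exact List.exists_cons_of_ne_nil hne
  choose z' P hP using hex
  have hdj : ∀ i j : Fin Ps.length, i ≠ j → (z' i :: P i).Disjoint (z' j :: P j) := by
    have h := (List.nodup_flatten.1 hnd).2
    rw [List.pairwise_iff_get] at h
    intro i j hij
    rw [← hP, ← hP]
    rcases lt_or_gt_of_ne hij with h1 | h1
    · exact h i j h1
    · exact (h j i h1).symm
  have hfact : ∀ i, (z' i :: P i).IsChain G.Adj ∧ (P i).length + 1 ≤ k ∧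
      (z' i ∉ Bad ∧ z' i ∉ wireSet Y ℓ) ∧ ((z' i :: P i).getLast (by simp) ∉ Bad ∧
        (z' i :: P i).getLast (by simp) ∉ wireSet Y ℓ) := by
    intro i
    obtain ⟨hne, h⟩ := hPs _ (List.get_mem Ps i)
    simp only [hP, List.head_cons, List.length_cons] at h
    exact h
  have hns : ∀ v, v ∉ wireSet Y ℓ → ∀ S i, i < ℓ → Y S i ≠ v := fun v hv S i hi he =>
    hv (mem_wireSet.2 ⟨S, i, hi, he⟩)
  obtain ⟨hs, h1, h2⟩ := hL.exists_links hY hK (univ : Finset (Fin Ps.length))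
    (fun i => (z' i :: P i).getLast (by simp)) z'
    (fun i _ => ⟨(hfact i).2.2.2.1, hns _ (hfact i).2.2.2.2⟩)
    (fun i _ => ⟨(hfact i).2.2.1.1, hns _ (hfact i).2.2.1.2⟩)
    (fun i _ j _ hij => by
      by_contra hne
      have hij' : (z' i :: P i).getLast (by simp) = (z' j :: P j).getLast (by simp) := hij
      exact hdj i j hne (List.getLast_mem (by simp))
        (by rw [hij']; exact List.getLast_mem (by simp)))
    (fun i _ j _ hij => by
      by_contra hne
      have hij' : z' i = z' j := hij
      exact hdj i j hne List.mem_cons_self (hij' ▸ List.mem_cons_self))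
    (by simpa using hB) (by simpa using hu)
  obtain ⟨π, l, h3, h4⟩ := exists_reroute (hY.mono hb) hℓ univ _ z' P hs
    (fun i _ => ⟨seg_of_isChain (hfact i).1, (hfact i).2.1⟩)
    (fun i hi => ⟨(h1 i hi).1.mono hc, (h1 i hi).2⟩) h2
  refine ⟨π, l, h3, h4.trans ?_⟩
  congr 1
  have hflat : ∀ L : List (List V),
      (L.map (Multiset.ofList : List V → Multiset V)).sum = (L.flatten : Multiset V) := by
    intro L
    induction L with
    | nil => rfl
    | cons x L ih => rw [List.map_cons, List.sum_cons, ih, List.flatten_cons, Multiset.coe_add]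
  rw [← hflat, ← Fin.sum_univ_fun_getElem]
  exact sum_congr rfl fun i _ => by rw [← hP]; rfl

/-- The wires can be rerouted such that they cover the complement of `Z`. -/
def Absorbs (G : SimpleGraph V) (Y : ι → ℕ → V) (ℓ Λ : ℕ) (Z : Finset V) : Prop :=
  ∃ (π : Equiv.Perm ι) (len : ι → ℕ), (∀ S, len S ≤ Λ) ∧
    RouteFor G π (fun S => Y S 0) (fun S => Y S (ℓ - 1))
      (univ \ (Z ∪ univ.image fun S => Y S 0)) len

lemma sum_wireTail (hY : Wires H Y ℓ) :
    ∑ S, (wireTail Y ℓ S : Multiset V) =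
      (wireSet Y ℓ \ univ.image fun S => Y S 0).val := by
  have hnd : ∀ S, (wireTail Y ℓ S).Nodup := by
    intro S
    refine List.Nodup.map_on ?_ (List.nodup_range')
    intro i hi j hj hij
    rw [List.mem_range'_1] at hi hj
    exact (hY.inj S i S j (by omega) (by omega) hij).2
  have hmem : ∀ S v, v ∈ wireTail Y ℓ S ↔ ∃ i, 1 ≤ i ∧ i < ℓ ∧ Y S i = v := by
    intro S v
    simp only [wireTail, wirePart, List.mem_map, List.mem_range'_1]
    exact ⟨fun ⟨i, h1, h2⟩ => ⟨i, h1.1, by omega, h2⟩, fun ⟨i, h1, h2, h3⟩ => ⟨i, by omega, h3⟩⟩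
  have hval : ∀ S, ((wireTail Y ℓ S : Multiset V)) = (wireTail Y ℓ S).toFinset.val := fun S => by
    rw [List.toFinset_val, (hnd S).dedup]
  simp only [hval]
  rw [← biUnion_val_of_disjoint]
  · congr 1
    ext v
    simp only [mem_biUnion, mem_univ, true_and, List.mem_toFinset, hmem,
      mem_sdiff, mem_wireSet, mem_image, not_exists]
    constructor
    · rintro ⟨S, i, h1, h2, rfl⟩
      refine ⟨⟨S, i, h2, rfl⟩, fun S' h => ?_⟩
      have := (hY.inj S' 0 S i (by omega) h2 h).2
      omega
    · rintro ⟨⟨S, i, h1, rfl⟩, h2⟩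
      refine ⟨S, i, ?_, h1, rfl⟩
      rcases Nat.eq_zero_or_pos i with rfl | h
      exacts [absurd rfl (h2 S), h]
  · intro S _ S' _ hne
    rw [disjoint_left]
    intro v hv hv'
    rw [List.mem_toFinset, hmem] at hv hv'
    obtain ⟨i, -, hi, rfl⟩ := hv
    obtain ⟨j, -, hj, h⟩ := hv'
    exact hne (hY.inj S' j S i hj hi h).1.symm

theorem Linkable.absorbs {gp : ι → Bool × ℕ} {Bad : Finset V} {m B h K u : ℕ} {a : ℕ → ℕ}
    (hL : Linkable Hc Y ℓ gp Bad m B h K u a) (hY : Wires Hb Y ℓ) (ha : Ha ≤ G) (hb : Hb ≤ G)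
    (hc : Hc ≤ G) (hℓ : 1 ≤ ℓ) (hK : 1 ≤ K) {k : ℕ} (hk : 3 ≤ k) {X Z : Finset V}
    (C : V → Finset V) (w : V → V × V)
    (hC : ∀ v ∈ Bad \ wireSet Y ℓ, Ha.Adj v (w v).1 ∧ Ha.Adj v (w v).2 ∧ (w v).1 ≠ (w v).2 ∧
        C v = {(w v).1, (w v).2})
    (hCd : ∀ v ∈ Bad \ wireSet Y ℓ, ∀ v' ∈ Bad \ wireSet Y ℓ, v ≠ v' → Disjoint (C v) (C v'))
    (hCX : Disjoint (wireSet Y ℓ ∪ Bad) ((Bad \ wireSet Y ℓ).biUnion C))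
    (hX : X = wireSet Y ℓ ∪ Bad ∪ (Bad \ wireSet Y ℓ).biUnion C)
    (hXZ : Disjoint X Z)
    (hham : ∃ l, IsOrd (univ \ (X ∪ Z)) l ∧ l.IsChain G.Adj)
    (hB : (Fintype.card V / k + 1 + Bad.card) * (2 * h + 2) + 1 + 4 * 2 ^ h ≤ B)
    (hu : (Fintype.card V / k + 1 + Bad.card) * (2 * K) ≤ u) :
    Absorbs G Y ℓ (k + 2 * ℓ) Z := by
  obtain ⟨Q, hQ, hQc⟩ := hham
  obtain ⟨Qs, q1, q2, q3⟩ := exists_chunks (show 1 ≤ k by omega) Q hQc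
  set S := Bad \ wireSet Y ℓ with hS
  have hSB : ∀ v ∈ S, v ∈ Bad ∧ v ∉ wireSet Y ℓ := fun v hv => mem_sdiff.1 hv
  have hCout : ∀ v ∈ S, ∀ x ∈ C v, x ∉ wireSet Y ℓ ∧ x ∉ Bad := by
    intro v hv x hx
    have h1 : x ∈ S.biUnion C := mem_biUnion.2 ⟨v, hv, hx⟩
    have h2 := disjoint_right.1 hCX h1
    rw [mem_union, not_or] at h2
    exact h2
  let R : V → List V := fun v => [(w v).1, v, (w v).2]
  have hRmem : ∀ v ∈ S, ∀ x, x ∈ R v ↔ x = v ∨ x ∈ C v := by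
    intro v hv x
    rw [(hC v hv).2.2.2]
    simp only [R, List.mem_cons, List.not_mem_nil, or_false, mem_insert,
      mem_singleton]
    tauto
  have hQmem : ∀ v, v ∈ Q ↔ v ∉ X ∧ v ∉ Z := by
    intro v
    rw [← List.mem_toFinset, hQ.2]
    simp
  have hRX : ∀ v ∈ S, ∀ x ∈ R v, x ∈ X := by
    intro v hv x hx
    rw [hX]
    rcases (hRmem v hv x).1 hx with rfl | hx
    · exact mem_union_left _ (mem_union_right _ (hSB x hv).1)
    · exact mem_union_right _ (mem_biUnion.2 ⟨v, hv, hx⟩)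
  have hnd : (Qs ++ S.toList.map R).flatten.Nodup := by
    rw [List.flatten_append, q1, List.nodup_append]
    refine ⟨hQ.1, ?_, ?_⟩
    · rw [List.nodup_flatten]
      constructor
      · intro l hl
        obtain ⟨v, hv, rfl⟩ := List.mem_map.1 hl
        rw [mem_toList] at hv
        obtain ⟨c1, c2, c3, -⟩ := hC v hv
        have h1 := c1.ne
        have h2 := c2.ne
        simp [R, h1.symm, h2, c3]
      · rw [List.pairwise_map]
        refine List.Pairwise.imp_of_mem ?_ S.nodup_toList
        intro v v' hv hv' hne
        rw [mem_toList] at hv hv'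
        intro x hx hx'
        rcases (hRmem v hv x).1 hx with rfl | h1 <;> rcases (hRmem v' hv' x).1 hx' with h2 | h2
        · exact hne h2
        · exact (hCout v' hv' x h2).2 (hSB x hv).1
        · subst h2; exact (hCout v hv x h1).2 (hSB x hv').1
        · exact disjoint_left.1 (hCd v hv v' hv' hne) h1 h2
    · rintro x hx y hy rfl
      obtain ⟨l, hl, hxl⟩ := List.mem_flatten.1 hy
      obtain ⟨v, hv, rfl⟩ := List.mem_map.1 hl
      rw [mem_toList] at hv
      exact ((hQmem x).1 hx).1 (hRX v hv x hxl)
  have hQout : ∀ v ∈ Q, v ∉ Bad ∧ v ∉ wireSet Y ℓ := by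
    intro v hv
    have h1 := ((hQmem v).1 hv).1
    rw [hX, mem_union, mem_union, not_or, not_or] at h1
    exact ⟨h1.1.2, h1.1.1⟩
  have hlen : (Qs ++ S.toList.map R).length ≤ Fintype.card V / k + 1 + Bad.card := by
    rw [List.length_append, List.length_map, length_toList]
    have h1 : Q.length / k ≤ Fintype.card V / k := Nat.div_le_div_right hQ.1.length_le_card
    have h2 : S.card ≤ Bad.card := card_le_card sdiff_subset
    omega
  obtain ⟨π, l, h1, h2⟩ := hL.reroute hY hb hc hℓ hK (Qs ++ S.toList.map R) hnd (k := k) (by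
    intro P hP
    rcases List.mem_append.1 hP with hP | hP
    · obtain ⟨p1, p2, p3⟩ := q3 P hP
      have hPQ : ∀ v ∈ P, v ∈ Q := fun v hv => by
        rw [← q1]; exact List.mem_flatten.2 ⟨P, hP, hv⟩
      exact ⟨p1, p2, p3, hQout _ (hPQ _ (List.head_mem p1)),
        hQout _ (hPQ _ (List.getLast_mem p1))⟩
    · obtain ⟨v, hv, rfl⟩ := List.mem_map.1 hP
      rw [mem_toList] at hv
      obtain ⟨c1, c2, c3, c4⟩ := hC v hv
      refine ⟨by simp [R], ?_, by simpa [R] using hk, ?_, ?_⟩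
      · simp only [R, List.isChain_cons_cons, List.isChain_singleton, and_true]
        exact ⟨ha c1.symm, ha c2⟩
      · exact (hCout v hv _ (by rw [c4]; simp [R])).symm
      · exact (hCout v hv _ (by rw [c4]; simp [R])).symm)
    ((add_le_add_left (add_le_add_left (Nat.mul_le_mul_right _ hlen) _) _).trans hB)
    ((Nat.mul_le_mul_right _ hlen).trans hu)
  refine ⟨π, fun S => (l S).length, fun S => (h1 S).2, l, fun S => ⟨(h1 S).1, rfl⟩, ?_⟩
  rw [h2, sum_wireTail hY]
  have hval : ((Qs ++ S.toList.map R).flatten : Multiset V) =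
      (Qs ++ S.toList.map R).flatten.toFinset.val := by
    rw [List.toFinset_val, hnd.dedup]
  have hfm : ∀ v, v ∈ (Qs ++ S.toList.map R).flatten ↔ v ∈ Q ∨ ∃ v' ∈ S, v ∈ R v' := by
    intro v
    rw [List.flatten_append, q1, List.mem_append, List.mem_flatten]
    simp
  rw [hval, ← union_val_of_disjoint]
  · congr 1
    ext v
    rw [mem_union, List.mem_toFinset, hfm, mem_sdiff, mem_sdiff,
      mem_union, not_or]
    have himg : ∀ v, v ∈ (univ.image fun S => Y S 0) → v ∈ wireSet Y ℓ := by
      intro v hv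
      obtain ⟨S, -, rfl⟩ := mem_image.1 hv
      exact mem_wireSet.2 ⟨S, 0, hℓ, rfl⟩
    constructor
    · rintro ((h | ⟨v', hv', h⟩) | h)
      · exact ⟨mem_univ _, ((hQmem v).1 h).2, fun hh => (hQout v h).2 (himg v hh)⟩
      · refine ⟨mem_univ _, disjoint_left.1 hXZ (hRX v' hv' v h), fun hh => ?_⟩
        rcases (hRmem v' hv' v).1 h with rfl | h
        · exact (hSB v hv').2 (himg v hh)
        · exact (hCout v' hv' v h).1 (himg v hh)
      · refine ⟨mem_univ _, disjoint_left.1 hXZ ?_, h.2⟩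
        rw [hX]
        exact mem_union_left _ (mem_union_left _ h.1)
    · rintro ⟨-, hvZ, hv0⟩
      by_cases hvX : v ∈ X
      · rw [hX, mem_union, mem_union] at hvX
        by_cases hw : v ∈ wireSet Y ℓ
        · exact Or.inr ⟨hw, hv0⟩
        · rcases hvX with (h | h) | h
          · exact absurd h hw
          · have hvS : v ∈ S := mem_sdiff.2 ⟨h, hw⟩
            exact Or.inl (Or.inr ⟨v, hvS, (hRmem v hvS v).2 (Or.inl rfl)⟩)
          · obtain ⟨v', hv', h⟩ := mem_biUnion.1 h
            exact Or.inl (Or.inr ⟨v', hv', (hRmem v' hv' v).2 (Or.inr h)⟩)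
      · exact Or.inl (Or.inl ((hQmem v).2 ⟨hvX, hvZ⟩))
  · rw [disjoint_left]
    intro v hv hv'
    rw [List.mem_toFinset, hfm] at hv
    have hw := (mem_sdiff.1 hv').1
    rcases hv with h | ⟨v', hv', h⟩
    · exact (hQout v h).2 hw
    · rcases (hRmem v' hv' v).1 h with rfl | h
      · exact (hSB v hv').2 hw
      · exact (hCout v' hv' v h).1 hw

end Absorb

section Routes

variable {V : Type*} [Fintype V] [DecidableEq V] {H G : SimpleGraph V} {m d B h : ℕ}

lemma RouteFor.mono (hle : H ≤ G) {ι κ : Type*} [Fintype ι] {σ : ι → κ} {a : ι → V} {b : κ → V}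
    {Z : Finset V} {len : ι → ℕ} (hr : RouteFor H σ a b Z len) : RouteFor G σ a b Z len := by
  obtain ⟨l, h1, h2⟩ := hr
  exact ⟨l, fun i => ⟨(h1 i).1.mono hle, (h1 i).2⟩, h2⟩

lemma RouteFor.nil {ι : Type*} [Fintype ι] (a : ι → V) :
    RouteFor H (fun i => i) a a ∅ (fun _ => 0) :=
  ⟨fun _ => [], fun _ => ⟨rfl, rfl⟩, by simp⟩

lemma RouteFor.sum {ι ι' : Type*} [Fintype ι] [Fintype ι'] {σ : ι → ι} {σ' : ι' → ι'}
    {a b : ι ⊕ ι' → V} {Z Z' : Finset V} {len : ι → ℕ} {len' : ι' → ℕ}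
    (hr : RouteFor H σ (fun i => a (Sum.inl i)) (fun i => b (Sum.inl i)) Z len)
    (hr' : RouteFor H σ' (fun i => a (Sum.inr i)) (fun i => b (Sum.inr i)) Z' len')
    (hd : Disjoint Z Z') : RouteFor H (Sum.map σ σ') a b (Z ∪ Z') (Sum.elim len len') := by
  obtain ⟨l, h1, h2⟩ := hr
  obtain ⟨l', h1', h2'⟩ := hr'
  refine ⟨Sum.elim l l', ?_, ?_⟩
  · rintro (i | i)
    exacts [h1 i, h1' i]
  · rw [union_val_of_disjoint hd, ← h2, ← h2', Fintype.sum_sum_type]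
    rfl

lemma Seg.flatten_ofFn {n : ℕ} (f : Fin (n + 1) → List V) (u v : Fin (n + 1) → V)
    (h : ∀ s, Seg H (u s) (f s) (v s)) (hs : ∀ s : Fin n, v s.castSucc = u s.succ) :
    Seg H (u 0) (List.ofFn f).flatten (v (Fin.last n)) := by
  induction n with
  | zero => simpa using h 0
  | succ n ih =>
    rw [List.ofFn_succ, List.flatten_cons]
    refine (h 0).append ?_
    have h1 := ih (fun s => f s.succ) (fun s => u s.succ) (fun s => v s.succ) (fun s => h _)
      (fun s => by rw [Fin.succ_castSucc]; exact hs s.succ)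
    have h2 := hs 0
    rw [Fin.castSucc_zero] at h2
    rw [h2]
    simpa using h1

lemma coe_flatten_ofFn {n : ℕ} (f : Fin n → List V) :
    ((List.ofFn f).flatten : Multiset V) = ∑ s, (f s : Multiset V) := by
  induction n with
  | zero => simp
  | succ n ih =>
    rw [List.ofFn_succ, List.flatten_cons, ← Multiset.coe_add, ih, Fin.sum_univ_succ]

/-- Concatenation of the routes along the orbits of a permutation. -/
lemma RouteFor.collapse {I κ : Type*} [Fintype I] [Fintype κ] {J : ℕ} (c : I × Fin (J + 1) ≃ κ)
    {ρ : κ → κ} {a a' : κ → V} {Z : Finset V} {len : κ → ℕ} (hr : RouteFor H ρ a a' Z len)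
    (hs : ∀ i (s : Fin J), a' (ρ (c (i, s.castSucc))) = a (c (i, s.succ))) :
    RouteFor H (fun i => i) (fun i => a (c (i, 0))) (fun i => a' (ρ (c (i, Fin.last J)))) Z
      (fun i => ∑ s, len (c (i, s))) := by
  obtain ⟨l, h1, h2⟩ := hr
  refine ⟨fun i => (List.ofFn fun s => l (c (i, s))).flatten, fun i => ⟨?_, ?_⟩, ?_⟩
  · exact Seg.flatten_ofFn (fun s => l (c (i, s))) (fun s => a (c (i, s)))
      (fun s => a' (ρ (c (i, s)))) (fun s => (h1 _).1) (hs i)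
  · have h3 := congrArg Multiset.card (coe_flatten_ofFn fun s => l (c (i, s)))
    rw [Multiset.coe_card, Multiset.card_sum] at h3
    rw [h3]
    exact sum_congr rfl fun s _ => (h1 _).2
  · simp only [coe_flatten_ofFn]
    rw [← h2, ← Equiv.sum_comp c, Fintype.sum_prod_type]

lemma GSt.connects (hE : Expander H m d B h) {ι : Type*} [Fintype ι] [DecidableEq ι]
    {X : Finset V} {c : V → ℕ} (hst : GSt H m d X c) {s t : ι → V}
    (hinj : Injective (Sum.elim s t))
    (hX : ∀ i, s i ∈ X ∧ t i ∈ X ∧ 1 ≤ c (s i) ∧ 1 ≤ c (t i))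
    (hB : X.card + Fintype.card ι * (2 * h + 2) ≤ B) :
    ∃ (Z : Finset V) (c' : V → ℕ),
      Built H m d X c (univ.image s ∪ univ.image t) Z c' ∧
      RouteFor H (fun i => i) s t (Z ∪ univ.image t) (fun _ => 2 * h + 3) := by
  have hs : Injective s := hinj.comp Sum.inl_injective
  have ht : Injective t := hinj.comp Sum.inr_injective
  have hst' : ∀ i j, s i ≠ t j := fun i j hij => by
    have := @hinj (Sum.inl i) (Sum.inr j) hij
    cases this
  obtain ⟨Z, c', l, h1, h2, h3⟩ := GSt.family (H := H) (m := m) (d := d) (B := B)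
    (univ : Finset ι) (fun i => {s i, t i}) (2 * h + 2)
    (fun i Z (l : List V) => Seg H (s i) (l ++ [t i]) (t i) ∧ l.length = 2 * h + 2 ∧
      (l : Multiset V) = Z.val)
    (fun _ _ => ∅) 0 (fun i c => 1 ≤ c (s i) ∧ 1 ≤ c (t i))
    (fun i _ c c' hcc hi => by rw [hcc _ (by simp), hcc _ (by simp)]; exact hi)
    (fun i _ X c hst hI hi hB => by
      obtain ⟨l, c', g1, g2, g3, g4, -, -⟩ := hst.connect hE le_rfl (k := 1) (by omega)
        (hI (by simp)) (hI (by simp)) (hst' i i) hi.1 hi.2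
      refine ⟨l.toFinset, c', l, g4, ⟨g1, by omega, ?_⟩, ?_, by simp, by simp⟩
      · rw [List.toFinset_val, g3.dedup]
      · exact (List.toFinset_card_le l).trans (by omega))
    hst (fun i _ => by
      rw [insert_subset_iff, singleton_subset_iff]
      exact ⟨(hX i).1, (hX i).2.1⟩)
    (fun i _ j _ hij => by
      rw [disjoint_left]
      intro v hv hv'
      simp only [mem_insert, mem_singleton] at hv hv'
      rcases hv with rfl | rfl <;> rcases hv' with h | h
      · exact hij (hs h)
      · exact hst' _ _ h
      · exact hst' _ _ h.symm
      · exact hij (ht h))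
    (fun i _ => (hX i).2.2) (by simpa using hB)
  refine ⟨univ.biUnion Z, c', h1.weaken ?_, fun i => l i ++ [t i],
    fun i => ⟨(h2 i (mem_univ i)).1.1, ?_⟩, ?_⟩
  · intro v hv
    obtain ⟨i, -, hv⟩ := mem_biUnion.1 hv
    simp only [mem_insert, mem_singleton] at hv
    rcases hv with rfl | rfl
    · exact mem_union_left _ (mem_image_of_mem _ (mem_univ _))
    · exact mem_union_right _ (mem_image_of_mem _ (mem_univ _))
  · rw [List.length_append, (h2 i (mem_univ i)).1.2.1]
    simp
  · have hval : (univ.image t).val = ∑ i, ({t i} : Multiset V) := by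
      rw [image_val_of_injOn ht.injOn, sum_eq_multiset_sum,
        ← Multiset.sum_map_singleton (Multiset.map t _), Multiset.map_map]
      rfl
    rw [union_val_of_disjoint, biUnion_val_of_disjoint _ _ h3, hval, ← sum_add_distrib]
    · refine sum_congr rfl fun i _ => ?_
      rw [← (h2 i (mem_univ i)).1.2.2, ← Multiset.coe_add]
      rfl
    · refine (h1.disj.mono_left ?_).symm
      intro v hv
      obtain ⟨i, -, rfl⟩ := mem_image.1 hv
      exact (hX i).2.1

end Routes

/-- Numbers can be distributed into groups of equal size with balanced sums. -/
lemma exists_balanced {ι : Type*} [Fintype ι] {r J Λ : ℕ} (hι : Fintype.card ι = r * J)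
    (wl : ι → ℕ) (hwl : ∀ S, wl S ≤ Λ) :
    ∃ g : Fin r × Fin J ≃ ι, ∀ i i', ∑ s, wl (g (i, s)) ≤ ∑ s, wl (g (i', s)) + Λ := by
  have e₀ : Fin (J * r) ≃ ι := (finCongr (by rw [hι, mul_comm])).trans (Fintype.equivFin ι).symm
  have hmono := Tuple.monotone_sort (fun k => wl (e₀ k))
  set e : Fin (J * r) ≃ ι := (Tuple.sort fun k => wl (e₀ k)).trans e₀ with he
  have hmono' : ∀ k k', k ≤ k' → wl (e k) ≤ wl (e k') := fun k k' hk => hmono hk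
  let f : ℕ → ℕ := fun k => if hk : k < J * r then wl (e ⟨k, hk⟩) else Λ
  have hf : Monotone f := by
    intro k k' hk
    simp only [f]
    split_ifs with h1 h2 h2
    · exact hmono' _ _ hk
    · exact hwl _
    · omega
    · exact le_rfl
  have hfΛ : ∀ k, f k ≤ Λ := by
    intro k
    simp only [f]
    split_ifs
    exacts [hwl _, le_rfl]
  refine ⟨((Equiv.prodComm _ _).trans finProdFinEquiv).trans e, fun i i' => ?_⟩
  have key : ∀ (i : Fin r) (s : Fin J),
      wl (((Equiv.prodComm _ _).trans finProdFinEquiv).trans e (i, s)) = f (i + r * s) := by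
    intro i s
    have hlt : (i : ℕ) + r * s < J * r := (finProdFinEquiv (s, i)).2
    simp only [f, dif_pos hlt]
    rfl
  simp only [key]
  rw [Fin.sum_univ_eq_sum_range (fun s => f (i + r * s)),
    Fin.sum_univ_eq_sum_range (fun s => f (i' + r * s))]
  calc ∑ s ∈ range J, f (i + r * s) ≤ ∑ s ∈ range J, f (i' + r * (s + 1)) :=
        sum_le_sum fun s _ => hf (by have := i.2; rw [mul_add]; omega)
    _ ≤ ∑ s ∈ range (J + 1), f (i' + r * s) := by
        rw [sum_range_succ']; exact Nat.le_add_right _ _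
    _ ≤ _ := by
        rw [sum_range_succ]; exact Nat.add_le_add_left (hfΛ _) _

/-- The lengths of the routes can be adjusted to a common value. -/
lemma exists_adjust {ι : Type*} [Fintype ι] {r J Λ F L q : ℕ} (hι : Fintype.card ι = r * J)
    (wl : ι → ℕ) (hwl : ∀ S, wl S ≤ Λ) (hr : r = 2 * q) (hq : 1 ≤ q)
    (htot : r * F + ∑ S, wl S + 2 * Λ * q = r * L) :
    ∃ (g : Fin r × Fin J ≃ ι) (e : Fin r → ℕ), (∀ i, e i ≤ 2 * Λ) ∧ ∑ i, e i = 2 * Λ * q ∧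
      ∀ i, F + ∑ s, wl (g (i, s)) + e i = L := by
  obtain ⟨g, hg⟩ := exists_balanced hι wl hwl
  set w : Fin r → ℕ := fun i => ∑ s, wl (g (i, s)) with hw
  have hsum : ∑ i, w i = ∑ S, wl S := by
    rw [← Equiv.sum_comp g, Fintype.sum_prod_type]
  have hup : ∀ i, r * w i ≤ ∑ S, wl S + r * Λ := by
    intro i
    have : ∑ _i' : Fin r, w i ≤ ∑ i', (w i' + Λ) := sum_le_sum fun i' _ => hg i i'
    rw [sum_add_distrib, hsum] at this
    simpa using this
  have hlo : ∀ i, ∑ S, wl S ≤ r * w i + r * Λ := by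
    intro i
    have : ∑ i', w i' ≤ ∑ _i' : Fin r, (w i + Λ) := sum_le_sum fun i' _ => hg i' i
    rw [hsum] at this
    simpa [mul_add] using this
  have hr0 : 0 < r := by omega
  have hrq : 2 * Λ * q = r * Λ := by rw [hr]; ring
  have h1 : ∀ i, F + w i ≤ L := by
    intro i
    refine Nat.le_of_mul_le_mul_left ?_ hr0
    have := hup i
    rw [mul_add]
    omega
  have h2 : ∀ i, L ≤ F + w i + 2 * Λ := by
    intro i
    refine Nat.le_of_mul_le_mul_left ?_ hr0
    have := hlo i
    have e1 : r * (F + w i + 2 * Λ) = r * F + r * w i + 2 * (r * Λ) := by ring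
    omega
  refine ⟨g, fun i => L - (F + w i), fun i => ?_, ?_, fun i => ?_⟩
  · have := h2 i
    change L - (F + w i) ≤ 2 * Λ
    omega
  · have : ∑ i, (L - (F + w i)) + ∑ i, (F + w i) = r * L := by
      rw [← sum_add_distrib]
      simp [Nat.sub_add_cancel (h1 _)]
    rw [sum_add_distrib, hsum] at this
    simp only [sum_const, card_univ, Fintype.card_fin, smul_eq_mul] at this
    change ∑ i, (L - (F + w i)) = 2 * Λ * q
    omega
  · have := h1 i
    change F + w i + (L - (F + w i)) = L
    omega

section Layout

variable {V : Type*} [Fintype V] [DecidableEq V] {Ha Hb G : SimpleGraph V} {m d B h : ℕ}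

/-- The equivalence listing each starting point followed by its group. -/
def groupEquiv {I ι : Type*} {J : ℕ} (g : I × Fin J ≃ ι) : I × Fin (J + 1) ≃ I ⊕ ι where
  toFun p := Fin.cases (Sum.inl p.1) (fun s => Sum.inr (g (p.1, s))) p.2
  invFun := Sum.elim (fun i => (i, 0)) (fun S => ((g.symm S).1, (g.symm S).2.succ))
  left_inv := by
    rintro ⟨i, s⟩
    refine Fin.cases ?_ (fun s => ?_) s <;> simp
  right_inv := by
    rintro (i | S) <;> simp

/-- A network followed by fixed return routes realises routes through prescribed groups. -/
lemma RouteFor.cyclic {I ι : Type*} [Fintype I] [Fintype ι] {H : SimpleGraph V}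
    {J n₁ F : ℕ} {x y : I → V} {q : ι → V} {o : I ⊕ ι → V} {Z Z' : Finset V}
    (hnet : ∀ σ : Equiv.Perm (I ⊕ ι), RouteFor H σ (Sum.elim x q) o Z (fun _ => n₁))
    (π : Equiv.Perm ι) {wl : ι → ℕ} {e : I → ℕ}
    (hret : RouteFor H (Sum.map id π) o (Sum.elim y q) Z' (Sum.elim (fun i => F + e i) wl))
    (hd : Disjoint Z Z') (g : I × Fin J ≃ ι) :
    RouteFor H (fun i => i) x y (Z ∪ Z')
      (fun i => (J + 1) * n₁ + F + ∑ s, wl (g (i, s)) + e i) := by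
  set σ₂ : Equiv.Perm (I ⊕ ι) := Equiv.sumCongr (Equiv.refl I) π with hσ₂
  set c := groupEquiv (g.trans π) with hc
  set ρ : Equiv.Perm (I ⊕ ι) :=
    (c.symm.trans (Equiv.prodCongr (Equiv.refl I) (finRotate (J + 1)))).trans c with hρ
  have hρc : ∀ i s, ρ (c (i, s)) = c (i, finRotate (J + 1) s) := by
    intro i s
    simp [hρ]
  have h1 := (hnet (ρ.trans σ₂.symm)).comp hret (ρ.trans σ₂.symm).bijective hd
  have h2 : (fun k => Sum.map id π ((ρ.trans σ₂.symm) k)) = ρ := by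
    funext k
    have : Sum.map id π = σ₂ := by
      rw [hσ₂]; rfl
    rw [this]
    simp
  rw [h2] at h1
  have h3 := h1.collapse c (fun i s => by
    rw [hρc, finRotate_of_lt (by simp)]
    rfl)
  have e1 : (fun i => Sum.elim x q (c (i, 0))) = x := rfl
  have e2 : (fun i => Sum.elim y q (ρ (c (i, Fin.last J)))) = y := by
    funext i
    rw [hρc, finRotate_last]
    rfl
  rw [e1, e2] at h3
  convert h3 using 2 with i
  have h4 : ∀ s, (ρ.trans σ₂.symm) (c (i, s)) = σ₂.symm (c (i, finRotate (J + 1) s)) := by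
    intro s
    rw [Equiv.trans_apply, hρc]
  simp only [h4]
  rw [sum_add_distrib,
    Equiv.sum_comp (finRotate (J + 1))
      (fun s => Sum.elim (fun i => F + e i) wl (σ₂.symm (c (i, s)))), sum_const, Fin.sum_univ_succ]
  have e3 : σ₂.symm (c (i, 0)) = Sum.inl i := rfl
  have e4 : ∀ s : Fin J, σ₂.symm (c (i, s.succ)) = Sum.inr (g (i, s)) := by
    intro s
    rw [Equiv.symm_apply_eq]
    rfl
  rw [e3]
  simp only [e4, Sum.elim_inl, Sum.elim_inr, card_univ, Fintype.card_fin,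
    smul_eq_mul]
  ring

lemma univ_sdiff_eq_union {Z₁ Z₂ Z₃ Z₄ Q P : Finset V} (hQ : Q ⊆ Z₁) (hP : Disjoint P Z₁)
    (h₂ : Disjoint Z₁ Z₂) (h₃ : Disjoint Z₁ Z₃) (h₄ : Disjoint Z₁ Z₄) :
    univ \ (Z₁ \ Q) =
      Z₂ ∪ (Z₃ ∪ (Z₄ ∪ (Q ∪ P)) ∪ univ \ (Z₁ ∪ Z₂ ∪ Z₃ ∪ Z₄ ∪ P)) := by
  ext v
  have d1 := @hQ v
  simp only [mem_union, mem_sdiff, mem_univ, true_and]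
  by_cases h1 : v ∈ Z₁
  · have h6 : v ∉ P := fun hv => disjoint_left.1 hP hv h1
    simp [h1, disjoint_left.1 h₂ h1, disjoint_left.1 h₃ h1,
      disjoint_left.1 h₄ h1, h6]
  · have h6 : v ∉ Q := fun hv => h1 (d1 hv)
    simp only [h1, h6, false_and, not_false_eq_true, false_or, true_iff]
    by_cases a₂ : v ∈ Z₂ <;> by_cases a₃ : v ∈ Z₃ <;> by_cases a₄ : v ∈ Z₄ <;>
      by_cases a₅ : v ∈ P <;> simp [a₂, a₃, a₄, a₅]

open Classical in
theorem exists_layout (hE : Expander Ha m d B h) {A : Type*} {T : SimpleGraph A} (hT : T.IsTree)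
    {Δ : ℕ} (hΔ : Δ + 4 ≤ d) {X : Finset V} {c : V → ℕ} (hst : GSt Ha m d X c)
    {ι : Type} [Fintype ι] [Nonempty ι] {Y : ι → ℕ → V} {ℓ Λ : ℕ}
    (hY : Wires Hb Y ℓ) (hℓ : 3 ≤ ℓ) (hYX : ∀ S i, i < ℓ → Y S i ∈ X ∧ d ≤ c (Y S i))
    (habs : ∀ Z c', Disjoint X Z → GSt Ha m d (X ∪ Z) c' → Absorbs G Y ℓ Λ Z) (ha : Ha ≤ G)
    (S : Finset A) (hdeg : ∀ v ∈ S, (S.filter (T.Adj v)).card ≤ Δ) {r k₁ k₂ : ℕ}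
    (hκ : r + Fintype.card ι = 2 ^ k₁) (hr : r = 2 ^ k₂) (x y : Fin r → A)
    (hx : ∀ i, x i ∈ S) (hy : ∀ i, y i ∈ S) (hxy : Injective (Sum.elim x y))
    (D : Finset (Fin r)) (E : ℕ)
    (hB : X.card + S.card + 2 ^ k₁ * benesLen h k₁ +
      ((E + 1) * (r * benesLen h k₂) + E * D.card) + 2 ^ k₁ * (2 * h + 2) ≤ B) :
    ∃ (φ : A → V) (F : ℕ) (wl : ι → ℕ), Set.InjOn φ S ∧
      (∀ u ∈ S, ∀ v ∈ S, T.Adj u v → G.Adj (φ u) (φ v)) ∧ (∀ S, wl S ≤ Λ + (2 * h + 3)) ∧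
      ∀ (J : ℕ) (g : Fin r × Fin J ≃ ι) (e : Fin r → ℕ), (∀ i, e i ≤ E) →
        ∑ i, e i = E * D.card →
        RouteFor G (fun i => i) (fun i => φ (x i)) (fun i => φ (y i))
          (univ \ (S.image φ \ univ.image fun i => φ (y i)))
          (fun i => ((J + 1) * benesLen h k₁ + F) + ∑ s, wl (g (i, s)) + e i) := by
  obtain ⟨S₀⟩ := ‹Nonempty ι›
  have hd := hE.d_ge
  have hcκ : Fintype.card (Fin r ⊕ ι) = 2 ^ k₁ := by rw [Fintype.card_sum, Fintype.card_fin, hκ]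
  obtain ⟨Z₁, c₁, φ, b1, hφ, hφZ, hφa, hφc⟩ := GSt.embed hE hT (Δ := Δ) (by omega) hst
    (w := Y S₀ 1) (hYX S₀ 1 (by omega)).1 (by have := (hYX S₀ 1 (by omega)).2; omega) S hdeg
    (by omega)
  have hφm : ∀ u ∈ S, φ u ∈ Z₁ := fun u hu => hφZ ▸ mem_image_of_mem _ hu
  have hZ₁ : Z₁.card ≤ S.card := hφZ ▸ card_image_le
  have hXu : ∀ {Z : Finset V}, (X ∪ Z).card ≤ X.card + Z.card := card_union_le _ _
  have hpX : ∀ S, Y S 0 ∈ X := fun S => (hYX S 0 (by omega)).1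
  have hqX : ∀ S, Y S (ℓ - 1) ∈ X := fun S => (hYX S _ (by omega)).1
  have hkp : ∀ S, c₁ (Y S 0) = c (Y S 0) := fun S => b1.keep _ (hpX S) (by
    rw [mem_singleton]
    intro hh
    have := (hY.inj _ _ _ _ (by omega) (by omega) hh).2
    omega)
  have hkq : ∀ S, c₁ (Y S (ℓ - 1)) = c (Y S (ℓ - 1)) := fun S => b1.keep _ (hqX S) (by
    rw [mem_singleton]
    intro hh
    have := (hY.inj _ _ _ _ (by omega) (by omega) hh).2
    omega)
  have hXZ₁ : ∀ v ∈ X, ∀ w ∈ Z₁, v ≠ w := fun v hv w hw =>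
    disjoint_iff_ne.1 b1.disj v hv w hw
  have hxinj : Injective x := hxy.comp Sum.inl_injective
  have hyinj : Injective y := hxy.comp Sum.inr_injective
  have hxyne : ∀ i j, x i ≠ y j := fun i j hij => by
    cases @hxy (Sum.inl i) (Sum.inr j) hij
  have hqinj : Injective fun S => Y S (ℓ - 1) := fun S S' hS =>
    (hY.inj _ _ _ _ (by omega) (by omega) hS).1
  have hpinj : Injective fun S => Y S 0 := fun S S' hS =>
    (hY.inj _ _ _ _ (by omega) (by omega) hS).1
  -- the switching network
  set a : Fin r ⊕ ι → V := Sum.elim (fun i => φ (x i)) (fun S => Y S (ℓ - 1)) with ha_def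
  have hainj : Injective a := by
    refine Injective.sumElim ?_ hqinj ?_
    · exact fun i j hij => hxinj (hφ (hx i) (hx j) hij)
    · exact fun i S => (hXZ₁ _ (hqX S) _ (hφm _ (hx i))).symm
  obtain ⟨Z₂, c₂, o, b2, hoinj, hoZ, hoc, hnet⟩ := hasNetwork hE k₁ hcκ (X ∪ Z₁) c₁ b1.st a hainj
    (by
      rintro (i | S')
      · exact mem_union_right _ (hφm _ (hx i))
      · exact mem_union_left _ (hqX S'))
    (by
      rintro (i | S')
      · have := hφc _ (hx i)
        simp only [ha_def, Sum.elim_inl]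
        omega
      · simp only [ha_def, Sum.elim_inr, hkq]
        have := (hYX S' (ℓ - 1) (by omega)).2
        omega)
    (by rw [hcκ]; have := hXu (Z := Z₁); omega)
  have hZ₂ : Z₂.card = 2 ^ k₁ * benesLen h k₁ := by
    rw [(hnet (Equiv.refl _)).card]
    simp [Fintype.card_sum, ← hκ]
  have hkp₂ : ∀ S, c₂ (Y S 0) = c (Y S 0) := fun S' => by
    rw [b2.keep _ (mem_union_left _ (hpX S')), hkp]
    rw [mem_image]
    rintro ⟨i | S'', -, hh⟩
    · exact hXZ₁ _ (hpX S') _ (hφm _ (hx i)) hh.symm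
    · have := (hY.inj _ _ _ _ (by omega) (by omega) hh).2
      omega
  have hky₂ : ∀ i, c₂ (φ (y i)) = c₁ (φ (y i)) := fun i => by
    rw [b2.keep _ (mem_union_right _ (hφm _ (hy i)))]
    rw [mem_image]
    rintro ⟨j | S'', -, hh⟩
    · exact hxyne j i (hφ (hx j) (hy i) hh)
    · exact hXZ₁ _ (hqX S'') _ (hφm _ (hy i)) hh
  have hdis₂ : ∀ v ∈ X ∪ Z₁, ∀ w ∈ Z₂, v ≠ w := fun v hv w hw =>
    disjoint_iff_ne.1 b2.disj v hv w hw
  -- the length adjustment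
  obtain ⟨Z₃, c₃, b, b3, hbinj, hbZ, hbc, hstage⟩ := GSt.stages hE
    (hasNetwork hE k₂ (ι := Fin r) (by rw [Fintype.card_fin, hr])) D E b2.st
    (a := fun i => o (Sum.inl i)) (hoinj.comp Sum.inl_injective)
    (fun i => mem_union_right _ (hoZ _)) (fun i => by have := hoc (Sum.inl i); omega)
    (by
      rw [Fintype.card_fin]
      have := hXu (Z := Z₁)
      have := card_union_le (X ∪ Z₁) Z₂
      omega)
  have hZ₃ : Z₃.card = (E + 1) * (r * benesLen h k₂) + E * D.card := by
    have hs : ∑ i, (if i ∈ D then E else 0) = E * D.card := by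
      rw [sum_ite_mem, univ_inter, sum_const, smul_eq_mul, mul_comm]
    rw [(hstage (Equiv.refl _) (fun i => if i ∈ D then E else 0)
      (fun i => by split_ifs <;> omega) hs).card, sum_add_distrib, hs]
    simp only [sum_const, card_univ, Fintype.card_fin, smul_eq_mul]
    ring
  have hdis₃ : ∀ v ∈ X ∪ Z₁ ∪ Z₂, ∀ w ∈ Z₃, v ≠ w := fun v hv w hw =>
    disjoint_iff_ne.1 b3.disj v hv w hw
  have hk₃ : ∀ v ∈ X ∪ Z₁, c₃ v = c₂ v := fun v hv => by
    rw [b3.keep _ (mem_union_left _ hv)]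
    rw [mem_image]
    rintro ⟨i, -, hh⟩
    exact hdis₂ _ hv _ (hoZ (Sum.inl i)) hh.symm
  have hko₃ : ∀ S, c₃ (o (Sum.inr S)) = c₂ (o (Sum.inr S)) := fun S' => by
    rw [b3.keep _ (mem_union_right _ (hoZ _))]
    rw [mem_image]
    rintro ⟨i, -, hh⟩
    cases hoinj hh
  -- the connections
  set s : Fin r ⊕ ι → V := Sum.elim b (fun S => o (Sum.inr S)) with hs_def
  set t : Fin r ⊕ ι → V := Sum.elim (fun i => φ (y i)) (fun S => Y S 0) with ht_def
  have htm : ∀ k, t k ∈ X ∪ Z₁ := by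
    rintro (i | S')
    · exact mem_union_right _ (hφm _ (hy i))
    · exact mem_union_left _ (hpX S')
  have hinj : Injective (Sum.elim s t) := by
    refine Injective.sumElim (Injective.sumElim hbinj
      (hoinj.comp Sum.inr_injective) ?_) (Injective.sumElim ?_ hpinj ?_) ?_
    · exact fun i S' => (hdis₃ _ (mem_union_right _ (hoZ _)) _ (hbZ i)).symm
    · exact fun i j hij => hyinj (hφ (hy i) (hy j) hij)
    · exact fun i S' => (hXZ₁ _ (hpX S') _ (hφm _ (hy i))).symm
    · rintro (i | S') k
      · exact (hdis₃ _ (mem_union_left _ (htm k)) _ (hbZ i)).symm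
      · exact (hdis₂ _ (htm k) _ (hoZ _)).symm
  obtain ⟨Z₄, c₄, b4, hconn⟩ := GSt.connects hE b3.st hinj
    (by
      intro k
      refine ⟨?_, mem_union_left _ (mem_union_left _ (htm k)), ?_, ?_⟩
      · rcases k with i | S'
        · exact mem_union_right _ (hbZ i)
        · exact mem_union_left _ (mem_union_right _ (hoZ _))
      · rcases k with i | S'
        · have := hbc i
          simp only [hs_def, Sum.elim_inl]
          omega
        · have := hoc (Sum.inr S')
          simp only [hs_def, Sum.elim_inr, hko₃]
          omega
      · rw [hk₃ _ (htm k)]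
        rcases k with i | S'
        · have := hφc _ (hy i)
          simp only [ht_def, Sum.elim_inl, hky₂]
          omega
        · have := (hYX S' 0 (by omega)).2
          simp only [ht_def, Sum.elim_inr, hkp₂]
          omega)
    (by
      rw [hcκ]
      have := hXu (Z := Z₁)
      have := card_union_le (X ∪ Z₁) Z₂
      have := card_union_le (X ∪ Z₁ ∪ Z₂) Z₃
      omega)
  have hd₁ : Disjoint X (Z₁ ∪ Z₂ ∪ Z₃ ∪ Z₄) := by
    have e2 := b2.disj
    have e3 := b3.disj
    have e4 := b4.disj
    simp only [disjoint_union_left, disjoint_union_right] at e2 e3 e4 ⊢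
    exact ⟨⟨⟨b1.disj, e2.1⟩, e3.1.1⟩, e4.1.1.1⟩
  obtain ⟨π, wl, hwl, hwire⟩ := habs (Z₁ ∪ Z₂ ∪ Z₃ ∪ Z₄) c₄ hd₁ (by
    have := b4.st
    rwa [show X ∪ (Z₁ ∪ Z₂ ∪ Z₃ ∪ Z₄) = X ∪ Z₁ ∪ Z₂ ∪ Z₃ ∪ Z₄ by
      simp only [union_assoc]])
  set P : Finset V := univ.image fun S => Y S 0 with hP
  set Z₅ := univ \ (Z₁ ∪ Z₂ ∪ Z₃ ∪ Z₄ ∪ P) with hZ₅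
  have hPX : P ⊆ X := by
    intro v hv
    obtain ⟨S', -, rfl⟩ := mem_image.1 hv
    exact hpX S'
  have hYφ : (univ.image fun i => φ (y i)) ⊆ Z₁ := by
    intro v hv
    obtain ⟨i, -, rfl⟩ := mem_image.1 hv
    exact hφm _ (hy i)
  have ht_img : univ.image t = (univ.image fun i => φ (y i)) ∪ P := by
    ext v
    simp [ht_def, hP]
  have e2 := b2.disj
  have e3 := b3.disj
  have e4 := b4.disj
  have e1 := b1.disj
  simp only [disjoint_union_left] at e2 e3 e4
  refine ⟨φ, (E + 1) * benesLen h k₂ + (2 * h + 3), fun S => 2 * h + 3 + wl S, hφ,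
    fun u hu v hv huv => ha (hφa u hu v hv huv), ?_, ?_⟩
  · intro S'
    have := hwl S'
    dsimp only
    omega
  intro J g e he hes
  have r1 : RouteFor G (Sum.map id id) o s (Z₃ ∪ ∅) _ := RouteFor.sum
    ((hstage (Equiv.refl _) e he hes).mono ha) (RouteFor.nil fun S => o (Sum.inr S)) (by simp)
  have r3 : RouteFor G (Sum.map id π) t (Sum.elim (fun i => φ (y i)) fun S => Y S (ℓ - 1))
      (∅ ∪ Z₅) _ := RouteFor.sum (RouteFor.nil fun i => φ (y i)) hwire (by simp)
  rw [ht_img] at hconn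
  rw [union_empty] at r1
  rw [empty_union] at r3
  have hdA : Disjoint Z₃ (Z₄ ∪ ((univ.image fun i => φ (y i)) ∪ P)) := by
    rw [disjoint_union_right, disjoint_union_right]
    exact ⟨e4.2, e3.1.2.symm.mono_right hYφ, e3.1.1.symm.mono_right hPX⟩
  have hdB : Disjoint (Z₃ ∪ (Z₄ ∪ ((univ.image fun i => φ (y i)) ∪ P))) Z₅ := by
    refine disjoint_sdiff.mono_left ?_
    intro v
    have := @hYφ v
    simp only [mem_union]
    tauto
  have r12 := r1.comp (hconn.mono ha) (by simp) hdA
  have r123 := r12.comp r3 (by simp) hdB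
  have hret : RouteFor G (Sum.map id π) o (Sum.elim (fun i => φ (y i)) fun S => Y S (ℓ - 1))
      (Z₃ ∪ (Z₄ ∪ ((univ.image fun i => φ (y i)) ∪ P)) ∪ Z₅)
      (Sum.elim (fun i => ((E + 1) * benesLen h k₂ + (2 * h + 3)) + e i)
        (fun S => 2 * h + 3 + wl S)) := by
    convert r123 using 1
    · funext k
      rcases k with i | S' <;> rfl
    · funext k
      rcases k with i | S'
      · simp
        ring
      · simp
  have hdC : Disjoint Z₂ (Z₃ ∪ (Z₄ ∪ ((univ.image fun i => φ (y i)) ∪ P)) ∪ Z₅) := by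
    rw [disjoint_union_right, disjoint_union_right, disjoint_union_right,
      disjoint_union_right]
    refine ⟨⟨e3.2, e4.1.2, e2.2.symm.mono_right hYφ, e2.1.symm.mono_right hPX⟩, ?_⟩
    refine disjoint_sdiff.mono_left ?_
    intro v
    simp only [mem_union]
    tauto
  have hfin := RouteFor.cyclic (fun σ => (hnet σ).mono ha) π hret hdC g
  have hZ : univ \ (S.image φ \ univ.image fun i => φ (y i)) =
      Z₂ ∪ (Z₃ ∪ (Z₄ ∪ ((univ.image fun i => φ (y i)) ∪ P)) ∪ Z₅) := by
    rw [hφZ]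
    exact univ_sdiff_eq_union hYφ (e1.mono_left hPX) e2.2 e3.1.2 e4.1.1.2
  rw [hZ]
  exact hfin

end Layout

section Copy

variable {A V : Type*} [Fintype V] [DecidableEq V] {Ha Hb G : SimpleGraph V}
variable {T : SimpleGraph A}

/-- The vertices of disjoint bare paths of length `L`. -/
structure BarePaths (T : SimpleGraph A) {r : ℕ} (P : Fin r → ℕ → A) (L : ℕ) : Prop where
  inj : ∀ i j i' j', j ≤ L → j' ≤ L → P i j = P i' j' → i = i' ∧ j = j'
  nbr : ∀ i j a, 1 ≤ j → j < L → T.Adj (P i j) a → a = P i (j - 1) ∨ a = P i (j + 1)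

lemma exists_barePaths [Finite A] {L m r : ℕ} (h : HasDisjBarePaths T L m) (hr : r ≤ m) :
    ∃ P : Fin r → ℕ → A, BarePaths T P L := by
  obtain ⟨u, v, w, h1, h2⟩ := h
  have hinj : ∀ i j j', j ≤ L → j' ≤ L → (w i).getVert j = (w i).getVert j' → j = j' := by
    intro i j j' hj hj' hjj
    exact (h1 i).1.1.getVert_injOn (by rw [Set.mem_ofPred_eq, (h1 i).2]; exact hj)
      (by rw [Set.mem_ofPred_eq, (h1 i).2]; exact hj') hjj
  refine ⟨fun i j => (w (Fin.castLE hr i)).getVert j, ?_, ?_⟩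
  · intro i j i' j' hj hj' hP
    by_cases hii : i = i'
    · subst hii
      exact ⟨rfl, hinj _ _ _ hj hj' hP⟩
    · refine absurd ?_ (h2 (Fin.castLE hr i) (Fin.castLE hr i')
        (fun hh => hii (Fin.castLE_injective hr hh)) ((w _).getVert_mem_support j))
      rw [hP]
      simp
  · intro i j a hj hjL ha
    obtain ⟨⟨p1, p2⟩, p3⟩ := h1 (Fin.castLE hr i)
    have q1 := hinj (Fin.castLE hr i)
    generalize hW : w (Fin.castLE hr i) = W at p1 p2 p3 ha q1 ⊢
    have h0 : W.getVert 0 = u (Fin.castLE hr i) := W.getVert_zero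
    have hL : W.getVert L = v (Fin.castLE hr i) := by rw [← p3]; exact W.getVert_length
    have hcard := p2 (W.getVert j) (W.getVert_mem_support j)
      (fun hh => by have := q1 j 0 (by omega) (by omega) (hh.trans h0.symm); omega)
      (fun hh => by have := q1 j L (by omega) le_rfl (hh.trans hL.symm); omega)
    have hsub : ({W.getVert (j - 1), W.getVert (j + 1)} : Set A) ⊆ T.neighborSet (W.getVert j) := by
      rintro x (rfl | rfl)
      · have := W.adj_getVert_succ (i := j - 1) (by omega)
        rw [Nat.sub_add_cancel hj] at this
        exact this.symm
      · exact W.adj_getVert_succ (by omega)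
    have hne : W.getVert (j - 1) ≠ W.getVert (j + 1) := fun hh => by
      have := q1 _ _ (by omega) (by omega) hh
      omega
    have heq := Set.eq_of_subset_of_ncard_le hsub (by rw [hcard, Set.ncard_pair hne])
      (Set.toFinite _)
    have : a ∈ T.neighborSet (W.getVert j) := ha
    rw [← heq] at this
    exact this

lemma Seg.getD {H : SimpleGraph V} {u v : V} {l : List V} (h : Seg H u l v) :
    (u :: l).getD l.length u = v ∧
      ∀ j, j < l.length → H.Adj ((u :: l).getD j u) ((u :: l).getD (j + 1) u) := by
  have key : ∀ (l : List V) (u x : V), Seg H u l v → (u :: l).getD l.length x = v ∧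
      ∀ j, j < l.length → H.Adj ((u :: l).getD j x) ((u :: l).getD (j + 1) x) := by
    intro l
    induction l with
    | nil => exact fun u x h => ⟨h, fun j hj => by simp at hj⟩
    | cons y l ih =>
      intro u x h
      obtain ⟨h1, h2⟩ := ih y x h.2
      refine ⟨h1, fun j hj => ?_⟩
      cases j with
      | zero => exact h.1
      | succ j => exact h2 j (by simpa using hj)
  exact key l u u h

lemma exists_copy_of_route [Fintype A] [DecidableEq A] {r L : ℕ} {P : Fin r → ℕ → A}
    (hP : BarePaths T P L) (hcard : Fintype.card A = Fintype.card V) (S : Finset A)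
    (hS : ∀ a, a ∈ S ↔ ∀ i j, 1 ≤ j → j < L → P i j ≠ a) {φ : A → V}
    (hadj : ∀ a ∈ S, ∀ b ∈ S, T.Adj a b → G.Adj (φ a) (φ b))
    (hr : RouteFor G (fun i => i) (fun i => φ (P i 0)) (fun i => φ (P i L))
      (univ \ (S.image φ \ univ.image fun i => φ (P i L))) (fun _ => L)) :
    ContainsCopy T G := by
  obtain ⟨l, h1, h2⟩ := hr
  let F : Fin r → ℕ → V := fun i j => (φ (P i 0) :: l i).getD j (φ (P i 0))
  have hF0 : ∀ i, F i 0 = φ (P i 0) := fun i => rfl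
  have hFL : ∀ i, F i L = φ (P i L) := fun i => by
    have := (h1 i).1.getD.1
    rwa [(h1 i).2] at this
  have hFa : ∀ i j, j < L → G.Adj (F i j) (F i (j + 1)) := fun i j hj =>
    (h1 i).1.getD.2 j (by rw [(h1 i).2]; exact hj)
  obtain ⟨f, hf, hf'⟩ : ∃ f : A → V, (∀ i j, j ≤ L → f (P i j) = F i j) ∧
      ∀ a, (∀ i j, j ≤ L → P i j ≠ a) → f a = φ a := by
    classical
    refine ⟨fun a => if ha : ∃ p : Fin r × ℕ, p.2 ≤ L ∧ P p.1 p.2 = a then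
      F ha.choose.1 ha.choose.2 else φ a, fun i j hj => ?_, fun a ha => ?_⟩
    · have hex : ∃ p : Fin r × ℕ, p.2 ≤ L ∧ P p.1 p.2 = P i j := ⟨(i, j), hj, rfl⟩
      dsimp only
      rw [dif_pos hex]
      obtain ⟨e1, e2⟩ := hP.inj _ _ _ _ hex.choose_spec.1 hj hex.choose_spec.2
      rw [e1, e2]
    · dsimp only
      rw [dif_neg]
      rintro ⟨p, hp, h⟩
      exact ha _ _ hp h
  have hfS : ∀ a ∈ S, f a = φ a := by
    intro a ha
    by_cases hex : ∃ i j, j ≤ L ∧ P i j = a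
    · obtain ⟨i, j, hj, rfl⟩ := hex
      rw [hf i j hj]
      rcases Nat.eq_zero_or_pos j with rfl | h0
      · exact hF0 i
      · rcases hj.eq_or_lt with rfl | h
        · exact hFL i
        · exact absurd rfl ((hS _).1 ha i j h0 h)
    · push Not at hex
      exact hf' a hex
  have hint : ∀ i j b, 1 ≤ j → j < L → T.Adj (P i j) b → G.Adj (f (P i j)) (f b) := by
    intro i j b hj hjL hb
    rw [hf i j hjL.le]
    rcases hP.nbr i j b hj hjL hb with rfl | rfl
    · rw [hf i _ (by omega)]
      have := hFa i (j - 1) (by omega)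
      rw [Nat.sub_add_cancel hj] at this
      exact this.symm
    · rw [hf i _ (by omega)]
      exact hFa i j hjL
  have hhom : ∀ a b, T.Adj a b → G.Adj (f a) (f b) := by
    intro a b hab
    by_cases ha : a ∈ S
    · by_cases hb : b ∈ S
      · rw [hfS a ha, hfS b hb]
        exact hadj a ha b hb hab
      · rw [hS] at hb
        push Not at hb
        obtain ⟨i, j, hj, hjL, rfl⟩ := hb
        exact (hint i j a hj hjL hab.symm).symm
    · rw [hS] at ha
      push Not at ha
      obtain ⟨i, j, hj, hjL, rfl⟩ := ha
      exact hint i j b hj hjL hab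
  have hsurj : Surjective f := by
    intro v
    by_cases hv : v ∈ S.image φ
    · obtain ⟨a, ha, rfl⟩ := mem_image.1 hv
      exact ⟨a, hfS a ha⟩
    · have hvm : v ∈ ∑ i, (l i : Multiset V) := by
        rw [h2, mem_val]
        simp [hv]
      obtain ⟨i, -, hvi⟩ := Multiset.mem_sum.1 hvm
      rw [Multiset.mem_coe] at hvi
      obtain ⟨j, hj, hjv⟩ := List.mem_iff_getElem.1 hvi
      have hl : (l i).length = L := (h1 i).2
      rw [hl] at hj
      refine ⟨P i (j + 1), ?_⟩
      rw [hf i _ (by omega), ← hjv]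
      simp [F, hl, hj]
  exact ⟨⟨f, fun {a b} hab => hhom a b hab⟩,
    ((Fintype.bijective_iff_surjective_and_card f).2 ⟨hsurj, hcard⟩).1⟩

/-- The deterministic embedding theorem. -/
theorem containsCopy_of_absorbs {m d B h : ℕ} (hE : Expander Ha m d B h) (hT : T.IsTree)
    {n : ℕ} [Fintype A] (hA : Fintype.card A = n) (hV : Fintype.card V = n)
    {Δ : ℕ} (hΔ : Δ + 4 ≤ d) (hdeg : ∀ v, (T.neighborSet v).ncard ≤ Δ)
    {X : Finset V} {c : V → ℕ} (hst : GSt Ha m d X c)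
    {ι : Type} [Fintype ι] [Nonempty ι] {Y : ι → ℕ → V} {ℓ Λ : ℕ}
    (hY : Wires Hb Y ℓ) (hℓ : 3 ≤ ℓ) (hYX : ∀ S i, i < ℓ → Y S i ∈ X ∧ d ≤ c (Y S i))
    (habs : ∀ Z c', Disjoint X Z → GSt Ha m d (X ∪ Z) c' → Absorbs G Y ℓ Λ Z) (ha : Ha ≤ G)
    {q J k₁ k₂ L M : ℕ} (hι : Fintype.card ι = 2 * q * J) (hκ : 2 * q * (J + 1) = 2 ^ k₁)
    (hr : 2 * q = 2 ^ k₂) (hL : 1 ≤ L) (hM : 2 * q ≤ M) (hpaths : HasDisjBarePaths T L M)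
    (hB : X.card + n + 2 ^ k₁ * benesLen h k₁ +
      (2 * (Λ + (2 * h + 3)) + 1) * (2 * q * (benesLen h k₂ + 1)) + 2 ^ k₁ * (2 * h + 2)
        ≤ B + 2 * q * (L - 1)) :
    ContainsCopy T G := by
  classical
  obtain ⟨P, hP⟩ := exists_barePaths hpaths hM
  have hq : 1 ≤ q := by
    have := Nat.two_pow_pos k₂
    omega
  set E := 2 * (Λ + (2 * h + 3)) with hEdef
  let e₁ : Fin (2 * q) × Fin (L - 1) ↪ A := ⟨fun p => P p.1 (p.2 + 1), by
    rintro ⟨i, j⟩ ⟨i', j'⟩ hh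
    have h1 := j.2
    have h2 := j'.2
    obtain ⟨h3, h4⟩ := hP.inj _ _ _ _ (by omega) (by omega) hh
    exact Prod.ext h3 (Fin.ext (by simpa using h4))⟩
  set S : Finset A := univ \ univ.map e₁ with hSdef
  have hScard : S.card + 2 * q * (L - 1) = n := by
    have h1 := card_sdiff_add_card_eq_card (subset_univ (univ.map e₁))
    rw [card_map, card_univ, card_univ, Fintype.card_prod, Fintype.card_fin,
      Fintype.card_fin, hA] at h1
    exact h1
  have hS : ∀ a, a ∈ S ↔ ∀ i j, 1 ≤ j → j < L → P i j ≠ a := by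
    intro a
    simp only [hSdef, mem_sdiff, mem_univ, true_and, mem_map, not_exists]
    constructor
    · intro hh i j hj hjL hP'
      refine hh (i, ⟨j - 1, by omega⟩) ?_
      change P i (j - 1 + 1) = a
      rw [Nat.sub_add_cancel hj]
      exact hP'
    · rintro hh ⟨i, j⟩ hP'
      exact hh i (j + 1) (by omega) (by have := j.2; omega) hP'
  have hPS : ∀ i j, (j = 0 ∨ j = L) → P i j ∈ S := by
    intro i j hj
    rw [hS]
    intro i' j' h1 h2 hh
    have := (hP.inj _ _ _ _ (by omega) (by omega) hh).2
    omega
  obtain ⟨D, -, hD⟩ := exists_subset_card_eq (s := (univ : Finset (Fin (2 * q))))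
    (n := q) (by rw [card_univ, Fintype.card_fin]; omega)
  obtain ⟨φ, F, wl, hφ, hφa, hwl, hroute⟩ := exists_layout hE hT hΔ hst hY hℓ hYX habs ha S
    (fun v _ => by
      rw [← Set.ncard_coe_finset]
      refine (Set.ncard_le_ncard ?_ (Set.toFinite _)).trans (hdeg v)
      intro x hx
      simp only [coe_filter, Set.mem_ofPred_eq] at hx
      exact hx.2)
    (r := 2 * q) (by rw [hι, ← hκ]; ring) hr (fun i => P i 0) (fun i => P i L)
    (fun i => hPS i 0 (Or.inl rfl)) (fun i => hPS i L (Or.inr rfl))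
    (by
      refine Injective.sumElim ?_ ?_ ?_
      · exact fun i j hij => (hP.inj _ _ _ _ (by omega) (by omega) hij).1
      · exact fun i j hij => (hP.inj _ _ _ _ (by omega) (by omega) hij).1
      · intro i j hij
        have := (hP.inj _ _ _ _ (by omega) (by omega) hij).2
        omega)
    D E (by
      have : (E + 1) * (2 * q * benesLen h k₂) + E * D.card ≤
          (E + 1) * (2 * q * (benesLen h k₂ + 1)) := by
        rw [hD]
        nlinarith
      omega)
  have hZ : (univ \ (S.image φ \ univ.image fun i => φ (P i L))).card =
      2 * q * L := by
    have hinj : Injective fun i => φ (P i L) := fun i j hij =>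
      (hP.inj _ _ _ _ (by omega) (by omega)
        (hφ (hPS i L (Or.inr rfl)) (hPS j L (Or.inr rfl)) hij)).1
    have h1 := card_sdiff_add_card_eq_card
      (subset_univ (S.image φ \ univ.image fun i => φ (P i L)))
    have h2 := card_sdiff_add_card_eq_card (s := univ.image fun i => φ (P i L))
      (t := S.image φ) (by
        intro v hv
        obtain ⟨i, -, rfl⟩ := mem_image.1 hv
        exact mem_image_of_mem _ (hPS i L (Or.inr rfl)))
    rw [card_image_of_injOn hφ, card_image_of_injective _ hinj, card_univ,
      Fintype.card_fin] at h2
    rw [card_univ, hV] at h1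
    have h3 : 2 * q * L = 2 * q * (L - 1) + 2 * q := by
      rw [← Nat.mul_succ]
      congr 1
      omega
    omega
  have htot : 2 * q * ((J + 1) * benesLen h k₁ + F) + ∑ S, wl S + E * q = 2 * q * L := by
    have g : Fin (2 * q) × Fin J ≃ ι := Fintype.equivOfCardEq (by simp [hι])
    have h1 := (hroute J g (fun i => if i ∈ D then E else 0)
      (fun i => by split_ifs <;> omega)
      (by rw [sum_ite_mem, univ_inter, sum_const, smul_eq_mul,
        mul_comm])).card
    rw [hZ, sum_add_distrib, sum_add_distrib, sum_ite_mem, univ_inter,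
      sum_const, sum_const, ← Fintype.sum_prod_type (fun p => wl (g p)),
      Equiv.sum_comp g, card_univ, Fintype.card_fin, hD, smul_eq_mul, smul_eq_mul,
      mul_comm q E] at h1
    exact h1.symm
  obtain ⟨g, e, he, hes, hlen⟩ := exists_adjust hι wl hwl rfl hq htot
  have hfin := hroute J g e he (by rw [hD, hes])
  simp only [hlen] at hfin
  exact exists_copy_of_route hP (hA.trans hV.symm) S hS hφa hfin

end Copy

section Counting

variable {α : Type*} [Fintype α] [DecidableEq α]

lemma sum_pow_card {y : ℝ} (hy : 0 ≤ y) :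
    ∑ M : Finset α, y ^ M.card ≤ Real.exp (Fintype.card α * y) := by
  have h := Fintype.sum_pow_mul_eq_add_pow α y 1
  simp only [one_pow, mul_one] at h
  rw [h, Real.exp_nat_mul]
  exact pow_le_pow_left₀ (by linarith) (Real.add_one_le_exp y) _

/-- A weighted count of the sets of size at most `J`. -/
lemma sum_pow_card_le (J : ℕ) {x y : ℝ} (hx : 1 ≤ x) (hy : 0 ≤ y) :
    ∑ M ∈ (univ : Finset (Finset α)).filter (·.card ≤ J), y ^ M.card ≤
      x ^ J * Real.exp (Fintype.card α * (y / x)) := by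
  have hx0 : 0 < x := by linarith
  calc _ ≤ ∑ M ∈ (univ : Finset (Finset α)).filter (·.card ≤ J),
        x ^ J * (y / x) ^ M.card := by
        refine sum_le_sum fun M hM => ?_
        have h1 := pow_le_pow_right₀ hx (mem_filter.1 hM).2
        rw [div_pow, mul_div_assoc', le_div_iff₀ (pow_pos hx0 _), mul_comm]
        exact mul_le_mul_of_nonneg_right h1 (pow_nonneg hy _)
    _ ≤ ∑ M : Finset α, x ^ J * (y / x) ^ M.card :=
        sum_le_sum_of_subset_of_nonneg (subset_univ _)
          fun _ _ _ => by positivity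
    _ ≤ _ := by
        rw [← mul_sum]
        exact mul_le_mul_of_nonneg_left (sum_pow_card (by positivity)) (by positivity)

lemma card_filter_card_le (J : ℕ) {x : ℝ} (hx : 1 ≤ x) :
    (((univ : Finset (Finset α)).filter (·.card ≤ J)).card : ℝ) ≤
      x ^ J * Real.exp (Fintype.card α / x) := by
  have := sum_pow_card_le (α := α) J hx zero_le_one
  simpa [div_eq_mul_inv] using this

lemma ex_exists_le_sum {κ : Type*} {p : ℝ} (h0 : 0 ≤ p) (h1 : p ≤ 1) (C : Finset κ)
    (P : κ → (α → Bool) → Prop) :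
    ex p (fun ω => ind (∃ c ∈ C, P c ω)) ≤ ∑ c ∈ C, ex p (fun ω => ind (P c ω)) := by
  refine (ex_mono h0 h1 fun ω => ind_exists_le C _).trans ?_
  rw [ex_sum]

lemma one_sub_pow_le {p : ℝ} (h1 : p ≤ 1) {k : ℕ} {t : ℝ} (ht : 0 ≤ p) (hk : t ≤ k) :
    (1 - p) ^ k ≤ Real.exp (-p * t) := by
  have h2 : 1 - p ≤ Real.exp (-p) := by linarith [Real.add_one_le_exp (-p)]
  calc (1 - p) ^ k ≤ Real.exp (-p) ^ k := pow_le_pow_left₀ (by linarith) h2 _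
    _ = Real.exp (-p * k) := by rw [← Real.exp_nat_mul]; ring_nf
    _ ≤ _ := Real.exp_le_exp.2 (by nlinarith)

end Counting

section Events

variable {V : Type*} [Fintype V] [DecidableEq V]

/-- Disjoint sets of size at least `k` are joined by an edge. -/
def Joined (H : SimpleGraph V) (k : ℕ) : Prop :=
  ∀ A B : Finset V, k ≤ A.card → k ≤ B.card → Disjoint A B → ∃ a ∈ A, ∃ b ∈ B, H.Adj a b

lemma ex_not_joined_le {p : ℝ} (h0 : 0 ≤ p) (h1 : p ≤ 1) (k : ℕ) :
    ex p (fun ω => ind (¬ Joined (graphOf (V := V) ω) k)) ≤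
      4 ^ Fintype.card V * Real.exp (-p * (k * k : ℕ)) := by
  let C : Finset (Finset V × Finset V) := univ.filter fun c =>
    k ≤ c.1.card ∧ k ≤ c.2.card ∧ Disjoint c.1 c.2
  refine (ex_mono h0 h1 fun ω => ind_mono ?_).trans ((ex_exists_no_edges_le h0 h1 C
    Prod.fst Prod.snd (k * k) ?_).trans ?_)
  · intro h
    simp only [Joined] at h
    push Not at h
    obtain ⟨A, B, hA, hB, hAB, h⟩ := h
    exact ⟨(A, B), by simp [C, hA, hB, hAB], h⟩
  · intro c hc
    obtain ⟨-, h2, h3, h4⟩ := mem_filter.1 hc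
    rw [sdiff_eq_self_of_disjoint h4.symm]
    exact Nat.mul_le_mul h2 h3
  · refine mul_le_mul_of_nonneg_right ?_ (Real.exp_nonneg _)
    have : C.card ≤ 4 ^ Fintype.card V := by
      refine (card_le_univ _).trans ?_
      rw [Fintype.card_prod, Fintype.card_finset, ← mul_pow]
      norm_num
    exact_mod_cast this

/-- The probability that the neighbourhood of `U` outside `F` is small. -/
lemma ex_card_nbhd_le {p : ℝ} (h0 : 0 ≤ p) (h1 : p ≤ 1) (F U : Finset V) (J : ℕ)
    (hx : 1 ≤ Fintype.card V * p) {t : ℝ}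
    (ht : t + F.card + U.card + J ≤ Fintype.card V) :
    ex p (fun ω => ind ((U.biUnion (nb (graphOf ω)) \ (F ∪ U)).card ≤ J)) ≤
      (Fintype.card V * p) ^ J * Real.exp U.card * Real.exp (-p * (U.card * t)) := by
  set n := Fintype.card V with hn
  let C := (univ : Finset (Finset V)).filter fun M => M.card ≤ J ∧ Disjoint M (F ∪ U)
  let D : Finset V → Finset (V → V) := fun M =>
    Fintype.piFinset fun x => if x ∈ M then U else {x}
  let P : Finset V → ({e : Sym2 V // ¬ e.IsDiag} → Bool) → Prop := fun M ω =>
    ∃ g ∈ D M, (∀ e ∈ M.image fun x => s(x, g x), e ∈ (graphOf ω).edgeSet) ∧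
      ∀ e ∈ between U (univ \ (F ∪ U ∪ M)), e ∉ (graphOf ω).edgeSet
  have hPM : ∀ M ∈ C, ex p (fun ω => ind (P M ω)) ≤
      (U.card * p) ^ M.card * Real.exp (-p * (U.card * t)) := by
    intro M hM
    obtain ⟨-, hMJ, hMd⟩ := mem_filter.1 hM
    have hMU : ∀ x ∈ M, x ∉ U := fun x hx hxU =>
      disjoint_left.1 hMd hx (mem_union_right _ hxU)
    have hgU : ∀ g ∈ D M, ∀ x ∈ M, g x ∈ U := fun g hg x hx => by
      have := Fintype.mem_piFinset.1 hg x
      rwa [if_pos hx] at this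
    have hUB : Disjoint U (univ \ (F ∪ U ∪ M)) := by
      rw [disjoint_left]
      intro x hx hx'
      simp [hx] at hx'
    refine (ex_exists_edges_le h0 h1 (D M) _ _ ?_ ?_ ?_).trans ?_
    · intro g hg
      rw [disjoint_left]
      intro e he he'
      obtain ⟨x, hx, rfl⟩ := mem_image.1 he
      obtain ⟨⟨a, b⟩, hab, h⟩ := mem_image.1 he'
      simp only [mem_product, mem_sdiff, mem_univ, true_and,
        mem_union, not_or] at hab
      rcases Sym2.eq_iff.1 h with ⟨h2, h3⟩ | ⟨h2, h3⟩
      · exact hMU x hx (h2 ▸ hab.1)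
      · have hb : b = x := h3
        exact hab.2.2 (hb ▸ hx)
    · intro g hg e he
      obtain ⟨x, hx, rfl⟩ := mem_image.1 he
      rw [Sym2.mk_isDiag_iff]
      intro h
      exact hMU x hx (h ▸ hgU g hg x hx)
    · exact fun g _ e he => not_isDiag_of_mem_between hUB he
    · have hcard : ∀ g ∈ D M, (M.image fun x => s(x, g x)).card = M.card := by
        intro g hg
        refine card_image_of_injOn ?_
        intro x hx y hy hxy
        rcases Sym2.eq_iff.1 hxy with ⟨h, -⟩ | ⟨h, -⟩
        · exact h
        · exact absurd (h ▸ hgU g hg y hy) (hMU x hx)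
      have hD : (D M).card = U.card ^ M.card := by
        rw [Fintype.card_piFinset]
        simp only [apply_ite card, card_singleton, prod_ite_mem,
          univ_inter, prod_const]
      rw [sum_congr rfl fun g hg => by rw [hcard g hg], sum_const, nsmul_eq_mul, hD,
        card_between hUB, Nat.cast_pow, ← mul_assoc, ← mul_pow]
      refine mul_le_mul_of_nonneg_left (one_sub_pow_le h1 h0 ?_) (by positivity)
      push_cast
      refine mul_le_mul_of_nonneg_left ?_ (by positivity)
      have h3 : n ≤ (univ \ (F ∪ U ∪ M)).card + (F.card + U.card + M.card) := by
        have h4 := card_sdiff_add_card_eq_card (subset_univ (F ∪ U ∪ M))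
        rw [card_univ] at h4
        have h5 := card_union_le (F ∪ U) M
        have h6 := card_union_le F U
        omega
      have h3' : (n : ℝ) ≤ (univ \ (F ∪ U ∪ M)).card + (F.card + U.card + M.card) := by
        exact_mod_cast h3
      have h4 : (M.card : ℝ) ≤ J := by exact_mod_cast hMJ
      linarith
  calc _ ≤ ex p (fun ω => ind (∃ M ∈ C, P M ω)) := by
        refine ex_mono h0 h1 fun ω => ind_mono fun h => ?_
        refine ⟨_, mem_filter.2 ⟨mem_univ _, h, sdiff_disjoint⟩, ?_⟩
        have hch : ∀ x, ∃ y, if x ∈ U.biUnion (nb (graphOf ω)) \ (F ∪ U) then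
            y ∈ U ∧ (graphOf ω).Adj x y else y = x := by
          intro x
          split_ifs with hx
          · obtain ⟨u, hu, hxu⟩ := mem_biUnion.1 (mem_sdiff.1 hx).1
            exact ⟨u, hu, (mem_nb.1 hxu).symm⟩
          · exact ⟨x, rfl⟩
        choose g hg using hch
        refine ⟨g, Fintype.mem_piFinset.2 fun x => ?_, ?_, ?_⟩
        · have := hg x
          split_ifs at this ⊢
          · exact this.1
          · simpa using this
        · intro e he
          obtain ⟨x, hx, rfl⟩ := mem_image.1 he
          have := hg x
          rw [if_pos hx] at this
          exact this.2
        · intro e he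
          obtain ⟨⟨a, b⟩, hab, rfl⟩ := mem_image.1 he
          simp only [mem_product, mem_sdiff, mem_univ, true_and,
            mem_union, not_or, mem_biUnion, not_and] at hab
          intro hadj
          obtain ⟨ha, ⟨hbF, hbU⟩, hb⟩ := hab
          exact hb ⟨a, ha, mem_nb.2 hadj⟩ hbF hbU
    _ ≤ ∑ M ∈ C, (U.card * p) ^ M.card * Real.exp (-p * (U.card * t)) :=
        (ex_exists_le_sum h0 h1 C P).trans (sum_le_sum hPM)
    _ ≤ ∑ M ∈ (univ : Finset (Finset V)).filter (·.card ≤ J),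
          (U.card * p) ^ M.card * Real.exp (-p * (U.card * t)) := by
        refine sum_le_sum_of_subset_of_nonneg ?_ fun _ _ _ => by positivity
        intro M hM
        rw [mem_filter] at hM ⊢
        exact ⟨hM.1, hM.2.1⟩
    _ ≤ _ := by
        rw [← sum_mul]
        refine mul_le_mul_of_nonneg_right ?_ (Real.exp_nonneg _)
        refine (sum_pow_card_le J hx (by positivity)).trans (le_of_eq ?_)
        congr 2
        have hn0 : (n : ℝ) ≠ 0 := fun h => by rw [h] at hx; norm_num at hx
        have hp0 : p ≠ 0 := fun h => by rw [h] at hx; norm_num at hx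
        rw [← hn]
        field_simp

/-- Small sets have many neighbours outside `F`, and large sets are joined. -/
structure Spreads (H : SimpleGraph V) (F : Finset V) (m D : ℕ) : Prop where
  nbhd : ∀ U : Finset V, U.Nonempty → U.card ≤ 2 * m →
    D * U.card < (U.biUnion (nb H) \ (F ∪ U)).card
  joined : Joined H m

lemma ex_not_spreads_le {p : ℝ} (h0 : 0 ≤ p) (h1 : p ≤ 1) (F : Finset V) (m D : ℕ)
    (hx : 1 ≤ Fintype.card V * p) {t : ℝ}
    (ht : t + F.card + (D + 1) * (2 * m) ≤ Fintype.card V) :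
    ex p (fun ω => ind (¬ Spreads (graphOf ω) F m D)) ≤
      (Real.exp (Fintype.card V * ((Fintype.card V * p) ^ D * Real.exp (1 - p * t))) - 1) +
        4 ^ Fintype.card V * Real.exp (-p * (m * m : ℕ)) := by
  set n := Fintype.card V with hn
  set q := (n * p) ^ D * Real.exp (1 - p * t) with hq
  have hq0 : 0 ≤ q := by positivity
  let C := (univ : Finset (Finset V)).filter fun U => U.Nonempty ∧ U.card ≤ 2 * m
  have hU : ∀ U ∈ C, ex p (fun ω => ind ((U.biUnion (nb (graphOf ω)) \ (F ∪ U)).card ≤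
      D * U.card)) ≤ q ^ U.card := by
    intro U hU
    have hUm : (U.card : ℝ) ≤ 2 * m := by exact_mod_cast (mem_filter.1 hU).2.2
    refine (ex_card_nbhd_le h0 h1 F U (D * U.card) hx (t := t) ?_).trans (le_of_eq ?_)
    · push_cast
      nlinarith
    · rw [hq, ← hn, mul_pow ((n * p) ^ D), ← pow_mul, mul_assoc, ← Real.exp_add,
        ← Real.exp_nat_mul]
      ring_nf
  have hC : ∑ U ∈ C, q ^ U.card ≤ Real.exp (n * q) - 1 := by
    have h2 : ∑ U ∈ C, q ^ U.card ≤ ∑ U ∈ univ.erase (∅ : Finset V), q ^ U.card := by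
      refine sum_le_sum_of_subset_of_nonneg ?_ fun _ _ _ => by positivity
      intro U hU
      exact mem_erase.2 ⟨(mem_filter.1 hU).2.1.ne_empty, mem_univ _⟩
    have h3 := add_sum_erase univ (fun U : Finset V => q ^ U.card)
      (mem_univ ∅)
    have h4 := sum_pow_card (α := V) hq0
    simp only [card_empty, pow_zero] at h3
    linarith
  calc _ ≤ ex p (fun ω => ind (∃ U ∈ C, (U.biUnion (nb (graphOf ω)) \ (F ∪ U)).card ≤
          D * U.card) + ind (¬ Joined (graphOf ω) m)) := by
        refine ex_mono h0 h1 fun ω => le_trans (ind_mono fun h => ?_) (ind_or_le _ _)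
        by_contra hcon
        push Not at hcon
        exact h ⟨fun U h2 h3 => hcon.1 U (by simp [C, h2, h3]), hcon.2⟩
    _ ≤ _ := by
        rw [ex_add]
        exact add_le_add ((ex_exists_le_sum h0 h1 C _).trans ((sum_le_sum hU).trans hC))
          (ex_not_joined_le h0 h1 m)

end Events

section Ham

variable {V : Type*} [Fintype V] [DecidableEq V]

/-- Every set on which `G` expands is traversed by a path of `G ⊔ G'`. -/
def Traversed (G G' : SimpleGraph V) (m : ℕ) : Prop :=
  ∀ W, Expands G W m → ∃ l, IsOrd W l ∧ l.IsChain (G ⊔ G').Adj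

lemma ex_not_isChain_le {p : ℝ} (h0 : 0 ≤ p) (h1 : p ≤ 1) {G : SimpleGraph V} {m : ℕ} {x : ℝ}
    (hx : 1 ≤ x) {W : Finset V} (hW : Expands G W m) :
    ex p (fun ω => ind (¬ ∃ l, IsOrd W l ∧ l.IsChain (G ⊔ graphOf ω).Adj)) ≤
      x ^ Fintype.card V * Real.exp ((Fintype.card V : ℝ) ^ 2 * (p / x)) *
        Real.exp (-p * ((m : ℝ) ^ 2 / 2)) := by
  set n := Fintype.card V with hn
  rcases W.eq_empty_or_nonempty with rfl | hne
  · have : ∀ ω, ind (¬ ∃ l, IsOrd ∅ l ∧ l.IsChain (G ⊔ graphOf ω).Adj) = 0 := fun ω => by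
      rw [ind, if_neg]
      rw [not_not]
      exact ⟨[], ⟨List.nodup_nil, rfl⟩, List.isChain_nil⟩
    simp only [this, ex_const]
    have : 0 ≤ x := by linarith
    positivity
  have hP : ∀ E : Finset (Sym2 V), ∃ P : Finset (Sym2 V),
      (∃ l, IsOrd W l ∧ l.IsChain (G ⊔ .fromEdgeSet E).Adj) ∨ (m * m ≤ 2 * P.card ∧
        (∀ e ∈ P, ¬ e.IsDiag) ∧ ∀ G', G ⊔ .fromEdgeSet E ≤ G' → ∀ l', IsOrd W l' →
          (∀ l, IsOrd W l → score G' l ≤ score (G ⊔ .fromEdgeSet E) l') →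
            ∀ e ∈ P, e ∉ G'.edgeSet) := by
    intro E
    rcases exists_boosters (hW.mono (le_sup_left (b := .fromEdgeSet (E : Set (Sym2 V))))) hne
      with h | ⟨P, h⟩
    exacts [⟨∅, Or.inl h⟩, ⟨P, Or.inr h⟩]
  choose P hP using hP
  let C : Finset (Finset (Sym2 V)) := univ.filter fun E => E.card ≤ n ∧
    (∀ e ∈ E, ¬ e.IsDiag) ∧ m * m ≤ 2 * (P E).card ∧ (∀ e ∈ P E, ¬ e.IsDiag) ∧ Disjoint E (P E)
  calc _ ≤ ex p (fun ω => ind (∃ E ∈ C, (∀ e ∈ E, e ∈ (graphOf ω).edgeSet) ∧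
          ∀ e ∈ P E, e ∉ (graphOf ω).edgeSet)) := by
        refine ex_mono h0 h1 fun ω => ind_mono fun h => ?_
        rcases exists_isChain_or_edges P (fun E => (hP E).imp id fun h => h.2.2) (graphOf ω) with
          h2 | ⟨E, h2, h3, h4⟩
        · exact absurd h2 h
        refine ⟨E, ?_, fun e he => h2 he, h4⟩
        rcases hP E with ⟨l, h5, h6⟩ | ⟨h5, h6, -⟩
        · refine absurd ⟨l, h5, h6.imp fun a b hab => ?_⟩ h
          rcases hab with hab | hab
          · exact Or.inl hab
          · exact Or.inr (h2 ((SimpleGraph.fromEdgeSet_adj _).1 hab).1)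
        · rw [mem_filter]
          refine ⟨mem_univ _, h3.trans (card_le_univ W), fun e he =>
            SimpleGraph.not_isDiag_of_mem_edgeSet _ (h2 he), h5, h6, ?_⟩
          rw [disjoint_left]
          exact fun e he he' => h4 e he' (h2 he)
    _ ≤ ∑ E ∈ C, p ^ E.card * (1 - p) ^ (P E).card :=
        ex_exists_edges_le h0 h1 C (fun E => E) P (fun E hE => (mem_filter.1 hE).2.2.2.2.2)
          (fun E hE => (mem_filter.1 hE).2.2.1)
          (fun E hE => (mem_filter.1 hE).2.2.2.2.1)
    _ ≤ ∑ E ∈ (univ : Finset (Finset (Sym2 V))).filter (·.card ≤ n),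
          p ^ E.card * Real.exp (-p * ((m : ℝ) ^ 2 / 2)) := by
        refine (sum_le_sum fun E hE => mul_le_mul_of_nonneg_left
          (one_sub_pow_le h1 h0 (t := (m : ℝ) ^ 2 / 2) ?_) (pow_nonneg h0 _)).trans
          (sum_le_sum_of_subset_of_nonneg ?_ fun _ _ _ => by positivity)
        · have : ((m * m : ℕ) : ℝ) ≤ (2 * (P E).card : ℕ) := by
            exact_mod_cast (mem_filter.1 hE).2.2.2.1
          push_cast at this
          nlinarith
        · intro E hE
          rw [mem_filter] at hE ⊢
          exact ⟨hE.1, hE.2.1⟩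
    _ ≤ _ := by
        rw [← sum_mul]
        refine mul_le_mul_of_nonneg_right ((sum_pow_card_le n hx h0).trans ?_) (Real.exp_nonneg _)
        refine mul_le_mul_of_nonneg_left (Real.exp_le_exp.2 ?_) (by positivity)
        refine mul_le_mul_of_nonneg_right ?_ (by positivity)
        have h2 : Fintype.card (Sym2 V) ≤ Fintype.card (V × V) :=
          Fintype.card_le_of_surjective _ Sym2.mk_surjective
        rw [Fintype.card_prod, ← hn] at h2
        rw [pow_two]
        exact_mod_cast h2

lemma ex_not_traversed_le {p : ℝ} (h0 : 0 ≤ p) (h1 : p ≤ 1) (G : SimpleGraph V) (m : ℕ) {x : ℝ}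
    (hx : 1 ≤ x) :
    ex p (fun ω => ind (¬ Traversed G (graphOf ω) m)) ≤ 2 ^ Fintype.card V *
      (x ^ Fintype.card V * Real.exp ((Fintype.card V : ℝ) ^ 2 * (p / x)) *
        Real.exp (-p * ((m : ℝ) ^ 2 / 2))) := by
  classical
  let C : Finset (Finset V) := univ.filter fun W => Expands G W m
  calc _ ≤ ex p (fun ω => ind (∃ W ∈ C, ¬ ∃ l, IsOrd W l ∧ l.IsChain (G ⊔ graphOf ω).Adj)) := by
        refine ex_mono h0 h1 fun ω => ind_mono fun h => ?_
        simp only [Traversed, not_forall] at h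
        obtain ⟨W, hW, h⟩ := h
        exact ⟨W, mem_filter.2 ⟨mem_univ _, hW⟩, h⟩
    _ ≤ ∑ W ∈ C, _ := (ex_exists_le_sum h0 h1 C _).trans (sum_le_sum fun W hW =>
        ex_not_isChain_le h0 h1 hx (mem_filter.1 hW).2)
    _ ≤ _ := by
        rw [sum_const, nsmul_eq_mul]
        have : 0 ≤ x := by linarith
        refine mul_le_mul_of_nonneg_right ?_ (by positivity)
        have h2 := card_le_univ C
        rw [Fintype.card_finset] at h2
        exact_mod_cast h2

end Ham

section Linking

variable {V ι : Type*} [Fintype V] [DecidableEq V] [Fintype ι] [DecidableEq ι]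
variable {H Hb : SimpleGraph V} {Y : ι → ℕ → V} {ℓ : ℕ} {gp : ι → Bool × ℕ}

lemma wireNb_anti {D D' : Finset V} (h : D ⊆ D') (x : V × Bool) :
    wireNb H Y ℓ gp D' x ⊆ wireNb H Y ℓ gp D x := by
  intro S hS
  obtain ⟨h1, i, h2, h3, h4, h5⟩ := mem_wireNb.1 hS
  exact mem_wireNb.2 ⟨h1, i, h2, h3, h4, fun hh => h5 (h hh)⟩

/-- Outside a small set of vertices, all sets have many neighbouring wires. -/
theorem exists_linkable {m u₀ h K u : ℕ} {a : ℕ → ℕ}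
    (hexp : ∀ (b : Bool) (U D : Finset V), u₀ ≤ U.card → U.card ≤ 3 * m → D.card ≤ 2 * U.card →
      64 * U.card < ((U ×ˢ {b}).biUnion (wireNb H Y ℓ gp D)).card)
    (hm : 1 ≤ m) (hpow : m ≤ 2 ^ h) (hu₀ : 8 * u₀ ≤ m) (ha : a 0 ≤ m)
    (hlevel : ∀ b j, j < K → ∀ (A : Finset V) (D : Finset ι), a j ≤ A.card → D.card ≤ u →
      a (j + 1) ≤ (exits H Y ℓ gp b (j + 1) A D).card)
    (hjoin : Joined H (a K)) :
    ∃ Bad : Finset V, Bad.card ≤ 2 * u₀ ∧ Linkable H Y ℓ gp Bad m (10 * m) h K u a := by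
  let F : Finset (Finset (V × Bool)) := univ.filter fun U => U.card ≤ 3 * m ∧
    (U.biUnion (wireNb H Y ℓ gp (U.image Prod.fst))).card ≤ 32 * U.card
  obtain ⟨Us, hUs, hmax⟩ := exists_max_image F card ⟨∅, by simp [F]⟩
  obtain ⟨-, h1, h2⟩ := mem_filter.1 hUs
  set Bad := Us.image Prod.fst with hBad
  have hBU : Bad.card ≤ Us.card := card_image_le
  have hsmall : Us.card ≤ 2 * u₀ := by
    by_contra! hcon
    obtain ⟨b, hb⟩ : ∃ b, Us.card ≤ 2 * (Us.filter fun x => x.2 = b).card := by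
      by_contra! hall
      have e1 := hall true
      have e2 := hall false
      have e3 := card_filter_add_card_filter_not (s := Us) (fun x => x.2 = true)
      have e4 : Us.filter (fun x => ¬ x.2 = true) = Us.filter fun x => x.2 = false :=
        filter_congr fun x _ => by simp
      rw [e4] at e3
      omega
    have hcard : ((Us.filter fun x => x.2 = b).image Prod.fst).card =
        (Us.filter fun x => x.2 = b).card := by
      refine card_image_of_injOn fun x hx y hy hxy => Prod.ext hxy ?_
      rw [(mem_filter.1 hx).2, (mem_filter.1 hy).2]
    have hle := card_le_card (filter_subset (fun x => x.2 = b) Us)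
    have h3 := hexp b ((Us.filter fun x => x.2 = b).image Prod.fst) Bad
      (by omega) (by omega) (by omega)
    have h4 : ((Us.filter fun x => x.2 = b).image Prod.fst ×ˢ {b}).biUnion (wireNb H Y ℓ gp Bad) ⊆
        Us.biUnion (wireNb H Y ℓ gp Bad) := by
      refine biUnion_subset_biUnion_of_subset_left _ ?_
      rintro ⟨x, b'⟩ hx
      rw [mem_product, mem_singleton] at hx
      obtain ⟨⟨y, hy, rfl⟩, rfl⟩ := And.imp_left mem_image.1 hx
      have := mem_filter.1 hy
      have hyb : y = (y.1, b') := Prod.ext rfl this.2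
      exact hyb ▸ this.1
    have h5 := card_le_card h4
    omega
  have key : ∀ U : Finset (V × Bool), U.card ≤ 2 * m → (∀ x ∈ U, x.1 ∉ Bad) → U.Nonempty →
      32 * U.card < (U.biUnion (wireNb H Y ℓ gp Bad)).card := by
    intro U hU hUB hne
    have hdis : Disjoint Us U := by
      rw [disjoint_left]
      exact fun x hx hx' => hUB x hx' (mem_image_of_mem _ hx)
    have hc := card_union_of_disjoint hdis
    have hpos := hne.card_pos
    have hnot : Us ∪ U ∉ F := fun hF => by
      have := hmax _ hF
      omega
    have h3 : 32 * (Us ∪ U).card <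
        ((Us ∪ U).biUnion (wireNb H Y ℓ gp ((Us ∪ U).image Prod.fst))).card := by
      by_contra! hcon
      exact hnot (mem_filter.2 ⟨mem_univ _, by omega, hcon⟩)
    have h4 : (Us ∪ U).biUnion (wireNb H Y ℓ gp ((Us ∪ U).image Prod.fst)) ⊆
        Us.biUnion (wireNb H Y ℓ gp Bad) ∪ U.biUnion (wireNb H Y ℓ gp Bad) := by
      rw [← union_biUnion]
      exact biUnion_mono fun x _ =>
        wireNb_anti (image_subset_image subset_union_left) x
    have h5 := (card_le_card h4).trans (card_union_le _ _)
    omega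
  refine ⟨Bad, by omega, hm, hpow, ?_, ?_, ha, hlevel, hjoin⟩
  · intro U hU
    have hs : ∑ x ∈ U, (if x.1 ∈ Bad then 0 else 3) = 3 * (U.filter fun x => x.1 ∉ Bad).card := by
      rw [card_filter, mul_sum]
      refine sum_congr rfl fun x _ => ?_
      by_cases hx : x.1 ∈ Bad <;> simp [hx]
    rw [hs]
    have hsub := filter_subset (fun x : V × Bool => x.1 ∉ Bad) U
    rcases (U.filter fun x => x.1 ∉ Bad).eq_empty_or_nonempty with he | hne
    · simp [he]
    · have h3 := key _ ((card_le_card hsub).trans hU)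
        (fun x hx => (mem_filter.1 hx).2) hne
      have h4 := card_le_card
        (biUnion_subset_biUnion_of_subset_left (wireNb H Y ℓ gp Bad) hsub)
      omega
  · intro U hmU hU
    have hsub := filter_subset (fun x : V × Bool => x.1 ∉ Bad) U
    have h3 : U.card ≤ (U.filter fun x => x.1 ∉ Bad).card + 2 * Bad.card := by
      rw [← card_filter_add_card_filter_not (s := U) (fun x => x.1 ∉ Bad)]
      refine Nat.add_le_add_left ?_ _
      have : U.filter (fun x => ¬ x.1 ∉ Bad) ⊆ Bad ×ˢ univ := fun x hx => by
        rw [mem_product]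
        exact ⟨not_not.1 (mem_filter.1 hx).2, mem_univ _⟩
      have := card_le_card this
      rw [card_product, card_univ, Fintype.card_bool] at this
      omega
    have hne : (U.filter fun x => x.1 ∉ Bad).Nonempty := by
      rw [← card_pos]
      omega
    have h4 := key _ ((card_le_card hsub).trans hU)
      (fun x hx => (mem_filter.1 hx).2) hne
    have h5 := card_le_card
      (biUnion_subset_biUnion_of_subset_left (wireNb H Y ℓ gp Bad) hsub)
    omega

/-- The entries of wires in `R` whose exits avoid `D`. -/
def slots (Y : ι → ℕ → V) (ℓ : ℕ) (b : Bool) (R : Finset ι) (D : Finset V) : Finset V :=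
  ((R ×ˢ Ico 1 ℓ).filter fun e => exit Y b e.1 e.2 ∉ D).image fun e => enter Y b e.1 e.2

lemma mem_slots {b : Bool} {R : Finset ι} {D : Finset V} {x : V} : x ∈ slots Y ℓ b R D ↔
    ∃ S ∈ R, ∃ i, 1 ≤ i ∧ i < ℓ ∧ exit Y b S i ∉ D ∧ enter Y b S i = x := by
  simp only [slots, mem_image, mem_filter, mem_product, mem_Ico,
    Prod.exists]
  constructor
  · rintro ⟨S, i, ⟨⟨h1, h2, h3⟩, h4⟩, h5⟩
    exact ⟨S, h1, i, h2, h3, h4, h5⟩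
  · rintro ⟨S, h1, i, h2, h3, h4, h5⟩
    exact ⟨S, i, ⟨⟨h1, h2, h3⟩, h4⟩, h5⟩

lemma card_slots (hY : Wires Hb Y ℓ) (b : Bool) (R : Finset ι) (D : Finset V) :
    R.card * (ℓ - 1) ≤ (slots Y ℓ b R D).card + D.card := by
  have h0 : R.card * (ℓ - 1) = (R ×ˢ Ico 1 ℓ).card := by
    rw [card_product, Nat.card_Ico]
  have hinj : ∀ (s t : ℕ → ℕ), (∀ i, 1 ≤ i → i < ℓ → s i < ℓ) →
      (∀ i j, 1 ≤ i → 1 ≤ j → s i = s j → i = j) →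
      Set.InjOn (fun e : ι × ℕ => Y e.1 (s e.2)) ↑(R ×ˢ Ico 1 ℓ) := by
    rintro s - hs hs' ⟨S, i⟩ h1 ⟨S', i'⟩ h2 h3
    simp only [coe_product, coe_Ico, Set.mem_prod, mem_coe, Set.mem_Ico]
      at h1 h2
    obtain ⟨h4, h5⟩ := hY.inj _ _ _ _ (hs i h1.2.1 h1.2.2) (hs i' h2.2.1 h2.2.2) h3
    exact Prod.ext h4 (hs' _ _ h1.2.1 h2.2.1 h5)
  have i1 := hinj id id (fun i _ h => h) (fun i j _ _ h => h)
  have i2 := hinj (· - 1) id (fun i _ h => by omega)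
    (fun i j _ _ h => by omega)
  have hen : Set.InjOn (fun e : ι × ℕ => enter Y b e.1 e.2) ↑(R ×ˢ Ico 1 ℓ) := by
    cases b
    · simpa [enter] using i2
    · simpa [enter] using i1
  have hex : Set.InjOn (fun e : ι × ℕ => exit Y b e.1 e.2) ↑(R ×ˢ Ico 1 ℓ) := by
    cases b
    · simpa [exit] using i1
    · simpa [exit] using i2
  rw [h0, slots, card_image_of_injOn (hen.mono (coe_subset.2 (filter_subset _ _))),
    ← card_filter_add_card_filter_not (s := R ×ˢ Ico 1 ℓ)
      (fun e => exit Y b e.1 e.2 ∉ D)]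
  refine Nat.add_le_add_left ?_ _
  refine card_le_card_of_injOn (fun e => exit Y b e.1 e.2) ?_
    (hex.mono (coe_subset.2 (filter_subset _ _)))
  intro e he
  exact not_not.1 (mem_filter.1 he).2

lemma ex_exits_lt_le (hY : Wires Hb Y ℓ) {p : ℝ} (h0 : 0 ≤ p) (h1 : p ≤ 1) (b : Bool)
    {j a a' u γ g : ℕ} (hγ : γ ≤ (univ.filter fun S => gp S = (b, j)).card)
    (hg : g + a + a' + u * (ℓ - 1) ≤ γ * (ℓ - 1)) {x : ℝ} (hx : 1 ≤ x) :
    ex p (fun ω => ind (¬ ∀ (A : Finset V) (D : Finset ι), a ≤ A.card → D.card ≤ u →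
      a' ≤ (exits (graphOf ω) Y ℓ gp b j A D).card)) ≤
      x ^ (a + a') * Real.exp (2 * (Fintype.card V / x)) * 2 ^ Fintype.card ι *
        Real.exp (-p * (a * g : ℕ)) := by
  let C₀ : ℕ → Finset (Finset V) := fun J => univ.filter (·.card ≤ J)
  let C : Finset (Finset V × Finset ι × Finset V) :=
    (C₀ a ×ˢ univ ×ˢ C₀ a').filter fun c => c.1.card = a ∧ c.2.1.card ≤ u
  let R : Finset ι → Finset ι := fun D => (univ.filter fun S => gp S = (b, j)) \ D
  refine (ex_mono h0 h1 fun ω => ind_mono ?_).trans ((ex_exists_no_edges_le h0 h1 C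
    Prod.fst (fun c => slots Y ℓ b (R c.2.1) c.2.2) (a * g) ?_).trans ?_)
  · intro h
    push Not at h
    obtain ⟨A, D, hA, hD, h⟩ := h
    obtain ⟨A', hA', hc⟩ := exists_subset_card_eq hA
    have hsub : exits (graphOf ω) Y ℓ gp b j A' D ⊆ exits (graphOf ω) Y ℓ gp b j A D := by
      intro z hz
      obtain ⟨v, hv, hz⟩ := mem_exits.1 hz
      exact mem_exits.2 ⟨v, hA' hv, hz⟩
    refine ⟨(A', D, exits (graphOf ω) Y ℓ gp b j A' D), ?_, ?_⟩
    · simp only [C, C₀, mem_filter, mem_product, mem_univ, true_and]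
      exact ⟨⟨hc.le, (card_le_card hsub).trans h.le⟩, hc, hD⟩
    · rintro v hv z hz hadj
      obtain ⟨S, hS, i, h2, h3, h4, rfl⟩ := mem_slots.1 hz
      simp only [R, mem_sdiff, mem_filter, mem_univ, true_and] at hS
      exact h4 (mem_exits.2 ⟨v, hv, S, hS.2, hS.1, i, ⟨h2, h3, hadj, notMem_empty _⟩, rfl⟩)
  · rintro ⟨A, D, M⟩ hc
    simp only [C, C₀, mem_filter, mem_product, mem_univ, true_and] at hc
    obtain ⟨⟨-, hM⟩, hA, hD⟩ := hc
    dsimp only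
    rw [hA]
    refine Nat.mul_le_mul_left _ ?_
    have e1 := card_slots hY b (R D) M
    have e2 : γ ≤ (R D).card + u := by
      have := le_card_sdiff D (univ.filter fun S => gp S = (b, j))
      simp only [R]
      omega
    have e3 := le_card_sdiff A (slots Y ℓ b (R D) M)
    have e4 := Nat.mul_le_mul_right (ℓ - 1) e2
    rw [add_mul] at e4
    omega
  · refine mul_le_mul_of_nonneg_right ?_ (Real.exp_nonneg _)
    have e1 := card_filter_card_le (α := V) a hx
    have e2 := card_filter_card_le (α := V) a' hx
    have e3 : (C.card : ℝ) ≤ (C₀ a).card * (2 ^ Fintype.card ι * (C₀ a').card) := by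
      have := card_filter_le (C₀ a ×ˢ (univ : Finset (Finset ι)) ×ˢ C₀ a')
        fun c => c.1.card = a ∧ c.2.1.card ≤ u
      rw [card_product, card_product, card_univ, Fintype.card_finset] at this
      exact_mod_cast this
    refine e3.trans ((mul_le_mul e1 (mul_le_mul_of_nonneg_left e2 (by positivity)) (by positivity)
      (by positivity)).trans (le_of_eq ?_))
    rw [pow_add, two_mul, Real.exp_add]
    ring

lemma ex_wireNb_le (hY : Wires Hb Y ℓ) {p : ℝ} (h0 : 0 ≤ p) (h1 : p ≤ 1) (b : Bool)
    {s γ g : ℕ} (hγ : γ ≤ (univ.filter fun S => gp S = (b, 0)).card)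
    (hg : g + 3 * s + 64 * s * (ℓ - 1) ≤ γ * (ℓ - 1)) {x : ℝ} (hx : 1 ≤ x)
    (hι : Fintype.card ι ≤ Fintype.card V) (hs : Fintype.card V / x ≤ s) :
    ex p (fun ω => ind (∃ U D : Finset V, U.card = s ∧ D.card ≤ 2 * s ∧
      ((U ×ˢ {b}).biUnion (wireNb (graphOf ω) Y ℓ gp D)).card ≤ 64 * s)) ≤
      (x ^ 67 * Real.exp (3 - p * g)) ^ s := by
  let C₀ : ℕ → Finset (Finset V) := fun J => univ.filter (·.card ≤ J)
  let C₁ : Finset (Finset ι) := univ.filter (·.card ≤ 64 * s)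
  let C : Finset (Finset V × Finset V × Finset ι) :=
    (C₀ s ×ˢ C₀ (2 * s) ×ˢ C₁).filter fun c => c.1.card = s
  let R : Finset ι → Finset ι := fun D => (univ.filter fun S => gp S = (b, 0)) \ D
  refine (ex_mono h0 h1 fun ω => ind_mono ?_).trans ((ex_exists_no_edges_le h0 h1 C
    Prod.fst (fun c => slots Y ℓ b (R c.2.2) c.2.1) (s * g) ?_).trans ?_)
  · rintro ⟨U, D, hU, hD, h⟩
    refine ⟨(U, D, (U ×ˢ {b}).biUnion (wireNb (graphOf ω) Y ℓ gp D)), ?_, ?_⟩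
    · simp only [C, C₀, C₁, mem_filter, mem_product, mem_univ, true_and]
      exact ⟨⟨hU.le, hD, h⟩, hU⟩
    · rintro v hv z hz hadj
      obtain ⟨S, hS, i, h2, h3, h4, rfl⟩ := mem_slots.1 hz
      simp only [R, mem_sdiff, mem_filter, mem_univ, true_and] at hS
      exact hS.2 (mem_biUnion.2 ⟨(v, b), by simpa using hv,
        mem_wireNb.2 ⟨hS.1, i, h2, h3, hadj, h4⟩⟩)
  · rintro ⟨U, D, M⟩ hc
    simp only [C, C₀, C₁, mem_filter, mem_product, mem_univ, true_and] at hc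
    obtain ⟨⟨-, hD, hM⟩, hU⟩ := hc
    dsimp only
    rw [hU]
    refine Nat.mul_le_mul_left _ ?_
    have e1 := card_slots hY b (R M) D
    have e2 : γ ≤ (R M).card + 64 * s := by
      have := le_card_sdiff M (univ.filter fun S => gp S = (b, 0))
      simp only [R]
      omega
    have e3 := le_card_sdiff U (slots Y ℓ b (R M) D)
    have e4 := Nat.mul_le_mul_right (ℓ - 1) e2
    rw [add_mul] at e4
    omega
  · have e1 := card_filter_card_le (α := V) s hx
    have e2 := card_filter_card_le (α := V) (2 * s) hx
    have e3 := card_filter_card_le (α := ι) (64 * s) hx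
    have e4 : (C.card : ℝ) ≤ (C₀ s).card * ((C₀ (2 * s)).card * C₁.card) := by
      have := card_filter_le (C₀ s ×ˢ C₀ (2 * s) ×ˢ C₁) fun c => c.1.card = s
      rw [card_product, card_product] at this
      exact_mod_cast this
    have e5 : Real.exp (Fintype.card V / x) ≤ Real.exp s := Real.exp_le_exp.2 hs
    have e6 : Real.exp (Fintype.card ι / x) ≤ Real.exp s := by
      refine Real.exp_le_exp.2 (le_trans ?_ hs)
      have : (Fintype.card ι : ℝ) ≤ Fintype.card V := by exact_mod_cast hι
      gcongr
    have e7 : (C.card : ℝ) ≤ x ^ s * Real.exp s * (x ^ (2 * s) * Real.exp s *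
        (x ^ (64 * s) * Real.exp s)) := by
      refine e4.trans ?_
      gcongr
      · exact e1.trans (by gcongr)
      · exact e2.trans (by gcongr)
      · exact e3.trans (by gcongr)
    refine (mul_le_mul_of_nonneg_right e7 (Real.exp_nonneg _)).trans (le_of_eq ?_)
    rw [mul_pow, ← pow_mul, ← Real.exp_nat_mul,
      show (s : ℝ) * (3 - p * g) = s + s + s + -p * (s * g : ℕ) by push_cast; ring,
      Real.exp_add, Real.exp_add, Real.exp_add,
      show 67 * s = s + 2 * s + 64 * s by ring, pow_add, pow_add]
    ring

end Linking

section Glue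

variable {V : Type*} [Fintype V] [DecidableEq V]

lemma sum_Icc_pow_le {ρ : ℝ} (h0 : 0 ≤ ρ) (h1 : ρ ≤ 1 / 2) {a b : ℕ} (ha : 1 ≤ a) :
    ∑ s ∈ Icc a b, ρ ^ s ≤ 2 * ρ := by
  have h2 : ∀ k, ∑ s ∈ Icc 1 k, ρ ^ s + ρ ^ k * ρ * 2 ≤ 2 * ρ := by
    intro k
    induction k with
    | zero => simp; linarith
    | succ k ih =>
      rw [sum_Icc_succ_top (by omega)]
      have := pow_nonneg h0 k
      have h3 : 0 ≤ ρ ^ k * ρ := mul_nonneg this h0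
      rw [pow_succ]
      nlinarith
  have h3 : ∑ s ∈ Icc a b, ρ ^ s ≤ ∑ s ∈ Icc 1 b, ρ ^ s :=
    sum_le_sum_of_subset_of_nonneg (Icc_subset_Icc_left ha)
      fun _ _ _ => pow_nonneg h0 _
  have h4 : 0 ≤ ρ ^ b * ρ * 2 := by positivity
  linarith [h2 b]

/-- A random graph links the wires. -/
theorem ex_not_linkable_le {ι : Type*} [Fintype ι] [DecidableEq ι] {Hb : SimpleGraph V}
    {Y : ι → ℕ → V} {ℓ : ℕ} {gp : ι → Bool × ℕ} (hY : Wires Hb Y ℓ) {p : ℝ} (h0 : 0 ≤ p)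
    (h1 : p ≤ 1) {m u₀ h K u γ g₀ g : ℕ} {a : ℕ → ℕ} {x x' ρ e : ℝ}
    (hι : Fintype.card ι ≤ Fintype.card V)
    (hγ : ∀ b j, j ≤ K → γ ≤ (univ.filter fun S => gp S = (b, j)).card)
    (hg₀ : g₀ + 9 * m + 192 * m * (ℓ - 1) ≤ γ * (ℓ - 1))
    (hx : 1 ≤ x) (hu₀ : 1 ≤ u₀) (hxu : Fintype.card V / x ≤ u₀)
    (hρ : x ^ 67 * Real.exp (3 - p * g₀) ≤ ρ) (hρ2 : ρ ≤ 1 / 2)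
    (hm : 1 ≤ m) (hpow : m ≤ 2 ^ h) (hum : 8 * u₀ ≤ m) (ha : a 0 ≤ m)
    (hg : ∀ j < K, g + a j + a (j + 1) + u * (ℓ - 1) ≤ γ * (ℓ - 1)) (hx' : 1 ≤ x')
    (he : ∀ j < K, x' ^ (a j + a (j + 1)) * Real.exp (2 * (Fintype.card V / x')) *
      2 ^ Fintype.card ι * Real.exp (-p * (a j * g : ℕ)) ≤ e) :
    ex p (fun ω => ind (¬ ∃ Bad : Finset V, Bad.card ≤ 2 * u₀ ∧
      Linkable (graphOf ω) Y ℓ gp Bad m (10 * m) h K u a)) ≤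
      4 * ρ + 2 * K * e + 4 ^ Fintype.card V * Real.exp (-p * (a K * a K : ℕ)) := by
  have hρ0 : 0 ≤ ρ := le_trans (by positivity) hρ
  let C₁ : Finset (Bool × ℕ) := univ ×ˢ Icc u₀ (3 * m)
  let C₂ : Finset (Bool × ℕ) := univ ×ˢ range K
  let P₁ : Bool × ℕ → ({e : Sym2 V // ¬ e.IsDiag} → Bool) → Prop := fun c ω =>
    ∃ U D : Finset V, U.card = c.2 ∧ D.card ≤ 2 * c.2 ∧
      ((U ×ˢ {c.1}).biUnion (wireNb (graphOf ω) Y ℓ gp D)).card ≤ 64 * c.2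
  let P₂ : Bool × ℕ → ({e : Sym2 V // ¬ e.IsDiag} → Bool) → Prop := fun c ω =>
    ¬ ∀ (A : Finset V) (D : Finset ι), a c.2 ≤ A.card → D.card ≤ u →
      a (c.2 + 1) ≤ (exits (graphOf ω) Y ℓ gp c.1 (c.2 + 1) A D).card
  have hsub : ∀ ω, ind (¬ ∃ Bad : Finset V, Bad.card ≤ 2 * u₀ ∧
      Linkable (graphOf ω) Y ℓ gp Bad m (10 * m) h K u a) ≤
      ind (∃ c ∈ C₁, P₁ c ω) + ind (∃ c ∈ C₂, P₂ c ω) + ind (¬ Joined (graphOf ω) (a K)) := by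
    intro ω
    refine (ind_mono fun hneg => ?_).trans ((ind_or_le _ _).trans
      (add_le_add_left (ind_or_le _ _) _))
    by_contra hcon
    simp only [not_or, not_not] at hcon
    obtain ⟨⟨c1, c2⟩, c3⟩ := hcon
    refine hneg (exists_linkable ?_ hm hpow hum ha ?_ c3)
    · intro b U D hU hU' hD
      by_contra! hc
      exact c1 ⟨(b, U.card), by simp [C₁, hU, hU'], U, D, rfl, hD, hc⟩
    · intro b j hj
      by_contra hc
      exact c2 ⟨(b, j), by simp [C₂, hj], hc⟩
  refine (ex_mono h0 h1 hsub).trans ?_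
  rw [ex_add, ex_add]
  refine add_le_add (add_le_add ?_ ?_) (ex_not_joined_le h0 h1 _)
  · refine (ex_exists_le_sum h0 h1 C₁ P₁).trans ?_
    have hb : ∀ c ∈ C₁, ex p (fun ω => ind (P₁ c ω)) ≤ ρ ^ c.2 := by
      rintro ⟨b, s⟩ hs
      simp only [C₁, mem_product, mem_univ, true_and, mem_Icc] at hs
      refine (ex_wireNb_le hY h0 h1 b (hγ b 0 (Nat.zero_le _)) (g := g₀) ?_ hx hι ?_).trans ?_
      · dsimp only
        have : 64 * s * (ℓ - 1) ≤ 192 * m * (ℓ - 1) := Nat.mul_le_mul_right _ (by omega)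
        omega
      · exact hxu.trans (by exact_mod_cast hs.1)
      · exact pow_le_pow_left₀ (by positivity) hρ _
    refine (sum_le_sum hb).trans ?_
    rw [sum_product]
    have := sum_Icc_pow_le hρ0 hρ2 hu₀ (b := 3 * m)
    simp only [sum_const, card_univ, Fintype.card_bool, nsmul_eq_mul]
    push_cast
    linarith
  · refine (ex_exists_le_sum h0 h1 C₂ P₂).trans ?_
    have hb : ∀ c ∈ C₂, ex p (fun ω => ind (P₂ c ω)) ≤ e := by
      rintro ⟨b, j⟩ hj
      simp only [C₂, mem_product, mem_univ, true_and, mem_range] at hj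
      exact (ex_exits_lt_le hY h0 h1 b (hγ b (j + 1) (by omega)) (hg j hj) hx').trans (he j hj)
    refine (sum_le_sum hb).trans (le_of_eq ?_)
    simp [C₂]

/-- A combination of three graphs with pseudorandom properties contains every bounded degree tree
with many bare paths. -/
theorem containsCopy_of_spreads {A : Type*} [Fintype A] {T : SimpleGraph A}
    {Ha Hb Hc G : SimpleGraph V}
    {ι : Type} [Fintype ι] [DecidableEq ι] [Nonempty ι] {Y : ι → ℕ → V} {gp : ι → Bool × ℕ}
    {Bad : Finset V} {m d B h mc Bc hc K u k ℓ n b₀ Δ q J k₁ k₂ L M : ℕ} {a : ℕ → ℕ}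
    (ha : Ha ≤ G) (hb : Hb ≤ G) (hcG : Hc ≤ G) (hY : Wires Hb Y ℓ)
    (hL : Linkable Hc Y ℓ gp Bad mc Bc hc K u a) (hBad : Bad.card ≤ b₀)
    (hS : Spreads Ha (wireSet Y ℓ ∪ Bad) m d) (hH : Traversed Ha Hb m)
    (hm : 1 ≤ m) (hd : 6 ≤ d) (hmh : m ≤ 2 ^ h) (hV : Fintype.card V = n)
    (hA : Fintype.card A = n)
    (hBm : 2 * m * d + (B + 4 * 2 ^ h) + 3 * m ≤ n) (hT : T.IsTree) (hΔ : Δ + 4 ≤ d)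
    (hdeg : ∀ v, (T.neighborSet v).ncard ≤ Δ) (hℓ : 3 ≤ ℓ) (hK : 1 ≤ K) (hk : 3 ≤ k)
    (hBc : (n / k + 1 + b₀) * (2 * hc + 2) + 1 + 4 * 2 ^ hc ≤ Bc)
    (hu : (n / k + 1 + b₀) * (2 * K) ≤ u)
    (hι : Fintype.card ι = 2 * q * J) (hκ : 2 * q * (J + 1) = 2 ^ k₁)
    (hr : 2 * q = 2 ^ k₂) (hL1 : 1 ≤ L) (hM : 2 * q ≤ M) (hpaths : HasDisjBarePaths T L M)
    (hB₀ : 2 * q * J * ℓ + 3 * b₀ ≤ B)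
    (hB : 2 * q * J * ℓ + 3 * b₀ + n + 2 ^ k₁ * benesLen h k₁ +
      (2 * ((k + 2 * ℓ) + (2 * h + 3)) + 1) * (2 * q * (benesLen h k₂ + 1)) + 2 ^ k₁ * (2 * h + 2)
        ≤ B + 2 * q * (L - 1)) :
    ContainsCopy T G := by
  have hws : (wireSet Y ℓ).card ≤ 2 * q * J * ℓ := by
    have : wireSet Y ℓ ⊆ ((univ : Finset ι) ×ˢ range ℓ).image fun e => Y e.1 e.2 := by
      intro v hv
      obtain ⟨S, i, hi, rfl⟩ := mem_wireSet.1 hv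
      exact mem_image.2 ⟨(S, i), by simp [hi], rfl⟩
    refine (card_le_card this).trans (card_image_le.trans ?_)
    rw [card_product, card_univ, hι, card_range]
  set F := wireSet Y ℓ ∪ Bad with hF
  set S := Bad \ wireSet Y ℓ with hSdef
  have hFc : F.card ≤ 2 * q * J * ℓ + b₀ := (card_union_le _ _).trans (by omega)
  have hSc : S.card ≤ b₀ := (card_le_card sdiff_subset).trans hBad
  have hnb : ∀ U : Finset V, m ≤ U.card → n < (U.biUnion (nb Ha)).card + 3 * m := by
    intro U hU
    by_contra! hc
    obtain ⟨U', hU', hU'c⟩ := exists_subset_card_eq hU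
    set M' := univ \ (U'.biUnion (nb Ha) ∪ U') with hM'
    have h1 : (U'.biUnion (nb Ha)).card ≤ (U.biUnion (nb Ha)).card :=
      card_le_card (biUnion_subset_biUnion_of_subset_left _ hU')
    have h2 := card_union_le (U'.biUnion (nb Ha)) U'
    have h3 : M'.card + (U'.biUnion (nb Ha) ∪ U').card = n := by
      rw [hM', card_sdiff_add_card_eq_card (subset_univ _), card_univ, hV]
    obtain ⟨x, hx, y, hy, hxy⟩ := hS.joined U' M' hU'c.ge (by omega) (by
      rw [hM']
      exact disjoint_left.2 fun z hz hz' => (mem_sdiff.1 hz').2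
        (mem_union_right _ hz))
    exact (mem_sdiff.1 hy).2 (mem_union_left _
      (mem_biUnion.2 ⟨x, hx, mem_nb.2 hxy⟩))
  have hE : Expander Ha m d B h := ⟨hm, hd, hmh,
    fun U hU _ => by have := hnb U hU; omega, hS.joined⟩
  have hst : GSt Ha m d F (fun _ => d) := by
    refine ⟨fun U hU => ?_, fun _ => le_rfl, fun _ _ _ _ => le_rfl⟩
    rcases U.eq_empty_or_nonempty with rfl | hne
    · simp
    · rw [sum_const, smul_eq_mul, mul_comm]
      exact (hS.nbhd U hne hU).le.trans (card_le_card
        (sdiff_subset_sdiff le_rfl subset_union_left))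
  have hSF : S ⊆ F := sdiff_subset.trans subset_union_right
  obtain ⟨C, c', w, hBt, hC, hCd⟩ := GSt.cherries hE hst S hSF (fun v _ => by omega) (by omega)
  have hCc : (S.biUnion C).card ≤ 2 * b₀ := by
    refine card_biUnion_le.trans ((sum_le_card_nsmul S _ 2 fun v hv => ?_).trans ?_)
    · rw [(hC v hv).2.2.2]; exact card_le_two
    · rw [smul_eq_mul]; omega
  have hXc : (F ∪ S.biUnion C).card ≤ 2 * q * J * ℓ + 3 * b₀ :=
    (card_union_le _ _).trans (by omega)
  refine containsCopy_of_absorbs hE hT hA hV hΔ hdeg hBt.st hY hℓ (Λ := k + 2 * ℓ) ?_ ?_ ha hι hκ hr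
    hL1 hM hpaths (by omega)
  · intro T' i hi
    have h1 : Y T' i ∈ wireSet Y ℓ := mem_wireSet.2 ⟨T', i, hi, rfl⟩
    have h2 : Y T' i ∈ F := mem_union_left _ h1
    exact ⟨mem_union_left _ h2,
      (hBt.keep _ h2 fun h3 => (mem_sdiff.1 h3).2 h1).ge⟩
  · intro Z c'' hdisj hst'
    refine hL.absorbs hY ha hb hcG (by omega) hK hk C w hC hCd hBt.disj rfl hdisj ?_ ?_ ?_
    · obtain ⟨l, hl, hl'⟩ := hH (univ \ (F ∪ S.biUnion C ∪ Z)) (by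
        intro U hU hne hUm
        have h1 := hst'.good U (by omega)
        have h2 : U.biUnion (nb Ha) ∩ (univ \ (F ∪ S.biUnion C ∪ Z)) =
            U.biUnion (nb Ha) \ (F ∪ S.biUnion C ∪ Z) := by
          ext z; simp
        rw [h2]
        have h3 : ∀ u' ∈ U, 4 ≤ c'' u' := by
          intro u' hu'
          have h4 := hS.nbhd {u'} (singleton_nonempty _) (by rw [card_singleton]; omega)
          obtain ⟨s, hs⟩ := card_pos.1 (Nat.zero_lt_of_lt h4)
          have h5 := (mem_sdiff.1 hs).1
          rw [singleton_biUnion, mem_nb] at h5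
          have h6 := hst'.fresh s u' (mem_nb.2 h5.symm) (mem_sdiff.1 (hU hu')).2
          omega
        have h4 := card_nsmul_le_sum U c'' 4 h3
        have h5 := hne.card_pos
        rw [smul_eq_mul] at h4
        exact (show 3 * U.card < U.card * 4 by omega).trans_le (h4.trans h1))
      exact ⟨l, hl, hl'.imp fun x y hxy => (sup_le ha hb) hxy⟩
    · rw [hV]
      have : n / k + 1 + Bad.card ≤ n / k + 1 + b₀ := by omega
      have := Nat.mul_le_mul_right (2 * hc + 2) this
      omega
    · rw [hV]
      exact (Nat.mul_le_mul_right (2 * K) (by omega)).trans hu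

end Glue

lemma wt_graphOf {n : ℕ} (p : ℝ) (ω : {e : Sym2 (Fin n) // ¬ e.IsDiag} → Bool) :
    wt p ω = p ^ (graphOf ω).edgeSet.ncard *
      (1 - p) ^ (n.choose 2 - (graphOf ω).edgeSet.ncard) := by
  have h1 : (graphOf ω).edgeSet.ncard = (univ.filter fun e => ω e = true).card := by
    rw [← card_map (Embedding.subtype _), ← Set.ncard_coe_finset]
    congr 1
    ext e
    rw [mem_edgeSet_graphOf]
    simp
  have h2 : (univ.filter fun e => ω e = true).card +
      (univ.filter fun e => ¬ ω e = true).card = n.choose 2 := by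
    rw [card_filter_add_card_filter_not, card_univ, Sym2.card_subtype_not_diag,
      Fintype.card_fin]
  rw [wt, prod_ite, prod_const, prod_const, h1, ← h2, Nat.add_sub_cancel_left]

lemma graphOf_bijective {n : ℕ} :
    Bijective (graphOf : ({e : Sym2 (Fin n) // ¬ e.IsDiag} → Bool) → _) := by
  classical
  refine ⟨fun ω η h => ?_, fun G => ⟨fun e => decide (e.1 ∈ G.edgeSet), ?_⟩⟩
  · funext e
    have h1 : e.1 ∈ (graphOf ω).edgeSet ↔ e.1 ∈ (graphOf η).edgeSet := by rw [h]
    rw [mem_edgeSet_graphOf, mem_edgeSet_graphOf] at h1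
    have h2 : ω e = true ↔ η e = true :=
      ⟨fun h' => (h1.1 ⟨e.2, h'⟩).2, fun h' => (h1.2 ⟨e.2, h'⟩).2⟩
    exact Bool.eq_iff_iff.2 h2
  · rw [← SimpleGraph.edgeSet_inj]
    ext e
    rw [mem_edgeSet_graphOf]
    simp only [decide_eq_true_eq]
    exact ⟨fun ⟨_, h⟩ => h, fun h => ⟨G.not_isDiag_of_mem_edgeSet h, h⟩⟩

lemma probOf_eq_ex (n : ℕ) (p : ℝ) (P : SimpleGraph (Fin n) → Prop) :
    probOf n p P = ex p fun ω => ind (P (graphOf ω)) := by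
  rw [probOf, ex]
  refine (Fintype.sum_bijective graphOf graphOf_bijective _ _ fun ω => ?_).symm
  rw [wt_graphOf, ind]
  split_ifs <;> simp

lemma probOf_le_one {n : ℕ} {p : ℝ} (h0 : 0 ≤ p) (h1 : p ≤ 1) (P : SimpleGraph (Fin n) → Prop) :
    probOf n p P ≤ 1 := by
  rw [probOf_eq_ex]
  exact (ex_mono h0 h1 fun ω => ind_le_one _).trans_eq (ex_one p)

lemma card_groups {γ : ℕ} (b : Bool) {j : ℕ} (hj : j < 8) :
    (univ.filter fun S : Bool × Fin 8 × Fin γ => (S.1, (S.2.1 : ℕ)) = (b, j)).card = γ := by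
  have : (univ.filter fun S : Bool × Fin 8 × Fin γ => (S.1, (S.2.1 : ℕ)) = (b, j)) =
      univ.image fun i : Fin γ => (b, (⟨j, hj⟩ : Fin 8), i) := by
    ext ⟨b', j', i⟩
    simp only [mem_filter, mem_univ, true_and, Prod.mk.injEq, mem_image]
    constructor
    · rintro ⟨rfl, rfl⟩
      exact ⟨i, rfl, rfl, rfl⟩
    · rintro ⟨i', h1, h2, -⟩
      exact ⟨h1.symm, congrArg Fin.val h2.symm⟩
  rw [this, card_image_of_injective _ (fun i i' h => (Prod.mk.inj (Prod.mk.inj h).2).2),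
    card_univ, Fintype.card_fin]

/-- A lower bound for the probability of containing all bounded degree trees with many bare paths,
for explicit parameters. -/
theorem one_sub_le_probOf {n d m B h mc hc K u u₀ k ℓ Δ γ kb g₀ g q J k₁ k₂ L M : ℕ} {a : ℕ → ℕ}
    {p pa pb x x' xH ρ t e e₁ e₂ e₃ e₄ : ℝ}
    (hp : p = 1 - (1 - (1 - (1 - pb) * (1 - pb))) * (1 - pa))
    (hpa0 : 0 ≤ pa) (hpa1 : pa ≤ 1) (hpb0 : 0 ≤ pb) (hpb1 : pb ≤ 1)
    (hm : 1 ≤ m) (hd : 6 ≤ d) (hmh : m ≤ 2 ^ h)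
    (hBm : 2 * m * d + (B + 4 * 2 ^ h) + 3 * m ≤ n) (hΔ : Δ + 4 ≤ d) (hℓ : 3 ≤ ℓ)
    (hK : 1 ≤ K) (hK' : K ≤ 7) (hk : 3 ≤ k)
    (hBc : (n / k + 1 + 2 * u₀) * (2 * hc + 2) + 1 + 4 * 2 ^ hc ≤ 10 * mc)
    (hu : (n / k + 1 + 2 * u₀) * (2 * K) ≤ u)
    (hγ0 : 1 ≤ γ) (hι : 16 * γ = 2 * q * J) (hκ : 2 * q * (J + 1) = 2 ^ k₁) (hr : 2 * q = 2 ^ k₂)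
    (hL : 1 ≤ L) (hM : 2 * q ≤ M) (hB₀ : 2 * q * J * ℓ + 3 * (2 * u₀) ≤ B)
    (hB : 2 * q * J * ℓ + 3 * (2 * u₀) + n + 2 ^ k₁ * benesLen h k₁ +
      (2 * ((k + 2 * ℓ) + (2 * h + 3)) + 1) * (2 * q * (benesLen h k₂ + 1)) + 2 ^ k₁ * (2 * h + 2)
        ≤ B + 2 * q * (L - 1))
    (hkb : 16 * γ * ℓ + 2 * kb ≤ n)
    (hg₀ : g₀ + 9 * mc + 192 * mc * (ℓ - 1) ≤ γ * (ℓ - 1))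
    (hx : 1 ≤ x) (hu₀ : 1 ≤ u₀) (hxu : n / x ≤ u₀)
    (hρ : x ^ 67 * Real.exp (3 - pb * g₀) ≤ ρ) (hρ2 : ρ ≤ 1 / 2)
    (hmc : 1 ≤ mc) (hmch : mc ≤ 2 ^ hc) (hum : 8 * u₀ ≤ mc) (ha : a 0 ≤ mc)
    (hg : ∀ j < K, g + a j + a (j + 1) + u * (ℓ - 1) ≤ γ * (ℓ - 1)) (hx' : 1 ≤ x')
    (he : ∀ j < K, x' ^ (a j + a (j + 1)) * Real.exp (2 * (n / x')) *
      2 ^ (16 * γ) * Real.exp (-pb * (a j * g : ℕ)) ≤ e)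
    (hnp : 1 ≤ n * pa) (ht : t + (16 * γ * ℓ + 2 * u₀) + (d + 1) * (2 * m) ≤ n) (hxH : 1 ≤ xH)
    (he₁ : 4 ^ n * Real.exp (-pb * (kb * kb : ℕ)) ≤ e₁)
    (he₂ : 4 * ρ + 2 * K * e + 4 ^ n * Real.exp (-pb * (a K * a K : ℕ)) ≤ e₂)
    (he₃ : (Real.exp (n * ((n * pa) ^ d * Real.exp (1 - pa * t))) - 1) +
      4 ^ n * Real.exp (-pa * (m * m : ℕ)) ≤ e₃)
    (he₄ : 2 ^ n * (xH ^ n * Real.exp ((n : ℝ) ^ 2 * (pb / xH)) *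
      Real.exp (-pb * ((m : ℝ) ^ 2 / 2))) ≤ e₄) (he₂0 : 0 ≤ e₂) (he₃0 : 0 ≤ e₃) :
    1 - (e₁ + e₂ + e₃ + e₄) ≤ probOf n p fun G => ∀ T : SimpleGraph (Fin n), T.IsTree →
      (∀ v, (T.neighborSet v).ncard ≤ Δ) → (∃ M', M ≤ M' ∧ HasDisjBarePaths T L M') →
      ContainsCopy T G := by
  classical
  let ι := Bool × Fin 8 × Fin γ
  let gp : ι → Bool × ℕ := fun S => (S.1, (S.2.1 : ℕ))
  have hcard : Fintype.card ι = 16 * γ := by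
    simp only [ι, Fintype.card_prod, Fintype.card_bool, Fintype.card_fin]
    ring
  have : Nonempty ι := ⟨(true, 0, ⟨0, hγ0⟩)⟩
  have hn : Fintype.card (Fin n) = n := Fintype.card_fin n
  rw [probOf_eq_ex, hp]
  refine one_sub_le_ex hpb0 hpb1 hpb0 hpb1 hpa0 hpa1
    (fun ω => Joined (graphOf ω) kb)
    (fun ω η => ∃ (Y : ι → ℕ → Fin n) (Bad : Finset (Fin n)), Wires (graphOf ω) Y ℓ ∧
      Bad.card ≤ 2 * u₀ ∧ Linkable (graphOf η) Y ℓ gp Bad mc (10 * mc) hc K u a)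
    (fun ξ ω => Traversed (graphOf ξ) (graphOf ω) m)
    (fun ω η ξ => ∃ (Y : ι → ℕ → Fin n) (Bad : Finset (Fin n)), (Wires (graphOf ω) Y ℓ ∧
      Bad.card ≤ 2 * u₀ ∧ Linkable (graphOf η) Y ℓ gp Bad mc (10 * mc) hc K u a) ∧
      Spreads (graphOf ξ) (wireSet Y ℓ ∪ Bad) m d) ?_ ?_ ?_ ?_ he₂0 he₃0 ?_
  · refine (ex_not_joined_le hpb0 hpb1 kb).trans ?_
    rw [hn]; exact he₁
  · intro ω hω
    obtain ⟨Y, hY⟩ := exists_wires ι ℓ hω (by rw [hcard, hn]; exact hkb)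
    refine le_trans (ex_mono hpb0 hpb1 fun η => ind_mono fun hneg => ?_)
      ((ex_not_linkable_le hY (gp := gp) (a := a) (e := e) hpb0 hpb1 ?_ ?_ hg₀
        hx hu₀ ?_ hρ hρ2 hmc hmch hum ha hg
        hx' ?_).trans ?_)
    · rintro ⟨Bad, h1, h2⟩
      exact hneg ⟨Y, Bad, hY, h1, h2⟩
    · rw [hcard, hn]
      have : 16 * γ * 1 ≤ 16 * γ * ℓ := Nat.mul_le_mul_left _ (by omega)
      omega
    · intro b j hj
      exact (card_groups b (by omega)).ge
    · rw [hn]; exact hxu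
    · rw [hn, hcard]; exact he
    · rw [hn]; exact he₂
  · rintro ω η - ⟨Y, Bad, hY⟩
    refine le_trans (ex_mono hpa0 hpa1 fun ξ => ind_mono fun hneg hS => hneg ⟨Y, Bad, hY, hS⟩)
      ((ex_not_spreads_le hpa0 hpa1 (wireSet Y ℓ ∪ Bad) m d (t := t) ?_ ?_).trans ?_)
    · rw [hn]; exact hnp
    · have h1 : (wireSet Y ℓ).card ≤ 16 * γ * ℓ := by
        have : wireSet Y ℓ ⊆ ((univ : Finset ι) ×ˢ range ℓ).image
            fun e => Y e.1 e.2 := by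
          intro v hv
          obtain ⟨S, i, hi, rfl⟩ := mem_wireSet.1 hv
          exact mem_image.2 ⟨(S, i), by simp [hi], rfl⟩
        refine (card_le_card this).trans (card_image_le.trans ?_)
        rw [card_product, card_univ, hcard, card_range]
      have h2 : ((wireSet Y ℓ ∪ Bad).card : ℝ) ≤ 16 * γ * ℓ + 2 * u₀ := by
        exact_mod_cast (card_union_le _ _).trans (Nat.add_le_add h1 hY.2.1)
      rw [hn]
      linarith
    · rw [hn]; exact he₃
  · intro ξ
    refine (ex_not_traversed_le hpb0 hpb1 (graphOf ξ) m hxH).trans ?_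
    rw [hn]; exact he₄
  · rintro ω η ξ - - ⟨Y, Bad, ⟨hY, hBad, hLk⟩, hS⟩ hH T hT hdeg ⟨M', hM', hpaths⟩
    have hG : graphOf (fun a => (ω a || η a) || ξ a) = (graphOf ω ⊔ graphOf η) ⊔ graphOf ξ := by
      rw [← graphOf_or, ← graphOf_or]
    rw [hG]
    exact containsCopy_of_spreads le_sup_right (le_sup_left.trans le_sup_left)
      (le_sup_right.trans le_sup_left) hY hLk hBad hS hH hm hd hmh hn hn hBm hT hΔ hdeg hℓ hK hk hBc
      hu (hcard.trans hι) hκ hr hL (hM.trans hM') hpaths hB₀ hB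

open Real

lemma sq_prod_le {α β η δ : ℝ} (hα : 0 < α) (hα1 : α ≤ 1) (hβ : 0 < β) (hβ1 : β ≤ 1 / 128)
    (hη : 0 < η) (hη1 : η ≤ 1 / 128) (hδ : 0 < δ) (hδ1 : δ ≤ 1) (i j s t : Fin 3) :
    (α * β * η * δ) ^ 2 ≤ α ^ (i : ℕ) * β ^ (j : ℕ) * η ^ (s : ℕ) * δ ^ (t : ℕ) := by
  have hpow : ∀ {x : ℝ} (i : Fin 3), 0 < x → x ≤ 1 → x ^ 2 ≤ x ^ (i : ℕ) := fun i h0 h1 =>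
    pow_le_pow_of_le_one h0.le h1 (by omega)
  have h1 := hpow i hα hα1
  have h2 := hpow j hβ (hβ1.trans (by norm_num))
  have h3 := hpow s hη (hη1.trans (by norm_num))
  have h4 := hpow t hδ hδ1
  rw [mul_pow, mul_pow, mul_pow]
  gcongr

lemma benesLen_eq (h k : ℕ) : benesLen h k = 2 * k * gadgetLen h + 1 := by
  induction k with
  | zero => simp [benesLen]
  | succ k ih => rw [benesLen, ih]; ring

lemma two_pow_le_exp (N : ℕ) : (2 : ℝ) ^ N ≤ exp N := by
  rw [← mul_one (N : ℝ), exp_nat_mul]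
  exact pow_le_pow_left₀ (by norm_num) (by linarith [add_one_le_exp (1 : ℝ)]) N

lemma four_pow_mul_exp_le {N : ℕ} {s : ℝ} (h : 3 * N ≤ s) :
    4 ^ N * exp (-s) ≤ exp (-N) := by
  have h1 : (4 : ℝ) ^ N ≤ exp (2 * N) := by
    rw [show (4 : ℝ) = 2 * 2 by norm_num, mul_pow, two_mul, exp_add]
    have := two_pow_le_exp N
    gcongr
  calc 4 ^ N * exp (-s) ≤ exp (2 * N) * exp (-s) := by gcongr
    _ = exp (2 * N + -s) := (exp_add _ _).symm
    _ ≤ _ := exp_le_exp.2 (by linarith)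

/-- The orders of magnitude of the parameters, where `y ^ 4` is the logarithm of `n`. -/
structure Sized (n q J k₁ k₂ γ ℓ k mc hc u₀ m h : ℕ) (y α β η δ : ℝ) : Prop where
  α_pos : 0 < α
  α_le : α ≤ 1
  β_pos : 0 < β
  β_le : β ≤ 1 / 128
  η_pos : 0 < η
  η_le : η ≤ 1 / 128
  δ_pos : 0 < δ
  δ_le : δ ≤ 1
  big : 2 ^ 64 ≤ (α * β * η * δ) ^ 2 * y
  log_eq : log n = y ^ 4
  pow_le : y ^ 60 ≤ n
  log_le : 2 ^ 20 * log y ≤ (α * β * η * δ) ^ 2 * y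
  card_eq : 16 * γ = 2 * q * J
  two_pow_k₁ : 2 * q * (J + 1) = 2 ^ k₁
  two_pow_k₂ : 2 * q = 2 ^ k₂
  q_le : 2 * q * y ^ 36 ≤ α * n
  le_q : α * n ≤ 4 * q * y ^ 36
  J_le : (J : ℝ) + 1 ≤ y ^ 20
  le_J : y ^ 20 ≤ 2 * ((J : ℝ) + 1)
  le_ℓ : β * y ^ 16 ≤ ℓ
  ℓ_le : ℓ ≤ β * y ^ 16 + 1
  le_k : y ^ 22 ≤ k
  k_le : k ≤ y ^ 22 + 1
  mc_eq : mc = γ / 1024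
  le_hc : mc ≤ 2 ^ hc
  hc_le : 2 ^ hc ≤ 2 * mc
  le_u₀ : 1 ≤ u₀
  u₀_le : u₀ * y ^ 22 ≤ n
  m_le : m ≤ η * n
  le_m : η * n ≤ 2 * m
  le_h : m ≤ 2 ^ h
  h_le : 2 ^ h ≤ 2 * m

namespace Sized

variable {n q J k₁ k₂ γ ℓ k mc hc u₀ m h : ℕ} {y α β η δ : ℝ}

lemma y_nonneg (H : Sized n q J k₁ k₂ γ ℓ k mc hc u₀ m h y α β η δ) : 0 ≤ y := by
  by_contra! hy
  have h1 : (α * β * η * δ) ^ 2 * y ≤ 0 := mul_nonpos_of_nonneg_of_nonpos (sq_nonneg _) hy.le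
  have := H.big
  norm_num at this
  linarith

lemma le_mul_y (H : Sized n q J k₁ k₂ γ ℓ k mc hc u₀ m h y α β η δ) {w : ℝ}
    (hw : (α * β * η * δ) ^ 2 ≤ w) : 2 ^ 64 ≤ w * y :=
  H.big.trans (mul_le_mul_of_nonneg_right hw H.y_nonneg)

lemma mono_prod (H : Sized n q J k₁ k₂ γ ℓ k mc hc u₀ m h y α β η δ) (i j s t : Fin 3) :
    (α * β * η * δ) ^ 2 ≤ α ^ (i : ℕ) * β ^ (j : ℕ) * η ^ (s : ℕ) * δ ^ (t : ℕ) :=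
  sq_prod_le H.α_pos H.α_le H.β_pos H.β_le H.η_pos H.η_le H.δ_pos H.δ_le i j s t

lemma big_y (H : Sized n q J k₁ k₂ γ ℓ k mc hc u₀ m h y α β η δ) : 2 ^ 64 ≤ y := by
  simpa using H.le_mul_y (H.mono_prod 0 0 0 0)

lemma big_α (H : Sized n q J k₁ k₂ γ ℓ k mc hc u₀ m h y α β η δ) : 2 ^ 64 ≤ α * y := by
  simpa using H.le_mul_y (H.mono_prod 1 0 0 0)

lemma big_β (H : Sized n q J k₁ k₂ γ ℓ k mc hc u₀ m h y α β η δ) : 2 ^ 64 ≤ β * y := by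
  simpa using H.le_mul_y (H.mono_prod 0 1 0 0)

lemma y_pos (H : Sized n q J k₁ k₂ γ ℓ k mc hc u₀ m h y α β η δ) : 0 < y :=
  lt_of_lt_of_le (by norm_num) H.big_y

lemma one_le_pow (H : Sized n q J k₁ k₂ γ ℓ k mc hc u₀ m h y α β η δ) (i : ℕ) : 1 ≤ y ^ i :=
  one_le_pow₀ (le_trans (by norm_num) H.big_y)

lemma pow_mono (H : Sized n q J k₁ k₂ γ ℓ k mc hc u₀ m h y α β η δ) {i j : ℕ} (hij : i ≤ j) :
    y ^ i ≤ y ^ j :=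
  pow_le_pow_right₀ (le_trans (by norm_num) H.big_y) hij

lemma pow_le_n (H : Sized n q J k₁ k₂ γ ℓ k mc hc u₀ m h y α β η δ) {j : ℕ} (hj : j ≤ 60) :
    y ^ j ≤ n := (H.pow_mono hj).trans H.pow_le

lemma big_α_mul (H : Sized n q J k₁ k₂ γ ℓ k mc hc u₀ m h y α β η δ) : 2 ^ 64 ≤ α * y * y ^ 5 :=
  H.big_α.trans (le_mul_of_one_le_right (by linarith [H.big_α]) (H.one_le_pow 5))

lemma n_pos (H : Sized n q J k₁ k₂ γ ℓ k mc hc u₀ m h y α β η δ) : (0 : ℝ) < n :=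
  (pow_pos H.y_pos 60).trans_le H.pow_le

lemma n_eq (H : Sized n q J k₁ k₂ γ ℓ k mc hc u₀ m h y α β η δ) : (n : ℝ) = exp (y ^ 4) := by
  rw [← H.log_eq, exp_log H.n_pos]

lemma γ_le (H : Sized n q J k₁ k₂ γ ℓ k mc hc u₀ m h y α β η δ) :
    16 * (γ : ℝ) * y ^ 16 ≤ α * n := by
  have h1 : 16 * (γ : ℝ) = 2 * q * J := by exact_mod_cast H.card_eq
  refine le_of_mul_le_mul_right ?_ (pow_pos H.y_pos 20)
  have h3 : (0 : ℝ) ≤ J := Nat.cast_nonneg _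
  have h4 : 0 ≤ α * n := mul_nonneg H.α_pos.le H.n_pos.le
  calc 16 * (γ : ℝ) * y ^ 16 * y ^ 20 = 2 * q * y ^ 36 * J := by rw [h1]; ring
    _ ≤ α * n * J := mul_le_mul_of_nonneg_right H.q_le h3
    _ ≤ α * n * y ^ 20 := mul_le_mul_of_nonneg_left (by linarith [H.J_le]) h4

lemma le_γ (H : Sized n q J k₁ k₂ γ ℓ k mc hc u₀ m h y α β η δ) :
    α * n ≤ 128 * γ * y ^ 16 := by
  have h1 : 16 * (γ : ℝ) = 2 * q * J := by exact_mod_cast H.card_eq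
  refine le_of_mul_le_mul_right ?_ (pow_pos H.y_pos 20)
  have h4 : 0 ≤ α * n := mul_nonneg H.α_pos.le H.n_pos.le
  have h5 : 4 ≤ y ^ 20 := (le_trans (by norm_num) H.big_y).trans
    (le_self_pow₀ (H.one_le_pow 1 |>.trans_eq (pow_one y)) (by norm_num))
  have h6 : y ^ 20 ≤ 4 * J := by linarith [H.le_J]
  calc α * n * y ^ 20 ≤ α * n * (4 * J) := mul_le_mul_of_nonneg_left h6 h4
    _ ≤ 4 * q * y ^ 36 * (4 * J) := mul_le_mul_of_nonneg_right H.le_q (by positivity)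
    _ = 8 * (2 * q * J) * y ^ 16 * y ^ 20 := by ring
    _ = 128 * γ * y ^ 16 * y ^ 20 := by rw [← h1]; ring

lemma βy (H : Sized n q J k₁ k₂ γ ℓ k mc hc u₀ m h y α β η δ) : 2 ^ 64 ≤ β * y ^ 16 := by
  refine H.big_β.trans (mul_le_mul_of_nonneg_left ?_ H.β_pos.le)
  simpa using H.pow_mono (show 1 ≤ 16 by norm_num)

lemma one_le_ℓ (H : Sized n q J k₁ k₂ γ ℓ k mc hc u₀ m h y α β η δ) : 3 ≤ ℓ := by
  have h1 : (3 : ℝ) ≤ ℓ := le_trans (by norm_num) (H.βy.trans H.le_ℓ)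
  exact_mod_cast h1

lemma cast_ℓ_sub (H : Sized n q J k₁ k₂ γ ℓ k mc hc u₀ m h y α β η δ) :
    ((ℓ - 1 : ℕ) : ℝ) = ℓ - 1 := by
  rw [Nat.cast_sub (by have := H.one_le_ℓ; omega), Nat.cast_one]

/-- The total length of the wires of a group is linear. -/
lemma le_group (H : Sized n q J k₁ k₂ γ ℓ k mc hc u₀ m h y α β η δ) :
    α * β * n ≤ 256 * (γ * (ℓ - 1 : ℕ)) := by
  have h1 : β * y ^ 16 ≤ 2 * (ℓ - 1 : ℕ) := by
    have h1 := H.βy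
    norm_num at h1
    rw [H.cast_ℓ_sub]
    linarith [H.le_ℓ]
  refine le_of_mul_le_mul_right ?_ (pow_pos H.y_pos 16)
  calc α * β * n * y ^ 16 = (α * n) * (β * y ^ 16) := by ring
    _ ≤ (128 * γ * y ^ 16) * (2 * (ℓ - 1 : ℕ)) := by
        refine mul_le_mul H.le_γ h1 ?_ (by positivity)
        exact mul_nonneg H.β_pos.le (pow_pos H.y_pos 16).le
    _ = _ := by ring

lemma wires_le (H : Sized n q J k₁ k₂ γ ℓ k mc hc u₀ m h y α β η δ) :
    16 * (γ : ℝ) * ℓ ≤ 2 * (α * β * n) := by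
  have h1 : (ℓ : ℝ) ≤ 2 * (β * y ^ 16) := by
    have h1 := H.βy
    norm_num at h1
    linarith [H.ℓ_le]
  calc 16 * (γ : ℝ) * ℓ ≤ 16 * γ * (2 * (β * y ^ 16)) := by gcongr
    _ = 2 * β * (16 * γ * y ^ 16) := by ring
    _ ≤ 2 * β * (α * n) := mul_le_mul_of_nonneg_left H.γ_le (by have := H.β_pos; positivity)
    _ = _ := by ring

lemma mc_le (H : Sized n q J k₁ k₂ γ ℓ k mc hc u₀ m h y α β η δ) : 1024 * mc ≤ γ := by
  have := H.mc_eq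
  omega

lemma αn_big (H : Sized n q J k₁ k₂ γ ℓ k mc hc u₀ m h y α β η δ) {j : ℕ} (hj : j ≤ 59) :
    2 ^ 64 * y ^ j ≤ α * n := by
  calc 2 ^ 64 * y ^ j ≤ (α * y) * y ^ j :=
        mul_le_mul_of_nonneg_right H.big_α (pow_nonneg H.y_nonneg _)
    _ = α * y ^ (j + 1) := by ring
    _ ≤ α * n := mul_le_mul_of_nonneg_left (H.pow_le_n (by omega)) H.α_pos.le

lemma big_γ (H : Sized n q J k₁ k₂ γ ℓ k mc hc u₀ m h y α β η δ) : 2 ^ 57 ≤ γ := by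
  have h2 : (0 : ℝ) < y ^ 16 := pow_pos H.y_pos _
  have h1 : (2 ^ 64 : ℝ) * y ^ 16 ≤ 128 * γ * y ^ 16 := (H.αn_big (by norm_num)).trans H.le_γ
  have h3 := le_of_mul_le_mul_right h1 h2
  have h4 : (2 ^ 57 : ℝ) ≤ γ := by linarith
  exact_mod_cast h4

lemma γ_le_mc (H : Sized n q J k₁ k₂ γ ℓ k mc hc u₀ m h y α β η δ) : γ ≤ 2048 * mc := by
  have := H.mc_eq
  have := H.big_γ
  omega

lemma le_mc (H : Sized n q J k₁ k₂ γ ℓ k mc hc u₀ m h y α β η δ) :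
    α * n ≤ 2 ^ 18 * mc * y ^ 16 := by
  have h1 : (γ : ℝ) ≤ 2048 * mc := by exact_mod_cast H.γ_le_mc
  have h2 : (0 : ℝ) ≤ y ^ 16 := pow_nonneg H.y_nonneg _
  refine H.le_γ.trans (mul_le_mul_of_nonneg_right ?_ h2)
  norm_num
  linarith

lemma mc_le' (H : Sized n q J k₁ k₂ γ ℓ k mc hc u₀ m h y α β η δ) :
    2 ^ 14 * mc * y ^ 16 ≤ α * n := by
  have h1 : (1024 : ℝ) * mc ≤ γ := by exact_mod_cast H.mc_le
  have h2 : (0 : ℝ) ≤ y ^ 16 := pow_nonneg H.y_nonneg _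
  refine le_trans (mul_le_mul_of_nonneg_right ?_ h2) H.γ_le
  norm_num
  linarith

lemma exponent_le (H : Sized n q J k₁ k₂ γ ℓ k mc hc u₀ m h y α β η δ) {j : ℕ} (hj : 2 ^ j ≤ n) :
    (j : ℝ) ≤ 2 * y ^ 4 := by
  have h1 : (2 : ℝ) ^ j ≤ n := by exact_mod_cast hj
  have h2 := log_le_log (by positivity) h1
  rw [log_pow, H.log_eq] at h2
  have h3 := log_two_gt_d9
  have h4 : (0 : ℝ) ≤ j := Nat.cast_nonneg _
  nlinarith

lemma αβη_le (H : Sized n q J k₁ k₂ γ ℓ k mc hc u₀ m h y α β η δ) : α * β * n ≤ n / 128 := by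
  have h1 : α * β ≤ 1 * (1 / 128) := mul_le_mul H.α_le H.β_le H.β_pos.le zero_le_one
  have h2 := mul_le_mul_of_nonneg_right h1 H.n_pos.le
  linarith

lemma hc_exp_le (H : Sized n q J k₁ k₂ γ ℓ k mc hc u₀ m h y α β η δ) : (hc : ℝ) ≤ 2 * y ^ 4 := by
  refine H.exponent_le (H.hc_le.trans ?_)
  have h1 : 16 * (γ : ℝ) * 1 ≤ 16 * γ * ℓ := by
    refine mul_le_mul_of_nonneg_left ?_ (by positivity)
    have := H.one_le_ℓ
    exact_mod_cast (by omega : 1 ≤ ℓ)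
  have h2 := H.wires_le
  have h3 := H.αβη_le
  have h4 : (γ : ℝ) ≤ n := by linarith [H.n_pos, (Nat.cast_nonneg γ : (0 : ℝ) ≤ γ)]
  have h5 : γ ≤ n := by exact_mod_cast h4
  have := H.mc_le
  omega

lemma h_exp_le (H : Sized n q J k₁ k₂ γ ℓ k mc hc u₀ m h y α β η δ) : (h : ℝ) ≤ 2 * y ^ 4 := by
  refine H.exponent_le (H.h_le.trans ?_)
  have h2 : (m : ℝ) ≤ n / 128 := by
    have := mul_le_mul_of_nonneg_right H.η_le H.n_pos.le
    linarith [H.m_le]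
  have h4 : 2 * (m : ℝ) ≤ n := by linarith [H.n_pos]
  exact_mod_cast h4

lemma four_le (H : Sized n q J k₁ k₂ γ ℓ k mc hc u₀ m h y α β η δ) : 2 ^ 64 ≤ y ^ 4 :=
  H.big_y.trans (by simpa using H.pow_mono (show 1 ≤ 4 by norm_num))

lemma benesLen_le (H : Sized n q J k₁ k₂ γ ℓ k mc hc u₀ m h y α β η δ) {j : ℕ}
    (hj : 2 ^ j ≤ n) : (benesLen h j : ℝ) ≤ 40 * y ^ 12 := by
  have h1 := H.exponent_le hj
  have h2 := H.h_exp_le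
  have h3 := H.four_le
  have h0 : (0 : ℝ) ≤ h := Nat.cast_nonneg _
  have h5 : (1 : ℝ) ≤ y ^ 4 := le_trans (by norm_num) h3
  have h4 : (gadgetLen h : ℝ) ≤ 9 * (y ^ 4) ^ 2 := by
    rw [gadgetLen]
    push_cast
    nlinarith
  rw [benesLen_eq]
  push_cast
  calc 2 * (j : ℝ) * gadgetLen h + 1 ≤ 2 * (2 * y ^ 4) * (9 * (y ^ 4) ^ 2) + 1 * 1 * 1 := by
        gcongr
        norm_num
    _ ≤ 2 * (2 * y ^ 4) * (9 * (y ^ 4) ^ 2) + y ^ 4 * y ^ 4 * y ^ 4 := by gcongr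
    _ = 37 * y ^ 12 := by ring
    _ ≤ 40 * y ^ 12 := by
        have := H.one_le_pow 12
        linarith

lemma αn_le (H : Sized n q J k₁ k₂ γ ℓ k mc hc u₀ m h y α β η δ) : α * n ≤ n := by
  have := mul_le_mul_of_nonneg_right H.α_le H.n_pos.le
  linarith

lemma two_q_le (H : Sized n q J k₁ k₂ γ ℓ k mc hc u₀ m h y α β η δ) : 2 ^ k₂ ≤ n := by
  have h1 : 2 * (q : ℝ) ≤ n := by
    refine le_trans ?_ (H.q_le.trans H.αn_le)
    exact le_mul_of_one_le_right (by positivity) (H.one_le_pow _)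
  rw [← H.two_pow_k₂]
  exact_mod_cast h1

lemma routers_le (H : Sized n q J k₁ k₂ γ ℓ k mc hc u₀ m h y α β η δ) :
    (2 : ℝ) ^ k₁ * y ^ 16 ≤ α * n := by
  have h1 : (2 : ℝ) ^ k₁ = 2 * q * (J + 1) := by exact_mod_cast H.two_pow_k₁.symm
  have := H.J_le
  calc (2 : ℝ) ^ k₁ * y ^ 16 = 2 * q * (J + 1) * y ^ 16 := by rw [h1]
    _ ≤ 2 * q * y ^ 20 * y ^ 16 := by
        have := H.y_nonneg
        gcongr
    _ = 2 * q * y ^ 36 := by ring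
    _ ≤ _ := H.q_le

lemma two_pow_k₁_le (H : Sized n q J k₁ k₂ γ ℓ k mc hc u₀ m h y α β η δ) : 2 ^ k₁ ≤ n := by
  have h1 : (2 : ℝ) ^ k₁ ≤ n := by
    refine le_trans ?_ (H.routers_le.trans H.αn_le)
    exact le_mul_of_one_le_right (by positivity) (H.one_le_pow _)
  exact_mod_cast h1

lemma spokes_le (H : Sized n q J k₁ k₂ γ ℓ k mc hc u₀ m h y α β η δ) :
    ((n / k + 1 + 2 * u₀ : ℕ) : ℝ) * y ^ 22 ≤ 4 * n := by
  have h1 : ((n / k : ℕ) : ℝ) * y ^ 22 ≤ n := by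
    calc ((n / k : ℕ) : ℝ) * y ^ 22 ≤ (n / k : ℕ) * k := by gcongr; exact H.le_k
      _ ≤ n := by exact_mod_cast Nat.div_mul_le_self n k
  have h2 := H.u₀_le
  have h3 := H.pow_le_n (show 22 ≤ 60 by norm_num)
  push_cast at h1 ⊢
  linarith

/-- The supply of connector vertices suffices. -/
lemma connectors_le (H : Sized n q J k₁ k₂ γ ℓ k mc hc u₀ m h y α β η δ) :
    (n / k + 1 + 2 * u₀) * (2 * hc + 2) + 1 + 4 * 2 ^ hc ≤ 10 * mc := by
  have h1 : ((n / k + 1 + 2 * u₀ : ℕ) : ℝ) * (2 * hc + 2) + 1 ≤ 2 * mc := by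
    refine le_of_mul_le_mul_right ?_ (pow_pos H.y_pos 22)
    have h3 : (2 * hc + 2 : ℝ) ≤ 5 * y ^ 4 := by
      linarith [H.hc_exp_le, H.four_le]
    have h4 := H.pow_le_n (show 22 ≤ 60 by norm_num)
    have h5 := H.one_le_pow 4
    calc (((n / k + 1 + 2 * u₀ : ℕ) : ℝ) * (2 * hc + 2) + 1) * y ^ 22
        = ((n / k + 1 + 2 * u₀ : ℕ) : ℝ) * y ^ 22 * (2 * hc + 2) + y ^ 22 := by ring
      _ ≤ (4 * n) * (5 * y ^ 4) + n * y ^ 4 := by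
          refine add_le_add (mul_le_mul H.spokes_le h3 (by positivity) (by positivity)) ?_
          exact h4.trans (le_mul_of_one_le_right (Nat.cast_nonneg _) h5)
      _ = 21 * (n * y ^ 4) := by ring
      _ ≤ (α * y) * y * (2 ^ (-17 : ℤ)) * (n * y ^ 4) := by
          refine mul_le_mul_of_nonneg_right ?_ (mul_nonneg (Nat.cast_nonneg _) (by linarith))
          have h6 := H.big_α
          have h7 := H.big_y
          have h8 := mul_le_mul h6 h7 (by norm_num) (by linarith)
          norm_num at h8 ⊢
          linarith
      _ = 2 ^ (-17 : ℤ) * y ^ 6 * (α * n) := by ring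
      _ ≤ 2 ^ (-17 : ℤ) * y ^ 6 * (2 ^ 18 * mc * y ^ 16) :=
          mul_le_mul_of_nonneg_left H.le_mc (mul_nonneg (by norm_num) (pow_nonneg H.y_nonneg _))
      _ = 2 * mc * y ^ 22 := by norm_num; ring
  have h2 : (n / k + 1 + 2 * u₀) * (2 * hc + 2) + 1 ≤ 2 * mc := by exact_mod_cast h1
  have := H.hc_le
  omega

lemma absorbers_le (H : Sized n q J k₁ k₂ γ ℓ k mc hc u₀ m h y α β η δ) :
    (n / k + 1 + 2 * u₀) * (2 * 5) ≤ γ / 4 := by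
  rw [Nat.le_div_iff_mul_le (by norm_num)]
  have h1 : ((n / k + 1 + 2 * u₀ : ℕ) : ℝ) * (2 * 5) * 4 ≤ γ := by
    refine le_of_mul_le_mul_right ?_ (pow_pos H.y_pos 22)
    calc ((n / k + 1 + 2 * u₀ : ℕ) : ℝ) * (2 * 5) * 4 * y ^ 22
        = 40 * (((n / k + 1 + 2 * u₀ : ℕ) : ℝ) * y ^ 22) := by ring
      _ ≤ 40 * (4 * (n : ℝ)) := mul_le_mul_of_nonneg_left H.spokes_le (by norm_num)
      _ ≤ (α * y) * y ^ 5 / 128 * n := by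
          rw [← mul_assoc]
          refine mul_le_mul_of_nonneg_right ?_ (Nat.cast_nonneg _)
          have h8 := H.big_α_mul
          norm_num at h8 ⊢
          linarith
      _ = y ^ 6 / 128 * (α * n) := by ring
      _ ≤ y ^ 6 / 128 * (128 * γ * y ^ 16) :=
          mul_le_mul_of_nonneg_left H.le_γ (div_nonneg (pow_nonneg H.y_nonneg _) (by norm_num))
      _ = γ * y ^ 22 := by ring
  exact_mod_cast h1

lemma bad_le (H : Sized n q J k₁ k₂ γ ℓ k mc hc u₀ m h y α β η δ) : 8 * u₀ ≤ mc := by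
  have h1 : (8 : ℝ) * u₀ ≤ mc := by
    refine le_of_mul_le_mul_right ?_ (pow_pos H.y_pos 22)
    calc (8 : ℝ) * u₀ * y ^ 22 = 8 * (u₀ * y ^ 22) := by ring
      _ ≤ 8 * (n : ℝ) := mul_le_mul_of_nonneg_left H.u₀_le (by norm_num)
      _ ≤ (α * y) * y ^ 5 / 2 ^ 18 * n := by
          refine mul_le_mul_of_nonneg_right ?_ (Nat.cast_nonneg _)
          have h8 := H.big_α_mul
          norm_num at h8 ⊢
          linarith
      _ = y ^ 6 / 2 ^ 18 * (α * n) := by ring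
      _ ≤ y ^ 6 / 2 ^ 18 * (2 ^ 18 * mc * y ^ 16) :=
          mul_le_mul_of_nonneg_left H.le_mc (div_nonneg (pow_nonneg H.y_nonneg _) (by norm_num))
      _ = mc * y ^ 22 := by ring
  exact_mod_cast h1

lemma one_le_mc (H : Sized n q J k₁ k₂ γ ℓ k mc hc u₀ m h y α β η δ) : 1 ≤ mc := by
  have := H.mc_eq
  have := H.big_γ
  omega

lemma good_wires_le (H : Sized n q J k₁ k₂ γ ℓ k mc hc u₀ m h y α β η δ) :
    γ * (ℓ - 1) / 2 + 9 * mc + 192 * mc * (ℓ - 1) ≤ γ * (ℓ - 1) := by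
  have h1 : 1 ≤ ℓ - 1 := by have := H.one_le_ℓ; omega
  have h2 : 1024 * mc * (ℓ - 1) ≤ γ * (ℓ - 1) := Nat.mul_le_mul_right _ H.mc_le
  have h3 : mc * 1 ≤ mc * (ℓ - 1) := Nat.mul_le_mul_left _ h1
  have h4 : 1024 * mc * (ℓ - 1) = 1024 * (mc * (ℓ - 1)) := by ring
  have h5 : 192 * mc * (ℓ - 1) = 192 * (mc * (ℓ - 1)) := by ring
  omega

lemma m_mul_le (H : Sized n q J k₁ k₂ γ ℓ k mc hc u₀ m h y α β η δ) {d : ℕ}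
    (hη : η * (2 * d + 16) ≤ α * β) : (m : ℝ) * (2 * d + 16) ≤ α * β * n := by
  calc (m : ℝ) * (2 * d + 16) ≤ η * n * (2 * d + 16) := by gcongr; exact H.m_le
    _ = η * (2 * d + 16) * n := by ring
    _ ≤ _ := mul_le_mul_of_nonneg_right hη (Nat.cast_nonneg _)

lemma u₀_small (H : Sized n q J k₁ k₂ γ ℓ k mc hc u₀ m h y α β η δ) :
    16 * (u₀ : ℝ) ≤ α * β * n := by
  have h1 : 0 ≤ α * β := mul_nonneg H.α_pos.le H.β_pos.le
  have h2 : 16 ≤ α * β * y ^ 22 := by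
    have h3 := H.le_mul_y (H.mono_prod 1 1 0 0)
    simp at h3
    have h4 := H.pow_mono (show 1 ≤ 22 by norm_num)
    have := mul_le_mul_of_nonneg_left h4 h1
    norm_num at this
    linarith
  calc 16 * (u₀ : ℝ) ≤ α * β * y ^ 22 * u₀ := by gcongr
    _ = α * β * (u₀ * y ^ 22) := by ring
    _ ≤ _ := mul_le_mul_of_nonneg_left H.u₀_le h1

lemma αβ_le (H : Sized n q J k₁ k₂ γ ℓ k mc hc u₀ m h y α β η δ) : α * β * n ≤ α * n / 128 := by
  have := mul_le_mul_of_nonneg_left H.β_le (mul_nonneg H.α_pos.le H.n_pos.le)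
  linarith

/-- The vertices on bare paths leave enough room for the whole structure. -/
lemma room_le (H : Sized n q J k₁ k₂ γ ℓ k mc hc u₀ m h y α β η δ) {d L B : ℕ}
    (hη : η * (2 * d + 16) ≤ α * β) (hL : y ^ 36 ≤ L)
    (hB : 2 * m * d + (B + 4 * 2 ^ h) + 3 * m = n) :
    2 * q * J * ℓ + 3 * (2 * u₀) + n + 2 ^ k₁ * benesLen h k₁ +
      (2 * ((k + 2 * ℓ) + (2 * h + 3)) + 1) * (2 * q * (benesLen h k₂ + 1)) + 2 ^ k₁ * (2 * h + 2)
        ≤ B + 2 * q * (L - 1) := by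
  have hα := mul_nonneg H.α_pos.le H.n_pos.le
  have b1 := H.benesLen_le H.two_pow_k₁_le
  have b2 := H.benesLen_le H.two_q_le
  have h4 := H.four_le
  have hh := H.h_exp_le
  have hy := H.y_pos
  have hy36 : (1 : ℝ) ≤ L := (H.one_le_pow _).trans hL
  have s1 : 2 * (q : ℝ) * J * ℓ ≤ α * n / 64 := by
    have h1 : 16 * (γ : ℝ) = 2 * q * J := by exact_mod_cast H.card_eq
    rw [← h1]
    linarith [H.wires_le, H.αβ_le]
  have s2 : 3 * (2 * (u₀ : ℝ)) ≤ α * n / 128 := by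
    linarith [H.u₀_small, H.αβ_le, (Nat.cast_nonneg u₀ : (0 : ℝ) ≤ u₀)]
  have s3 : (n : ℝ) ≤ B + α * n / 128 := by
    have h1 : 2 * (m : ℝ) * d + (B + 4 * 2 ^ h) + 3 * m = n := by exact_mod_cast hB
    have h2 : (2 : ℝ) ^ h ≤ 2 * m := by exact_mod_cast H.h_le
    have h3 := H.m_mul_le hη
    have h5 := H.αβ_le
    nlinarith [(Nat.cast_nonneg m : (0 : ℝ) ≤ m)]
  have big : ∀ c : ℝ, c ≤ 2 ^ 50 → ∀ j : ℕ, 1 ≤ j → ∀ X : ℝ, 0 ≤ X → X * y ^ j ≤ c * (α * n) →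
      X ≤ α * n / 128 := by
    intro c hc j hj X hX h
    have h1 : y ≤ y ^ j := by simpa using H.pow_mono hj
    have h2 : X * 2 ^ 64 ≤ 2 ^ 50 * (α * n) :=
      (mul_le_mul_of_nonneg_left (H.big_y.trans h1) hX).trans
        (h.trans (mul_le_mul_of_nonneg_right hc hα))
    norm_num at h2
    linarith
  have s4 : (2 : ℝ) ^ k₁ * benesLen h k₁ ≤ α * n / 128 := by
    refine big 40 (by norm_num) 4 (by norm_num) _ (by positivity) ?_
    calc (2 : ℝ) ^ k₁ * benesLen h k₁ * y ^ 4 ≤ 2 ^ k₁ * (40 * y ^ 12) * y ^ 4 := by gcongr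
      _ = 40 * (2 ^ k₁ * y ^ 16) := by ring
      _ ≤ _ := mul_le_mul_of_nonneg_left H.routers_le (by norm_num)
  have s5 : (2 * (((k : ℝ) + 2 * ℓ) + (2 * h + 3)) + 1) * (2 * q * (benesLen h k₂ + 1)) ≤
      α * n / 128 := by
    refine big (33 * 41) (by norm_num) 2 (by norm_num) _ (by positivity) ?_
    have h1 := H.one_le_pow 22
    have h2 := H.pow_mono (show 16 ≤ 22 by norm_num)
    have h3 := H.pow_mono (show 4 ≤ 22 by norm_num)
    have h5 : β * y ^ 16 ≤ y ^ 22 := by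
      have := mul_le_mul_of_nonneg_right H.β_le (pow_nonneg hy.le 16)
      linarith [H.one_le_pow 16]
    have h6 : 2 * (((k : ℝ) + 2 * ℓ) + (2 * h + 3)) + 1 ≤ 33 * y ^ 22 := by
      linarith [H.k_le, H.ℓ_le]
    have h7 : (benesLen h k₂ : ℝ) + 1 ≤ 41 * y ^ 12 := by linarith [H.one_le_pow 12]
    calc (2 * (((k : ℝ) + 2 * ℓ) + (2 * h + 3)) + 1) * (2 * q * (benesLen h k₂ + 1)) * y ^ 2
        ≤ (33 * y ^ 22) * (2 * q * (41 * y ^ 12)) * y ^ 2 := by gcongr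
      _ = 33 * 41 * (2 * q * y ^ 36) := by ring
      _ ≤ _ := mul_le_mul_of_nonneg_left H.q_le (by norm_num)
  have s6 : (2 : ℝ) ^ k₁ * (2 * h + 2) ≤ α * n / 128 := by
    refine big 5 (by norm_num) 12 (by norm_num) _ (by positivity) ?_
    calc (2 : ℝ) ^ k₁ * (2 * h + 2) * y ^ 12 ≤ 2 ^ k₁ * (5 * y ^ 4) * y ^ 12 := by
          gcongr
          linarith
      _ = 5 * (2 ^ k₁ * y ^ 16) := by ring
      _ ≤ _ := mul_le_mul_of_nonneg_left H.routers_le (by norm_num)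
  have s7 : α * n / 4 ≤ 2 * q * (L - 1) := by
    have h1 : 2 * (q : ℝ) ≤ α * n / 128 := by
      refine big 1 (by norm_num) 36 (by norm_num) _ (by positivity) ?_
      rw [one_mul]
      exact H.q_le
    have h2 : α * n ≤ 4 * q * L := H.le_q.trans (by gcongr)
    linarith
  have hL1 : ((L - 1 : ℕ) : ℝ) = L - 1 := by
    rw [Nat.cast_sub (by exact_mod_cast hy36), Nat.cast_one]
  have goal : 2 * (q : ℝ) * J * ℓ + 3 * (2 * u₀) + n + 2 ^ k₁ * benesLen h k₁ +
      (2 * ((k + 2 * ℓ) + (2 * h + 3)) + 1) * (2 * q * (benesLen h k₂ + 1)) +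
      2 ^ k₁ * (2 * h + 2) ≤ B + 2 * q * (L - 1 : ℕ) := by
    rw [hL1]
    linarith
  exact_mod_cast goal

lemma wires_room (H : Sized n q J k₁ k₂ γ ℓ k mc hc u₀ m h y α β η δ) {d B : ℕ}
    (hη : η * (2 * d + 16) ≤ α * β) (hB : 2 * m * d + (B + 4 * 2 ^ h) + 3 * m = n) :
    2 * q * J * ℓ + 3 * (2 * u₀) ≤ B := by
  have h1 : 16 * (γ : ℝ) = 2 * q * J := by exact_mod_cast H.card_eq
  have h2 : 2 * (m : ℝ) * d + (B + 4 * 2 ^ h) + 3 * m = n := by exact_mod_cast hB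
  have h3 : (2 : ℝ) ^ h ≤ 2 * m := by exact_mod_cast H.h_le
  have goal : 2 * (q : ℝ) * J * ℓ + 3 * (2 * u₀) ≤ B := by
    rw [← h1]
    nlinarith [H.m_mul_le hη, H.αβη_le, H.u₀_small, H.wires_le, (Nat.cast_nonneg m : (0 : ℝ) ≤ m),
      (Nat.cast_nonneg u₀ : (0 : ℝ) ≤ u₀), H.n_pos]
  exact_mod_cast goal

lemma pairs_le (H : Sized n q J k₁ k₂ γ ℓ k mc hc u₀ m h y α β η δ) :
    16 * γ * ℓ + 2 * (n / 4) ≤ n := by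
  have h1 : 16 * (γ : ℝ) * ℓ * 64 ≤ n := by linarith [H.wires_le, H.αβη_le]
  have h2 : 16 * γ * ℓ * 64 ≤ n := by exact_mod_cast h1
  omega

lemma three_le (H : Sized n q J k₁ k₂ γ ℓ k mc hc u₀ m h y α β η δ) {w : ℝ} {i : ℕ} (hi : 1 ≤ i)
    (hw : (α * β * η * δ) ^ 2 ≤ w) : 2 ^ 64 ≤ w * y ^ i := by
  have h1 := H.pow_mono hi
  rw [pow_one] at h1
  exact (H.le_mul_y hw).trans (mul_le_mul_of_nonneg_left h1 ((sq_nonneg _).trans hw))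

lemma exp_joined_le (H : Sized n q J k₁ k₂ γ ℓ k mc hc u₀ m h y α β η δ) :
    4 ^ n * exp (-(δ * y ^ 4 / n) * (n / 4 * (n / 4) : ℕ)) ≤ exp (-n) := by
  rw [neg_mul]
  refine four_pow_mul_exp_le ?_
  have hn := H.n_pos
  have h1 := H.three_le (show 1 ≤ 4 by norm_num) (H.mono_prod 0 0 0 1)
  simp at h1
  have h2 : (n : ℝ) / 8 ≤ (n / 4 : ℕ) := by
    have h3 : (8 : ℝ) ≤ n := le_trans (by norm_num) (H.big_y.trans
      (by simpa using H.pow_le_n (show 1 ≤ 60 by norm_num)))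
    have h4 : 8 ≤ n := by exact_mod_cast h3
    have h5 : n ≤ 8 * (n / 4) := by omega
    have h6 : (n : ℝ) ≤ 8 * (n / 4 : ℕ) := by exact_mod_cast h5
    linarith
  calc 3 * (n : ℝ) ≤ δ * y ^ 4 / n * (n / 8 * (n / 8)) := by
        rw [show δ * y ^ 4 / n * (n / 8 * (n / 8)) = (δ * y ^ 4 / 64) * n by field_simp; norm_num]
        refine mul_le_mul_of_nonneg_right ?_ hn.le
        linarith
    _ ≤ δ * y ^ 4 / n * (n / 4 * (n / 4) : ℕ) := by
        push_cast
        have := H.δ_pos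
        have := H.y_pos
        gcongr

lemma group_half_le (H : Sized n q J k₁ k₂ γ ℓ k mc hc u₀ m h y α β η δ) :
    α * β * n ≤ 2048 * (γ * (ℓ - 1) / 4 : ℕ) := by
  have h1 : 1 ≤ ℓ - 1 := by have := H.one_le_ℓ; omega
  have h2 : 2 ^ 57 * 1 ≤ γ * (ℓ - 1) := Nat.mul_le_mul H.big_γ h1
  have h3 : γ * (ℓ - 1) ≤ 8 * (γ * (ℓ - 1) / 4) := by omega
  have h4 : ((γ : ℝ) * (ℓ - 1 : ℕ)) ≤ 8 * (γ * (ℓ - 1) / 4 : ℕ) := by exact_mod_cast h3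
  linarith [H.le_group]

lemma exp_group_le (H : Sized n q J k₁ k₂ γ ℓ k mc hc u₀ m h y α β η δ) :
    δ * α * β * y ^ 4 / 2048 ≤ δ * y ^ 4 / n * (γ * (ℓ - 1) / 4 : ℕ) := by
  have hn := H.n_pos
  have := H.δ_pos
  have := H.y_pos
  calc δ * α * β * y ^ 4 / 2048 = δ * y ^ 4 / n * (α * β * n / 2048) := by field_simp
    _ ≤ _ := by
        gcongr
        linarith [H.group_half_le]

lemma clean_le (H : Sized n q J k₁ k₂ γ ℓ k mc hc u₀ m h y α β η δ) :
    exp (α * β * δ * y ^ 4 / 2 ^ 18) ^ 67 *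
      exp (3 - δ * y ^ 4 / n * (γ * (ℓ - 1) / 2 : ℕ)) ≤
      exp (3 - α * β * δ * y ^ 4 / 2 ^ 13) := by
  rw [← exp_nat_mul, ← exp_add]
  refine exp_le_exp.2 ?_
  have h1 := H.exp_group_le
  have h2 : δ * y ^ 4 / n * (γ * (ℓ - 1) / 4 : ℕ) ≤ δ * y ^ 4 / n * (γ * (ℓ - 1) / 2 : ℕ) := by
    have := H.δ_pos
    have := H.y_pos
    gcongr
    norm_num
  have h3 : 0 ≤ α * β * δ * y ^ 4 := by
    have := H.δ_pos
    have := H.α_pos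
    have := H.β_pos
    have := H.y_pos
    positivity
  have h4 : δ * α * β * y ^ 4 = α * β * δ * y ^ 4 := by ring
  rw [h4] at h1
  push_cast
  linarith

lemma clean_half (H : Sized n q J k₁ k₂ γ ℓ k mc hc u₀ m h y α β η δ) :
    exp (3 - α * β * δ * y ^ 4 / 2 ^ 13) ≤ 1 / 2 := by
  have h1 := H.three_le (show 1 ≤ 4 by norm_num) (H.mono_prod 1 1 0 1)
  simp at h1
  have h2 : exp (3 - α * β * δ * y ^ 4 / 2 ^ 13) ≤ exp (-1) :=
    exp_le_exp.2 (by linarith)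
  refine h2.trans ?_
  rw [exp_neg, one_div]
  exact inv_anti₀ (by norm_num) (by linarith [add_one_le_exp (1 : ℝ)])

lemma level_mono {S : ℕ} (hS : 1 ≤ S) {i j : ℕ} (hij : i ≤ j) : mc * S ^ i ≤ mc * S ^ j :=
  Nat.mul_le_mul_left _ (Nat.pow_le_pow_right hS hij)

lemma level_le (H : Sized n q J k₁ k₂ γ ℓ k mc hc u₀ m h y α β η δ) {S : ℕ}
    (hS : S ≤ 2 * y ^ 3) : 4 * (mc * S ^ 5) ≤ γ * (ℓ - 1) := by
  have hy := H.y_pos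
  have goal : (4 : ℝ) * (mc * S ^ 5) ≤ γ * (ℓ - 1 : ℕ) := by
    calc (4 : ℝ) * (mc * S ^ 5) ≤ 4 * (mc * (2 * y ^ 3) ^ 5) := by gcongr
      _ = 2 ^ 7 * mc * y ^ 15 := by ring
      _ ≤ α * β * n / 256 := by
          refine le_of_mul_le_mul_right ?_ hy
          have h1 := H.big_β
          have h2 := H.mc_le'
          have h3 := mul_le_mul_of_nonneg_left h1 (mul_nonneg H.α_pos.le H.n_pos.le)
          have h5 := mul_nonneg H.α_pos.le H.n_pos.le
          have h4 : 2 ^ 7 * mc * y ^ 15 * y = (2 ^ 14 * mc * y ^ 16) / 2 ^ 7 := by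
            norm_num
            ring
          rw [h4]
          norm_num at h3 h2 ⊢
          linarith
      _ ≤ _ := by linarith [H.le_group]
  exact_mod_cast goal

lemma levels_le (H : Sized n q J k₁ k₂ γ ℓ k mc hc u₀ m h y α β η δ) {S : ℕ} (hS1 : 1 ≤ S)
    (hS : S ≤ 2 * y ^ 3) {j : ℕ} (hj : j < 5) :
    γ * (ℓ - 1) / 4 + mc * S ^ j + mc * S ^ (j + 1) + γ / 4 * (ℓ - 1) ≤ γ * (ℓ - 1) := by
  have h1 := H.level_le hS
  have h2 := level_mono (mc := mc) hS1 (show j ≤ 5 by omega)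
  have h3 := level_mono (mc := mc) hS1 (show j + 1 ≤ 5 by omega)
  have h4 : γ / 4 * (ℓ - 1) * 4 ≤ γ * (ℓ - 1) := by
    rw [mul_right_comm]
    exact Nat.mul_le_mul_right _ (Nat.div_mul_le_self _ _)
  omega

lemma level_five_le (H : Sized n q J k₁ k₂ γ ℓ k mc hc u₀ m h y α β η δ) {S : ℕ}
    (hS : y ^ 3 ≤ S) :
    4 ^ n * exp (-(δ * y ^ 4 / n) * (mc * S ^ 5 * (mc * S ^ 5) : ℕ)) ≤ exp (-n) := by
  rw [neg_mul]
  refine four_pow_mul_exp_le ?_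
  have hn := H.n_pos
  have hy := H.y_pos
  have hα := H.α_pos
  have hδ := H.δ_pos
  have h1 := H.three_le (show 1 ≤ 2 by norm_num) (H.mono_prod 2 0 0 1)
  simp at h1
  have h2 : α * n / (2 ^ 18 * y) ≤ mc * S ^ 5 := by
    rw [div_le_iff₀ (by positivity)]
    calc α * n ≤ 2 ^ 18 * mc * y ^ 16 := H.le_mc
      _ = mc * (y ^ 3) ^ 5 * (2 ^ 18 * y) := by ring
      _ ≤ _ := by gcongr
  calc 3 * (n : ℝ) ≤ δ * y ^ 4 / n * (α * n / (2 ^ 18 * y) * (α * n / (2 ^ 18 * y))) := by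
        rw [show δ * y ^ 4 / n * (α * n / (2 ^ 18 * y) * (α * n / (2 ^ 18 * y))) =
          (α ^ 2 * δ * y ^ 2 / 2 ^ 36) * n by field_simp]
        refine mul_le_mul_of_nonneg_right ?_ hn.le
        norm_num
        linarith
    _ ≤ _ := by
        push_cast
        gcongr

lemma level_step_le (H : Sized n q J k₁ k₂ γ ℓ k mc hc u₀ m h y α β η δ) {S j : ℕ} (hS1 : 1 ≤ S)
    (hS : S ≤ 2 * y ^ 3) :
    (y ^ 16) ^ (mc * S ^ j + mc * S ^ (j + 1)) * exp (2 * (n / y ^ 16)) *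
      2 ^ (16 * γ) * exp (-(δ * y ^ 4 / n) * (mc * S ^ j * (γ * (ℓ - 1) / 4) : ℕ)) ≤
      exp (-(n / y ^ 16)) := by
  have hn := H.n_pos
  have hy := H.y_pos
  have hα := H.α_pos
  have hβ := H.β_pos
  have hδ := H.δ_pos
  set A := mc * S ^ j with hA
  have e1 : (y ^ 16) ^ (A + mc * S ^ (j + 1)) =
      exp ((A + mc * S ^ (j + 1) : ℕ) * (16 * log y)) := by
    rw [exp_nat_mul]
    congr 1
    rw [mul_comm, exp_mul, exp_log hy]
    norm_cast
  have hlog0 : 0 ≤ log y := log_nonneg (le_trans (by norm_num) H.big_y)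
  have h1 : ((A + mc * S ^ (j + 1) : ℕ) : ℝ) ≤ A * (3 * y ^ 3) := by
    have h3 := H.one_le_pow 3
    have : ((A + mc * S ^ (j + 1) : ℕ) : ℝ) = A * (1 + S) := by
      rw [hA]; push_cast; ring
    rw [this]
    gcongr
    linarith
  have h2 : ((16 * γ : ℕ) : ℝ) ≤ n / y ^ 16 := by
    rw [le_div_iff₀ (by positivity)]
    push_cast
    exact H.γ_le.trans H.αn_le
  have h3 : A * (δ * α * β * y ^ 4 / 2048) ≤
      δ * y ^ 4 / n * ((A * (γ * (ℓ - 1) / 4) : ℕ) : ℝ) := by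
    have := mul_le_mul_of_nonneg_left H.exp_group_le (Nat.cast_nonneg A : (0 : ℝ) ≤ A)
    push_cast at this ⊢
    linarith
  have hw : (α * β * η * δ) ^ 2 ≤ δ * α * β := by
    refine (H.mono_prod 1 1 0 1).trans_eq ?_
    simp
    ring
  have h4 : 2 ^ 20 * log y ≤ δ * α * β * y :=
    H.log_le.trans (mul_le_mul_of_nonneg_right hw hy.le)
  have h5 : (A : ℝ) * (3 * y ^ 3) * (16 * log y) ≤ A * (δ * α * β * y ^ 4 / 4096) := by
    have h6 : 3 * y ^ 3 * (16 * log y) ≤ δ * α * β * y ^ 4 / 4096 := by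
      have := mul_le_mul_of_nonneg_left h4 (pow_nonneg hy.le 3)
      have h7 : 0 ≤ y ^ 3 * log y := by positivity
      norm_num at this
      linarith
    rw [mul_assoc]
    exact mul_le_mul_of_nonneg_left h6 (Nat.cast_nonneg _)
  have h6 : 4 * (n / y ^ 16) ≤ A * (δ * α * β * y ^ 4 / 4096) := by
    have g1 : (mc : ℝ) ≤ A := by
      have : mc * 1 ≤ A := Nat.mul_le_mul_left _ (Nat.one_le_pow _ _ hS1)
      exact_mod_cast (mul_one mc ▸ this)
    have g2 := H.three_le (show 1 ≤ 4 by norm_num) (H.mono_prod 2 1 0 1)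
    simp at g2
    have g3 : α * n / (2 ^ 18 * y ^ 16) ≤ mc := by
      rw [div_le_iff₀ (by positivity)]
      linarith [H.le_mc]
    calc 4 * (n / y ^ 16) ≤ (α ^ 2 * β * δ * y ^ 4 / 2 ^ 30) * (n / y ^ 16) := by
          refine mul_le_mul_of_nonneg_right ?_ (by positivity)
          norm_num
          linarith
      _ = α * n / (2 ^ 18 * y ^ 16) * (δ * α * β * y ^ 4 / 4096) := by
          field_simp
          norm_num
      _ ≤ _ := by
          refine mul_le_mul_of_nonneg_right (g3.trans g1) (by positivity)
  rw [e1]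
  calc exp ((A + mc * S ^ (j + 1) : ℕ) * (16 * log y)) * exp (2 * (n / y ^ 16)) *
        2 ^ (16 * γ) * exp (-(δ * y ^ 4 / n) * (A * (γ * (ℓ - 1) / 4) : ℕ))
      ≤ exp (A * (3 * y ^ 3) * (16 * log y)) * exp (2 * (n / y ^ 16)) *
        exp (n / y ^ 16) * exp (-(A * (δ * α * β * y ^ 4 / 2048))) := by
        gcongr
        · exact (two_pow_le_exp _).trans (exp_le_exp.2 h2)
        · rw [neg_mul]
          exact neg_le_neg h3
    _ = exp (A * (3 * y ^ 3) * (16 * log y) + 2 * (n / y ^ 16) + n / y ^ 16 +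
        -(A * (δ * α * β * y ^ 4 / 2048))) := by
        rw [exp_add, exp_add, exp_add]
    _ ≤ _ := by
        refine exp_le_exp.2 ?_
        linarith

lemma degree_le (H : Sized n q J k₁ k₂ γ ℓ k mc hc u₀ m h y α β η δ) {d : ℕ}
    (hη : η * (2 * d + 16) ≤ α * β) {τ : ℝ} (hτ : 4 * β ≤ τ) :
    n * (1 - τ) + (16 * γ * ℓ + 2 * u₀) + (d + 1) * (2 * m) ≤ n := by
  have h1 := H.m_mul_le hη
  have h2 := H.u₀_small
  have h3 := H.wires_le
  have h4 : α * β * n ≤ β * n := by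
    have := mul_le_mul_of_nonneg_right H.α_le (mul_nonneg H.β_pos.le H.n_pos.le)
    linarith
  have h5 := mul_le_mul_of_nonneg_right hτ H.n_pos.le
  nlinarith [(Nat.cast_nonneg m : (0 : ℝ) ≤ m), (Nat.cast_nonneg u₀ : (0 : ℝ) ≤ u₀)]

lemma spread_le (H : Sized n q J k₁ k₂ γ ℓ k mc hc u₀ m h y α β η δ) {pa : ℝ}
    (hpa : y ^ 4 ≤ n * pa) : 4 ^ n * exp (-pa * (m * m : ℕ)) ≤ exp (-n) := by
  rw [neg_mul]
  refine four_pow_mul_exp_le ?_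
  have hn := H.n_pos
  have hy := H.y_pos
  have hη := H.η_pos
  have h1 := H.three_le (show 1 ≤ 4 by norm_num) (H.mono_prod 0 0 2 0)
  simp at h1
  have h2 : η * n / 2 ≤ m := by linarith [H.le_m]
  have h3 : y ^ 4 / n ≤ pa := by
    rw [div_le_iff₀ hn]
    linarith
  calc 3 * (n : ℝ) ≤ y ^ 4 / n * (η * n / 2 * (η * n / 2)) := by
        rw [show y ^ 4 / n * (η * n / 2 * (η * n / 2)) = (η ^ 2 * y ^ 4 / 4) * n by
          field_simp; norm_num]
        refine mul_le_mul_of_nonneg_right ?_ hn.le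
        linarith
    _ ≤ _ := by
        push_cast
        have : 0 ≤ pa := le_trans (by positivity) h3
        gcongr

lemma traverse_le (H : Sized n q J k₁ k₂ γ ℓ k mc hc u₀ m h y α β η δ) :
    2 ^ n * ((y ^ 4) ^ n * exp ((n : ℝ) ^ 2 * (δ * y ^ 4 / n / y ^ 4)) *
      exp (-(δ * y ^ 4 / n) * ((m : ℝ) ^ 2 / 2))) ≤ exp (-n) := by
  have hn := H.n_pos
  have hy := H.y_pos
  have hη := H.η_pos
  have hδ := H.δ_pos
  have h1 := H.three_le (show 1 ≤ 3 by norm_num) (H.mono_prod 0 0 2 1)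
  simp at h1
  have h2 : η * n / 2 ≤ m := by linarith [H.le_m]
  have e1 : (y ^ 4) ^ n = exp (n * (4 * log y)) := by
    rw [exp_nat_mul]
    congr 1
    rw [mul_comm, exp_mul, exp_log hy]
    norm_cast
  have hlog : log y ≤ y := (log_le_sub_one_of_pos hy).trans (by linarith)
  have e2 : (n : ℝ) ^ 2 * (δ * y ^ 4 / n / y ^ 4) = δ * n := by field_simp
  have h3 : δ * η ^ 2 * y ^ 4 * n / 8 ≤ δ * y ^ 4 / n * ((m : ℝ) ^ 2 / 2) := by
    calc δ * η ^ 2 * y ^ 4 * n / 8 = δ * y ^ 4 / n * ((η * n / 2) ^ 2 / 2) := by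
          field_simp
          norm_num
      _ ≤ _ := by gcongr
  have h4 : 8 * y ≤ δ * η ^ 2 * y ^ 4 / 8 := by
    have := mul_le_mul_of_nonneg_right h1 hy.le
    have h5 : δ * η ^ 2 * y ^ 4 = η ^ 2 * δ * y ^ 3 * y := by ring
    rw [h5]
    linarith
  have h5 : 8 * y * n ≤ δ * η ^ 2 * y ^ 4 * n / 8 := by
    have := mul_le_mul_of_nonneg_right h4 hn.le
    linarith
  rw [e1, e2]
  calc 2 ^ n * (exp (n * (4 * log y)) * exp (δ * n) *
        exp (-(δ * y ^ 4 / n) * ((m : ℝ) ^ 2 / 2)))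
      ≤ exp n * (exp (n * (4 * y)) * exp n *
        exp (-(8 * y * n))) := by
        gcongr
        · exact two_pow_le_exp n
        · nlinarith [H.δ_le]
        · rw [neg_mul]
          exact neg_le_neg (h5.trans h3)
    _ = exp (n + (n * (4 * y) + n + -(8 * y * n))) := by
        rw [exp_add, exp_add, exp_add]
    _ ≤ _ := by
        refine exp_le_exp.2 ?_
        have := mul_le_mul_of_nonneg_left H.big_y hn.le
        norm_num at this
        linarith

end Sized

section Final

open Filter

/-- An upper bound for the probability of failure, in terms of `z = log n`. -/
noncomputable def failure (κ ε : ℝ) (d : ℕ) (z : ℝ) : ℝ :=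
  14 * exp (-z) + 4 * exp (3 - κ * z) +
    (exp (((1 + ε) * z) ^ d * exp (1 - ε / 4 * z)) - 1)

lemma tendsto_failure {κ ε : ℝ} (hκ : 0 < κ) (hε : 0 < ε) (d : ℕ) :
    Tendsto (failure κ ε d) atTop (nhds 0) := by
  have h1 : Tendsto (fun z : ℝ => exp (-z)) atTop (nhds 0) :=
    tendsto_exp_neg_atTop_nhds_zero
  have h2 : Tendsto (fun z : ℝ => exp (3 - κ * z)) atTop (nhds 0) := by
    refine tendsto_exp_atBot.comp ?_
    exact tendsto_atBot_add_const_left _ 3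
      (tendsto_neg_atTop_atBot.comp (tendsto_id.const_mul_atTop hκ))
  have h3 : Tendsto (fun z : ℝ => ((1 + ε) * z) ^ d * exp (1 - ε / 4 * z))
      atTop (nhds 0) := by
    have h4 := (tendsto_pow_mul_exp_neg_atTop_nhds_zero d).comp
      (tendsto_id.const_mul_atTop (show (0 : ℝ) < ε / 4 by positivity))
    have h5 := h4.const_mul (((1 + ε) / (ε / 4)) ^ d * exp 1)
    rw [mul_zero] at h5
    refine h5.congr fun z => ?_
    simp only [Function.comp_apply, id]
    rw [sub_eq_add_neg, exp_add]
    have : (1 + ε) * z = ((1 + ε) / (ε / 4)) * (ε / 4 * z) := by field_simp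
    rw [this, mul_pow ((1 + ε) / (ε / 4))]
    ring
  have h4 := (continuous_exp.tendsto 0).comp h3
  rw [exp_zero] at h4
  have h5 := ((h1.const_mul 14).add (h2.const_mul 4)).add (h4.sub_const 1)
  rw [mul_zero, mul_zero, sub_self, add_zero, add_zero] at h5
  exact h5

lemma exists_two_pow {m : ℕ} (hm : 1 ≤ m) : ∃ h, m ≤ 2 ^ h ∧ 2 ^ h ≤ 2 * m := by
  refine ⟨Nat.log 2 m + 1, (Nat.lt_pow_succ_log_self (by norm_num) m).le, ?_⟩
  rw [pow_succ, mul_comm]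
  exact Nat.mul_le_mul_left 2 (Nat.pow_log_le_self 2 (by omega))

lemma exists_sized {n : ℕ} {y α β η δ : ℝ} (hα : 0 < α) (hα1 : α ≤ 1) (hβ : 0 < β)
    (hβ1 : β ≤ 1 / 128) (hη : 0 < η) (hη1 : η ≤ 1 / 128) (hδ : 0 < δ) (hδ1 : δ ≤ 1)
    (hbig : 2 ^ 64 ≤ (α * β * η * δ) ^ 2 * y) (hn : log n = y ^ 4) (hpow : y ^ 60 ≤ n)
    (hlog : 2 ^ 20 * log y ≤ (α * β * η * δ) ^ 2 * y) :
    ∃ q J k₁ k₂ γ ℓ k mc hc u₀ m h : ℕ, Sized n q J k₁ k₂ γ ℓ k mc hc u₀ m h y α β η δ ∧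
      n / exp (α * β * δ * y ^ 4 / 2 ^ 18) ≤ u₀ := by
  have hy0 : 0 < y := by
    by_contra! hy
    have h1 : (α * β * η * δ) ^ 2 * y ≤ 0 := mul_nonpos_of_nonneg_of_nonpos (sq_nonneg _) hy
    norm_num at hbig
    linarith
  have hP : ∀ w : ℝ, (α * β * η * δ) ^ 2 ≤ w → 2 ^ 64 ≤ w * y := fun w hw =>
    hbig.trans (mul_le_mul_of_nonneg_right hw hy0.le)
  have hprod := sq_prod_le hα hα1 hβ hβ1 hη hη1 hδ hδ1
  have hPα : (α * β * η * δ) ^ 2 ≤ α := by simpa using hprod 1 0 0 0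
  have hPη : (α * β * η * δ) ^ 2 ≤ η := by simpa using hprod 0 0 1 0
  have hPc : (α * β * η * δ) ^ 2 ≤ α * β * δ := by simpa using hprod 1 1 0 1
  have hy : 2 ^ 64 ≤ y := by simpa using hP 1 (by simpa using hprod 0 0 0 0)
  have hy1 : 1 ≤ y := le_trans (by norm_num) hy
  have hnpos : (0 : ℝ) < n := (pow_pos hy0 60).trans_le hpow
  obtain ⟨k₂, hk₂, hk₂'⟩ := exists_nat_pow_near (x := α * n / y ^ 36) (y := 2) (by
      rw [one_le_div (by positivity)]
      calc y ^ 36 ≤ 2 ^ 64 * y ^ 59 := by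
            have := pow_le_pow_right₀ hy1 (show 36 ≤ 59 by norm_num)
            have h0 : 0 < y ^ 59 := by positivity
            norm_num
            linarith
        _ ≤ (α * y) * y ^ 59 := by gcongr; exact hP α hPα
        _ = α * y ^ 60 := by ring
        _ ≤ α * n := by gcongr) one_lt_two
  have hk₂4 : 4 ≤ k₂ := by
    by_contra! hlt
    have h1 : (2 : ℝ) ^ (k₂ + 1) ≤ 2 ^ 4 := pow_le_pow_right₀ (by norm_num) (by omega)
    have h2 : 2 ^ 64 ≤ α * n / y ^ 36 := by
      rw [le_div_iff₀ (by positivity)]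
      calc 2 ^ 64 * y ^ 36 ≤ (α * y) * y ^ 36 := by gcongr; exact hP α hPα
        _ = α * y ^ 37 := by ring
        _ ≤ α * y ^ 60 := by gcongr; norm_num
        _ ≤ α * n := by gcongr
    norm_num at h1 h2
    linarith
  obtain ⟨s, rfl⟩ := Nat.exists_eq_add_of_le' hk₂4
  obtain ⟨b, hb, hb'⟩ := exists_nat_pow_near (x := y ^ 20) (y := 2) (one_le_pow₀ hy1) one_lt_two
  have hb1 : 1 ≤ 2 ^ b := Nat.one_le_two_pow
  have hb1024 : 2048 ≤ 2 ^ b := by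
    have h1 : y ≤ y ^ 20 := le_self_pow₀ hy1 (by norm_num)
    have h2 : (2048 : ℝ) ≤ 2 ^ b := by
      rw [pow_succ (2 : ℝ)] at hb'
      norm_num at hy
      linarith
    exact_mod_cast h2
  have hJ : ((2 ^ b - 1 : ℕ) : ℝ) + 1 = 2 ^ b := by
    rw [Nat.cast_sub hb1]; push_cast; ring
  have hγ : 1024 ≤ 2 ^ s * (2 ^ b - 1) := by
    have : 1 * 1024 ≤ 2 ^ s * (2 ^ b - 1) := Nat.mul_le_mul Nat.one_le_two_pow (by omega)
    omega
  have hηn : 2 ≤ η * n := by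
    calc (2 : ℝ) ≤ 2 ^ 64 := by norm_num
      _ ≤ η * y := hP η hPη
      _ ≤ η * y ^ 60 := by gcongr; exact le_self_pow₀ hy1 (by norm_num)
      _ ≤ η * n := by gcongr
  have hm1 : 1 ≤ ⌊η * n⌋₊ := Nat.le_floor (by push_cast; linarith)
  obtain ⟨hc, hhc, hhc'⟩ := exists_two_pow (m := 2 ^ s * (2 ^ b - 1) / 1024) (by omega)
  obtain ⟨h, hh, hh'⟩ := exists_two_pow hm1
  have hx : 2 * y ^ 22 ≤ exp (α * β * δ * y ^ 4 / 2 ^ 18) := by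
    have e1 : y ^ 22 = exp (22 * log y) := by
      rw [mul_comm, exp_mul, exp_log hy0]; norm_cast
    have e2 : (2 : ℝ) ≤ exp 1 := by linarith [add_one_le_exp (1 : ℝ)]
    rw [e1]
    calc 2 * exp (22 * log y) ≤ exp 1 * exp (22 * log y) := by gcongr
      _ = exp (1 + 22 * log y) := (exp_add _ _).symm
      _ ≤ _ := by
        refine exp_le_exp.2 ?_
        have h1 := hP _ hPc
        have h2 := hlog.trans (mul_le_mul_of_nonneg_right hPc hy0.le)
        have h3 : α * β * δ * y * y ≤ α * β * δ * y ^ 4 := by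
          rw [mul_assoc, ← sq]
          gcongr; norm_num
        have h4 : α * β * δ * y * 2 ^ 64 ≤ α * β * δ * y * y := by gcongr
        norm_num at h1 h2 h4 ⊢
        linarith
  have hu : (⌈n / exp (α * β * δ * y ^ 4 / 2 ^ 18)⌉₊ : ℝ) * y ^ 22 ≤ n := by
    have h1 := (Nat.ceil_lt_add_one (a := n / exp (α * β * δ * y ^ 4 / 2 ^ 18))
      (by positivity)).le
    have h2 : n / exp (α * β * δ * y ^ 4 / 2 ^ 18) ≤ n / (2 * y ^ 22) := by gcongr
    have h3 : y ^ 22 * 2 ≤ n := by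
      calc y ^ 22 * 2 ≤ y ^ 22 * y := by gcongr; exact le_trans (by norm_num) hy
        _ = y ^ 23 := by ring
        _ ≤ y ^ 60 := pow_le_pow_right₀ hy1 (by norm_num)
        _ ≤ n := hpow
    calc (⌈n / exp (α * β * δ * y ^ 4 / 2 ^ 18)⌉₊ : ℝ) * y ^ 22
        ≤ (n / (2 * y ^ 22) + 1) * y ^ 22 := by gcongr; linarith
      _ = n / 2 + y ^ 22 := by field_simp
      _ ≤ n := by linarith
  refine ⟨2 ^ (s + 3), 2 ^ b - 1, s + 4 + b, s + 4, 2 ^ s * (2 ^ b - 1), ⌈β * y ^ 16⌉₊,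
    ⌈y ^ 22⌉₊, 2 ^ s * (2 ^ b - 1) / 1024, hc, ⌈n / exp (α * β * δ * y ^ 4 / 2 ^ 18)⌉₊,
    ⌊η * n⌋₊, h, ?_, Nat.le_ceil _⟩
  exact
  { α_pos := hα
    α_le := hα1
    β_pos := hβ
    β_le := hβ1
    η_pos := hη
    η_le := hη1
    δ_pos := hδ
    δ_le := hδ1
    big := hbig
    log_eq := hn
    pow_le := hpow
    log_le := hlog
    card_eq := by ring
    two_pow_k₁ := by
      rw [Nat.sub_add_cancel hb1]
      ring
    two_pow_k₂ := by ring
    q_le := by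
      rw [le_div_iff₀ (by positivity)] at hk₂
      refine le_trans (le_of_eq ?_) hk₂
      push_cast
      ring
    le_q := by
      rw [div_lt_iff₀ (by positivity)] at hk₂'
      refine hk₂'.le.trans (le_of_eq ?_)
      push_cast
      ring
    J_le := by rw [hJ]; exact hb
    le_J := by
      rw [hJ, mul_comm, ← pow_succ]
      exact hb'.le
    le_ℓ := Nat.le_ceil _
    ℓ_le := (Nat.ceil_lt_add_one (by positivity)).le
    le_k := Nat.le_ceil _
    k_le := (Nat.ceil_lt_add_one (by positivity)).le
    mc_eq := rfl
    le_hc := hhc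
    hc_le := hhc'
    le_u₀ := Nat.ceil_pos.2 (by positivity)
    u₀_le := hu
    m_le := Nat.floor_le (by positivity)
    le_m := by linarith [Nat.lt_floor_add_one (η * n)]
    le_h := hh
    h_le := hh' }

/-- The probability of failure is small for parameters of the right magnitude. -/
lemma Sized.one_sub_le {n q J k₁ k₂ γ ℓ k mc hc u₀ m h : ℕ} {y α β η δ ε : ℝ}
    (H : Sized n q J k₁ k₂ γ ℓ k mc hc u₀ m h y α β η δ) {Δ d L M : ℕ} (hε : 0 < ε)
    (hd : d = Δ + 6) (hη : η * (2 * d + 16) ≤ α * β) (hδ : δ ≤ ε / 4)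
    (hβ : 4 * β ≤ ε / (4 * (1 + ε))) (hp1 : (1 + ε) * y ^ 4 / n ≤ 1 / 2)
    (hxu : n / exp (α * β * δ * y ^ 4 / 2 ^ 18) ≤ u₀) (hL : y ^ 36 ≤ L) (hM : 2 * q ≤ M) :
    1 - failure (α * β * δ / 2 ^ 13) ε d (y ^ 4) ≤ probOf n ((1 + ε) * y ^ 4 / n) fun G =>
      ∀ T : SimpleGraph (Fin n), T.IsTree → (∀ v, (T.neighborSet v).ncard ≤ Δ) →
        (∃ M', M ≤ M' ∧ HasDisjBarePaths T L M') → ContainsCopy T G := by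
  have hn := H.n_pos
  have hy := H.y_pos
  have hy4 : 0 < y ^ 4 := pow_pos hy 4
  have hα := H.α_pos
  have hβ0 := H.β_pos
  have hδ0 := H.δ_pos
  obtain ⟨B, hB⟩ : ∃ B, 2 * m * d + (B + 4 * 2 ^ h) + 3 * m = n := by
    have h2 : (2 : ℝ) ^ h ≤ 2 * m := by exact_mod_cast H.h_le
    have h3 : 2 * (m : ℝ) * d + 4 * 2 ^ h + 3 * m ≤ n := by
      nlinarith [H.m_mul_le hη, H.αβη_le, (Nat.cast_nonneg m : (0 : ℝ) ≤ m)]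
    have h4 : 2 * m * d + 4 * 2 ^ h + 3 * m ≤ n := by exact_mod_cast h3
    exact ⟨n - (2 * m * d + 4 * 2 ^ h + 3 * m), by omega⟩
  set p := (1 + ε) * y ^ 4 / n with hp
  set pb := δ * y ^ 4 / n with hpb
  have hpb0 : 0 ≤ pb := by positivity
  have hp0 : 0 ≤ p := by positivity
  have hpbp : 2 * pb ≤ p := by
    rw [hp, hpb, ← mul_div_assoc, ← mul_assoc]
    gcongr
    linarith
  have hpb1 : pb ≤ 1 / 2 := by linarith
  have hs : 0 < (1 - pb) * (1 - pb) := mul_pos (by linarith) (by linarith)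
  set pa := 1 - (1 - p) / ((1 - pb) * (1 - pb)) with hpa
  have hpa_le : pa ≤ p := by
    have : 1 - p ≤ (1 - p) / ((1 - pb) * (1 - pb)) := by
      rw [le_div_iff₀ hs]
      exact mul_le_of_le_one_right (by linarith) (by nlinarith)
    linarith
  have hle_pa : p - 2 * pb ≤ pa := by
    have : (1 - p) / ((1 - pb) * (1 - pb)) ≤ 1 - p + 2 * pb := by
      rw [div_le_iff₀ hs]
      nlinarith [mul_nonneg hpb0 (sub_nonneg.2 hpbp), mul_nonneg (mul_nonneg hpb0 hpb0)
        (show 0 ≤ 1 - p + 2 * pb by linarith)]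
    linarith
  have hnp : n * p = (1 + ε) * y ^ 4 := by rw [hp]; field_simp
  have hnpb : n * pb = δ * y ^ 4 := by rw [hpb]; field_simp
  have hnpa : (1 + ε / 2) * y ^ 4 ≤ n * pa := by
    have h1 := mul_le_mul_of_nonneg_left hle_pa hn.le
    have h2 := mul_le_mul_of_nonneg_right hδ hy4.le
    linarith
  have hnpa' : n * pa ≤ (1 + ε) * y ^ 4 := hnp ▸ mul_le_mul_of_nonneg_left hpa_le hn.le
  have hypa : y ^ 4 ≤ n * pa := le_trans (by nlinarith) hnpa
  set τ := ε / (4 * (1 + ε)) with hτ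
  have hτ1 : (1 + ε) * τ = ε / 4 := by rw [hτ]; field_simp
  have hτ0 : 0 < τ := by positivity
  have hpat : (1 + ε / 4) * y ^ 4 ≤ pa * (n * (1 - τ)) := by
    have h1 : 0 ≤ 1 - τ := by nlinarith
    have h2 := mul_le_mul_of_nonneg_right hnpa h1
    have h3 : (1 + ε / 4) ≤ (1 + ε / 2) * (1 - τ) := by nlinarith
    have h4 := mul_le_mul_of_nonneg_right h3 hy4.le
    linarith
  set S := ⌈y ^ 3⌉₊ with hS
  have hS1 : 1 ≤ S := Nat.ceil_pos.2 (by positivity)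
  have hS2 : y ^ 3 ≤ S := Nat.le_ceil _
  have hS3 : S ≤ 2 * y ^ 3 := by
    have := (Nat.ceil_lt_add_one (a := y ^ 3) (by positivity)).le
    linarith [H.one_le_pow 3]
  have hm1 : 1 ≤ m := by
    have h1 := H.le_mul_y (H.mono_prod 0 0 1 0)
    simp at h1
    have h2 : η * y ≤ η * n := mul_le_mul_of_nonneg_left
      (by simpa using H.pow_le_n (show 1 ≤ 60 by norm_num)) H.η_pos.le
    have h3 : (1 : ℝ) ≤ m := by linarith [H.le_m]
    exact_mod_cast h3
  have hL1 : 1 ≤ L := by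
    have : (1 : ℝ) ≤ L := (H.one_le_pow 36).trans hL
    exact_mod_cast this
  have hk3 : 3 ≤ k := by
    have h1 : (3 : ℝ) ≤ k := by
      refine le_trans ?_ H.le_k
      have := H.big_y.trans (by simpa using H.pow_mono (show 1 ≤ 22 by norm_num))
      exact le_trans (by norm_num) this
    exact_mod_cast h1
  have hexp : n * ((n * pa) ^ d * exp (1 - pa * (n * (1 - τ)))) ≤
      ((1 + ε) * y ^ 4) ^ d * exp (1 - ε / 4 * y ^ 4) := by
    have h0 : 0 ≤ n * pa := hy4.le.trans hypa
    calc n * ((n * pa) ^ d * exp (1 - pa * (n * (1 - τ))))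
        = (n * pa) ^ d * (exp (y ^ 4) * exp (1 - pa * (n * (1 - τ)))) := by
          rw [← H.n_eq]; ring
      _ ≤ ((1 + ε) * y ^ 4) ^ d * exp (1 - ε / 4 * y ^ 4) := by
          rw [← exp_add]
          gcongr
          linarith
  have hmain := one_sub_le_probOf (n := n) (d := d) (m := m) (B := B) (h := h) (mc := mc)
    (hc := hc) (K := 5) (u := γ / 4) (u₀ := u₀) (k := k) (ℓ := ℓ) (Δ := Δ) (γ := γ)
    (kb := n / 4) (g₀ := γ * (ℓ - 1) / 2) (g := γ * (ℓ - 1) / 4) (q := q) (J := J) (k₁ := k₁)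
    (k₂ := k₂) (L := L) (M := M) (a := fun j => mc * S ^ j) (p := p) (pa := pa) (pb := pb)
    (x := exp (α * β * δ * y ^ 4 / 2 ^ 18)) (x' := y ^ 16) (xH := y ^ 4)
    (ρ := exp (3 - α * β * δ * y ^ 4 / 2 ^ 13)) (t := n * (1 - τ))
    (e := exp (-(n / y ^ 16)))
    (by
      rw [hpa, sub_sub_cancel, sub_sub_cancel, mul_div_cancel₀ _ hs.ne', sub_sub_cancel])
    (by linarith) (by linarith) hpb0 (by linarith) hm1 (by omega) H.le_h hB.le (by omega)
    H.one_le_ℓ (by norm_num) (by norm_num) hk3 H.connectors_le H.absorbers_le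
    (by have := H.big_γ; omega) H.card_eq H.two_pow_k₁ H.two_pow_k₂ hL1 hM
    (H.wires_room hη hB) (H.room_le hη hL hB) H.pairs_le H.good_wires_le
    (one_le_exp (by positivity)) H.le_u₀ hxu H.clean_le H.clean_half H.one_le_mc H.le_hc
    H.bad_le (by simp) (fun j hj => H.levels_le hS1 hS3 hj) (H.one_le_pow 16)
    (fun j _ => H.level_step_le hS1 hS3) ((H.one_le_pow 4).trans hypa) (H.degree_le hη hβ)
    (H.one_le_pow 4) H.exp_joined_le
    (add_le_add le_rfl (H.level_five_le hS2))
    (add_le_add (sub_le_sub_right (exp_le_exp.2 hexp) 1) (H.spread_le hypa))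
    H.traverse_le (by positivity)
    (add_nonneg (sub_nonneg.2 (one_le_exp (by positivity))) (exp_pos _).le)
  refine le_trans ?_ hmain
  have f1 : exp (-(n : ℝ)) ≤ exp (-y ^ 4) :=
    exp_le_exp.2 (neg_le_neg (H.pow_le_n (by norm_num)))
  have f2 : exp (-(n / y ^ 16)) ≤ exp (-y ^ 4) := by
    refine exp_le_exp.2 (neg_le_neg ?_)
    rw [le_div_iff₀ (by positivity), ← pow_add]
    exact H.pow_le_n (by norm_num)
  rw [failure]
  have f3 : α * β * δ / 2 ^ 13 * y ^ 4 = α * β * δ * y ^ 4 / 2 ^ 13 := by ring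
  rw [f3]
  push_cast
  linarith

end Final

end SpanningTree

/-- Almost surely, `G(n,(1+ε)log n/n)` contains a copy of every tree on `n` vertices with
maximum degree at most `Δ` which has at least `αn/log⁹n` vertex-disjoint bare paths of
length `⌈log⁹ n⌉`. -/
theorem stmt1 (α ε Δ : ℝ) (hα : 0 < α) (hε : 0 < ε) (hΔ : 0 < Δ) :
    Filter.Tendsto
      (fun n : ℕ => probOf n ((1 + ε) * Real.log n / n) (fun G =>
        ∀ T : SimpleGraph (Fin n), T.IsTree →
          (∀ v, ((T.neighborSet v).ncard : ℝ) ≤ Δ) →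
          (∃ m : ℕ, α * n / (Real.log n) ^ 9 ≤ m ∧
            HasDisjBarePaths T ⌈(Real.log n) ^ 9⌉₊ m) →
          ContainsCopy T G))
      Filter.atTop (nhds 1) := by
  have hα0 : 0 < min α 1 := lt_min hα one_pos
  have hδ0 : 0 < min (ε / 4) 1 := lt_min (by positivity) one_pos
  set d := ⌊Δ⌋₊ + 6 with hd
  set β := ε / (4 * (1 + ε)) / 128 with hβ
  have hβ0 : 0 < β := by positivity
  have hβ1 : β ≤ 1 / 128 := by
    have : ε / (4 * (1 + ε)) ≤ 1 := (div_le_one (by positivity)).2 (by linarith)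
    linarith
  set η := min α 1 * β / (2 * d + 16) with hη
  have hη0 : 0 < η := by positivity
  have hηd : η * (2 * d + 16) = min α 1 * β := div_mul_cancel₀ _ (by positivity)
  have hη1 : η ≤ 1 / 128 := by
    have h1 : min α 1 * β ≤ 1 * (1 / 128) := mul_le_mul (min_le_right _ _) hβ1 hβ0.le zero_le_one
    have h2 : η * 1 ≤ η * (2 * d + 16) := by
      gcongr
      linarith [(Nat.cast_nonneg d : (0 : ℝ) ≤ d)]
    linarith
  set w := (min α 1 * β * η * min (ε / 4) 1) ^ 2 with hw
  have hw0 : 0 < w := by positivity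
  have hlogn : Filter.Tendsto (fun n : ℕ => Real.log n) Filter.atTop Filter.atTop :=
    Real.tendsto_log_atTop.comp tendsto_natCast_atTop_atTop
  have hy : Filter.Tendsto (fun n : ℕ => √√(Real.log n)) Filter.atTop Filter.atTop :=
    Real.tendsto_sqrt_atTop.comp (Real.tendsto_sqrt_atTop.comp hlogn)
  have hfail := (SpanningTree.tendsto_failure
    (show 0 < min α 1 * β * min (ε / 4) 1 / 2 ^ 13 by positivity) hε d).comp hlogn
  have hlower := hfail.const_sub 1
  rw [sub_zero] at hlower
  have hev : ∀ᶠ y : ℝ in Filter.atTop, 2 ^ 64 ≤ w * y ∧ 2 ^ 20 * Real.log y ≤ w * y ∧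
      2 * (1 + ε) ≤ y ∧ 60 * Real.log y ≤ y := by
    have hsmall : ∀ c : ℝ, 0 < c → ∀ᶠ y : ℝ in Filter.atTop, Real.log y ≤ c * y := by
      intro c hc
      filter_upwards [Real.isLittleO_log_id_atTop.bound hc, Filter.eventually_ge_atTop 0]
        with y h1 h2
      simp only [id, Real.norm_eq_abs, abs_of_nonneg h2] at h1
      exact (le_abs_self _).trans h1
    filter_upwards [Filter.eventually_ge_atTop (2 ^ 64 / w), hsmall (w / 2 ^ 20) (by positivity),
      Filter.eventually_ge_atTop (2 * (1 + ε)), hsmall (1 / 60) (by positivity)] with y h1 h2 h3 h4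
    rw [div_le_iff₀ hw0] at h1
    exact ⟨by linarith, by linarith, h3, by linarith⟩
  have hbounds : ∀ᶠ n : ℕ in Filter.atTop, (0 ≤ (1 + ε) * Real.log n / n ∧
      (1 + ε) * Real.log n / n ≤ 1 / 2) ∧
      1 - SpanningTree.failure (min α 1 * β * min (ε / 4) 1 / 2 ^ 13) ε d (Real.log n) ≤
        probOf n ((1 + ε) * Real.log n / n) (fun G =>
          ∀ T : SimpleGraph (Fin n), T.IsTree →
            (∀ v, ((T.neighborSet v).ncard : ℝ) ≤ Δ) →
            (∃ m : ℕ, α * n / (Real.log n) ^ 9 ≤ m ∧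
              HasDisjBarePaths T ⌈(Real.log n) ^ 9⌉₊ m) →
            ContainsCopy T G) := by
    filter_upwards [hy.eventually hev, Filter.eventually_ge_atTop 1] with n hn hn1
    have hl : Real.log n = √√(Real.log n) ^ 4 := by
      have h0 : 0 ≤ Real.log n := Real.log_natCast_nonneg n
      rw [show 4 = 2 * 2 by norm_num, pow_mul, Real.sq_sqrt (Real.sqrt_nonneg _), Real.sq_sqrt h0]
    set y := √√(Real.log n) with hydef
    obtain ⟨hbig, hlog, hyε, hy60⟩ := hn
    have hy1 : 1 ≤ y := by linarith
    have hy0 : 0 < y := by linarith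
    have hn0 : (0 : ℝ) < n := by exact_mod_cast hn1
    have hpow : y ^ 60 ≤ n := by
      rw [← Real.exp_log hn0, hl, show y ^ 60 = Real.exp (60 * Real.log y) by
        rw [mul_comm, Real.exp_mul, Real.exp_log hy0]; norm_cast]
      exact Real.exp_le_exp.2 (hy60.trans (le_self_pow₀ hy1 (by norm_num)))
    have hp1 : (1 + ε) * y ^ 4 / n ≤ 1 / 2 := by
      rw [div_le_iff₀ hn0]
      have h1 : y * y ^ 4 ≤ n := by
        rw [← pow_succ']
        exact (pow_le_pow_right₀ hy1 (by norm_num)).trans hpow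
      have h2 := mul_le_mul_of_nonneg_right hyε (pow_nonneg hy0.le 4)
      linarith
    obtain ⟨q, J, k₁, k₂, γ, ℓ, k, mc, hc, u₀, m, h, H, hxu⟩ := SpanningTree.exists_sized hα0
      (min_le_right _ _) hβ0 hβ1 hη0 hη1 hδ0 (min_le_right _ _) hbig hl hpow hlog
    rw [hl]
    have hp0 : 0 ≤ (1 + ε) * y ^ 4 / n := by positivity
    refine ⟨⟨hp0, hp1⟩, (H.one_sub_le (M := 2 * q) (L := ⌈(y ^ 4) ^ 9⌉₊) hε hd hηd.le
      (min_le_left _ _) (by linarith) hp1 hxu ?_ le_rfl).trans ?_⟩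
    · rw [show y ^ 36 = (y ^ 4) ^ 9 by ring]
      exact Nat.le_ceil _
    · rw [SpanningTree.probOf_eq_ex, SpanningTree.probOf_eq_ex]
      refine SpanningTree.ex_mono hp0 (hp1.trans (by norm_num)) fun ω =>
        SpanningTree.ind_mono fun hG T hT hdeg hpaths => ?_
      obtain ⟨M, hM, hpaths⟩ := hpaths
      refine hG T hT (fun v => Nat.le_floor (hdeg v)) ⟨M, ?_, hpaths⟩
      have h1 : 2 * (q : ℝ) ≤ M := by
        refine le_trans ?_ hM
        rw [le_div_iff₀ (by positivity), ← pow_mul]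
        exact H.q_le.trans (by gcongr; exact min_le_left _ _)
      exact_mod_cast h1
  refine tendsto_of_tendsto_of_tendsto_of_le_of_le' hlower tendsto_const_nhds
    (hbounds.mono fun n hn => hn.2) (hbounds.mono fun n hn => ?_)
  exact SpanningTree.probOf_le_one hn.1.1 (hn.1.2.trans (by norm_num)) _
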